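/- Let q⃗ = (q₁,q₂,q₃) with q_j > 1 for each j and 1/q₁+1/q₂+1/q₃ = 1. There exists a constant ε > 0, depending only on q⃗, such that: if (u,Π) is a suitable weak solution of the 3D Navier-Stokes equations on Q(ϱ) for some ϱ > 0 and the essential supremum over t ∈ (−ϱ²,0) of ‖u(·,t)‖_{L^{q⃗}(B(ϱ))} is at most ε, then (0,0) is a regular point of u. -/

import Mathlib

open MeasureTheory ENNReal Set Metric Filter

noncomputable section

/-- Euclidean 3-space. -/
abbrev E3 : Type := EuclideanSpace ℝ (Fin 3)

/-- The point (x₁,x₂,x₃) of ℝ³. -/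
def pt3 (x1 x2 x3 : ℝ) : E3 := (WithLp.equiv 2 (Fin 3 → ℝ)).symm ![x1, x2, x3]

/-- Anisotropic Lebesgue (quasi-)norm `‖f‖_{L^{q⃗}(Ω)}` with finite exponents:
iterated L^{q₁}, L^{q₂}, L^{q₃} norms in x₁, x₂, x₃ of f extended by 0 outside Ω. -/
def anisoNorm (q1 q2 q3 : ℝ) (Ω : Set E3) (f : E3 → ℝ) : ℝ≥0∞ :=
  (∫⁻ x3 : ℝ, (∫⁻ x2 : ℝ, (∫⁻ x1 : ℝ,
      (ENNReal.ofReal |Ω.indicator f (pt3 x1 x2 x3)|) ^ q1) ^ (q2 / q1)) ^ (q3 / q2)) ^ (1 / q3)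

/-- Mixed norm `‖f‖_{L^p_t L^{q⃗}_x(Q(r))}`, time exponent `p ∈ [1,∞]`,
where `Q(r) = B(r) × (−r²,0)`. -/
def mixedNorm (p : ℝ≥0∞) (q1 q2 q3 r : ℝ) (f : E3 → ℝ → ℝ) : ℝ≥0∞ :=
  if p = ∞ then
    essSup (fun t => anisoNorm q1 q2 q3 (ball (0 : E3) r) (fun x => f x t))
      (volume.restrict (Ioo (-(r^2)) 0))
  else
    (∫⁻ t in Ioo (-(r^2)) 0,
        (anisoNorm q1 q2 q3 (ball (0 : E3) r) (fun x => f x t)) ^ p.toReal) ^ (1 / p.toReal)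

/-- Partial derivative in the i-th coordinate direction. -/
def pd (i : Fin 3) (f : E3 → ℝ) (x : E3) : ℝ := fderiv ℝ f x (EuclideanSpace.single i 1)

/-- Laplacian. -/
def lap (f : E3 → ℝ) (x : E3) : ℝ := ∑ i : Fin 3, pd i (fun y => pd i f y) x

/-- Scalar test functions compactly supported in `Q(R) = B(R) × (−R²,0)`. -/
def IsTest (R : ℝ) (φ : E3 → ℝ → ℝ) : Prop :=
  ContDiff ℝ (⊤ : ℕ∞) (fun z : E3 × ℝ => φ z.1 z.2) ∧
  HasCompactSupport (fun z : E3 × ℝ => φ z.1 z.2) ∧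
  tsupport (fun z : E3 × ℝ => φ z.1 z.2) ⊆ (ball (0 : E3) R) ×ˢ (Ioo (-(R^2)) 0)

/-- Vector test functions compactly supported in `Q(R) = B(R) × (−R²,0)`. -/
def IsTestV (R : ℝ) (w : E3 → ℝ → E3) : Prop :=
  ContDiff ℝ (⊤ : ℕ∞) (fun z : E3 × ℝ => w z.1 z.2) ∧
  HasCompactSupport (fun z : E3 × ℝ => w z.1 z.2) ∧
  tsupport (fun z : E3 × ℝ => w z.1 z.2) ⊆ (ball (0 : E3) R) ×ˢ (Ioo (-(R^2)) 0)

/-- A suitable weak solution `(u, P)` of the 3D Navier–Stokes equations on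
`Q(R) = B(R) × (−R²,0)`: `u ∈ L^∞_t L²_x` with a distributional spatial gradient
`gu ∈ L²(Q(R))`, pressure `P ∈ L^{3/2}(Q(R))`, the equations hold in the sense of
distributions, and the local energy inequality holds. -/
structure SuitableWeakSolution (R : ℝ) (u : E3 → ℝ → E3) (P : E3 → ℝ → ℝ) where
  /-- the distributional spatial gradient: `gu x t i j = ∂ⱼuᵢ(x,t)` -/
  gu : E3 → ℝ → Fin 3 → Fin 3 → ℝ
  meas_u : Measurable (Function.uncurry u)
  meas_gu : Measurable (Function.uncurry gu)
  meas_press : Measurable (Function.uncurry P)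
  /-- `u ∈ L^∞(−R²,0; L²(B(R)))` -/
  bdd_L2 : essSup (fun t => ∫⁻ x in ball (0 : E3) R, ((‖u x t‖₊ : ℝ≥0∞)) ^ 2)
      (volume.restrict (Ioo (-(R^2)) 0)) < ∞
  /-- `∇u ∈ L²(Q(R))` -/
  grad_L2 : (∫⁻ t in Ioo (-(R^2)) 0, ∫⁻ x in ball (0 : E3) R,
      ENNReal.ofReal (∑ i : Fin 3, ∑ j : Fin 3, (gu x t i j) ^ 2)) < ∞
  /-- `P ∈ L^{3/2}(Q(R))` -/
  press_L32 : (∫⁻ t in Ioo (-(R^2)) 0, ∫⁻ x in ball (0 : E3) R,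
      (ENNReal.ofReal |P x t|) ^ (3/2 : ℝ)) < ∞
  /-- `gu` is the distributional spatial gradient of `u` on `Q(R)` -/
  is_grad : ∀ φ : E3 → ℝ → ℝ, IsTest R φ → ∀ i j : Fin 3,
      (∫ t in Ioo (-(R^2)) 0, ∫ x in ball (0 : E3) R, u x t i * pd j (fun y => φ y t) x)
        = - ∫ t in Ioo (-(R^2)) 0, ∫ x in ball (0 : E3) R, gu x t i j * φ x t
  /-- `∂ₜu − Δu + (u·∇)u + ∇P = 0` in the sense of distributions on `Q(R)` -/
  weak_NS : ∀ w : E3 → ℝ → E3, IsTestV R w →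
      (∫ t in Ioo (-(R^2)) 0, ∫ x in ball (0 : E3) R,
        (-(∑ i : Fin 3, u x t i * deriv (fun s => w x s i) t)
          - (∑ i : Fin 3, u x t i * lap (fun y => w y t i) x)
          - (∑ i : Fin 3, ∑ j : Fin 3, u x t i * u x t j * pd i (fun y => w y t j) x)
          - P x t * (∑ j : Fin 3, pd j (fun y => w y t j) x))) = 0
  /-- `div u = 0` in the sense of distributions on `Q(R)` -/
  weak_div : ∀ ψ : E3 → ℝ → ℝ, IsTest R ψ →
      (∫ t in Ioo (-(R^2)) 0, ∫ x in ball (0 : E3) R,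
        ∑ i : Fin 3, u x t i * pd i (fun y => ψ y t) x) = 0
  /-- the local energy inequality -/
  local_energy : ∀ φ : E3 → ℝ → ℝ, IsTest R φ → (∀ x t, 0 ≤ φ x t) →
      ∀ᵐ t ∂(volume.restrict (Ioo (-(R^2)) 0)),
        (∫ x in ball (0 : E3) R, ‖u x t‖ ^ 2 * φ x t)
          + 2 * ∫ s in Ioo (-(R^2)) t, ∫ x in ball (0 : E3) R,
              (∑ i : Fin 3, ∑ j : Fin 3, (gu x s i j) ^ 2) * φ x s
        ≤ (∫ s in Ioo (-(R^2)) t, ∫ x in ball (0 : E3) R,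
              ‖u x s‖ ^ 2 * (deriv (fun τ => φ x τ) s + lap (fun y => φ y s) x))
          + ∫ s in Ioo (-(R^2)) t, ∫ x in ball (0 : E3) R,
              (∑ i : Fin 3, u x s i * pd i (fun y => φ y s) x) * (‖u x s‖ ^ 2 + 2 * P x s)

/-- `(0,0)` is a regular point of `u`: `u` is essentially bounded on some `Q(r)`, `r > 0`. -/
def RegularPoint (u : E3 → ℝ → E3) : Prop :=
  ∃ r > (0 : ℝ), ∃ M : ℝ,
    ∀ᵐ z : E3 × ℝ ∂(volume.restrict ((ball (0 : E3) r) ×ˢ (Ioo (-(r^2)) 0))),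
      ‖u z.1 z.2‖ ≤ M

lemma holder3 {p q r : ℝ} (hp : 0 < p) (hq : 0 < q) (hr : 0 < r) (h : 1/p + 1/q + 1/r = 1)
    {a b c : ℝ → ℝ≥0∞} (ha : Measurable a) (hb : Measurable b) (hc : Measurable c) :
    ∫⁻ x, a x * b x ^ (1/q) * c x ^ (1/r) ≤
      (∫⁻ x, a x ^ p) ^ (1/p) * (∫⁻ x, b x) ^ (1/q) * (∫⁻ x, c x) ^ (1/r) := by
  have := ENNReal.lintegral_prod_norm_pow_le (μ := (volume : Measure ℝ)) (Finset.univ : Finset (Fin 3))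
    (f := ![fun x => a x ^ p, b, c]) (p := ![1/p, 1/q, 1/r])
    (by
      intro i _
      fin_cases i
      · exact (ha.pow_const p).aemeasurable
      · exact hb.aemeasurable
      · exact hc.aemeasurable)
    (by simpa [Fin.sum_univ_three] using h)
    (by
      intro i _
      fin_cases i <;> simp <;> positivity)
  simp only [Fin.prod_univ_three, Matrix.cons_val_zero, Matrix.cons_val_one, Matrix.cons_val] at this
  refine le_trans (le_of_eq ?_) this
  congr 1
  ext x
  rw [← ENNReal.rpow_mul, mul_one_div_cancel hp.ne', ENNReal.rpow_one]

/-- The anisotropic trace inequality in abstract coordinates. -/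
lemma aniso_trace {q1 q2 q3 : ℝ} (h1 : 0 < q1) (h2 : 0 < q2) (h3 : 0 < q3)
    (hq : 1/q1 + 1/q2 + 1/q3 = 1) {V f D : ℝ × ℝ × ℝ → ℝ≥0∞}
    (hV : Measurable V) (hD : Measurable D)
    (b1 : ∀ x y z, f (x, y, z) ≤ ∫⁻ s, D (s, y, z))
    (b2 : ∀ x y z, f (x, y, z) ≤ ∫⁻ s, D (x, s, z))
    (b3 : ∀ x y z, f (x, y, z) ≤ ∫⁻ s, D (x, y, s)) :
    ∫⁻ z, ∫⁻ y, ∫⁻ x, V (x, y, z) * f (x, y, z) ≤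
      (∫⁻ z, (∫⁻ y, (∫⁻ x, V (x, y, z) ^ q1) ^ (q2/q1)) ^ (q3/q2)) ^ (1/q3)
        * ∫⁻ z, ∫⁻ y, ∫⁻ x, D (x, y, z) := by
  set F1 : ℝ × ℝ → ℝ≥0∞ := fun w => ∫⁻ s, D (s, w.1, w.2) with hF1
  set F2 : ℝ × ℝ → ℝ≥0∞ := fun w => ∫⁻ s, D (w.1, s, w.2) with hF2
  set F3 : ℝ × ℝ → ℝ≥0∞ := fun w => ∫⁻ s, D (w.1, w.2, s) with hF3
  have mF1 : Measurable F1 := by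
    apply Measurable.lintegral_prod_left' (f := fun p : ℝ × (ℝ × ℝ) => D (p.1, p.2.1, p.2.2))
    fun_prop
  have mF2 : Measurable F2 := by
    apply Measurable.lintegral_prod_left' (f := fun p : ℝ × (ℝ × ℝ) => D (p.2.1, p.1, p.2.2))
    fun_prop
  have mF3 : Measurable F3 := by
    apply Measurable.lintegral_prod_left' (f := fun p : ℝ × (ℝ × ℝ) => D (p.2.1, p.2.2, p.1))
    fun_prop
  set A : ℝ × ℝ → ℝ≥0∞ := fun w => ∫⁻ x, V (x, w.1, w.2) ^ q1 with hA
  have mA : Measurable A := by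
    apply Measurable.lintegral_prod_left' (f := fun p : ℝ × (ℝ × ℝ) => V (p.1, p.2.1, p.2.2) ^ q1)
    fun_prop
  set T := ∫⁻ z, ∫⁻ y, ∫⁻ x, D (x, y, z) with hT
  have key : ∀ x y z, f (x, y, z) ≤ F1 (y, z) ^ (1/q1) * F2 (x, z) ^ (1/q2) * F3 (x, y) ^ (1/q3) := by
    intro x y z
    calc f (x, y, z) = f (x, y, z) ^ (1/q1) * f (x, y, z) ^ (1/q2) * f (x, y, z) ^ (1/q3) := by
          rw [← ENNReal.rpow_add_of_nonneg _ _ (by positivity) (by positivity),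
            ← ENNReal.rpow_add_of_nonneg _ _ (by positivity) (by positivity), hq, ENNReal.rpow_one]
      _ ≤ _ := by
          gcongr
          · exact b1 x y z
          · exact b2 x y z
          · exact b3 x y z
  set G2 : ℝ → ℝ≥0∞ := fun z => ∫⁻ x, F2 (x, z) with hG2
  set G3 : ℝ → ℝ≥0∞ := fun y => ∫⁻ x, F3 (x, y) with hG3
  have mG2 : Measurable G2 := mF2.lintegral_prod_left'
  have mG3 : Measurable G3 := mF3.lintegral_prod_left'
  have step1 : ∀ y z, ∫⁻ x, V (x, y, z) * f (x, y, z) ≤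
      A (y, z) ^ (1/q1) * F1 (y, z) ^ (1/q1) * G3 y ^ (1/q3) * G2 z ^ (1/q2) := by
    intro y z
    calc ∫⁻ x, V (x, y, z) * f (x, y, z)
        ≤ ∫⁻ x, F1 (y, z) ^ (1/q1) * (V (x, y, z) * F2 (x, z) ^ (1/q2) * F3 (x, y) ^ (1/q3)) := by
          apply lintegral_mono
          intro x
          calc _ ≤ V (x, y, z) * (F1 (y, z) ^ (1/q1) * F2 (x, z) ^ (1/q2) * F3 (x, y) ^ (1/q3)) := 
                mul_le_mul' le_rfl (key x y z)
            _ = _ := by ring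
      _ = F1 (y, z) ^ (1/q1) * ∫⁻ x, (V (x, y, z) * F2 (x, z) ^ (1/q2) * F3 (x, y) ^ (1/q3)) := by
          rw [lintegral_const_mul]
          fun_prop
      _ ≤ F1 (y, z) ^ (1/q1) * (A (y, z) ^ (1/q1) * G2 z ^ (1/q2) * G3 y ^ (1/q3)) := by
          gcongr
          exact holder3 h1 h2 h3 hq (by fun_prop) (by fun_prop) (by fun_prop)
      _ = _ := by ring
  have eG3 : ∫⁻ y, G3 y = T := by
    simp only [hG3, hF3, hT]
    rw [lintegral_lintegral_swap (μ := (volume : Measure ℝ)) (ν := (volume : Measure ℝ))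
      (f := fun z y => ∫⁻ x, D (x, y, z))]
    · apply lintegral_congr; intro y
      rw [lintegral_lintegral_swap (f := fun x z => D (x, y, z))]
      apply Measurable.aemeasurable; unfold Function.uncurry; fun_prop
    · apply Measurable.aemeasurable
      apply Measurable.lintegral_prod_left' (f := fun p : ℝ × (ℝ × ℝ) => D (p.1, p.2.2, p.2.1))
      fun_prop
  set B : ℝ → ℝ≥0∞ := fun z => ∫⁻ y, A (y, z) ^ (q2/q1) with hB
  have mB : Measurable B := (mA.pow_const _).lintegral_prod_left'
  set H1 : ℝ → ℝ≥0∞ := fun z => ∫⁻ y, F1 (y, z) with hH1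
  have mH1 : Measurable H1 := mF1.lintegral_prod_left'
  have step2 : ∀ z, ∫⁻ y, ∫⁻ x, V (x, y, z) * f (x, y, z) ≤
      T ^ (1/q3) * (B z ^ (1/q2) * H1 z ^ (1/q1) * G2 z ^ (1/q2)) := by
    intro z
    calc ∫⁻ y, ∫⁻ x, V (x, y, z) * f (x, y, z)
        ≤ ∫⁻ y, (A (y, z) ^ (1/q1) * F1 (y, z) ^ (1/q1) * G3 y ^ (1/q3)) * G2 z ^ (1/q2) :=
          lintegral_mono (fun y => step1 y z)
      _ = (∫⁻ y, (A (y, z) ^ (1/q1) * F1 (y, z) ^ (1/q1) * G3 y ^ (1/q3))) * G2 z ^ (1/q2) := by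
          rw [lintegral_mul_const]
          fun_prop
      _ ≤ ((∫⁻ y, (A (y, z) ^ (1/q1)) ^ q2) ^ (1/q2) * H1 z ^ (1/q1) * T ^ (1/q3)) * G2 z ^ (1/q2) := by
          gcongr
          rw [← eG3]
          exact holder3 h2 h1 h3 (by linarith) (by fun_prop) (by fun_prop) (by fun_prop)
      _ = _ := by
          have : ∀ y, (A (y, z) ^ (1/q1)) ^ q2 = A (y, z) ^ (q2/q1) := by
            intro y
            rw [← ENNReal.rpow_mul]; congr 1; field_simp
          simp only [this, hB]
          ring
  have eH1 : ∫⁻ z, H1 z = T := rfl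
  have eG2 : ∫⁻ z, G2 z = T := by
    simp only [hG2, hF2, hT]
    apply lintegral_congr; intro z
    rw [lintegral_lintegral_swap (f := fun x y => D (x, y, z))]
    apply Measurable.aemeasurable; unfold Function.uncurry; fun_prop
  calc ∫⁻ z, ∫⁻ y, ∫⁻ x, V (x, y, z) * f (x, y, z)
      ≤ ∫⁻ z, T ^ (1/q3) * (B z ^ (1/q2) * H1 z ^ (1/q1) * G2 z ^ (1/q2)) := lintegral_mono step2
    _ = T ^ (1/q3) * ∫⁻ z, (B z ^ (1/q2) * H1 z ^ (1/q1) * G2 z ^ (1/q2)) := by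
        rw [lintegral_const_mul]
        fun_prop
    _ ≤ T ^ (1/q3) * ((∫⁻ z, (B z ^ (1/q2)) ^ q3) ^ (1/q3) * T ^ (1/q1) * T ^ (1/q2)) := by
        gcongr
        conv_rhs => rw [← eH1]
        conv_rhs => rw [eH1]; enter [2]; rw [← eG2]
        rw [← eH1]
        exact holder3 h3 h1 h2 (by linarith) (by fun_prop) (by fun_prop) (by fun_prop)
    _ = (∫⁻ z, B z ^ (q3/q2)) ^ (1/q3) * (T ^ (1/q1) * T ^ (1/q2) * T ^ (1/q3)) := by
        have : ∀ z, (B z ^ (1/q2)) ^ q3 = B z ^ (q3/q2) := by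
          intro z
          rw [← ENNReal.rpow_mul]; congr 1; field_simp
        simp only [this]
        ring
    _ = _ := by
        rw [← ENNReal.rpow_add_of_nonneg _ _ (by positivity) (by positivity),
            ← ENNReal.rpow_add_of_nonneg _ _ (by positivity) (by positivity), hq, ENNReal.rpow_one]

lemma pt3_eq (x y z : ℝ) : pt3 x y z = WithLp.toLp 2 ![x, y, z] := rfl

lemma continuous_pt3 : Continuous (fun w : ℝ × ℝ × ℝ => pt3 w.1 w.2.1 w.2.2) := by
  simp only [pt3_eq]
  refine (PiLp.continuous_toLp 2 _).comp ?_
  refine continuous_pi fun i => ?_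
  fin_cases i <;> simp <;> fun_prop

lemma lintegral_pt3 {F : E3 → ℝ≥0∞} (hF : Measurable F) :
    ∫⁻ x, F x = ∫⁻ z, ∫⁻ y, ∫⁻ x, F (pt3 x y z) := by
  have e1 := (EuclideanSpace.volume_preserving_symm_measurableEquiv_toLp (Fin 3)).symm
  have e2 := (volume_preserving_piFinSuccAbove (fun _ : Fin 3 => ℝ) 0).symm
  have e3 := (volume_preserving_piFinSuccAbove (fun _ : Fin 2 => ℝ) 0).symm
  have e4 := (volume_preserving_funUnique (Fin 1) ℝ).symm
  set G : (Fin 3 → ℝ) → ℝ≥0∞ := fun w => F (WithLp.toLp 2 w) with hG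
  have mG : Measurable G := hF.comp (MeasurableEquiv.measurable (MeasurableEquiv.toLp 2 (Fin 3 → ℝ)))
  have h0 : ∫⁻ x, F x = ∫⁻ w, G w := (e1.lintegral_comp hF).symm
  rw [h0, ← e2.lintegral_comp mG]
  rw [Measure.volume_eq_prod, lintegral_prod _ (by fun_prop)]
  have : ∀ x : ℝ, (∫⁻ y : Fin 2 → ℝ, G ((MeasurableEquiv.piFinSuccAbove (fun _ => ℝ) 0).symm (x, y)))
     = ∫⁻ y, ∫⁻ z, F (pt3 x y z) := by
    intro x
    rw [← e3.lintegral_comp (by fun_prop), Measure.volume_eq_prod, lintegral_prod _ (by fun_prop)]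
    apply lintegral_congr; intro y
    refine (e4.lintegral_comp ?_).symm.trans ?_
    · fun_prop
    apply lintegral_congr; intro z
    simp only [hG]
    congr 1
    ext i
    fin_cases i <;> rfl
  have mF : Measurable (fun w : ℝ × ℝ × ℝ => F (pt3 w.1 w.2.1 w.2.2)) := hF.comp continuous_pt3.measurable
  refine (lintegral_congr this).trans ?_
  rw [lintegral_lintegral_swap (f := fun x y => ∫⁻ z, F (pt3 x y z))]
  · have : ∀ y, ∫⁻ x, ∫⁻ z, F (pt3 x y z) = ∫⁻ z, ∫⁻ x, F (pt3 x y z) := by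
      intro y
      rw [lintegral_lintegral_swap (f := fun x z => F (pt3 x y z))]
      apply Measurable.aemeasurable
      exact mF.comp (f := fun p : ℝ × ℝ => (p.1, y, p.2)) (by fun_prop)
    simp only [this]
    rw [lintegral_lintegral_swap (f := fun y z => ∫⁻ x, F (pt3 x y z))]
    apply Measurable.aemeasurable
    exact Measurable.lintegral_prod_left' (f := fun p : ℝ × (ℝ × ℝ) => F (pt3 p.1 p.2.1 p.2.2)) mF
  · apply Measurable.aemeasurable
    exact Measurable.lintegral_prod_left' (f := fun p : ℝ × (ℝ × ℝ) => F (pt3 p.2.1 p.2.2 p.1)) (mF.comp (f := fun p : ℝ × (ℝ × ℝ) => (p.2.1, p.2.2, p.1)) (by fun_prop))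

/-- one-dimensional sup bound along a line -/
lemma enorm_le_line {f : E3 → ℝ} (hf : ContDiff ℝ 1 f) (hc : HasCompactSupport f) (i : Fin 3) (x : E3)
    (γ : ℝ → E3) (hγ : ∀ s, γ s = γ 0 + s • EuclideanSpace.single i 1) (s0 : ℝ) (hx : γ s0 = x) :
    ‖f x‖ₑ ≤ ∫⁻ s, ‖fderiv ℝ f (γ s)‖ₑ := by
  have hd : ∀ s, HasDerivAt γ (EuclideanSpace.single i 1) s := by
    intro s
    have : γ = fun s => γ 0 + s • EuclideanSpace.single i (1:ℝ) := funext hγ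
    rw [this]
    simpa using ((hasDerivAt_id s).smul_const (EuclideanSpace.single i (1:ℝ))).const_add (γ 0)
  have hcont : Continuous γ := continuous_iff_continuousAt.2 fun s => (hd s).continuousAt
  have hdf : ∀ s, HasDerivAt (f ∘ γ) (fderiv ℝ f (γ s) (EuclideanSpace.single i 1)) s := fun s =>
    ((hf.differentiable one_ne_zero (γ s)).hasFDerivAt).comp_hasDerivAt s (hd s)
  have hiso : Topology.IsClosedEmbedding γ := by
    apply Isometry.isClosedEmbedding
    refine Isometry.of_dist_eq fun a b => ?_
    rw [hγ a, hγ b, dist_add_left, dist_eq_norm, ← sub_smul, norm_smul]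
    simp [Real.dist_eq]
  have hcs : HasCompactSupport (f ∘ γ) := hc.comp_isClosedEmbedding hiso
  have hC1 : ContDiff ℝ 1 (f ∘ γ) := by
    apply hf.comp
    have : γ = fun s => γ 0 + s • EuclideanSpace.single i (1:ℝ) := funext hγ
    rw [this]; fun_prop
  have h1 := hcs.enorm_le_lintegral_Ici_deriv hC1 s0
  rw [Function.comp_apply, hx] at h1
  refine h1.trans ((setLIntegral_le_lintegral _ _).trans (lintegral_mono fun s => ?_))
  rw [(hdf s).deriv]
  have := (fderiv ℝ f (γ s)).le_opENorm (EuclideanSpace.single i 1)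
  refine this.trans (le_of_eq ?_)
  have : ‖EuclideanSpace.single i (1:ℝ)‖ₑ = 1 := by
    rw [← ofReal_norm]; simp
  rw [this, mul_one]

/-- Part A: trace inequality. -/
lemma trace_ineq {q1 q2 q3 : ℝ} (h1 : 0 < q1) (h2 : 0 < q2) (h3 : 0 < q3)
    (hq : 1/q1 + 1/q2 + 1/q3 = 1) {Ω : Set E3} {V : E3 → ℝ} (hΩ : MeasurableSet Ω) (hV : Measurable V)
    {f : E3 → ℝ} (hf : ContDiff ℝ 1 f) (hc : HasCompactSupport f) :
    ∫⁻ x, ‖Ω.indicator V x‖ₑ * ‖f x‖ₑ ≤ anisoNorm q1 q2 q3 Ω V * ∫⁻ x, ‖fderiv ℝ f x‖ₑ := by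
  have mf : Measurable f := hf.continuous.measurable
  have mV : Measurable (Ω.indicator V) := hV.indicator hΩ
  have mD : Measurable (fun x => ‖fderiv ℝ f x‖ₑ) := (hf.continuous_fderiv one_ne_zero).enorm.measurable
  have mD3 := mD.comp continuous_pt3.measurable
  have mV3 := mV.comp continuous_pt3.measurable
  rw [lintegral_pt3 (by fun_prop), lintegral_pt3 mD]
  have := aniso_trace h1 h2 h3 hq (V := fun w => ‖Ω.indicator V (pt3 w.1 w.2.1 w.2.2)‖ₑ)
    (f := fun w => ‖f (pt3 w.1 w.2.1 w.2.2)‖ₑ) (D := fun w => ‖fderiv ℝ f (pt3 w.1 w.2.1 w.2.2)‖ₑ)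
    mV3.enorm mD3 ?_ ?_ ?_
  · refine this.trans (le_of_eq ?_)
    simp only [anisoNorm, ← Real.norm_eq_abs, ofReal_norm]
  · intro x y z
    exact enorm_le_line hf hc 0 _ (fun s => pt3 s y z) (by
      intro s; ext i; fin_cases i <;> simp [pt3_eq]) x rfl
  · intro x y z
    exact enorm_le_line hf hc 1 _ (fun s => pt3 x s z) (by
      intro s; ext i; fin_cases i <;> simp [pt3_eq]) y rfl
  · intro x y z
    exact enorm_le_line hf hc 2 _ (fun s => pt3 x y s) (by
      intro s; ext i; fin_cases i <;> simp [pt3_eq]) z rfl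

/-- convolution -/
def cv (k a : E3 → ℝ) (x : E3) : ℝ := ∫ y, a y * k (x - y)

lemma cv_eq (k a : E3 → ℝ) : cv k a = convolution a k (ContinuousLinearMap.mul ℝ ℝ) volume := by
  ext x
  simp [cv, convolution]

lemma cv_contDiff {k a : E3 → ℝ} {n : ℕ∞} (hk : ContDiff ℝ n k) (hc : HasCompactSupport k)
    (ha : LocallyIntegrable a) : ContDiff ℝ n (cv k a) := by
  rw [cv_eq]
  exact hc.contDiff_convolution_right _ ha hk

lemma cv_pd {k a : E3 → ℝ} (hk : ContDiff ℝ 1 k) (hc : HasCompactSupport k)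
    (ha : LocallyIntegrable a) (j : Fin 3) (x : E3) : pd j (cv k a) x = cv (pd j k) a x := by
  rw [pd, cv_eq, (hc.hasFDerivAt_convolution_right (ContinuousLinearMap.mul ℝ ℝ) ha hk x).fderiv,
    cv_eq, convolution_precompR_apply]
  · rfl
  · exact ha
  · exact hc.fderiv ℝ
  · exact hk.continuous_fderiv one_ne_zero

lemma trans_cont {f : E3 → ℝ} {p : ℝ≥0∞} (hp1 : 1 ≤ p) (hp : p ≠ ∞) (hf : MemLp f p volume) :
    Tendsto (fun z : E3 => eLpNorm (fun x => f (x - z) - f x) p volume) (nhds 0) (nhds 0) := by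
  haveI : Fact (1 ≤ p) := ⟨hp1⟩
  have hmp : ∀ z : E3, MeasurePreserving (fun x : E3 => x - z) volume volume := fun z =>
    measurePreserving_sub_right volume z
  let g : C(E3, C(E3, E3)) := (ContinuousMap.mk (fun a : E3 × E3 => a.2 - a.1) (by fun_prop)).curry
  have hgm : ∀ z, MeasurePreserving (g z) volume volume := fun z => hmp z
  have := (tendsto_const_nhds (x := hf.toLp f)).compMeasurePreservingLp (g.continuous.tendsto 0) hgm (hgm 0) hp
  rw [Metric.tendsto_nhds] at this
  rw [ENNReal.tendsto_nhds_zero]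
  intro ε hε
  rcases eq_or_ne ε ∞ with rfl | hε'
  · simp
  filter_upwards [this ε.toReal (ENNReal.toReal_pos hε.ne' hε')] with z hz
  have e0 : Lp.compMeasurePreserving (g 0) (hgm 0) (hf.toLp f) = hf.toLp f := by
    apply Lp.ext
    refine (Lp.coeFn_compMeasurePreserving _ (hgm 0)).trans ?_
    refine Eventually.of_forall fun x => ?_
    simp [g]
  rw [e0, dist_comm, Lp.dist_def] at hz
  have e1 : eLpNorm (fun x => f (x - z) - f x) p volume =
      eLpNorm ((hf.toLp f : E3 → ℝ) - (Lp.compMeasurePreserving (g z) (hgm z) (hf.toLp f) : E3 → ℝ)) p volume := by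
    rw [eLpNorm_sub_comm]
    apply eLpNorm_congr_ae
    have h1 := Lp.coeFn_compMeasurePreserving (hf.toLp f) (hgm z)
    have h2 := hf.coeFn_toLp
    have h3 := (hgm z).quasiMeasurePreserving.ae_eq_comp h2
    filter_upwards [h1, h2, h3] with x h1 h2 h3
    simp only [Pi.sub_apply, h1, h2, h3]
    rfl
  rw [e1]
  have := (ENNReal.lt_ofReal_iff_toReal_lt ?_).2 hz
  · rw [ENNReal.ofReal_toReal hε'] at this
    exact this.le
  · rw [← eLpNorm_congr_ae (Lp.coeFn_sub _ _)]
    exact Lp.eLpNorm_ne_top _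

/-- standard mollifiers -/
def bmp (n : ℕ) : ContDiffBump (0 : E3) where
  rIn := 1 / (2 * (n + 1))
  rOut := 1 / (n + 1)
  rIn_pos := by positivity
  rIn_lt_rOut := by
    apply one_div_lt_one_div_of_lt <;> nlinarith [(n.cast_nonneg : (0:ℝ) ≤ n)]

def eta (n : ℕ) : E3 → ℝ := (bmp n).normed volume

lemma eta_nonneg (n : ℕ) (x : E3) : 0 ≤ eta n x := (bmp n).nonneg_normed x
lemma eta_contDiff (n : ℕ) {m : ℕ∞} : ContDiff ℝ m (eta n) := (bmp n).contDiff_normed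
lemma eta_compact (n : ℕ) : HasCompactSupport (eta n) := (bmp n).hasCompactSupport_normed
lemma eta_integral (n : ℕ) : ∫ x, eta n x = 1 := (bmp n).integral_normed
lemma eta_integrable (n : ℕ) : Integrable (eta n) := (bmp n).integrable_normed
lemma eta_tsupport (n : ℕ) : tsupport (eta n) = closedBall 0 (1 / (n + 1 : ℝ)) := (bmp n).tsupport_normed_eq
lemma eta_eq_zero (n : ℕ) {x : E3} (hx : 1 / (n + 1 : ℝ) < ‖x‖) : eta n x = 0 := by
  apply image_eq_zero_of_notMem_tsupport
  rw [eta_tsupport]; simpa using hx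

lemma eta_lintegral (n : ℕ) : ∫⁻ x, ‖eta n x‖ₑ = 1 := by
  have := integral_eq_lintegral_of_nonneg_ae (μ := (volume : Measure E3)) (f := eta n)
    (Eventually.of_forall (eta_nonneg n)) (eta_contDiff n (m := 0)).continuous.aestronglyMeasurable
  rw [eta_integral] at this
  have h2 : ∀ x, ‖eta n x‖ₑ = ENNReal.ofReal (eta n x) := fun x => by
    rw [← ofReal_norm, Real.norm_of_nonneg (eta_nonneg n x)]
  simp only [h2]
  have := congrArg ENNReal.ofReal this
  rwa [ENNReal.ofReal_toReal, ENNReal.ofReal_one, eq_comm] at this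
  intro h
  rw [h] at this
  simp at this

lemma lint_sq_le {X : Type*} [MeasurableSpace X] {μ : Measure X} {k d : X → ℝ≥0∞} (hk : AEMeasurable k μ)
    (hd : AEMeasurable d μ) (h1 : ∫⁻ x, k x ∂μ = 1) : (∫⁻ x, k x * d x ∂μ) ^ 2 ≤ ∫⁻ x, k x * d x ^ 2 ∂μ := by
  have := ENNReal.lintegral_mul_le_Lp_mul_Lq μ (p := 2) (q := 2) Real.HolderConjugate.two_two
    (f := fun x => k x ^ (1/2 : ℝ)) (g := fun x => k x ^ (1/2:ℝ) * d x) (by fun_prop) (by fun_prop)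
  have e1 : ∀ x, (k x ^ (1/2:ℝ)) ^ (2:ℝ) = k x := fun x => by
    rw [← ENNReal.rpow_mul]; norm_num
  have e2 : ∀ x, k x ^ (1/2:ℝ) * (k x ^ (1/2:ℝ) * d x) = k x * d x := fun x => by
    rw [← mul_assoc, ← ENNReal.rpow_add_of_nonneg _ _ (by norm_num) (by norm_num)]; norm_num
  simp only [Pi.mul_apply, ENNReal.mul_rpow_of_nonneg _ _ (zero_le_two : (0:ℝ) ≤ 2), e1, e2, h1, ENNReal.one_rpow, one_mul] at this
  calc _ ≤ ((∫⁻ a, k a * d a ^ (2:ℝ) ∂μ) ^ (1 / 2 : ℝ)) ^ 2 := by gcongr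
    _ = _ := by
      rw [← ENNReal.rpow_natCast, ← ENNReal.rpow_mul]
      norm_num

lemma cv_comm (k a : E3 → ℝ) (x : E3) : cv k a x = ∫ z, a (x - z) * k z := by
  rw [cv, ← integral_sub_left_eq_self (fun y => a y * k (x - y)) volume x]
  simp

/-- convergence of mollification in L² -/
lemma moll_L2 {a : E3 → ℝ} (ham : Measurable a) (ha : MemLp a 2 volume) :
    Tendsto (fun n => ∫⁻ x, ‖cv (eta n) a x - a x‖ₑ ^ 2) atTop (nhds 0) := by
  have hle : ∀ n, ∫⁻ x, ‖cv (eta n) a x - a x‖ₑ ^ 2 ≤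
      ∫⁻ z, ‖eta n z‖ₑ * (eLpNorm (fun x => a (x - z) - a x) 2 volume) ^ 2 := by
    intro n
    have mη : Measurable (eta n) := (eta_contDiff n (m := 0)).continuous.measurable
    have h1 : ∀ x, ‖cv (eta n) a x - a x‖ₑ ≤ ∫⁻ z, ‖eta n z‖ₑ * ‖a (x - z) - a x‖ₑ := by
      intro x
      have hl : LocallyIntegrable a := ha.locallyIntegrable (by norm_num)
      have hi : Integrable (fun z => a (x - z) * eta n z) := by
        have := (eta_compact n).convolutionExists_right (ContinuousLinearMap.mul ℝ ℝ) (μ := volume) hl (eta_contDiff n (m := 0)).continuous x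
        have h2 := this.integrable.comp_sub_left x
        simpa using h2
      have : cv (eta n) a x - a x = ∫ z, eta n z * (a (x - z) - a x) := by
        have e : a x = ∫ z, a x * eta n z := by rw [integral_const_mul, eta_integral, mul_one]
        conv_lhs => rw [e]
        rw [cv_comm, ← integral_sub hi ((eta_integrable n).const_mul _)]
        congr 1; ext z; ring
      rw [this]
      refine (enorm_integral_le_lintegral_enorm _).trans (le_of_eq ?_)
      simp only [enorm_mul]
    calc ∫⁻ x, ‖cv (eta n) a x - a x‖ₑ ^ 2
        ≤ ∫⁻ x, ∫⁻ z, ‖eta n z‖ₑ * ‖a (x - z) - a x‖ₑ ^ 2 := by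
          apply lintegral_mono; intro x
          refine (pow_le_pow_left' (h1 x) 2).trans ?_
          exact lint_sq_le (by fun_prop) (by fun_prop) (eta_lintegral n)
      _ = ∫⁻ z, ∫⁻ x, ‖eta n z‖ₑ * ‖a (x - z) - a x‖ₑ ^ 2 := by
          rw [lintegral_lintegral_swap]
          apply Measurable.aemeasurable; unfold Function.uncurry; fun_prop
      _ = _ := by
          apply lintegral_congr; intro z
          rw [lintegral_const_mul _ (by fun_prop)]
          congr 1
          rw [eLpNorm_eq_lintegral_rpow_enorm_toReal (by norm_num) (by norm_num)]
          simp only [ENNReal.toReal_ofNat]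
          rw [← ENNReal.rpow_natCast, ← ENNReal.rpow_mul]
          norm_num
  have ht := trans_cont (by norm_num) (by norm_num) ha
  rw [ENNReal.tendsto_nhds_zero] at ht ⊢
  intro ε hε
  have hs := ht (ε ^ (1/2:ℝ)) (ENNReal.rpow_pos_of_nonneg hε (by norm_num))
  rw [Metric.eventually_nhds_iff] at hs
  obtain ⟨r, hr, hs⟩ := hs
  obtain ⟨N, hN⟩ := exists_nat_one_div_lt hr
  filter_upwards [eventually_ge_atTop N] with n hn
  refine (hle n).trans ?_
  calc _ ≤ ∫⁻ z, ‖eta n z‖ₑ * ε := by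
        apply lintegral_mono; intro z
        dsimp only
        by_cases hz : 1 / (n + 1 : ℝ) < ‖z‖
        · simp [eta_eq_zero n hz]
        · gcongr
          have hz2 : dist z 0 < r := by
            rw [dist_zero_right]
            have : 1 / (n + 1 : ℝ) ≤ 1 / (N + 1 : ℝ) := by gcongr
            linarith
          calc _ ≤ (ε ^ (1/2:ℝ)) ^ 2 := by gcongr; exact hs hz2
            _ = ε := by
              rw [← ENNReal.rpow_natCast, ← ENNReal.rpow_mul]
              norm_num
    _ = ε := by
        rw [lintegral_mul_const, eta_lintegral, one_mul]
        exact (eta_contDiff n (m := 0)).continuous.enorm.measurable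

/-- weak gradient on `U` -/
def WG (U : Set E3) (a : E3 → ℝ) (b : Fin 3 → E3 → ℝ) : Prop :=
  ∀ ζ : E3 → ℝ, ContDiff ℝ (⊤ : ℕ∞) ζ → HasCompactSupport ζ → tsupport ζ ⊆ U → ∀ j : Fin 3,
    ∫ x, a x * pd j ζ x = - ∫ x, b j x * ζ x

lemma pd_reflect {k : E3 → ℝ} (hk : Differentiable ℝ k) (x : E3) (j : Fin 3) (y : E3) :
    pd j (fun y => k (x - y)) y = - pd j k (x - y) := by
  unfold pd
  have h : HasFDerivAt (fun y => k (x - y)) ((fderiv ℝ k (x - y)).comp (-ContinuousLinearMap.id ℝ E3)) y :=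
    (hk (x - y)).hasFDerivAt.comp y ((hasFDerivAt_id y).const_sub x)
  rw [h.fderiv]
  simp

lemma reflect_tsupport {k : E3 → ℝ} {r : ℝ} (hk : ∀ y, r < ‖y‖ → k y = 0) (x : E3) :
    tsupport (fun y => k (x - y)) ⊆ closedBall x r := by
  apply closure_minimal _ isClosed_closedBall
  intro y hy
  by_contra h
  apply hy
  apply hk
  rw [mem_closedBall, not_le, dist_comm, dist_eq_norm] at h
  exact h

lemma moll_grad {U : Set E3} {a : E3 → ℝ} {b : Fin 3 → E3 → ℝ} (h : WG U a b) (ha : LocallyIntegrable a)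
    (n : ℕ) {x : E3} (hx : closedBall x (1 / (n + 1 : ℝ)) ⊆ U) (j : Fin 3) :
    pd j (cv (eta n) a) x = cv (eta n) (b j) x := by
  rw [cv_pd (eta_contDiff n (m := 1)) (eta_compact n) ha]
  have hs := reflect_tsupport (k := eta n) (fun y hy => eta_eq_zero n hy) x
  have h1 := h (fun y => eta n (x - y)) ((eta_contDiff n).comp (contDiff_const.sub contDiff_id))
    ((isCompact_closedBall x _).of_isClosed_subset (isClosed_tsupport _) hs) (hs.trans hx) j
  simp only [pd_reflect ((eta_contDiff n (m := 1)).differentiable one_ne_zero)] at h1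
  simp only [mul_neg, integral_neg] at h1
  unfold cv
  linarith

lemma moll_ae {a : E3 → ℝ} (ha : LocallyIntegrable a) :
    ∀ᵐ x, Tendsto (fun n => cv (eta n) a x) atTop (nhds (a x)) := by
  have := ContDiffBump.ae_convolution_tendsto_right_of_locallyIntegrable (μ := (volume : Measure E3))
    (φ := bmp) (l := atTop) (K := 2) (g := a) ?_ ?_ ha
  · filter_upwards [this] with x hx
    refine hx.congr fun n => ?_
    rw [cv_comm]
    simp only [convolution, ContinuousLinearMap.lsmul_apply, smul_eq_mul, eta]
    congr 1; ext z; ring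
  · exact tendsto_one_div_add_atTop_nhds_zero_nat
  · refine Eventually.of_forall fun n => ?_
    simp only [bmp]
    apply le_of_eq; field_simp

lemma enorm_sq_le_eps (x y : ℝ) {ε : ℝ} (hε : 0 < ε) :
    ‖x‖ₑ ^ 2 ≤ ENNReal.ofReal (1 + ε) * ‖y‖ₑ ^ 2 + ENNReal.ofReal (1 + 1/ε) * ‖x - y‖ₑ ^ 2 := by
  simp only [← ofReal_norm, ← ENNReal.ofReal_pow (norm_nonneg _)]
  rw [← ENNReal.ofReal_mul (by positivity), ← ENNReal.ofReal_mul (by positivity),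
    ← ENNReal.ofReal_add (by positivity) (by positivity)]
  apply ENNReal.ofReal_le_ofReal
  simp only [Real.norm_eq_abs, sq_abs]
  have : 0 ≤ (ε * y - (x - y)) ^ 2 / ε := by positivity
  have e : (ε * y - (x - y)) ^ 2 / ε = ε * y^2 - 2 * y * (x - y) + 1/ε * (x-y)^2 := by
    field_simp; ring
  nlinarith

/-- closure of quadratic inequalities under weak gradients -/
lemma qclose {U : Set E3} {a : E3 → ℝ} {b : Fin 3 → E3 → ℝ} (h : WG U a b)
    (ham : Measurable a) (ha : MemLp a 2 volume) (hbm : ∀ j, Measurable (b j))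
    (hb : ∀ j, MemLp (b j) 2 volume) {W0 w1 w2 : E3 → ℝ≥0∞} (m0 : Measurable W0) (m1 : Measurable w1)
    (m2 : Measurable w2) {M : ℝ≥0∞} (hM : M ≠ ∞) (b1 : ∀ x, w1 x ≤ M) (b2 : ∀ x, w2 x ≤ M)
    {r : ℝ} (hr : 0 < r) (hU : ∀ x, w1 x ≠ 0 → closedBall x r ⊆ U)
    (hT : ∀ A : E3 → ℝ, ContDiff ℝ (⊤ : ℕ∞) A →
      ∫⁻ x, W0 x * ‖A x‖ₑ ^ 2 ≤ ∫⁻ x, ((∑ j, ‖pd j A x‖ₑ ^ 2) * w1 x + ‖A x‖ₑ ^ 2 * w2 x)) :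
    ∫⁻ x, W0 x * ‖a x‖ₑ ^ 2 ≤ ∫⁻ x, ((∑ j, ‖b j x‖ₑ ^ 2) * w1 x + ‖a x‖ₑ ^ 2 * w2 x) := by
  have hal : LocallyIntegrable a := ha.locallyIntegrable (by norm_num)
  have hbl : ∀ j, LocallyIntegrable (b j) := fun j => (hb j).locallyIntegrable (by norm_num)
  have cA : ∀ n, ContDiff ℝ (⊤ : ℕ∞) (cv (eta n) a) := fun n => cv_contDiff (eta_contDiff n) (eta_compact n) hal
  have mA : ∀ n, Measurable (cv (eta n) a) := fun n => (cA n).continuous.measurable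
  have mB : ∀ n j, Measurable (cv (eta n) (b j)) := fun n j =>
    (cv_contDiff (eta_contDiff n (m := 0)) (eta_compact n) (hbl j)).continuous.measurable
  set RHS := ∫⁻ x, ((∑ j, ‖b j x‖ₑ ^ 2) * w1 x + ‖a x‖ₑ ^ 2 * w2 x) with hRHS
  -- Fatou
  have fatou : ∫⁻ x, W0 x * ‖a x‖ₑ ^ 2 ≤ liminf (fun n => ∫⁻ x, W0 x * ‖cv (eta n) a x‖ₑ ^ 2) atTop := by
    calc ∫⁻ x, W0 x * ‖a x‖ₑ ^ 2 ≤ ∫⁻ x, liminf (fun n => W0 x * ‖cv (eta n) a x‖ₑ ^ 2) atTop := by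
          apply lintegral_mono_ae
          filter_upwards [moll_ae hal] with x hx
          have h1 : Tendsto (fun n => ‖cv (eta n) a x‖ₑ ^ 2) atTop (nhds (‖a x‖ₑ ^ 2)) :=
            ENNReal.Tendsto.pow (hx.enorm)
          by_cases hw : W0 x = ∞
          · by_cases ha0 : a x = 0
            · simp [ha0]
            · have : ∀ᶠ n in atTop, W0 x * ‖cv (eta n) a x‖ₑ ^ 2 = ∞ := by
                filter_upwards [hx.eventually_ne ha0] with n hn
                rw [hw, ENNReal.top_mul]
                simpa using hn
              rw [liminf_congr this]
              simp
          · exact (ENNReal.Tendsto.const_mul h1 (Or.inr hw)).liminf_eq.ge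
      _ ≤ _ := lintegral_liminf_le (fun n => by have := mA n; fun_prop)
  -- error
  set err : ℕ → ℝ≥0∞ := fun n => (∑ j, ∫⁻ x, ‖cv (eta n) (b j) x - b j x‖ₑ ^ 2) + ∫⁻ x, ‖cv (eta n) a x - a x‖ₑ ^ 2
  have herr : Tendsto err atTop (nhds 0) := by
    have := (tendsto_finsetSum (Finset.univ : Finset (Fin 3)) (fun j _ => moll_L2 (hbm j) (hb j))).add (moll_L2 ham ha)
    simpa [err] using this
  have main : ∀ ε : ℝ, 0 < ε → ∫⁻ x, W0 x * ‖a x‖ₑ ^ 2 ≤ ENNReal.ofReal (1 + ε) * RHS := by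
    intro ε hε
    refine fatou.trans ?_
    set C := ENNReal.ofReal (1 + 1/ε) * M with hC
    have hlim : Tendsto (fun n => ENNReal.ofReal (1 + ε) * RHS + C * err n) atTop
        (nhds (ENNReal.ofReal (1 + ε) * RHS)) := by
      have : Tendsto (fun n => C * err n) atTop (nhds (C * 0)) :=
        ENNReal.Tendsto.const_mul herr (Or.inr (ENNReal.mul_ne_top ENNReal.ofReal_ne_top hM))
      simpa using tendsto_const_nhds.add this
    refine le_trans (liminf_le_liminf ?_) hlim.liminf_eq.le
    obtain ⟨N, hN⟩ := exists_nat_one_div_lt hr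
    filter_upwards [eventually_ge_atTop N] with n hn
    refine (hT _ (cA n)).trans ?_
    have hnr : 1 / (n + 1 : ℝ) ≤ r := by
      have : 1 / (n + 1 : ℝ) ≤ 1 / (N + 1 : ℝ) := by gcongr
      linarith
    have pt : ∀ x, (∑ j, ‖pd j (cv (eta n) a) x‖ₑ ^ 2) * w1 x + ‖cv (eta n) a x‖ₑ ^ 2 * w2 x ≤
        ENNReal.ofReal (1 + ε) * ((∑ j, ‖b j x‖ₑ ^ 2) * w1 x + ‖a x‖ₑ ^ 2 * w2 x) +
        C * ((∑ j, ‖cv (eta n) (b j) x - b j x‖ₑ ^ 2) + ‖cv (eta n) a x - a x‖ₑ ^ 2) := by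
      intro x
      have i1 : (∑ j, ‖pd j (cv (eta n) a) x‖ₑ ^ 2) * w1 x ≤
          ENNReal.ofReal (1 + ε) * ((∑ j, ‖b j x‖ₑ ^ 2) * w1 x) + C * (∑ j, ‖cv (eta n) (b j) x - b j x‖ₑ ^ 2) := by
        by_cases hw : w1 x = 0
        · simp [hw]
        · have : ∀ j, pd j (cv (eta n) a) x = cv (eta n) (b j) x := fun j =>
            moll_grad h hal n ((closedBall_subset_closedBall hnr).trans (hU x hw)) j
          simp only [this]
          calc _ ≤ (∑ j, (ENNReal.ofReal (1 + ε) * ‖b j x‖ₑ ^ 2 + ENNReal.ofReal (1 + 1/ε) * ‖cv (eta n) (b j) x - b j x‖ₑ ^ 2)) * w1 x := by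
                gcongr with j
                exact enorm_sq_le_eps _ _ hε
            _ = ENNReal.ofReal (1 + ε) * ((∑ j, ‖b j x‖ₑ ^ 2) * w1 x) + ENNReal.ofReal (1 + 1/ε) * w1 x * (∑ j, ‖cv (eta n) (b j) x - b j x‖ₑ ^ 2) := by
                rw [Finset.sum_add_distrib, ← Finset.mul_sum, ← Finset.mul_sum]; ring
            _ ≤ _ := by
                rw [hC]; gcongr; exact b1 x
      have i2 : ‖cv (eta n) a x‖ₑ ^ 2 * w2 x ≤ ENNReal.ofReal (1 + ε) * (‖a x‖ₑ ^ 2 * w2 x) + C * ‖cv (eta n) a x - a x‖ₑ ^ 2 := by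
        calc _ ≤ (ENNReal.ofReal (1 + ε) * ‖a x‖ₑ ^ 2 + ENNReal.ofReal (1 + 1/ε) * ‖cv (eta n) a x - a x‖ₑ ^ 2) * w2 x := by
              gcongr
              exact enorm_sq_le_eps _ _ hε
          _ = ENNReal.ofReal (1 + ε) * (‖a x‖ₑ ^ 2 * w2 x) + ENNReal.ofReal (1 + 1/ε) * w2 x * ‖cv (eta n) a x - a x‖ₑ ^ 2 := by ring
          _ ≤ _ := by rw [hC]; gcongr; exact b2 x
      refine (add_le_add i1 i2).trans (le_of_eq ?_)
      ring
    refine (lintegral_mono pt).trans (le_of_eq ?_)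
    have := mA n
    have := mB n
    have e : ∫⁻ x, ((∑ j, ‖cv (eta n) (b j) x - b j x‖ₑ ^ 2) + ‖cv (eta n) a x - a x‖ₑ ^ 2) = err n := by
      rw [lintegral_add_left (by fun_prop), lintegral_finsetSum _ (fun j _ => by fun_prop)]
    rw [lintegral_add_left (by fun_prop), lintegral_const_mul _ (by fun_prop), lintegral_const_mul _ (by fun_prop), e]
  have hl : Tendsto (fun ε : ℝ => ENNReal.ofReal (1 + ε) * RHS) (nhdsWithin 0 (Ioi 0)) (nhds (ENNReal.ofReal (1 + 0) * RHS)) := by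
    apply ENNReal.Tendsto.mul_const
    · apply ENNReal.tendsto_ofReal
      exact (tendsto_const_nhds.add tendsto_id).mono_left nhdsWithin_le_nhds
    · left; simp
  rw [add_zero, ENNReal.ofReal_one, one_mul] at hl
  exact ge_of_tendsto hl (by filter_upwards [self_mem_nhdsWithin] with ε hε using main ε hε)

/-! ### radial calculus -/

lemma rad_hasFDerivAt {F : ℝ → ℝ} {F' : ℝ} {x0 x : E3} (h : HasDerivAt F F' (‖x - x0‖ ^ 2)) :
    HasFDerivAt (fun y => F (‖y - x0‖ ^ 2)) ((2 * F') • innerSL ℝ (x - x0)) x := by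
  have h1 : HasFDerivAt (fun y : E3 => ‖y - x0‖ ^ 2) (2 • (innerSL ℝ (x - x0)).comp (ContinuousLinearMap.id ℝ E3)) x :=
    ((hasFDerivAt_id x).sub_const x0).norm_sq
  have h2 := h.comp_hasFDerivAt x h1
  refine h2.congr_fderiv ?_
  rw [ContinuousLinearMap.comp_id, two_nsmul, mul_smul, two_smul, smul_add]

lemma rad_pd {F : ℝ → ℝ} {F' : ℝ} {x0 x : E3} (h : HasDerivAt F F' (‖x - x0‖ ^ 2)) (i : Fin 3) :
    pd i (fun y => F (‖y - x0‖ ^ 2)) x = 2 * (x - x0) i * F' := by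
  rw [pd, (rad_hasFDerivAt h).fderiv]
  simp [EuclideanSpace.inner_single_right]
  ring

lemma rad_fderiv_norm {F : ℝ → ℝ} {F' : ℝ} {x0 x : E3} (h : HasDerivAt F F' (‖x - x0‖ ^ 2)) :
    ‖fderiv ℝ (fun y => F (‖y - x0‖ ^ 2)) x‖ = 2 * |F'| * ‖x - x0‖ := by
  rw [(rad_hasFDerivAt h).fderiv, norm_smul, innerSL_apply_norm]
  simp

lemma pd_coord (i j : Fin 3) (x0 x : E3) : pd j (fun y : E3 => (y - x0) i) x = if i = j then 1 else 0 := by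
  have : HasFDerivAt (fun y : E3 => (y - x0) i) (EuclideanSpace.proj i : E3 →L[ℝ] ℝ) x := by
    have := (EuclideanSpace.proj i : E3 →L[ℝ] ℝ).hasFDerivAt (x := x - x0)
    exact this.comp x ((hasFDerivAt_id x).sub_const x0)
  rw [pd, this.fderiv]
  simp

lemma pd_mul {f g : E3 → ℝ} {x : E3} (hf : DifferentiableAt ℝ f x) (hg : DifferentiableAt ℝ g x) (i : Fin 3) :
    pd i (fun y => f y * g y) x = f x * pd i g x + g x * pd i f x := by
  unfold pd
  rw [fderiv_fun_mul hf hg]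
  simp

lemma pd_add {f g : E3 → ℝ} {x : E3} (hf : DifferentiableAt ℝ f x) (hg : DifferentiableAt ℝ g x) (i : Fin 3) :
    pd i (fun y => f y + g y) x = pd i f x + pd i g x := by
  unfold pd
  rw [fderiv_fun_add hf hg]
  simp

lemma pd_const_mul (c : ℝ) {f : E3 → ℝ} {x : E3} (hf : DifferentiableAt ℝ f x) (i : Fin 3) :
    pd i (fun y => c * f y) x = c * pd i f x := by
  unfold pd
  rw [fderiv_const_mul hf]
  simp

lemma coord_diff (i : Fin 3) (x0 x : E3) : DifferentiableAt ℝ (fun y : E3 => (y - x0) i) x := by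
  have := (EuclideanSpace.proj i : E3 →L[ℝ] ℝ).hasFDerivAt (x := x - x0)
  exact (this.comp x ((hasFDerivAt_id x).sub_const x0)).differentiableAt

lemma rad_pd2 {F F1 : ℝ → ℝ} {F2 : ℝ} {x0 x : E3} (h : ∀ᶠ τ in nhds (‖x - x0‖ ^ 2), HasDerivAt F (F1 τ) τ)
    (h2 : HasDerivAt F1 F2 (‖x - x0‖ ^ 2)) (i j : Fin 3) :
    pd j (pd i (fun y => F (‖y - x0‖ ^ 2))) x =
      (if i = j then 1 else 0) * (2 * F1 (‖x - x0‖ ^ 2)) + 4 * (x - x0) i * (x - x0) j * F2 := by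
  have hc : ContinuousAt (fun y : E3 => ‖y - x0‖ ^ 2) x := by fun_prop
  have e : pd i (fun y => F (‖y - x0‖ ^ 2)) =ᶠ[nhds x] fun y => (2 * F1 (‖y - x0‖ ^ 2)) * (y - x0) i := by
    filter_upwards [hc.eventually h] with y hy
    rw [rad_pd hy]; ring
  have e2 : pd j (pd i (fun y => F (‖y - x0‖ ^ 2))) x = pd j (fun y => (2 * F1 (‖y - x0‖ ^ 2)) * (y - x0) i) x := by
    conv_lhs => rw [pd]
    rw [e.fderiv_eq]; rfl
  have d1 : DifferentiableAt ℝ (fun y : E3 => F1 (‖y - x0‖ ^ 2)) x := (rad_hasFDerivAt h2).differentiableAt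
  rw [e2, pd_mul (d1.const_mul 2) (coord_diff i x0 x), pd_coord, pd_const_mul 2 d1, rad_pd h2]
  ring

lemma sum_coord_sq (x : E3) : ∑ i : Fin 3, x i * x i = ‖x‖ ^ 2 := by
  rw [EuclideanSpace.norm_sq_eq]
  simp [sq]

lemma rad_lap {F F1 : ℝ → ℝ} {F2 : ℝ} {x0 x : E3} (h : ∀ᶠ τ in nhds (‖x - x0‖ ^ 2), HasDerivAt F (F1 τ) τ)
    (h2 : HasDerivAt F1 F2 (‖x - x0‖ ^ 2)) :
    lap (fun y => F (‖y - x0‖ ^ 2)) x = 6 * F1 (‖x - x0‖ ^ 2) + 4 * ‖x - x0‖ ^ 2 * F2 := by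
  unfold lap
  have : ∀ i, pd i (fun y => pd i (fun y => F (‖y - x0‖ ^ 2)) y) x = 2 * F1 (‖x - x0‖ ^ 2) + 4 * ((x - x0) i * (x - x0) i) * F2 := by
    intro i
    have := rad_pd2 h h2 i i
    rw [if_pos rfl] at this
    rw [show (fun y => pd i (fun y => F (‖y - x0‖ ^ 2)) y) = pd i (fun y => F (‖y - x0‖ ^ 2)) from rfl, this]; ring
  simp only [this]
  rw [← sum_coord_sq]
  simp only [Fin.sum_univ_three]; ring

lemma coord_le (x : E3) (i : Fin 3) : |x i| ≤ ‖x‖ := by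
  have := PiLp.norm_apply_le x i
  simpa using this

lemma fderiv_norm_le_pd (f : E3 → ℝ) (x : E3) : ‖fderiv ℝ f x‖ ^ 2 ≤ ∑ j, (pd j f x) ^ 2 := by
  have : ‖fderiv ℝ f x‖ ≤ Real.sqrt (∑ j, (pd j f x) ^ 2) := by
    apply ContinuousLinearMap.opNorm_le_bound _ (Real.sqrt_nonneg _)
    intro v
    have hv : v = ∑ j, v j • EuclideanSpace.single j (1:ℝ) := by
      have := (EuclideanSpace.basisFun (Fin 3) ℝ).sum_repr v
      simpa using this.symm
    have : fderiv ℝ f x v = ∑ j, pd j f x * v j := by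
      conv_lhs => rw [hv]
      rw [map_sum]
      apply Finset.sum_congr rfl
      intro j _
      rw [map_smul, smul_eq_mul, mul_comm]; rfl
    rw [this, Real.norm_eq_abs, EuclideanSpace.norm_eq, ← Real.sqrt_mul (by positivity)]
    apply Real.abs_le_sqrt
    simpa using Finset.sum_mul_sq_le_sq_mul_sq Finset.univ (fun j => pd j f x) (fun j => v j)
  calc _ ≤ (Real.sqrt (∑ j, (pd j f x) ^ 2)) ^ 2 := by gcongr
    _ = _ := Real.sq_sqrt (by positivity)

lemma pd_le_fderiv (f : E3 → ℝ) (x : E3) (j : Fin 3) : |pd j f x| ≤ ‖fderiv ℝ f x‖ := by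
  have := (fderiv ℝ f x).le_opNorm (EuclideanSpace.single j 1)
  simpa [pd] using this

/-! ### the cutoff -/

def ct (τ : ℝ) : ℝ := Real.smoothTransition ((1 - τ) * (4 / 3))

lemma ct_contDiff {n : ℕ∞} : ContDiff ℝ n ct := by
  unfold ct
  exact Real.smoothTransition.contDiff.comp (by fun_prop)

lemma ct_one {τ : ℝ} (h : τ ≤ 1/4) : ct τ = 1 := Real.smoothTransition.one_of_one_le (by linarith)
lemma ct_zero {τ : ℝ} (h : 1 ≤ τ) : ct τ = 0 := Real.smoothTransition.zero_of_nonpos (by linarith)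
lemma ct_nonneg (τ : ℝ) : 0 ≤ ct τ := Real.smoothTransition.nonneg _
lemma ct_le_one (τ : ℝ) : ct τ ≤ 1 := Real.smoothTransition.le_one _

lemma ct_deriv_zero {τ : ℝ} (h : τ < 1/4 ∨ 1 < τ) : deriv ct τ = 0 := by
  rcases h with h | h
  · have : ct =ᶠ[nhds τ] fun _ => 1 := by
      filter_upwards [Iio_mem_nhds h] with t ht using ct_one (le_of_lt ht)
    rw [this.deriv_eq]; simp
  · have : ct =ᶠ[nhds τ] fun _ => 0 := by
      filter_upwards [Ioi_mem_nhds h] with t ht using ct_zero (le_of_lt ht)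
    rw [this.deriv_eq]; simp

lemma ct_deriv2_zero {τ : ℝ} (h : τ < 1/4 ∨ 1 < τ) : deriv (deriv ct) τ = 0 := by
  have : deriv ct =ᶠ[nhds τ] fun _ => 0 := by
    rcases h with h | h
    · filter_upwards [Iio_mem_nhds h] with t ht using ct_deriv_zero (Or.inl ht)
    · filter_upwards [Ioi_mem_nhds h] with t ht using ct_deriv_zero (Or.inr ht)
  rw [this.deriv_eq]; simp

lemma ct_deriv_contDiff {n : ℕ∞} : ContDiff ℝ n (deriv ct) := by
  have : ContDiff ℝ ((n + 1 : ℕ∞)) ct := ct_contDiff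
  exact (contDiff_succ_iff_deriv.1 (by exact_mod_cast this)).2.2

lemma bdd_of_cont {f : ℝ → ℝ} (hf : Continuous f) (h : ∀ τ, τ < 1/4 ∨ 1 < τ → f τ = 0) : ∃ C, 0 < C ∧ ∀ τ, |f τ| ≤ C := by
  obtain ⟨C, hC⟩ := (isCompact_Icc (a := (1/4:ℝ)) (b := 1)).exists_bound_of_continuousOn hf.continuousOn
  refine ⟨max C 1, by positivity, fun τ => ?_⟩
  by_cases h1 : τ < 1/4 ∨ 1 < τ
  · rw [h τ h1]; simp
  · push Not at h1
    exact (hC τ h1).trans (le_max_left _ _)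

lemma ct_bounds : ∃ C, 1 ≤ C ∧ (∀ τ, |deriv ct τ| ≤ C) ∧ ∀ τ, |deriv (deriv ct) τ| ≤ C := by
  obtain ⟨C1, h1, h1'⟩ := bdd_of_cont (ct_deriv_contDiff (n := 0)).continuous (fun τ h => ct_deriv_zero h)
  obtain ⟨C2, h2, h2'⟩ := bdd_of_cont ((ct_deriv_contDiff (n := 1)).continuous_deriv le_rfl) (fun τ h => ct_deriv2_zero h)
  exact ⟨1 + C1 + C2, by linarith, fun τ => (h1' τ).trans (by linarith), fun τ => (h2' τ).trans (by linarith)⟩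

/-- universal bound for the derivatives of the cutoff -/
def Kct : ℝ := ct_bounds.choose
lemma Kct_one : 1 ≤ Kct := ct_bounds.choose_spec.1
lemma ct_deriv_le (τ : ℝ) : |deriv ct τ| ≤ Kct := ct_bounds.choose_spec.2.1 τ
lemma ct_deriv2_le (τ : ℝ) : |deriv (deriv ct) τ| ≤ Kct := ct_bounds.choose_spec.2.2 τ

lemma ct_hasDeriv (τ : ℝ) : HasDerivAt ct (deriv ct τ) τ :=
  ((ct_contDiff (n := 1)).differentiable one_ne_zero τ).hasDerivAt
lemma ct_hasDeriv2 (τ : ℝ) : HasDerivAt (deriv ct) (deriv (deriv ct) τ) τ :=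
  ((ct_deriv_contDiff (n := 1)).differentiable one_ne_zero τ).hasDerivAt

/-! ### weights -/

def hp (x0 : E3) (σ β : ℝ) (x : E3) : ℝ := (‖x - x0‖ ^ 2 + σ) ^ (β / 2)
def hw (x0 : E3) (σ β : ℝ) (x : E3) : ℝ≥0∞ := ENNReal.ofReal (hp x0 σ β x)

section weights
variable {x0 : E3} {σ : ℝ}

lemma hbase (hσ : 0 < σ) (x : E3) : 0 < ‖x - x0‖ ^ 2 + σ := by positivity
lemma hp_pos (hσ : 0 < σ) (β : ℝ) (x : E3) : 0 < hp x0 σ β x := by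
  unfold hp; have := hbase (x0 := x0) hσ x; positivity
lemma hp_mul (hσ : 0 < σ) (β γ : ℝ) (x : E3) : hp x0 σ β x * hp x0 σ γ x = hp x0 σ (β + γ) x := by
  unfold hp; rw [← Real.rpow_add (hbase hσ x)]; congr 1; ring
lemma hw_mul (hσ : 0 < σ) (β γ : ℝ) (x : E3) : hw x0 σ β x * hw x0 σ γ x = hw x0 σ (β + γ) x := by
  unfold hw; rw [← ENNReal.ofReal_mul (hp_pos hσ _ _).le, hp_mul hσ]
lemma hp_cont (hσ : 0 < σ) (β : ℝ) : Continuous (hp x0 σ β) := by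
  unfold hp
  exact Continuous.rpow_const (by fun_prop) (fun x => Or.inl (hbase hσ x).ne')
lemma hw_meas (hσ : 0 < σ) (β : ℝ) : Measurable (hw x0 σ β) :=
  (hp_cont hσ β).measurable.ennreal_ofReal
lemma hp_zero (x : E3) : hp x0 σ 0 x = 1 := by simp [hp]
lemma hw_zero (x : E3) : hw x0 σ 0 x = 1 := by simp [hw, hp]
lemma hp_two (x : E3) : hp x0 σ 2 x = ‖x - x0‖ ^ 2 + σ := by simp [hp]
lemma hp_one (x : E3) : hp x0 σ 1 x = Real.sqrt (‖x - x0‖ ^ 2 + σ) := by simp [hp, Real.sqrt_eq_rpow]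
lemma hp_one_sq (hσ : 0 < σ) (x : E3) : hp x0 σ 1 x ^ 2 = ‖x - x0‖ ^ 2 + σ := by
  rw [hp_one, Real.sq_sqrt (hbase hσ x).le]
lemma norm_le_hp (hσ : 0 < σ) (x : E3) : ‖x - x0‖ ≤ hp x0 σ 1 x := by
  rw [hp_one]; apply Real.le_sqrt_of_sq_le; linarith
lemma hp_eq_rpow (hσ : 0 < σ) (β : ℝ) (x : E3) : hp x0 σ β x = hp x0 σ 1 x ^ β := by
  unfold hp; rw [← Real.rpow_mul (hbase hσ x).le]; congr 1; ring
lemma hp_lip (hσ : 0 < σ) (x y : E3) : hp x0 σ 1 y ≤ hp x0 σ 1 x + ‖y - x‖ := by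
  have h1 := hp_one_sq (x0 := x0) hσ x
  have h2 := norm_le_hp (x0 := x0) hσ x
  have h3 := hp_pos (x0 := x0) hσ 1 x
  rw [hp_one (x := y)]
  apply Real.sqrt_le_iff.2
  refine ⟨by positivity, ?_⟩
  have : ‖y - x0‖ ≤ ‖x - x0‖ + ‖y - x‖ := by
    have := norm_add_le (x - x0) (y - x)
    simpa [add_comm] using this
  have h4 : ‖y - x0‖ ^ 2 ≤ (‖x - x0‖ + ‖y - x‖) ^ 2 := by gcongr
  nlinarith [norm_nonneg (y - x), norm_nonneg (x - x0), mul_nonneg (norm_nonneg (y - x)) (sub_nonneg.2 h2)]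
/-- comparison of weights at nearby points -/
lemma hp_comp (hσ : 0 < σ) {x y : E3} (hxy : ‖y - x‖ ≤ hp x0 σ 1 x / 2) (β : ℝ) :
    hp x0 σ β y ≤ 2 ^ |β| * hp x0 σ β x := by
  have h1 := hp_lip (x0 := x0) hσ x y
  have h2 := hp_lip (x0 := x0) hσ y x
  rw [norm_sub_rev] at h2
  have px := hp_pos (x0 := x0) hσ 1 x
  have py := hp_pos (x0 := x0) hσ 1 y
  rw [hp_eq_rpow hσ β y, hp_eq_rpow hσ β x]
  rcases le_total 0 β with hb | hb
  · rw [abs_of_nonneg hb, ← Real.mul_rpow (by norm_num) px.le]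
    exact Real.rpow_le_rpow py.le (by linarith) hb
  · rw [abs_of_nonpos hb]
    calc hp x0 σ 1 y ^ β ≤ (2⁻¹ * hp x0 σ 1 x) ^ β := Real.rpow_le_rpow_of_nonpos (by positivity) (by linarith) hb
      _ = _ := by
        rw [Real.mul_rpow (by norm_num) px.le, Real.inv_rpow (by norm_num), ← Real.rpow_neg (by norm_num)]
lemma hw_comp (hσ : 0 < σ) {x y : E3} (hxy : ‖y - x‖ ≤ hp x0 σ 1 x / 2) (β : ℝ) :
    hw x0 σ β y ≤ ENNReal.ofReal (2 ^ |β|) * hw x0 σ β x := by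
  unfold hw
  rw [← ENNReal.ofReal_mul (by positivity)]
  exact ENNReal.ofReal_le_ofReal (hp_comp hσ hxy β)
/-- boundedness of weights on bounded sets -/
lemma hp_bdd (hσ : 0 < σ) (β R : ℝ) : ∃ M, ∀ x ∈ closedBall x0 R, hp x0 σ β x ≤ M := by
  obtain ⟨M, hM⟩ := (isCompact_closedBall x0 R).exists_bound_of_continuousOn (hp_cont (x0 := x0) hσ β).continuousOn
  exact ⟨M, fun x hx => (le_abs_self _).trans (hM x hx)⟩
end weights

/-! ### the quadratic trace lemma -/

/-- weighted trace inequality -/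
def Tr (x0 : E3) (σ : ℝ) (κ : ℝ≥0∞) (α : ℝ) (V : E3 → ℝ≥0∞) : Prop :=
  ∀ f : E3 → ℝ, ContDiff ℝ 1 f → HasCompactSupport f → tsupport f ⊆ ball x0 4 →
    ∫⁻ x, V x * ‖f x‖ₑ ≤ κ * ∫⁻ x, (‖fderiv ℝ f x‖ₑ + ‖f x‖ₑ * hw x0 σ (-1) x) * hw x0 σ α x

def FQ (σ b c τ : ℝ) : ℝ := ct τ * (τ + σ) ^ (-b / 2) * ct (c / (τ + σ))
def FQ' (σ b c τ : ℝ) : ℝ := (deriv ct τ * (τ + σ) ^ (-b / 2) + ct τ * (1 * (-b / 2) * (τ + σ) ^ (-b / 2 - 1))) * ct (c / (τ + σ)) +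
  ct τ * (τ + σ) ^ (-b / 2) * (deriv ct (c / (τ + σ)) * ((0 * (τ + σ) - c * 1) / (τ + σ) ^ 2))

lemma FQ_deriv {σ b c τ : ℝ} (h : 0 < τ + σ) : HasDerivAt (FQ σ b c) (FQ' σ b c τ) τ := by
  have h1 : HasDerivAt (fun τ => τ + σ) 1 τ := (hasDerivAt_id τ).add_const σ
  have h2 := h1.rpow_const (p := -b/2) (Or.inl h.ne')
  have h3 := (hasDerivAt_const τ c).div h1 h.ne'
  have h4 := (ct_hasDeriv (c / (τ + σ))).comp τ h3
  exact ((ct_hasDeriv τ).mul h2).mul h4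

lemma FQ_zero {σ b c τ : ℝ} (h : 0 < τ + σ) (hS : ¬ (τ ≤ 1 ∧ c ≤ τ + σ)) : FQ σ b c τ = 0 ∧ FQ' σ b c τ = 0 := by
  rw [not_and_or] at hS
  rcases hS with hS | hS
  · push Not at hS
    simp [FQ, FQ', ct_zero hS.le, ct_deriv_zero (Or.inr hS)]
  · push Not at hS
    have : 1 < c / (τ + σ) := by rwa [lt_div_iff₀ h, one_mul]
    simp [FQ, FQ', ct_zero this.le, ct_deriv_zero (Or.inr this)]

lemma FQ_nonneg {σ b c τ : ℝ} (h : 0 < τ + σ) : 0 ≤ FQ σ b c τ := by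
  unfold FQ
  have := ct_nonneg τ
  have := ct_nonneg (c / (τ + σ))
  positivity

lemma FQ_le {σ b c τ : ℝ} (h : 0 < τ + σ) : FQ σ b c τ ≤ (τ + σ) ^ (-b/2) := by
  unfold FQ
  have := ct_nonneg τ
  have := ct_nonneg (c / (τ + σ))
  have := ct_le_one τ
  have := ct_le_one (c / (τ + σ))
  calc _ ≤ 1 * (τ + σ) ^ (-b / 2) * 1 := by gcongr
    _ = _ := by ring

lemma FQ'_le {σ b c τ : ℝ} (h : 0 < τ + σ) (hb : 0 ≤ b) (hc : 0 ≤ c) (h1 : τ ≤ 1) (h2 : c ≤ τ + σ) (hσ : σ ≤ 2) :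
    |FQ' σ b c τ| ≤ (4 * Kct + b / 2) * (τ + σ) ^ (-b/2 - 1) := by
  unfold FQ'
  have p := Real.rpow_pos_of_pos h (-b/2 - 1)
  have e : (τ + σ) ^ (-b / 2) = (τ + σ) ^ (-b / 2 - 1) * (τ + σ) := by
    rw [Real.rpow_sub_one h.ne']; field_simp
  set P := (τ + σ) ^ (-b / 2 - 1)
  have a1 := ct_nonneg τ
  have a2 := ct_nonneg (c / (τ + σ))
  have a3 := ct_le_one τ
  have a4 := ct_le_one (c / (τ + σ))
  have a5 := ct_deriv_le τ
  have a6 := ct_deriv_le (c / (τ + σ))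
  have K1 := Kct_one
  rw [e]
  have t1 : |(deriv ct τ * (P * (τ + σ)) + ct τ * (1 * (-b / 2) * P)) * ct (c / (τ + σ))| ≤ (3 * Kct + b/2) * P := by
    rw [abs_mul, abs_of_nonneg a2]
    have : |deriv ct τ * (P * (τ + σ)) + ct τ * (1 * (-b / 2) * P)| ≤ Kct * (P * 3) + 1 * (b / 2 * P) := by
      refine (abs_add_le _ _).trans ?_
      rw [abs_mul, abs_mul (ct τ), abs_of_nonneg a1, abs_of_pos (by positivity : 0 < P * (τ + σ)), abs_mul _ P, abs_of_pos p,
        show |1 * (-b/2)| = b / 2 by rw [one_mul, abs_of_nonpos (by linarith)]; ring]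
      gcongr
      linarith
    calc _ ≤ (Kct * (P * 3) + 1 * (b / 2 * P)) * 1 := by gcongr
      _ = _ := by ring
  have t2 : |ct τ * (P * (τ + σ)) * (deriv ct (c / (τ + σ)) * ((0 * (τ + σ) - c * 1) / (τ + σ) ^ 2))| ≤ Kct * P := by
    have : ct τ * (P * (τ + σ)) * (deriv ct (c / (τ + σ)) * ((0 * (τ + σ) - c * 1) / (τ + σ) ^ 2)) =
      - (ct τ * P * (deriv ct (c / (τ + σ)) * (c / (τ + σ)))) := by field_simp; ring
    rw [this, abs_neg, abs_mul, abs_mul, abs_mul, abs_of_nonneg a1, abs_of_pos p, abs_of_nonneg (by positivity : 0 ≤ c / (τ + σ))]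
    have : c / (τ + σ) ≤ 1 := by rwa [div_le_one h]
    calc _ ≤ 1 * P * (Kct * 1) := by gcongr
      _ = _ := by ring
  refine (abs_add_le _ _).trans ?_
  linarith

/-- the spatial weight in the quadratic trace lemma -/
def PsiQ (x0 : E3) (σ b : ℝ) (z x : E3) : ℝ := FQ σ b (4 * ‖z‖ ^ 2) (‖x - x0‖ ^ 2)
/-- its support -/
def SQ (x0 : E3) (σ : ℝ) (z : E3) : Set E3 := {x | x ∈ closedBall x0 1 ∧ ‖z‖ ≤ hp x0 σ 1 x / 2}

section
variable {x0 : E3} {σ : ℝ}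

lemma SQ_iff (hσ : 0 < σ) (z x : E3) : x ∈ SQ x0 σ z ↔ ‖x - x0‖ ^ 2 ≤ 1 ∧ 4 * ‖z‖ ^ 2 ≤ ‖x - x0‖ ^ 2 + σ := by
  rw [SQ, mem_ofPred_eq, mem_closedBall, dist_eq_norm, ← hp_one_sq hσ, sq_le_one_iff₀ (norm_nonneg _)]
  refine and_congr Iff.rfl ?_
  rw [show 4 * ‖z‖ ^ 2 = (2 * ‖z‖) ^ 2 by ring, sq_le_sq₀ (by positivity) (hp_pos hσ _ _).le]
  constructor <;> intro h <;> linarith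

lemma SQ_meas (hσ : 0 < σ) (z : E3) : MeasurableSet (SQ x0 σ z) := by
  have := (hp_cont (x0 := x0) hσ 1)
  exact (isClosed_closedBall.measurableSet).inter
    (isClosed_le continuous_const (this.div_const 2)).measurableSet

lemma PsiQ_contDiff (hσ : 0 < σ) (b : ℝ) (z : E3) {n : ℕ∞} : ContDiff ℝ n (PsiQ x0 σ b z) := by
  unfold PsiQ FQ
  have h1 : ContDiff ℝ n (fun x : E3 => ‖x - x0‖ ^ 2) := (contDiff_id.sub contDiff_const).norm_sq ℝ
  have h2 : ContDiff ℝ n (fun x : E3 => ‖x - x0‖ ^ 2 + σ) := h1.add contDiff_const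
  exact ((ct_contDiff.comp h1).mul (h2.rpow_const_of_ne (fun x => (hbase hσ x).ne'))).mul
    (ct_contDiff.comp (contDiff_const.div h2 (fun x => (hbase hσ x).ne')))

lemma PsiQ_nonneg (hσ : 0 < σ) (b : ℝ) (z x : E3) : 0 ≤ PsiQ x0 σ b z x := FQ_nonneg (hbase hσ x)

lemma PsiQ_zero (hσ : 0 < σ) (b : ℝ) {z x : E3} (h : x ∉ SQ x0 σ z) : PsiQ x0 σ b z x = 0 ∧ fderiv ℝ (PsiQ x0 σ b z) x = 0 := by
  rw [SQ_iff hσ] at h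
  have := FQ_zero (b := b) (hbase hσ x) h
  refine ⟨this.1, ?_⟩
  have h2 := rad_hasFDerivAt (FQ_deriv (σ := σ) (b := b) (c := 4 * ‖z‖ ^ 2) (hbase (x0 := x0) hσ x))
  rw [this.2] at h2
  have h3 := h2.fderiv
  simp only [mul_zero, zero_smul] at h3
  exact h3

lemma PsiQ_le (hσ : 0 < σ) (b : ℝ) (z x : E3) : PsiQ x0 σ b z x ≤ hp x0 σ (-b) x := FQ_le (hbase hσ x)

lemma PsiQ_fderiv_le (hσ : 0 < σ) (hσ2 : σ ≤ 2) {b : ℝ} (hb : 0 ≤ b) {z x : E3} (h : x ∈ SQ x0 σ z) :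
    ‖fderiv ℝ (PsiQ x0 σ b z) x‖ ≤ (8 * Kct + b) * hp x0 σ (-b - 1) x := by
  have h' := h
  rw [SQ_iff hσ] at h'
  have h1 := FQ'_le (hbase hσ x) hb (by positivity) h'.1 h'.2 hσ2
  have h2 := rad_fderiv_norm (FQ_deriv (σ := σ) (b := b) (c := 4 * ‖z‖ ^ 2) (hbase (x0 := x0) hσ x))
  have h3 : ‖fderiv ℝ (PsiQ x0 σ b z) x‖ = 2 * |FQ' σ b (4 * ‖z‖ ^ 2) (‖x - x0‖ ^ 2)| * ‖x - x0‖ := h2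
  rw [h3]
  have e : (‖x - x0‖ ^ 2 + σ) ^ (-b / 2 - 1) = hp x0 σ (-b - 2) x := by unfold hp; congr 1; ring
  rw [e] at h1
  have K1 := Kct_one
  calc _ ≤ 2 * ((4 * Kct + b / 2) * hp x0 σ (-b - 2) x) * hp x0 σ 1 x := by
        gcongr
        · exact mul_nonneg zero_le_two (mul_nonneg (by positivity) (hp_pos hσ _ _).le)
        · exact norm_le_hp hσ x
    _ = (8 * Kct + b) * (hp x0 σ (-b - 2) x * hp x0 σ 1 x) := by ring
    _ = _ := by rw [hp_mul hσ]; congr 2; ring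

lemma PsiQ_tsupport (hσ : 0 < σ) (b : ℝ) (z : E3) : tsupport (PsiQ x0 σ b z) ⊆ SQ x0 σ z := by
  apply closure_minimal
  · intro x hx
    by_contra h
    exact hx (PsiQ_zero hσ b h).1
  · have := (hp_cont (x0 := x0) hσ 1)
    exact (isClosed_closedBall).inter (isClosed_le continuous_const (this.div_const 2))

/-- pointwise estimate -/
lemma qpt (hσ : 0 < σ) (hσ2 : σ ≤ 2) {b α : ℝ} (hb : 0 ≤ b) (hα : 0 ≤ α) (hα1 : α ≤ 1) {z x : E3} {A : E3 → ℝ} (hA : ContDiff ℝ (⊤ : ℕ∞) A)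
    (h : x ∈ SQ x0 σ z) :
    (‖fderiv ℝ (fun x => A x ^ 2 * PsiQ x0 σ b z x) x‖ + |A x ^ 2 * PsiQ x0 σ b z x| * hp x0 σ (-1) (x + z)) * hp x0 σ α (x + z)
    ≤ (16 * Kct + 2 * b + 8) * ((∑ j, (pd j A x) ^ 2) * hp x0 σ (1 - b + α) x + A x ^ 2 * hp x0 σ (-1 - b + α) x) := by
  have hy : ‖(x + z) - x‖ ≤ hp x0 σ 1 x / 2 := by simpa using h.2
  have c1 := hp_comp (x0 := x0) hσ hy (-1)
  have c2 := hp_comp (x0 := x0) hσ hy α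
  rw [abs_neg, abs_one, Real.rpow_one] at c1
  have c3 : (2:ℝ) ^ |α| ≤ 2 := by
    rw [abs_of_nonneg hα]
    calc (2:ℝ) ^ α ≤ 2 ^ (1:ℝ) := Real.rpow_le_rpow_of_exponent_le (by norm_num) hα1
      _ = 2 := by simp
  have dA : DifferentiableAt ℝ A x := (hA.differentiable (by simp)) x
  have dP : DifferentiableAt ℝ (PsiQ x0 σ b z) x := ((PsiQ_contDiff hσ b z (n := 1)).differentiable one_ne_zero) x
  have d1 : ‖fderiv ℝ (fun x => A x ^ 2 * PsiQ x0 σ b z x) x‖ ≤ A x ^ 2 * ‖fderiv ℝ (PsiQ x0 σ b z) x‖ +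
      PsiQ x0 σ b z x * (2 * |A x| * ‖fderiv ℝ A x‖) := by
    rw [fderiv_fun_mul (dA.fun_pow 2) dP]
    refine (norm_add_le _ _).trans ?_
    rw [norm_smul, norm_smul]
    have : fderiv ℝ (fun x => A x ^ 2) x = (2 * A x) • fderiv ℝ A x := by
      rw [fderiv_fun_pow 2 dA]; simp
    rw [this, norm_smul]
    simp [abs_of_nonneg (PsiQ_nonneg (x0 := x0) hσ b z x)]
  have pP := PsiQ_nonneg (x0 := x0) hσ b z x
  have lP := PsiQ_le (x0 := x0) hσ b z x
  have gP := PsiQ_fderiv_le hσ hσ2 hb h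
  have gA := fderiv_norm_le_pd A x
  set G := ‖fderiv ℝ A x‖
  set S := ∑ j, (pd j A x) ^ 2
  set h0 := hp x0 σ (-b) x with e0
  have p0 : 0 < h0 := hp_pos hσ _ _
  have p1 : 0 < hp x0 σ 1 x := hp_pos hσ _ _
  have pm : 0 < hp x0 σ (-1) x := hp_pos hσ _ _
  have pa : 0 < hp x0 σ α x := hp_pos hσ _ _
  have e1 : hp x0 σ (1 - b + α) x = hp x0 σ 1 x * h0 * hp x0 σ α x := by
    rw [e0, hp_mul hσ, hp_mul hσ]; congr 1
  have e2 : hp x0 σ (-1 - b + α) x = hp x0 σ (-1) x * h0 * hp x0 σ α x := by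
    rw [e0, hp_mul hσ, hp_mul hσ]; congr 1
  have e3 : hp x0 σ (-b - 1) x = hp x0 σ (-1) x * h0 := by
    rw [e0, hp_mul hσ]; congr 1; ring
  have e4 : hp x0 σ 1 x * hp x0 σ (-1) x = 1 := by
    rw [hp_mul hσ]; simp [hp_zero]
  rw [e3] at gP
  rw [e1, e2]
  set H := hp x0 σ 1 x
  set Hm := hp x0 σ (-1) x
  set Ha := hp x0 σ α x
  have K1 := Kct_one
  have young : 2 * |A x| * G ≤ S * H + A x ^ 2 * Hm := by
    have : 2 * |A x| * G ≤ G ^ 2 * H + |A x| ^ 2 * Hm := by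
      have e5 : G ^ 2 * H + |A x| ^ 2 * Hm - 2 * |A x| * G = Hm * (G * H - |A x|) ^ 2 + (1 - H * Hm) * (G ^ 2 * H - 2 * G * |A x|) := by ring
      rw [e4] at e5
      have : 0 ≤ Hm * (G * H - |A x|) ^ 2 := by positivity
      linarith
    rw [sq_abs] at this
    have : G ^ 2 * H ≤ S * H := by gcongr
    linarith
  have hS : 0 ≤ S := by positivity
  calc _ ≤ ((A x ^ 2 * ((8 * Kct + b) * (Hm * h0)) + h0 * (S * H + A x ^ 2 * Hm)) + A x ^ 2 * h0 * (2 * Hm)) * (2 * Ha) := by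
        have q1 : ‖fderiv ℝ (fun x => A x ^ 2 * PsiQ x0 σ b z x) x‖ ≤ A x ^ 2 * ((8 * Kct + b) * (Hm * h0)) + h0 * (S * H + A x ^ 2 * Hm) := by
          refine d1.trans ?_
          gcongr
        have q2 : |A x ^ 2 * PsiQ x0 σ b z x| ≤ A x ^ 2 * h0 := by
          rw [abs_of_nonneg (by positivity)]; gcongr
        have q3 : hp x0 σ α (x + z) ≤ 2 * Ha := c2.trans (by gcongr)
        have := hp_pos (x0 := x0) hσ (-1) (x + z)
        have := hp_pos (x0 := x0) hσ α (x + z)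
        gcongr
    _ = 2 * (S * (H * h0 * Ha)) + (16 * Kct + 2 * b + 6) * (A x ^ 2 * (Hm * h0 * Ha)) := by ring
    _ ≤ (16 * Kct + 2 * b + 8) * (S * (H * h0 * Ha)) + (16 * Kct + 2 * b + 8) * (A x ^ 2 * (Hm * h0 * Ha)) := by
        gcongr <;> linarith
    _ = _ := by ring


/-- constant in the quadratic trace lemma -/
def CQ (b : ℝ) : ℝ := 16 * Kct + 2 * b + 8

lemma Qz (hx0 : x0 ∈ ball (0 : E3) 8) (hσ : 0 < σ) (hσ2 : σ ≤ 2) {κ : ℝ≥0∞} (hκ : κ ≠ ∞) {α b : ℝ} (hα : 0 ≤ α) (hα1 : α ≤ 1) (hb : 0 ≤ b)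
    {V : E3 → ℝ≥0∞} (hV : Measurable V) (hT : Tr x0 σ κ α V) {a : E3 → ℝ} {g : Fin 3 → E3 → ℝ} (h : WG (ball 0 16) a g)
    (ham : Measurable a) (ha : MemLp a 2 volume) (hbm : ∀ j, Measurable (g j)) (hg : ∀ j, MemLp (g j) 2 volume) (z : E3) :
    ∫⁻ x, V (x + z) * ENNReal.ofReal (PsiQ x0 σ b z x) * ‖a x‖ₑ ^ 2 ≤
      ∫⁻ x, ((∑ j, ‖g j x‖ₑ ^ 2) * (SQ x0 σ z).indicator (fun x => κ * ENNReal.ofReal (CQ b) * hw x0 σ (1 - b + α) x) x +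
        ‖a x‖ₑ ^ 2 * (SQ x0 σ z).indicator (fun x => κ * ENNReal.ofReal (CQ b) * hw x0 σ (-1 - b + α) x) x) := by
  have mS := SQ_meas (x0 := x0) hσ z
  have mw := fun β => hw_meas (x0 := x0) hσ β
  have mP : Measurable (PsiQ x0 σ b z) := (PsiQ_contDiff hσ b z (n := 0)).continuous.measurable
  obtain ⟨M1, hM1⟩ := hp_bdd (x0 := x0) hσ (1 - b + α) 1
  obtain ⟨M2, hM2⟩ := hp_bdd (x0 := x0) hσ (-1 - b + α) 1
  have hCQ : 0 ≤ CQ b := by have := Kct_one; unfold CQ; positivity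
  have bd : ∀ β M x, (∀ x ∈ closedBall x0 1, hp x0 σ β x ≤ M) → M ≤ max M1 M2 →
      (SQ x0 σ z).indicator (fun x => κ * ENNReal.ofReal (CQ b) * hw x0 σ β x) x ≤ κ * ENNReal.ofReal (CQ b) * ENNReal.ofReal (max M1 M2) := by
    intro β M x h1 h2
    refine indicator_le' (f := fun x => κ * ENNReal.ofReal (CQ b) * hw x0 σ β x) (g := fun _ => κ * ENNReal.ofReal (CQ b) * ENNReal.ofReal (max M1 M2)) ?_ ?_ x
    · intro y hy
      show _ * hw x0 σ β y ≤ _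
      unfold hw
      gcongr
      exact (h1 y hy.1).trans h2
    · intro y _; exact zero_le
  refine qclose h ham ha hbm hg (W0 := fun x => V (x + z) * ENNReal.ofReal (PsiQ x0 σ b z x)) (by fun_prop)
    (Measurable.indicator (by fun_prop) mS) (Measurable.indicator (by fun_prop) mS)
    (M := κ * ENNReal.ofReal (CQ b) * ENNReal.ofReal (max M1 M2)) ?_ (fun x => bd _ _ x hM1 (le_max_left _ _))
    (fun x => bd _ _ x hM2 (le_max_right _ _)) (r := 1) one_pos ?_ ?_
  · exact ENNReal.mul_ne_top (ENNReal.mul_ne_top hκ ENNReal.ofReal_ne_top) ENNReal.ofReal_ne_top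
  · intro x hx
    have : x ∈ SQ x0 σ z := by
      by_contra h'; exact hx (indicator_of_notMem h' _)
    intro y hy
    have h1 := this.1
    simp only [mem_ball, mem_closedBall, dist_zero_right] at *
    have : dist y 0 ≤ dist y x + dist x x0 + dist x0 0 := dist_triangle4 _ _ _ _
    simp only [dist_zero_right] at this
    linarith
  · intro A hA
    have hAm : Measurable A := hA.continuous.measurable
    set f0 : E3 → ℝ := fun x => A x ^ 2 * PsiQ x0 σ b z x with hf0
    set f : E3 → ℝ := fun y => f0 (y - z) with hf
    have cf0 : ContDiff ℝ 1 f0 := ((hA.of_le (by norm_cast)).pow 2).mul (PsiQ_contDiff hσ b z (n := 1))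
    have cf : ContDiff ℝ 1 f := cf0.comp (contDiff_id.sub contDiff_const)
    have sf : tsupport f ⊆ closedBall x0 3 := by
      apply closure_minimal _ isClosed_closedBall
      intro y hy
      have : y - z ∈ SQ x0 σ z := by
        by_contra h'
        apply hy
        simp [hf, hf0, (PsiQ_zero hσ b h').1]
      have h1 := this.1
      have h2 := this.2
      have h3 : hp x0 σ 1 (y - z) ≤ 2 := by
        rw [hp_one]
        apply Real.sqrt_le_iff.2
        rw [mem_closedBall, dist_eq_norm] at h1
        refine ⟨by norm_num, ?_⟩
        have : ‖y - z - x0‖ ^ 2 ≤ 1 := by rw [sq_le_one_iff₀ (norm_nonneg _)]; exact h1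
        linarith
      rw [mem_closedBall, dist_eq_norm] at h1 ⊢
      calc ‖y - x0‖ = ‖(y - z - x0) + z‖ := by congr 1; abel
        _ ≤ ‖y - z - x0‖ + ‖z‖ := norm_add_le _ _
        _ ≤ 3 := by linarith
    have key := hT f cf ((isCompact_closedBall x0 3).of_isClosed_subset (isClosed_tsupport _) sf)
      (sf.trans (closedBall_subset_ball (by norm_num)))
    have l1 : ∫⁻ y, V y * ‖f y‖ₑ = ∫⁻ x, V (x + z) * ENNReal.ofReal (PsiQ x0 σ b z x) * ‖A x‖ₑ ^ 2 := by
      rw [← lintegral_add_right_eq_self (fun y => V y * ‖f y‖ₑ) z]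
      apply lintegral_congr; intro x
      simp only [hf, hf0, add_sub_cancel_right, enorm_mul, enorm_pow]
      rw [Real.enorm_of_nonneg (PsiQ_nonneg hσ b z x)]; ring
    rw [l1] at key
    refine key.trans ?_
    rw [← lintegral_add_right_eq_self _ z, ← lintegral_const_mul' _ _ hκ]
    apply lintegral_mono
    intro x
    have ef : fderiv ℝ f (x + z) = fderiv ℝ f0 x := by
      rw [hf, fderiv_comp_sub, add_sub_cancel_right]
    simp only [ef]
    simp only [hf, add_sub_cancel_right]
    by_cases hx : x ∈ SQ x0 σ z
    · simp only [indicator_of_mem hx]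
      have := qpt hσ hσ2 hb hα hα1 hA hx
      have h2 := ENNReal.ofReal_le_ofReal this
      have pp : ∀ β y, 0 ≤ hp x0 σ β y := fun β y => (hp_pos hσ β y).le
      rw [ENNReal.ofReal_mul (by have := pp (-1) (x+z); positivity), ENNReal.ofReal_add (norm_nonneg _) (mul_nonneg (abs_nonneg _) (pp _ _)),
        ENNReal.ofReal_mul (abs_nonneg _), ENNReal.ofReal_mul (by exact hCQ), ENNReal.ofReal_add (mul_nonneg (by positivity) (pp _ _)) (mul_nonneg (by positivity) (pp _ _)),
        ENNReal.ofReal_mul (by positivity), ENNReal.ofReal_mul (by positivity), ENNReal.ofReal_sum_of_nonneg (fun _ _ => by positivity),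
        ofReal_norm, ← Real.norm_eq_abs, ofReal_norm] at h2
      have e1 : ∀ t : ℝ, ENNReal.ofReal (t ^ 2) = ‖t‖ₑ ^ 2 := fun t => by
        rw [← sq_abs, ENNReal.ofReal_pow (abs_nonneg _), ← Real.norm_eq_abs, ofReal_norm]
      simp only [e1] at h2
      calc _ ≤ κ * (ENNReal.ofReal (CQ b) * ((∑ j, ‖pd j A x‖ₑ ^ 2) * hw x0 σ (1 - b + α) x + ‖A x‖ₑ ^ 2 * hw x0 σ (-1 - b + α) x)) := by
            exact mul_le_mul_right h2 κ
        _ = _ := by ring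
    · have h1 := PsiQ_zero hσ b hx
      have : fderiv ℝ f0 x = 0 := by
        rw [hf0, fderiv_fun_mul ((hA.differentiable (by simp) x).fun_pow 2) ((PsiQ_contDiff hσ b z (n := 1)).differentiable one_ne_zero x)]
        rw [h1.1, h1.2]; simp
      have e0 : f0 x = 0 := by simp [hf0, h1.1]
      have e1 : ‖fderiv ℝ f0 x‖ₑ = 0 := by rw [← ofReal_norm, this, norm_zero, ENNReal.ofReal_zero]
      rw [e1, e0, enorm_zero, zero_mul, add_zero, zero_mul, mul_zero]
      exact zero_le

end

/-! ### dyadic potential estimates -/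

def Cdy (c d : ℝ) : ℝ := 2 ^ c / (1 - 2 ^ (-d))

lemma Cdy_pos {c d : ℝ} (hd : 0 < d) : 0 < Cdy c d := by
  have : (2:ℝ) ^ (-d) < 1 := Real.rpow_lt_one_of_one_lt_of_neg (by norm_num) (by linarith)
  unfold Cdy
  have : 0 < 1 - (2:ℝ) ^ (-d) := by linarith
  positivity

lemma dy_sum {c d A : ℝ} (hd : 0 < d) (hA : 0 ≤ A) {κ : ℝ≥0∞} :
    ∑' k : ℕ, κ * ENNReal.ofReal (2 ^ c * A * (2 ^ (-d)) ^ k) = κ * ENNReal.ofReal (Cdy c d * A) := by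
  have h1 : (2:ℝ) ^ (-d) < 1 := Real.rpow_lt_one_of_one_lt_of_neg (by norm_num) (by linarith)
  rw [ENNReal.tsum_mul_left, ← ENNReal.ofReal_tsum_of_nonneg (fun k => by positivity)
    ((summable_geometric_of_lt_one (by positivity) h1).mul_left _), tsum_mul_left, tsum_geometric_of_lt_one (by positivity) h1]
  congr 2; unfold Cdy; ring

lemma dy_alg1 {ρ β γ : ℝ} (hρ : 0 < ρ) (k : ℕ) :
    (ρ * 2⁻¹ ^ (k+1)) ^ (-β) * (ρ * 2⁻¹ ^ k) ^ γ = 2 ^ β * ρ ^ (γ - β) * (2 ^ (-(γ - β))) ^ k := by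
  have e : ∀ n : ℕ, (2⁻¹ : ℝ) ^ n = 2 ^ (-(n:ℝ)) := fun n => by
    rw [inv_pow, Real.rpow_neg (by norm_num), Real.rpow_natCast]
  have e2 : ((2:ℝ) ^ (-(γ - β))) ^ k = 2 ^ (-(γ - β) * k) := by
    rw [Real.rpow_mul (by norm_num), Real.rpow_natCast]
  rw [e, e, e2, Real.mul_rpow hρ.le (by positivity), Real.mul_rpow hρ.le (by positivity), ← Real.rpow_mul (by norm_num),
    ← Real.rpow_mul (by norm_num)]
  have e3 : ρ ^ (γ - β) = ρ ^ (-β) * ρ ^ γ := by rw [← Real.rpow_add hρ]; congr 1; ring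
  have e4 : (2:ℝ) ^ β * 2 ^ (-(γ - β) * k) = 2 ^ (-((k+1 : ℕ):ℝ) * (-β)) * 2 ^ (-(k:ℝ) * γ) := by
    rw [← Real.rpow_add (by norm_num), ← Real.rpow_add (by norm_num)]; congr 1; push_cast; ring
  rw [e3]
  linear_combination (-(ρ ^ (-β) * ρ ^ γ)) * e4

lemma dy_alg2 {ρ β γ : ℝ} (hρ : 0 < ρ) (k : ℕ) :
    (ρ * 2 ^ k) ^ (-β) * (ρ * 2 ^ (k+1)) ^ γ = 2 ^ γ * ρ ^ (γ - β) * (2 ^ (-(β - γ))) ^ k := by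
  have e : ∀ n : ℕ, (2 : ℝ) ^ n = 2 ^ ((n:ℝ)) := fun n => (Real.rpow_natCast _ _).symm
  have e2 : ((2:ℝ) ^ (-(β - γ))) ^ k = 2 ^ (-(β - γ) * k) := by
    rw [Real.rpow_mul (by norm_num), Real.rpow_natCast]
  rw [e2, e k, e (k+1), Real.mul_rpow hρ.le (by positivity), Real.mul_rpow hρ.le (by positivity), ← Real.rpow_mul (by norm_num),
    ← Real.rpow_mul (by norm_num)]
  have e3 : ρ ^ (γ - β) = ρ ^ (-β) * ρ ^ γ := by rw [← Real.rpow_add hρ]; congr 1; ring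
  have e4 : (2:ℝ) ^ γ * 2 ^ (-(β - γ) * k) = 2 ^ ((k:ℝ) * (-β)) * 2 ^ (((k+1 : ℕ):ℝ) * γ) := by
    rw [← Real.rpow_add (by norm_num), ← Real.rpow_add (by norm_num)]; congr 1; push_cast; ring
  rw [e3]
  linear_combination (-(ρ ^ (-β) * ρ ^ γ)) * e4

lemma near_pot {V : E3 → ℝ≥0∞} (hV : Measurable V) {κ : ℝ≥0∞} {γ β : ℝ} (hβ : 0 < β) (hβγ : β < γ) {x : E3}
    (h : ∀ s, 0 < s → ∫⁻ y in closedBall x s, V y ≤ κ * ENNReal.ofReal (s ^ γ)) {ρ : ℝ} (hρ : 0 < ρ) :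
    ∫⁻ y in closedBall x ρ, V y * ENNReal.ofReal (‖y - x‖ ^ (-β)) ≤ κ * ENNReal.ofReal (Cdy β (γ - β) * ρ ^ (γ - β)) := by
  have pt : ∀ y ∈ closedBall x ρ, V y * ENNReal.ofReal (‖y - x‖ ^ (-β)) ≤
      ∑' k : ℕ, ENNReal.ofReal ((ρ * 2⁻¹ ^ (k+1)) ^ (-β)) * (closedBall x (ρ * 2⁻¹ ^ k)).indicator V y := by
    intro y hy
    rcases eq_or_ne y x with rfl | hne
    · rw [sub_self, norm_zero, Real.zero_rpow (by linarith)]; simp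
    have hpos : 0 < ‖y - x‖ := by rw [norm_pos_iff]; exact sub_ne_zero.2 hne
    rw [mem_closedBall, dist_eq_norm] at hy
    obtain ⟨k, h1, h2⟩ := exists_nat_pow_near_of_lt_one (x := ‖y - x‖ / ρ) (y := (2⁻¹ : ℝ)) (by positivity)
      (by rwa [div_le_one hρ]) (by norm_num) (by norm_num)
    rw [lt_div_iff₀ hρ] at h1
    rw [div_le_iff₀ hρ] at h2
    refine le_trans ?_ (ENNReal.le_tsum k)
    rw [indicator_of_mem (by rw [mem_closedBall, dist_eq_norm]; linarith), mul_comm]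
    exact mul_le_mul' (ENNReal.ofReal_le_ofReal (Real.rpow_le_rpow_of_nonpos (by positivity) (by linarith) (by linarith))) le_rfl
  calc _ ≤ ∫⁻ y in closedBall x ρ, ∑' k : ℕ, ENNReal.ofReal ((ρ * 2⁻¹ ^ (k+1)) ^ (-β)) * (closedBall x (ρ * 2⁻¹ ^ k)).indicator V y :=
        setLIntegral_mono' isClosed_closedBall.measurableSet pt
    _ ≤ ∫⁻ y, ∑' k : ℕ, ENNReal.ofReal ((ρ * 2⁻¹ ^ (k+1)) ^ (-β)) * (closedBall x (ρ * 2⁻¹ ^ k)).indicator V y :=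
        setLIntegral_le_lintegral _ _
    _ = ∑' k : ℕ, ENNReal.ofReal ((ρ * 2⁻¹ ^ (k+1)) ^ (-β)) * ∫⁻ y in closedBall x (ρ * 2⁻¹ ^ k), V y := by
        rw [lintegral_tsum (fun k => ((hV.indicator isClosed_closedBall.measurableSet).const_mul _).aemeasurable)]
        congr 1; ext k
        rw [lintegral_const_mul _ (hV.indicator isClosed_closedBall.measurableSet), lintegral_indicator isClosed_closedBall.measurableSet]
    _ ≤ ∑' k : ℕ, κ * ENNReal.ofReal (2 ^ β * ρ ^ (γ - β) * (2 ^ (-(γ - β))) ^ k) := by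
        apply ENNReal.tsum_le_tsum; intro k
        refine (mul_le_mul_right (h _ (by positivity)) _).trans (le_of_eq ?_)
        rw [mul_left_comm, ← ENNReal.ofReal_mul (by positivity)]
        congr 2
        exact dy_alg1 hρ k
    _ = _ := dy_sum (by linarith) (by positivity)

lemma far_pot {V : E3 → ℝ≥0∞} (hV : Measurable V) {κ : ℝ≥0∞} {γ β : ℝ} (hβ : 0 < β) (hβγ : γ < β) {x : E3}
    (h : ∀ s, 0 < s → ∫⁻ y in closedBall x s, V y ≤ κ * ENNReal.ofReal (s ^ γ)) {ρ : ℝ} (hρ : 0 < ρ) :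
    ∫⁻ y in (ball x ρ)ᶜ, V y * ENNReal.ofReal (‖y - x‖ ^ (-β)) ≤ κ * ENNReal.ofReal (Cdy γ (β - γ) * ρ ^ (γ - β)) := by
  have pt : ∀ y ∈ (ball x ρ)ᶜ, V y * ENNReal.ofReal (‖y - x‖ ^ (-β)) ≤
      ∑' k : ℕ, ENNReal.ofReal ((ρ * 2 ^ k) ^ (-β)) * (closedBall x (ρ * 2 ^ (k + 1))).indicator V y := by
    intro y hy
    rw [mem_compl_iff, mem_ball, dist_eq_norm, not_lt] at hy
    obtain ⟨k, h1, h2⟩ := exists_nat_pow_near (x := ‖y - x‖ / ρ) (y := (2 : ℝ))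
      (by rwa [one_le_div hρ]) (by norm_num)
    rw [le_div_iff₀ hρ] at h1
    rw [div_lt_iff₀ hρ] at h2
    refine le_trans ?_ (ENNReal.le_tsum k)
    rw [indicator_of_mem (by rw [mem_closedBall, dist_eq_norm]; linarith), mul_comm]
    exact mul_le_mul' (ENNReal.ofReal_le_ofReal (Real.rpow_le_rpow_of_nonpos (by positivity) (by linarith) (by linarith))) le_rfl
  calc _ ≤ ∫⁻ y in (ball x ρ)ᶜ, ∑' k : ℕ, ENNReal.ofReal ((ρ * 2 ^ k) ^ (-β)) * (closedBall x (ρ * 2 ^ (k + 1))).indicator V y :=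
        setLIntegral_mono' isOpen_ball.measurableSet.compl pt
    _ ≤ ∫⁻ y, ∑' k : ℕ, ENNReal.ofReal ((ρ * 2 ^ k) ^ (-β)) * (closedBall x (ρ * 2 ^ (k + 1))).indicator V y :=
        setLIntegral_le_lintegral _ _
    _ = ∑' k : ℕ, ENNReal.ofReal ((ρ * 2 ^ k) ^ (-β)) * ∫⁻ y in closedBall x (ρ * 2 ^ (k + 1)), V y := by
        rw [lintegral_tsum (fun k => ((hV.indicator isClosed_closedBall.measurableSet).const_mul _).aemeasurable)]
        congr 1; ext k
        rw [lintegral_const_mul _ (hV.indicator isClosed_closedBall.measurableSet), lintegral_indicator isClosed_closedBall.measurableSet]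
    _ ≤ ∑' k : ℕ, κ * ENNReal.ofReal (2 ^ γ * ρ ^ (γ - β) * (2 ^ (-(β - γ))) ^ k) := by
        apply ENNReal.tsum_le_tsum; intro k
        refine (mul_le_mul_right (h _ (by positivity)) _).trans (le_of_eq ?_)
        rw [mul_left_comm, ← ENNReal.ofReal_mul (by positivity)]
        congr 2
        exact dy_alg2 hρ k
    _ = _ := dy_sum (by linarith) (by positivity)

/-- volume of the unit ball -/
def vB : ℝ≥0∞ := volume (closedBall (0 : E3) 1)
lemma vB_ne_top : vB ≠ ∞ := (isCompact_closedBall (0:E3) 1).measure_lt_top.ne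
lemma vol_cB (x : E3) {s : ℝ} (hs : 0 ≤ s) : volume (closedBall x s) = vB * ENNReal.ofReal (s ^ (3:ℝ)) := by
  rw [Measure.addHaar_closedBall _ _ hs, mul_comm, vB, Measure.addHaar_closedBall _ _ zero_le_one]
  simp

lemma near_vol (β : ℝ) (hβ : 0 < β) (hβ3 : β < 3) {ρ : ℝ} (hρ : 0 < ρ) :
    ∫⁻ z in closedBall (0 : E3) ρ, ENNReal.ofReal (‖z‖ ^ (-β)) ≤ vB * ENNReal.ofReal (Cdy β (3 - β) * ρ ^ (3 - β)) := by
  have := near_pot (V := fun _ => 1) (κ := vB) (γ := 3) measurable_const hβ hβ3 (x := (0:E3)) (fun s hs => by simp [vol_cB _ hs.le]) hρ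
  simpa using this

/-! ### slices -/

def G2 (g : E3 → Fin 3 → Fin 3 → ℝ) (x : E3) : ℝ≥0∞ := ∑ i, ∑ j, ‖g x i j‖ₑ ^ 2

structure Slice (v : E3 → E3) (g : E3 → Fin 3 → Fin 3 → ℝ) (p : E3 → ℝ) : Prop where
  mv : Measurable v
  mg : Measurable g
  mp : Measurable p
  v0 : ∀ x ∉ ball (0 : E3) 16, v x = 0
  g0 : ∀ x ∉ ball (0 : E3) 16, g x = 0
  p0 : ∀ x ∉ ball (0 : E3) 16, p x = 0
  v2 : ∫⁻ x, ‖v x‖ₑ ^ 2 < ∞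
  g2 : ∫⁻ x, G2 g x < ∞
  p32 : ∫⁻ x, ‖p x‖ₑ ^ (3/2 : ℝ) < ∞
  grad : ∀ i, WG (ball 0 16) (fun x => v x i) (fun j x => g x i j)
  div : ∀ ζ : E3 → ℝ, ContDiff ℝ (⊤ : ℕ∞) ζ → HasCompactSupport ζ → tsupport ζ ⊆ ball 0 16 →
    ∫ x, ∑ i, v x i * pd i ζ x = 0
  press : ∀ ζ : E3 → ℝ, ContDiff ℝ (⊤ : ℕ∞) ζ → HasCompactSupport ζ → tsupport ζ ⊆ ball 0 16 →
    ∫ x, ((∑ i, ∑ j, v x i * v x j * pd i (pd j ζ) x) + p x * lap ζ x) = 0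

lemma enorm_sq_sum (x : E3) : ‖x‖ₑ ^ 2 = ∑ i, ‖x i‖ₑ ^ 2 := by
  simp only [← ofReal_norm, ← ENNReal.ofReal_pow (norm_nonneg _)]
  rw [← ENNReal.ofReal_sum_of_nonneg (fun _ _ => by positivity), EuclideanSpace.norm_sq_eq]

lemma enorm_coord_le (x : E3) (i : Fin 3) : ‖x i‖ₑ ≤ ‖x‖ₑ := by
  simp only [← ofReal_norm]
  exact ENNReal.ofReal_le_ofReal (PiLp.norm_apply_le x i)

lemma memLp_two_of {f : E3 → ℝ} (hf : Measurable f) (h : ∫⁻ x, ‖f x‖ₑ ^ 2 < ∞) : MemLp f 2 volume := by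
  refine ⟨hf.aestronglyMeasurable, ?_⟩
  rw [eLpNorm_lt_top_iff_lintegral_rpow_enorm_lt_top (by norm_num) (by norm_num)]
  simpa using h

section
variable {v : E3 → E3} {g : E3 → Fin 3 → Fin 3 → ℝ} {p : E3 → ℝ}

lemma Slice.mvi (h : Slice v g p) (i : Fin 3) : Measurable (fun x => v x i) := by
  have := h.mv
  exact (EuclideanSpace.proj i : E3 →L[ℝ] ℝ).continuous.measurable.comp this

lemma Slice.mgij (h : Slice v g p) (i j : Fin 3) : Measurable (fun x => g x i j) := by
  have := h.mg
  fun_prop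

lemma Slice.vi2 (h : Slice v g p) (i : Fin 3) : MemLp (fun x => v x i) 2 volume := by
  apply memLp_two_of (h.mvi i)
  refine lt_of_le_of_lt (lintegral_mono fun x => ?_) h.v2
  gcongr; exact enorm_coord_le _ _

lemma Slice.gij2 (h : Slice v g p) (i j : Fin 3) : MemLp (fun x => g x i j) 2 volume := by
  apply memLp_two_of (h.mgij i j)
  refine lt_of_le_of_lt (lintegral_mono fun x => ?_) h.g2
  unfold G2
  exact (Finset.single_le_sum (f := fun j => ‖g x i j‖ₑ ^ 2) (fun _ _ => zero_le) (Finset.mem_univ j)).trans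
    (Finset.single_le_sum (f := fun i => ∑ j, ‖g x i j‖ₑ ^ 2) (fun _ _ => zero_le) (Finset.mem_univ i))

lemma Slice.mG2 (h : Slice v g p) : Measurable (G2 g) := by
  unfold G2
  have := h.mgij
  fun_prop

/-- weighted energy density -/
def En (v : E3 → E3) (g : E3 → Fin 3 → Fin 3 → ℝ) (x0 : E3) (σ α b : ℝ) (x : E3) : ℝ≥0∞ :=
  G2 g x * hw x0 σ (1 - b + α) x + ‖v x‖ₑ ^ 2 * hw x0 σ (-1 - b + α) x

lemma En_meas (h : Slice v g p) {x0 : E3} {σ : ℝ} (hσ : 0 < σ) (α b : ℝ) : Measurable (En v g x0 σ α b) := by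
  unfold En
  have := h.mG2
  have := h.mv
  have := hw_meas (x0 := x0) hσ
  fun_prop

lemma QV (h : Slice v g p) {x0 : E3} {σ : ℝ} (hx0 : x0 ∈ ball (0 : E3) 8) (hσ : 0 < σ) (hσ2 : σ ≤ 2) {κ : ℝ≥0∞} (hκ : κ ≠ ∞) {α b : ℝ}
    (hα : 0 ≤ α) (hα1 : α ≤ 1) (hb : 0 ≤ b)
    {V : E3 → ℝ≥0∞} (hV : Measurable V) (hT : Tr x0 σ κ α V) (z : E3) :
    ∫⁻ x, V (x + z) * ENNReal.ofReal (PsiQ x0 σ b z x) * ‖v x‖ₑ ^ 2 ≤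
      κ * ENNReal.ofReal (CQ b) * ∫⁻ x in SQ x0 σ z, En v g x0 σ α b x := by
  have mP : Measurable (PsiQ x0 σ b z) := (PsiQ_contDiff hσ b z (n := 0)).continuous.measurable
  have mS := SQ_meas (x0 := x0) hσ z
  have mvi := h.mvi
  have mgij := h.mgij
  have mw := fun β => hw_meas (x0 := x0) hσ β
  have mVz : Measurable (fun x => V (x + z)) := hV.comp (measurable_add_const z)
  have mm : ∀ i, Measurable (fun x => V (x + z) * ENNReal.ofReal (PsiQ x0 σ b z x) * ‖v x i‖ₑ ^ 2) :=
    fun i => (mVz.mul mP.ennreal_ofReal).mul ((mvi i).enorm.pow_const 2)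
  have a1 : Measurable ((SQ x0 σ z).indicator (fun x => κ * ENNReal.ofReal (CQ b) * hw x0 σ (1 - b + α) x)) := Measurable.indicator ((mw _).const_mul _) mS
  have a2 : Measurable ((SQ x0 σ z).indicator (fun x => κ * ENNReal.ofReal (CQ b) * hw x0 σ (-1 - b + α) x)) := Measurable.indicator ((mw _).const_mul _) mS
  have ms : ∀ i, Measurable (fun x => ∑ j, ‖g x i j‖ₑ ^ 2) := fun i => Finset.measurable_sum _ (fun j _ => (mgij i j).enorm.pow_const 2)
  have m3 : ∀ i, Measurable (fun x => (∑ j, ‖g x i j‖ₑ ^ 2) * (SQ x0 σ z).indicator (fun x => κ * ENNReal.ofReal (CQ b) * hw x0 σ (1 - b + α) x) x +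
          ‖v x i‖ₑ ^ 2 * (SQ x0 σ z).indicator (fun x => κ * ENNReal.ofReal (CQ b) * hw x0 σ (-1 - b + α) x) x) :=
    fun i => ((ms i).mul a1).add (((mvi i).enorm.pow_const 2).mul a2)
  have := fun i => Qz hx0 hσ hσ2 hκ hα hα1 hb hV hT (h.grad i) (h.mvi i) (h.vi2 i) (h.mgij i) (h.gij2 i) z
  calc _ = ∑ i, ∫⁻ x, V (x + z) * ENNReal.ofReal (PsiQ x0 σ b z x) * ‖v x i‖ₑ ^ 2 := by
        rw [← lintegral_finsetSum _ (fun i _ => mm i)]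
        apply lintegral_congr; intro x
        rw [enorm_sq_sum, Finset.mul_sum]
    _ ≤ ∑ i, ∫⁻ x, ((∑ j, ‖g x i j‖ₑ ^ 2) * (SQ x0 σ z).indicator (fun x => κ * ENNReal.ofReal (CQ b) * hw x0 σ (1 - b + α) x) x +
          ‖v x i‖ₑ ^ 2 * (SQ x0 σ z).indicator (fun x => κ * ENNReal.ofReal (CQ b) * hw x0 σ (-1 - b + α) x) x) := Finset.sum_le_sum (fun i _ => this i)
    _ = _ := by
      rw [← lintegral_finsetSum _ (fun i _ => m3 i), ← lintegral_const_mul _ (En_meas h hσ α b), ← lintegral_indicator mS]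
      apply lintegral_congr; intro x
      by_cases hx : x ∈ SQ x0 σ z
      · simp only [indicator_of_mem hx, En, G2, enorm_sq_sum]
        rw [Finset.sum_add_distrib, ← Finset.sum_mul, ← Finset.sum_mul]; ring
      · simp only [indicator_of_notMem hx, mul_zero, add_zero, Finset.sum_const_zero]

lemma PsiQ_eq {x0 : E3} {σ b : ℝ} (hσ : 0 < σ) {z x : E3} (hx : x ∈ closedBall x0 (1/2)) (hz : ‖z‖ ≤ hp x0 σ 1 x / 4) :
    PsiQ x0 σ b z x = hp x0 σ (-b) x := by
  unfold PsiQ FQ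
  rw [mem_closedBall, dist_eq_norm] at hx
  rw [ct_one, ct_one, one_mul, mul_one]
  · rfl
  · rw [div_le_iff₀ (hbase hσ x), ← hp_one_sq hσ]
    have := pow_le_pow_left₀ (norm_nonneg z) hz 2
    linarith
  · calc ‖x - x0‖ ^ 2 ≤ (1/2) ^ 2 := by gcongr
      _ = 1/4 := by norm_num

/-- cubic estimate -/
lemma cubic (h : Slice v g p) {x0 : E3} {σ : ℝ} (hx0 : x0 ∈ ball (0 : E3) 8) (hσ : 0 < σ) (hσ2 : σ ≤ 2) {κ : ℝ≥0∞} (hκ : κ ≠ ∞) {α : ℝ}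
    (hα : 0 ≤ α) (hα1 : α ≤ 1)
    {V : E3 → ℝ≥0∞} (hV : Measurable V) (hT : Tr x0 σ κ α V) :
    ∫⁻ x in closedBall x0 (1/2), V x * ‖v x‖ₑ ^ 2 * hw x0 σ (-4) x ≤
      κ * ENNReal.ofReal (CQ 4) * ∫⁻ x in closedBall x0 1, En v g x0 σ α 4 x := by
  have h1 := QV h hx0 hσ hσ2 hκ hα hα1 (b := 4) (by norm_num) hV hT 0
  calc _ = ∫⁻ x in closedBall x0 (1/2), V (x + 0) * ENNReal.ofReal (PsiQ x0 σ 4 0 x) * ‖v x‖ₑ ^ 2 := by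
        apply setLIntegral_congr_fun isClosed_closedBall.measurableSet
        intro x hx
        simp only [PsiQ_eq hσ hx (z := 0) (b := 4) (by have := hp_pos (x0 := x0) hσ 1 x; simp; positivity), add_zero, hw]
        ring
    _ ≤ _ := setLIntegral_le_lintegral _ _
    _ ≤ _ := h1
    _ ≤ _ := by gcongr; exact fun x hx => hx.1

end

section
variable {v : E3 → E3} {g : E3 → Fin 3 → Fin 3 → ℝ} {p : E3 → ℝ}

def kk (β : ℝ) (z : E3) : ℝ≥0∞ := ENNReal.ofReal (‖z‖ ^ (-β))
lemma kk_meas (β : ℝ) : Measurable (kk β) := by unfold kk; fun_prop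

lemma PsiQ_meas2 {x0 : E3} {σ : ℝ} (b : ℝ) : Measurable (fun q : E3 × E3 => PsiQ x0 σ b q.2 q.1) := by
  unfold PsiQ FQ
  have := (ct_contDiff (n := 0)).continuous.measurable
  fun_prop

lemma SQ_meas2 {x0 : E3} {σ : ℝ} (hσ : 0 < σ) : MeasurableSet {q : E3 × E3 | q.2 ∈ SQ x0 σ q.1} := by
  have mh := (hp_cont (x0 := x0) hσ 1).measurable
  have : {q : E3 × E3 | q.2 ∈ SQ x0 σ q.1} = {q | dist q.2 x0 ≤ 1} ∩ {q | ‖q.1‖ ≤ hp x0 σ 1 q.2 / 2} := rfl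
  rw [this]
  exact (measurableSet_le (by fun_prop) (by fun_prop)).inter (measurableSet_le (by fun_prop) (by fun_prop))

lemma W2a {x0 : E3} {σ : ℝ} (hσ : 0 < σ) {V : E3 → ℝ≥0∞} (hV : Measurable V) :
    ∫⁻ x in closedBall x0 (1/2), ‖v x‖ₑ ^ 2 * hw x0 σ (-(9/2)) x * ∫⁻ y in closedBall x (hp x0 σ 1 x / 4), V y * kk (5/2) (y - x) ≤
    ∫⁻ x, ∫⁻ z, kk (5/2) z * (V (x + z) * ENNReal.ofReal (PsiQ x0 σ (9/2) z x) * ‖v x‖ₑ ^ 2) := by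
  refine le_trans ?_ (setLIntegral_le_lintegral (closedBall x0 (1/2)) _)
  apply setLIntegral_mono' isClosed_closedBall.measurableSet
  intro x hx
  have mV : Measurable (fun y => V y * kk (5/2) (y - x)) := hV.mul ((kk_meas _).comp (measurable_sub_const x))
  rw [← lintegral_indicator isClosed_closedBall.measurableSet, ← lintegral_add_left_eq_self _ x,
    ← lintegral_const_mul]
  · apply lintegral_mono; intro z
    by_cases hz : x + z ∈ closedBall x (hp x0 σ 1 x / 4)
    · simp only [indicator_of_mem hz]
      rw [mem_closedBall, dist_eq_norm, add_sub_cancel_left] at hz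
      rw [PsiQ_eq hσ hx hz, add_sub_cancel_left]
      apply le_of_eq; simp only [hw]; ring
    · simp only [indicator_of_notMem hz, mul_zero]; exact zero_le
  · exact (Measurable.indicator mV isClosed_closedBall.measurableSet).comp (measurable_const_add x)

lemma W2b (h : Slice v g p) {x0 : E3} {σ : ℝ} {V : E3 → ℝ≥0∞} (hV : Measurable V) :
    ∫⁻ x, ∫⁻ z, kk (5/2) z * (V (x + z) * ENNReal.ofReal (PsiQ x0 σ (9/2) z x) * ‖v x‖ₑ ^ 2) =
    ∫⁻ z, ∫⁻ x, kk (5/2) z * (V (x + z) * ENNReal.ofReal (PsiQ x0 σ (9/2) z x) * ‖v x‖ₑ ^ 2) := by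
  apply lintegral_lintegral_swap
  have m1 : Measurable (fun q : E3 × E3 => V (q.1 + q.2)) := hV.comp measurable_add
  have m2 : Measurable (fun q : E3 × E3 => ‖v q.1‖ₑ ^ 2) := ((h.mv.comp measurable_fst).enorm.pow_const 2)
  exact (((kk_meas _).comp measurable_snd).mul ((m1.mul (PsiQ_meas2 _).ennreal_ofReal).mul m2)).aemeasurable

lemma W2c (h : Slice v g p) {x0 : E3} {σ : ℝ} (hx0 : x0 ∈ ball (0 : E3) 8) (hσ : 0 < σ) (hσ2 : σ ≤ 2) {κ : ℝ≥0∞} (hκ : κ ≠ ∞) {α : ℝ}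
    (hα : 0 ≤ α) (hα1 : α ≤ 1)
    {V : E3 → ℝ≥0∞} (hV : Measurable V) (hT : Tr x0 σ κ α V) :
    ∫⁻ z, ∫⁻ x, kk (5/2) z * (V (x + z) * ENNReal.ofReal (PsiQ x0 σ (9/2) z x) * ‖v x‖ₑ ^ 2) ≤
    κ * ENNReal.ofReal (CQ (9/2)) * ∫⁻ x, ∫⁻ z, kk (5/2) z * (SQ x0 σ z).indicator (En v g x0 σ α (9/2)) x := by
  have mE := En_meas h (x0 := x0) hσ α (9/2)
  calc _ ≤ ∫⁻ z, kk (5/2) z * (κ * ENNReal.ofReal (CQ (9/2)) * ∫⁻ x in SQ x0 σ z, En v g x0 σ α (9/2) x) := by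
        apply lintegral_mono; intro z
        have mP : Measurable (PsiQ x0 σ (9/2) z) := (PsiQ_contDiff hσ _ z (n := 0)).continuous.measurable
        have h1 := QV h hx0 hσ hσ2 hκ hα hα1 (b := 9/2) (by norm_num) hV hT z
        have mVz : Measurable (fun x => V (x + z)) := hV.comp (measurable_add_const z)
        have mm : Measurable (fun x => V (x + z) * ENNReal.ofReal (PsiQ x0 σ (9/2) z x) * ‖v x‖ₑ ^ 2) :=
          (mVz.mul mP.ennreal_ofReal).mul (h.mv.enorm.pow_const 2)
        beta_reduce
        rw [lintegral_const_mul _ mm]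
        exact mul_le_mul' le_rfl h1
    _ = κ * ENNReal.ofReal (CQ (9/2)) * ∫⁻ z, ∫⁻ x, kk (5/2) z * (SQ x0 σ z).indicator (En v g x0 σ α (9/2)) x := by
        rw [← lintegral_const_mul' _ _ (ENNReal.mul_ne_top hκ ENNReal.ofReal_ne_top)]
        apply lintegral_congr; intro z
        rw [lintegral_const_mul _ (mE.indicator (SQ_meas hσ z)), lintegral_indicator (SQ_meas hσ z)]; ring
    _ = _ := by
        congr 1
        apply lintegral_lintegral_swap
        have e : (Function.uncurry fun (z x : E3) => kk (5/2) z * (SQ x0 σ z).indicator (En v g x0 σ α (9/2)) x) =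
          fun q => kk (5/2) q.1 * {q : E3 × E3 | q.2 ∈ SQ x0 σ q.1}.indicator (fun q => En v g x0 σ α (9/2) q.2) q := by
          ext q; simp only [Function.uncurry, indicator]; rfl
        rw [e]
        exact (((kk_meas _).comp measurable_fst).mul ((mE.comp measurable_snd).indicator (SQ_meas2 hσ))).aemeasurable

lemma W2d {x0 : E3} {σ : ℝ} (hσ : 0 < σ) {α : ℝ} (x : E3) :
    ∫⁻ z, kk (5/2) z * (SQ x0 σ z).indicator (En v g x0 σ α (9/2)) x ≤
      (closedBall x0 1).indicator (fun x => vB * ENNReal.ofReal (Cdy (5/2) (1/2)) * En v g x0 σ α 4 x) x := by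
  by_cases hx : x ∈ closedBall x0 1
  · rw [indicator_of_mem hx]
    have hpx := hp_pos (x0 := x0) hσ 1 x
    have e : En v g x0 σ α (9/2) x * hw x0 σ (1/2) x = En v g x0 σ α 4 x := by
      unfold En
      rw [add_mul, mul_assoc, mul_assoc, hw_mul hσ, hw_mul hσ]
      congr 3 <;> ring_nf
    have nv := near_vol (5/2) (by norm_num) (by norm_num) hpx
    rw [show (3:ℝ) - 5/2 = 1/2 by norm_num] at nv
    calc _ ≤ ∫⁻ z, En v g x0 σ α (9/2) x * (closedBall (0:E3) (hp x0 σ 1 x)).indicator (kk (5/2)) z := by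
          apply lintegral_mono; intro z
          by_cases hz : x ∈ SQ x0 σ z
          · have hz' : z ∈ closedBall (0:E3) (hp x0 σ 1 x) := by
              rw [mem_closedBall, dist_zero_right]; have := hz.2; linarith
            simp only [indicator_of_mem hz, indicator_of_mem hz']
            rw [mul_comm]
          · simp only [indicator_of_notMem hz, mul_zero]; exact zero_le
      _ = En v g x0 σ α (9/2) x * ∫⁻ z in closedBall (0:E3) (hp x0 σ 1 x), kk (5/2) z := by
          rw [lintegral_const_mul _ ((kk_meas _).indicator isClosed_closedBall.measurableSet), lintegral_indicator isClosed_closedBall.measurableSet]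
      _ ≤ En v g x0 σ α (9/2) x * (vB * ENNReal.ofReal (Cdy (5/2) (1/2) * hp x0 σ 1 x ^ (1/2 : ℝ))) :=
          mul_le_mul' le_rfl nv
      _ = _ := by
          rw [ENNReal.ofReal_mul (Cdy_pos (by norm_num)).le, ← hp_eq_rpow hσ, ← e, hw]; ring
  · have : ∀ z, x ∉ SQ x0 σ z := fun z h' => hx h'.1
    simp only [indicator_of_notMem (this _), mul_zero, lintegral_zero]
    exact zero_le

/-- near potential with the exponent -5/2 -/
lemma W2est (h : Slice v g p) {x0 : E3} {σ : ℝ} (hx0 : x0 ∈ ball (0 : E3) 8) (hσ : 0 < σ) (hσ2 : σ ≤ 2) {κ : ℝ≥0∞} (hκ : κ ≠ ∞) {α : ℝ}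
    (hα : 0 ≤ α) (hα1 : α ≤ 1)
    {V : E3 → ℝ≥0∞} (hV : Measurable V) (hT : Tr x0 σ κ α V) :
    ∫⁻ x in closedBall x0 (1/2), ‖v x‖ₑ ^ 2 * hw x0 σ (-(9/2)) x * ∫⁻ y in closedBall x (hp x0 σ 1 x / 4), V y * kk (5/2) (y - x) ≤
      κ * (ENNReal.ofReal (CQ (9/2)) * vB * ENNReal.ofReal (Cdy (5/2) (1/2))) * ∫⁻ x in closedBall x0 1, En v g x0 σ α 4 x := by
  refine (W2a hσ hV).trans ((W2b h hV).le.trans ((W2c h hx0 hσ hσ2 hκ hα hα1 hV hT).trans ?_))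
  refine (mul_le_mul' le_rfl (lintegral_mono (W2d (v := v) (g := g) (x0 := x0) (α := α) hσ))).trans (le_of_eq ?_)
  rw [lintegral_indicator isClosed_closedBall.measurableSet, lintegral_const_mul _ (En_meas h hσ α 4)]; ring
end

/-! ### integration by parts for slices -/

lemma memLp_mul_cc {f ψ : E3 → ℝ} {q : ℝ≥0∞} (hf : MemLp f q volume) (hψ : Continuous ψ) (hc : HasCompactSupport ψ) :
    MemLp (fun x => f x * ψ x) q volume := by
  obtain ⟨C, hC⟩ := hψ.bounded_above_of_compact_support hc
  refine hf.of_le_mul (c := C) (hf.1.mul hψ.aestronglyMeasurable) (Eventually.of_forall fun x => ?_)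
  rw [norm_mul, mul_comm]
  exact mul_le_mul_of_nonneg_right (hC x) (norm_nonneg _)

lemma memLp_int_cc {f ψ : E3 → ℝ} {q : ℝ≥0∞} (hq : 1 ≤ q) (hf : MemLp f q volume) (hψ : Continuous ψ) (hc : HasCompactSupport ψ) :
    Integrable (fun x => f x * ψ x) := by
  have := (hf.locallyIntegrable hq).integrable_smul_left_of_hasCompactSupport hψ hc
  simpa [mul_comm] using this

lemma l2_pair {f a : E3 → ℝ} {A : ℕ → E3 → ℝ} (hf : MemLp f 2 volume) (ha : MemLp a 2 volume) (hA : ∀ n, AEStronglyMeasurable (A n) volume)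
    (hlim : Tendsto (fun n => ∫⁻ x, ‖A n x - a x‖ₑ ^ 2) atTop (nhds 0)) :
    Tendsto (fun n => ∫ x, f x * A n x) atTop (nhds (∫ x, f x * a x)) := by
  have hfa : Integrable (fun x => f x * a x) := hf.integrable_mul ha
  have key : ∀ n, ∫⁻ x, ‖f x * A n x - f x * a x‖ₑ ≤ (∫⁻ x, ‖f x‖ₑ ^ (2:ℝ)) ^ (1/2:ℝ) * (∫⁻ x, ‖A n x - a x‖ₑ ^ 2) ^ (1/2:ℝ) := by
    intro n
    have := ENNReal.lintegral_mul_le_Lp_mul_Lq volume (p := 2) (q := 2) Real.HolderConjugate.two_two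
      (f := fun x => ‖f x‖ₑ) (g := fun x => ‖A n x - a x‖ₑ) hf.1.enorm ((hA n).sub ha.1).enorm
    refine le_trans (le_of_eq ?_) (this.trans (le_of_eq ?_))
    · apply lintegral_congr; intro x; rw [← mul_sub, enorm_mul]; rfl
    · simp
  have fin : (∫⁻ x, ‖f x‖ₑ ^ (2:ℝ)) ^ (1/2:ℝ) ≠ ∞ := by
    apply ENNReal.rpow_ne_top_of_nonneg (by norm_num)
    have := (eLpNorm_lt_top_iff_lintegral_rpow_enorm_lt_top (by norm_num) (by norm_num)).1 hf.2
    simpa using this.ne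
  have l0 : Tendsto (fun n => (∫⁻ x, ‖f x‖ₑ ^ (2:ℝ)) ^ (1/2:ℝ) * (∫⁻ x, ‖A n x - a x‖ₑ ^ 2) ^ (1/2:ℝ)) atTop (nhds 0) := by
    have := ENNReal.Tendsto.const_mul (hlim.ennrpow_const (1/2:ℝ)) (Or.inr fin)
    rwa [ENNReal.zero_rpow_of_pos (by norm_num), mul_zero] at this
  have l1 := tendsto_of_tendsto_of_tendsto_of_le_of_le tendsto_const_nhds l0 (fun n => zero_le) key
  have ev : ∀ᶠ n in atTop, Integrable (fun x => f x * A n x) := by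
    filter_upwards [l1.eventually (gt_mem_nhds zero_lt_one)] with n hn
    have h1 : Integrable (fun x => f x * A n x - f x * a x) :=
      ⟨(hf.1.mul (hA n)).sub (hf.1.mul ha.1), hn.trans ENNReal.one_lt_top⟩
    refine (h1.add hfa).congr (Eventually.of_forall fun x => ?_)
    simp
  exact tendsto_integral_of_L1 _ hfa.1 ev l1

lemma ibp {v : E3 → E3} {g : E3 → Fin 3 → Fin 3 → ℝ} {p : E3 → ℝ} (h : Slice v g p) {θ : E3 → ℝ}
    (hθ : ContDiff ℝ (⊤ : ℕ∞) θ) (hc : HasCompactSupport θ) (hs : tsupport θ ⊆ ball 0 16) (j : Fin 3) :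
    ∫ x, ∑ i, v x i * v x j * pd i θ x = - ∫ x, ∑ i, v x i * g x j i * θ x := by
  have hpd : ∀ i, Continuous (pd i θ) := fun i => (hθ.continuous_fderiv (by simp)).clm_apply continuous_const
  have hpc : ∀ i, HasCompactSupport (pd i θ) := fun i => hc.fderiv_apply ℝ _
  have hli : LocallyIntegrable (fun x => v x j) := (h.vi2 j).locallyIntegrable (by norm_num)
  set A : ℕ → E3 → ℝ := fun n => cv (eta n) (fun x => v x j) with hA
  set B : Fin 3 → ℕ → E3 → ℝ := fun i n => cv (eta n) (fun x => g x j i) with hB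
  have cA : ∀ n, ContDiff ℝ (⊤ : ℕ∞) (A n) := fun n => cv_contDiff (eta_contDiff n) (eta_compact n) hli
  have cB : ∀ i n, Continuous (B i n) := fun i n => (cv_contDiff (n := 0) (eta_contDiff n) (eta_compact n)
    ((h.gij2 j i).locallyIntegrable (by norm_num))).continuous
  obtain ⟨r, hr, hrs⟩ := hc.isCompact.exists_cthickening_subset_open isOpen_ball hs
  have l1 : ∀ i, Tendsto (fun n => ∫ x, (v x i * pd i θ x) * A n x) atTop (nhds (∫ x, (v x i * pd i θ x) * v x j)) := fun i =>
    l2_pair (memLp_mul_cc (h.vi2 i) (hpd i) (hpc i)) (h.vi2 j) (fun n => (cA n).continuous.aestronglyMeasurable) (moll_L2 (h.mvi j) (h.vi2 j))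
  have l2 : ∀ i, Tendsto (fun n => ∫ x, (v x i * θ x) * B i n x) atTop (nhds (∫ x, (v x i * θ x) * g x j i)) := fun i =>
    l2_pair (memLp_mul_cc (h.vi2 i) hθ.continuous hc) (h.gij2 j i) (fun n => (cB i n).aestronglyMeasurable) (moll_L2 (h.mgij j i) (h.gij2 j i))
  have I1 : ∀ i n, Integrable (fun x => (v x i * pd i θ x) * A n x) := fun i n => by
    have := memLp_int_cc (q := 2) (by norm_num) (h.vi2 i) ((hpd i).mul (cA n).continuous) ((hpc i).mul_right)
    simpa [mul_assoc] using this
  have I2 : ∀ i n, Integrable (fun x => (v x i * θ x) * B i n x) := fun i n => by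
    have := memLp_int_cc (q := 2) (by norm_num) (h.vi2 i) (hθ.continuous.mul (cB i n)) (hc.mul_right)
    simpa [mul_assoc] using this
  have I3 : ∀ i n, Integrable (fun x => (v x i * pd i θ x) * A n x + (v x i * θ x) * B i n x) := fun i n => (I1 i n).add (I2 i n)
  have ev : ∀ᶠ n : ℕ in atTop, ∑ i, ∫ x, (v x i * pd i θ x) * A n x = - ∑ i, ∫ x, (v x i * θ x) * B i n x := by
    have : ∀ᶠ n : ℕ in atTop, 1 / (n + 1 : ℝ) < r := tendsto_one_div_add_atTop_nhds_zero_nat.eventually (gt_mem_nhds hr)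
    filter_upwards [this] with n hn
    have hd := h.div (fun x => A n x * θ x) ((cA n).mul hθ) hc.mul_left ((closure_mono (Function.support_mul_subset_right _ _)).trans hs)
    have e : ∀ x, ∑ i, v x i * pd i (fun x => A n x * θ x) x = ∑ i, ((v x i * pd i θ x) * A n x + (v x i * θ x) * B i n x) := by
      intro x
      apply Finset.sum_congr rfl; intro i _
      rw [pd_mul ((cA n).differentiable (by simp) x) (hθ.differentiable (by simp) x)]
      by_cases hx : x ∈ tsupport θ
      · rw [hA, moll_grad (h.grad j) hli n]
        · simp only [hB]; ring
        · exact (closedBall_subset_closedBall hn.le).trans ((closedBall_subset_cthickening hx r).trans hrs)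
      · rw [image_eq_zero_of_notMem_tsupport hx]; ring
    rw [integral_congr_ae (Eventually.of_forall e), integral_finsetSum _ (fun i _ => I3 i n)] at hd
    simp only [fun i => integral_add (I1 i n) (I2 i n), Finset.sum_add_distrib] at hd
    linarith
  have t1 := tendsto_finsetSum Finset.univ (fun i _ => l1 i)
  have t2 := (tendsto_finsetSum Finset.univ (fun i _ => l2 i)).neg
  have := tendsto_nhds_unique (t1.congr' ev) t2
  have J1 : ∀ i, Integrable (fun x => (v x i * pd i θ x) * v x j) := fun i => (memLp_mul_cc (h.vi2 i) (hpd i) (hpc i)).integrable_mul (h.vi2 j)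
  have J2 : ∀ i, Integrable (fun x => (v x i * θ x) * g x j i) := fun i => (memLp_mul_cc (h.vi2 i) hθ.continuous hc).integrable_mul (h.gij2 j i)
  rw [← integral_finsetSum _ (fun i _ => J1 i), ← integral_finsetSum _ (fun i _ => J2 i)] at this
  have e1 : (fun x => ∑ i, v x i * v x j * pd i θ x) = fun x => ∑ i, v x i * pd i θ x * v x j := by
    ext x; apply Finset.sum_congr rfl; intro i _; ring
  have e2 : (fun x => ∑ i, v x i * g x j i * θ x) = fun x => ∑ i, v x i * θ x * g x j i := by
    ext x; apply Finset.sum_congr rfl; intro i _; ring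
  rw [e1, e2, this]

/-! ### regularised Newton kernel -/
section
variable {c : E3} {σ : ℝ}

lemma hp_contDiff (hσ : 0 < σ) (β : ℝ) {n : ℕ∞} : ContDiff ℝ n (hp c σ β) := by
  unfold hp
  have h1 : ContDiff ℝ n (fun x : E3 => ‖x - c‖ ^ 2 + σ) := ((contDiff_id.sub contDiff_const).norm_sq ℝ).add contDiff_const
  exact h1.rpow_const_of_ne (fun x => (hbase hσ x).ne')

lemma rpw_deriv {τ : ℝ} (h : 0 < τ + σ) (β : ℝ) : HasDerivAt (fun τ : ℝ => (τ + σ) ^ β) (β * (τ + σ) ^ (β - 1)) τ := by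
  have := ((hasDerivAt_id τ).add_const σ).rpow_const (p := β) (Or.inl h.ne')
  simpa using this

lemma hp_pd (hσ : 0 < σ) (β : ℝ) (i : Fin 3) (x : E3) : pd i (hp c σ β) x = β * (x - c) i * hp c σ (β - 2) x := by
  unfold hp
  rw [rad_pd (F := fun τ => (τ + σ) ^ (β/2)) (rpw_deriv (hbase hσ x) _)]
  rw [show (β - 2) / 2 = β / 2 - 1 by ring]; ring

lemma hp_pd2 (hσ : 0 < σ) (β : ℝ) (i j : Fin 3) (x : E3) : pd j (pd i (hp c σ β)) x =
    (if i = j then 1 else 0) * (β * hp c σ (β - 2) x) + β * (β - 2) * ((x - c) i * (x - c) j) * hp c σ (β - 4) x := by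
  have e : pd i (hp c σ β) = fun x => (x - c) i * (β * hp c σ (β - 2) x) := by
    ext y; rw [hp_pd hσ]; ring
  have d := (hp_contDiff (c := c) hσ (β - 2) (n := 1)).differentiable one_ne_zero x
  rw [e, pd_mul (coord_diff i c x) (d.const_mul β), pd_coord, pd_const_mul _ d, hp_pd hσ, show β - 2 - 2 = β - 4 by ring]
  ring

lemma hp_refl (x y : E3) (β : ℝ) : hp 0 σ β (x - y) = hp x σ β y := by
  unfold hp; rw [sub_zero, norm_sub_rev]

lemma hp_le_kk (hσ : 0 < σ) {β : ℝ} (hβ : 0 < β) {y : E3} (hy : y ≠ c) : hp c σ (-β) y ≤ ‖y - c‖ ^ (-β) := by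
  have : 0 < ‖y - c‖ := by rw [norm_pos_iff]; exact sub_ne_zero.2 hy
  rw [hp_eq_rpow hσ]
  exact Real.rpow_le_rpow_of_nonpos this (norm_le_hp hσ y) (by linarith)

lemma hp_pd_le (hσ : 0 < σ) (i : Fin 3) {y : E3} (hy : y ≠ c) : |pd i (hp c σ (-1)) y| ≤ ‖y - c‖ ^ (-2 : ℝ) := by
  have h0 : 0 < ‖y - c‖ := by rw [norm_pos_iff]; exact sub_ne_zero.2 hy
  rw [hp_pd hσ, show (-1:ℝ) - 2 = -3 by norm_num, abs_mul, abs_mul, abs_of_pos (hp_pos hσ _ y)]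
  have h1 := hp_le_kk hσ (β := 3) (by norm_num) hy
  have h2 := coord_le (y - c) i
  have h3 : ‖y - c‖ ^ (-2:ℝ) = ‖y - c‖ * ‖y - c‖ ^ (-3:ℝ) := by
    rw [← Real.rpow_one_add' h0.le (by norm_num)]; norm_num
  rw [h3]
  have := hp_pos (x0 := c) hσ (-3) y
  simp only [abs_neg, abs_one, one_mul]
  gcongr

lemma hp_pd2_le (hσ : 0 < σ) (i j : Fin 3) {y : E3} (hy : y ≠ c) : |pd j (pd i (hp c σ (-1))) y| ≤ 4 * ‖y - c‖ ^ (-3 : ℝ) := by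
  have h0 : 0 < ‖y - c‖ := by rw [norm_pos_iff]; exact sub_ne_zero.2 hy
  rw [hp_pd2 hσ, show (-1:ℝ) - 2 = -3 by norm_num, show (-1:ℝ) - 4 = -5 by norm_num]
  have h1 := hp_le_kk hσ (β := 3) (by norm_num) hy
  have h5 := hp_le_kk hσ (β := 5) (by norm_num) hy
  have h2 := coord_le (y - c) i
  have h2' := coord_le (y - c) j
  have h3 : ‖y - c‖ ^ (-3:ℝ) = ‖y - c‖ * ‖y - c‖ * ‖y - c‖ ^ (-5:ℝ) := by
    rw [← sq, ← Real.rpow_natCast, ← Real.rpow_add h0]; norm_num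
  have p3 := hp_pos (x0 := c) hσ (-3) y
  have p5 := hp_pos (x0 := c) hσ (-5) y
  have a1 : |(if i = j then (1:ℝ) else 0) * (-1 * hp c σ (-3) y)| ≤ ‖y - c‖ ^ (-3 : ℝ) := by
    split_ifs
    · rw [one_mul, abs_mul, abs_of_pos p3]; simpa using h1
    · simp
  have a2 : |(-1:ℝ) * -3 * ((y - c) i * (y - c) j) * hp c σ (-5) y| ≤ 3 * ‖y - c‖ ^ (-3 : ℝ) := by
    rw [abs_mul, abs_mul, abs_mul ((y-c) i), abs_of_pos p5, h3, show |(-1:ℝ) * -3| = 3 by norm_num, mul_assoc]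
    gcongr
  refine (abs_add_le _ _).trans ?_
  linarith

lemma hp_lap (hσ : 0 < σ) (y : E3) : lap (hp c σ (-1)) y = -3 * σ * hp c σ (-5) y := by
  have e : ∀ i, pd i (fun y => pd i (hp c σ (-1)) y) y = -hp c σ (-3) y + 3 * ((y - c) i * (y - c) i) * hp c σ (-5) y := by
    intro i
    have := hp_pd2 (c := c) hσ (-1) i i y
    rw [show (-1:ℝ) - 2 = -3 by norm_num, show (-1:ℝ) - 4 = -5 by norm_num] at this
    simp only [if_true] at this
    rw [show (fun y => pd i (hp c σ (-1)) y) = pd i (hp c σ (-1)) from rfl, this]; ring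
  unfold lap
  simp only [e]
  rw [Finset.sum_add_distrib, ← Finset.sum_mul, ← Finset.mul_sum, sum_coord_sq]
  simp only [Finset.sum_const, Finset.card_univ, Fintype.card_fin, nsmul_eq_mul]
  have : hp c σ (-3) y = hp c σ (-5) y * (‖y - c‖ ^ 2 + σ) := by
    rw [← hp_two, hp_mul hσ]; norm_num
  rw [this]; push_cast; ring
end

/-- truncated kernel -/
def Nk (δ : ℝ) (z : E3) : ℝ := ct (‖z‖ ^ 2 / 256) * hp 0 (δ ^ 2) (-1) z

lemma pd_congr {f g : E3 → ℝ} {x : E3} (h : f =ᶠ[nhds x] g) (i : Fin 3) : pd i f x = pd i g x := by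
  unfold pd; rw [h.fderiv_eq]

lemma pd_congr_ev {f g : E3 → ℝ} {x : E3} (h : f =ᶠ[nhds x] g) (i : Fin 3) : pd i f =ᶠ[nhds x] pd i g := by
  filter_upwards [h.eventuallyEq_nhds] with y hy using pd_congr hy i

section
variable {δ : ℝ}
lemma Nk_contDiff (hδ : 0 < δ) {n : ℕ∞} : ContDiff ℝ n (Nk δ) := by
  unfold Nk
  exact (ct_contDiff.comp ((contDiff_id.norm_sq ℝ).div_const _)).mul (hp_contDiff (by positivity) _)

lemma Nk_supp : HasCompactSupport (Nk δ) := by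
  apply HasCompactSupport.intro (isCompact_closedBall (0:E3) 16)
  intro x hx
  rw [mem_closedBall, dist_zero_right, not_le] at hx
  unfold Nk
  rw [ct_zero, zero_mul]
  rw [le_div_iff₀ (by norm_num)]; nlinarith

lemma Nk_ev {z : E3} (hz : ‖z‖ < 8) : Nk δ =ᶠ[nhds z] hp 0 (δ ^ 2) (-1) := by
  have : ball (0:E3) 8 ∈ nhds z := isOpen_ball.mem_nhds (by simpa using hz)
  filter_upwards [this] with y hy
  rw [mem_ball, dist_zero_right] at hy
  unfold Nk
  rw [ct_one, one_mul]
  rw [div_le_iff₀ (by norm_num)]; nlinarith [norm_nonneg y]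
end

lemma pd_contDiff {f : E3 → ℝ} (hf : ContDiff ℝ (⊤ : ℕ∞) f) (i : Fin 3) : ContDiff ℝ (⊤ : ℕ∞) (pd i f) := by
  unfold pd
  exact (hf.fderiv_right (m := (⊤:ℕ∞)) (by simp)).clm_apply contDiff_const

lemma pd_supp {f : E3 → ℝ} (hf : HasCompactSupport f) (i : Fin 3) : HasCompactSupport (pd i f) := hf.fderiv_apply ℝ _

/-- smooth function supported in the ball of radius 1/8 -/
structure Ph0 (x0 : E3) (φ : E3 → ℝ) : Prop where
  sm : ContDiff ℝ (⊤ : ℕ∞) φ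
  su : ∀ x ∉ closedBall x0 (1/8), φ x = 0

section
variable {v : E3 → E3} {g : E3 → Fin 3 → Fin 3 → ℝ} {p : E3 → ℝ} {x0 : E3} {φ : E3 → ℝ} {δ : ℝ}

lemma Ph0.cs (hφ : Ph0 x0 φ) : HasCompactSupport φ := HasCompactSupport.intro (isCompact_closedBall x0 (1/8)) hφ.su
lemma Ph0.ts (hφ : Ph0 x0 φ) : tsupport φ ⊆ closedBall x0 (1/8) :=
  closure_minimal (fun x hx => by by_contra h; exact hx (hφ.su x h)) isClosed_closedBall
lemma Ph0.pdz (hφ : Ph0 x0 φ) (j : Fin 3) {x : E3} (hx : x ∉ closedBall x0 (1/8)) : pd j φ x = 0 := by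
  unfold pd
  rw [image_eq_zero_of_notMem_tsupport (f := fderiv ℝ φ) (fun h => hx (hφ.ts (tsupport_fderiv_subset ℝ h)))]; rfl

/-- the function v·∇φ -/
def vphi (v : E3 → E3) (φ : E3 → ℝ) (y : E3) : ℝ := ∑ j, v y j * pd j φ y

lemma vphi_memLp (h : Slice v g p) (hφ : Ph0 x0 φ) : MemLp (vphi v φ) 2 volume := by
  unfold vphi
  exact memLp_finsetSum _ (fun j _ => memLp_mul_cc (h.vi2 j) (pd_contDiff hφ.sm j).continuous (pd_supp hφ.cs j))

lemma vphi_zero (hφ : Ph0 x0 φ) {y : E3} (hy : y ∉ closedBall x0 (1/8)) : vphi v φ y = 0 := by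
  unfold vphi; simp [hφ.pdz _ hy]

/-- potential -/
def psi (δ : ℝ) (v : E3 → E3) (φ : E3 → ℝ) : E3 → ℝ := cv (Nk δ) (vphi v φ)

lemma psi_contDiff (h : Slice v g p) (hφ : Ph0 x0 φ) (hδ : 0 < δ) : ContDiff ℝ (⊤ : ℕ∞) (psi δ v φ) :=
  cv_contDiff (Nk_contDiff hδ) Nk_supp ((vphi_memLp h hφ).locallyIntegrable (by norm_num))

lemma nearby {x y : E3} (hx : x ∈ closedBall x0 1) (hy : y ∈ closedBall x0 1) : ‖x - y‖ ≤ 2 := by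
  rw [← dist_eq_norm]
  have := dist_triangle_right x y x0
  rw [mem_closedBall] at hx hy
  linarith

lemma psi_val (hφ : Ph0 x0 φ) {x : E3} (hx : x ∈ closedBall x0 1) :
    psi δ v φ x = ∫ y, vphi v φ y * hp x (δ ^ 2) (-1) y := by
  unfold psi cv
  congr 1; ext y
  by_cases hy : y ∈ closedBall x0 (1/8)
  · rw [(Nk_ev (lt_of_le_of_lt (nearby hx (closedBall_subset_closedBall (by norm_num) hy)) (by norm_num))).eq_of_nhds, hp_refl]
  · rw [vphi_zero hφ hy]; simp

lemma psi_pd_fun (h : Slice v g p) (hφ : Ph0 x0 φ) (hδ : 0 < δ) (i : Fin 3) : pd i (psi δ v φ) = cv (pd i (Nk δ)) (vphi v φ) := by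
  ext x; exact cv_pd (Nk_contDiff hδ (n := 1)) Nk_supp ((vphi_memLp h hφ).locallyIntegrable (by norm_num)) i x

lemma psi_pd (h : Slice v g p) (hφ : Ph0 x0 φ) (hδ : 0 < δ) (i : Fin 3) {x : E3} (hx : x ∈ closedBall x0 1) :
    pd i (psi δ v φ) x = ∫ y, vphi v φ y * (- pd i (hp x (δ ^ 2) (-1)) y) := by
  rw [psi_pd_fun h hφ hδ]
  unfold cv
  have hδ2 : 0 < δ ^ 2 := by positivity
  congr 1; ext y
  by_cases hy : y ∈ closedBall x0 (1/8)
  · rw [pd_congr (Nk_ev (lt_of_le_of_lt (nearby hx (closedBall_subset_closedBall (by norm_num) hy)) (by norm_num))),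
      hp_pd hδ2, hp_pd hδ2, hp_refl, sub_zero]
    have : (x - y) i = - (y - x) i := by simp
    rw [this]; ring
  · rw [vphi_zero hφ hy]; simp

lemma psi_lap (h : Slice v g p) (hφ : Ph0 x0 φ) (hδ : 0 < δ) {x : E3} (hx : x ∈ closedBall x0 1) :
    lap (psi δ v φ) x = -3 * ∫ y, vphi v φ y * (δ ^ 2 * hp x (δ ^ 2) (-5) y) := by
  have hδ2 : 0 < δ ^ 2 := by positivity
  have hli := (vphi_memLp h hφ).locallyIntegrable (by norm_num)
  have e : ∀ i, pd i (fun y => pd i (psi δ v φ) y) x = ∫ y, vphi v φ y * pd i (pd i (Nk δ)) (x - y) := by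
    intro i
    rw [show (fun y => pd i (psi δ v φ) y) = pd i (psi δ v φ) from rfl, psi_pd_fun h hφ hδ,
      cv_pd ((pd_contDiff (Nk_contDiff hδ) i).of_le (by exact_mod_cast le_top)) (pd_supp Nk_supp i) hli]
    rfl
  unfold lap
  simp only [e]
  rw [← integral_finsetSum, ← integral_const_mul]
  · congr 1; ext y
    by_cases hy : y ∈ closedBall x0 (1/8)
    · have hn : ‖x - y‖ < 8 := lt_of_le_of_lt (nearby hx (closedBall_subset_closedBall (by norm_num) hy)) (by norm_num)
      have e2 : ∀ i, pd i (pd i (Nk δ)) (x - y) = pd i (fun z => pd i (hp 0 (δ^2) (-1)) z) (x - y) := fun i =>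
        pd_congr (pd_congr_ev (Nk_ev hn) i) i
      simp only [e2]
      rw [← Finset.mul_sum]
      have := hp_lap (c := (0:E3)) hδ2 (x - y)
      unfold lap at this
      rw [this, hp_refl]; ring
    · rw [vphi_zero hφ hy]; simp
  · intro i _
    refine ((hli.integrable_smul_left_of_hasCompactSupport (g := fun y => pd i (pd i (Nk δ)) (x - y)) ?_ ?_)).congr
      (Eventually.of_forall fun y => by simp [mul_comm])
    · exact (pd_contDiff (pd_contDiff (Nk_contDiff hδ) i) i).continuous.comp (continuous_const.sub continuous_id)
    · exact (pd_supp (pd_supp Nk_supp i) i).comp_homeomorph (Homeomorph.subLeft x)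
end

/-! ### radial cutoffs and the divergence trick -/
/-- cutoff -/
def cu (c : E3) (R : ℝ) (y : E3) : ℝ := ct (R * ‖y - c‖ ^ 2)

section
variable {c : E3} {R : ℝ}
lemma cu_contDiff {n : ℕ∞} : ContDiff ℝ n (cu c R) := by
  unfold cu
  exact ct_contDiff.comp (contDiff_const.mul ((contDiff_id.sub contDiff_const).norm_sq ℝ))
lemma cu_zero {y : E3} (h : 1 ≤ R * ‖y - c‖ ^ 2) : cu c R y = 0 := ct_zero h
lemma cu_one {y : E3} (h : R * ‖y - c‖ ^ 2 ≤ 1/4) : cu c R y = 1 := ct_one h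
lemma cu_abs (y : E3) : |cu c R y| ≤ 1 := by
  unfold cu; rw [abs_of_nonneg (ct_nonneg _)]; exact ct_le_one _
lemma ctR_deriv (R τ : ℝ) : HasDerivAt (fun τ => ct (R * τ)) (R * deriv ct (R * τ)) τ := by
  have := (ct_hasDeriv (R * τ)).comp τ ((hasDerivAt_id τ).const_mul R)
  simpa [mul_comm, Function.comp_def] using this
lemma ctR_deriv2 (R τ : ℝ) : HasDerivAt (fun τ => R * deriv ct (R * τ)) (R ^ 2 * deriv (deriv ct) (R * τ)) τ := by
  have := ((ct_hasDeriv2 (R * τ)).comp τ ((hasDerivAt_id τ).const_mul R)).const_mul R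
  refine (this.congr_deriv ?_)
  simp; ring
lemma cu_pd (i : Fin 3) (y : E3) : pd i (cu c R) y = 2 * (y - c) i * (R * deriv ct (R * ‖y - c‖ ^ 2)) :=
  rad_pd (F := fun τ => ct (R * τ)) (ctR_deriv R _) i
lemma cu_lap (y : E3) : lap (cu c R) y = 6 * (R * deriv ct (R * ‖y - c‖ ^ 2)) + 4 * ‖y - c‖ ^ 2 * (R ^ 2 * deriv (deriv ct) (R * ‖y - c‖ ^ 2)) :=
  rad_lap (F := fun τ => ct (R * τ)) (F1 := fun τ => R * deriv ct (R * τ)) (Eventually.of_forall fun τ => ctR_deriv R τ) (ctR_deriv2 R _)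
lemma cu_supp (hR : 0 < R) {r : ℝ} (hr : 0 ≤ r) (h : 1 ≤ R * r ^ 2) : tsupport (cu c R) ⊆ closedBall c r := by
  refine closure_minimal (fun y hy => ?_) isClosed_closedBall
  by_contra hn
  rw [mem_closedBall, not_le, dist_eq_norm] at hn
  refine hy (cu_zero (h.trans ?_))
  gcongr
lemma cu_cs (hR : 0 < R) {r : ℝ} (hr : 0 ≤ r) (h : 1 ≤ R * r ^ 2) : HasCompactSupport (cu c R) :=
  HasCompactSupport.of_support_subset_isCompact (isCompact_closedBall c r) ((subset_tsupport _).trans (cu_supp hR hr h))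
end

lemma pd_sub_const (f : E3 → ℝ) (a : ℝ) (i : Fin 3) (x : E3) : pd i (fun y => f y - a) x = pd i f x := by
  unfold pd; rw [fderiv_sub_const]

lemma cB_sub {x0 : E3} (hx0 : ‖x0‖ ≤ 8) {r : ℝ} (hr : r ≤ 4) : closedBall x0 r ⊆ ball (0:E3) 16 := by
  intro y hy
  rw [mem_closedBall] at hy
  rw [mem_ball]
  have := dist_triangle y x0 0
  rw [dist_zero_right] at this
  rw [dist_zero_right] at this ⊢
  linarith

section
variable {v : E3 → E3} {g : E3 → Fin 3 → Fin 3 → ℝ} {p : E3 → ℝ} {x0 : E3} {φ : E3 → ℝ} {δ : ℝ}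

lemma cu1_pd_le (i : Fin 3) {y : E3} (hy : y ∈ closedBall x0 1) : |pd i (cu x0 1) y| ≤ 2 * Kct := by
  rw [cu_pd, abs_mul, abs_mul, one_mul, abs_two]
  have h1 := ct_deriv_le (1 * ‖y - x0‖ ^ 2)
  have h2 := coord_le (y - x0) i
  rw [mem_closedBall, dist_eq_norm] at hy
  have : |(y - x0) i| ≤ 1 := h2.trans hy
  calc _ ≤ 2 * 1 * Kct := by gcongr
    _ = _ := by ring

lemma cu1_zero' {y : E3} (hy : y ∉ closedBall x0 1) : cu x0 1 y = 0 := by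
  rw [mem_closedBall, not_le, dist_eq_norm] at hy
  exact cu_zero (by nlinarith)
lemma cu1_pdz (i : Fin 3) {y : E3} (hy : y ∉ closedBall x0 1) : pd i (cu x0 1) y = 0 := by
  rw [mem_closedBall, not_le, dist_eq_norm] at hy
  rw [cu_pd, ct_deriv_zero (Or.inr (by nlinarith))]; ring
lemma cu1_one' {y : E3} (hy : y ∈ closedBall x0 (1/8)) : cu x0 1 y = 1 := by
  rw [mem_closedBall, dist_eq_norm] at hy
  exact cu_one (by nlinarith [norm_nonneg (y - x0)])

lemma divtest (h : Slice v g p) (hφ : Ph0 x0 φ) (hx0 : ‖x0‖ ≤ 8) {K : E3 → ℝ} (hK : ContDiff ℝ (⊤ : ℕ∞) K) (a : ℝ) :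
    ∫ y, vphi v φ y * K y = - ∫ y, ∑ j, v y j * ((φ y - a) * (cu x0 1 y * pd j K y + pd j (cu x0 1) y * K y)) := by
  have hcs : HasCompactSupport (cu x0 1) := cu_cs one_pos (r := 1) zero_le_one (by norm_num)
  set ζ : E3 → ℝ := fun y => (φ y - a) * (cu x0 1 y * K y) with hζ
  have hck : ContDiff ℝ (⊤ : ℕ∞) (fun y => cu x0 1 y * K y) := cu_contDiff.mul hK
  have hfa : ContDiff ℝ (⊤ : ℕ∞) (fun y => φ y - a) := hφ.sm.sub contDiff_const
  have hζs : ContDiff ℝ (⊤ : ℕ∞) ζ := hfa.mul hck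
  have hcc : HasCompactSupport ζ := (hcs.mul_right (f' := K)).mul_left
  have hts : tsupport ζ ⊆ ball 0 16 :=
    (tsupport_mul_subset_right.trans tsupport_mul_subset_left).trans ((cu_supp one_pos (r := 1) zero_le_one (by norm_num)).trans (cB_sub hx0 (by norm_num)))
  have h0 := h.div ζ hζs hcc hts
  have e : ∀ y j, pd j ζ y = pd j φ y * K y + (φ y - a) * (cu x0 1 y * pd j K y + pd j (cu x0 1) y * K y) := by
    intro y j
    have d1 := hfa.differentiable (by simp) y
    have d2 := hck.differentiable (by simp) y
    have d3 := (cu_contDiff (c := x0) (R := 1) (n := 1)).differentiable (by simp) y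
    have d4 := hK.differentiable (by simp) y
    rw [hζ, pd_mul d1 d2, pd_mul d3 d4, pd_sub_const]
    by_cases hy : y ∈ closedBall x0 (1/8)
    · rw [cu1_one' hy]; ring
    · rw [hφ.pdz j hy]; ring
  have I1 : Integrable (fun y => vphi v φ y * K y) := by
    have hh : Integrable (fun y => vphi v φ y * (cu x0 1 y * K y)) :=
      memLp_int_cc (by norm_num) (vphi_memLp h hφ) hck.continuous hcs.mul_right
    refine hh.congr (Eventually.of_forall fun y => ?_)
    beta_reduce
    by_cases hy : y ∈ closedBall x0 (1/8)
    · rw [cu1_one' hy]; ring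
    · rw [vphi_zero hφ hy]; ring
  have I2 : Integrable (fun y => ∑ j, v y j * ((φ y - a) * (cu x0 1 y * pd j K y + pd j (cu x0 1) y * K y))) := by
    refine integrable_finsetSum _ (fun j _ => ?_)
    refine memLp_int_cc (by norm_num) (h.vi2 j) ?_ ?_
    · have := (pd_contDiff hK j).continuous
      have h4 := (pd_contDiff (cu_contDiff (c := x0) (R := 1)) j).continuous
      exact hfa.continuous.mul ((cu_contDiff (n := 0).continuous.mul this).add (h4.mul hK.continuous))
    · exact HasCompactSupport.mul_left (HasCompactSupport.add hcs.mul_right (pd_supp hcs j).mul_right)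
  rw [eq_neg_iff_add_eq_zero, ← integral_add I1 I2, ← h0]
  congr 1; ext y
  simp only [e, vphi, mul_add, Finset.sum_add_distrib, Finset.sum_mul, mul_assoc]

lemma divtest_le (h : Slice v g p) (hφ : Ph0 x0 φ) (hx0 : ‖x0‖ ≤ 8) {K : E3 → ℝ} (hK : ContDiff ℝ (⊤ : ℕ∞) K) (a : ℝ)
    {M : E3 → ℝ} {A B : ℝ} (hA : 0 ≤ A) (hB : 0 ≤ B)
    (hM1 : ∀ y ∈ closedBall x0 1, φ y - a ≠ 0 → ∀ j, |pd j K y| ≤ A * M y)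
    (hM2 : ∀ y ∈ closedBall x0 1, φ y - a ≠ 0 → |K y| ≤ B * M y) :
    ‖∫ y, vphi v φ y * K y‖ₑ ≤ ENNReal.ofReal (3 * (A + 2 * Kct * B)) * ∫⁻ y in closedBall x0 1, ‖v y‖ₑ * ‖φ y - a‖ₑ * ENNReal.ofReal (M y) := by
  rw [divtest h hφ hx0 hK a, enorm_neg, ← lintegral_const_mul' _ _ ENNReal.ofReal_ne_top]
  refine (enorm_integral_le_lintegral_enorm _).trans ?_
  rw [← lintegral_indicator measurableSet_closedBall]
  refine lintegral_mono fun y => ?_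
  beta_reduce
  by_cases hy : y ∈ closedBall x0 1
  · rw [indicator_of_mem hy]
    by_cases hz : φ y - a = 0
    · simp [hz]
    simp only [← ofReal_norm]
    rw [← ENNReal.ofReal_mul (norm_nonneg _)]
    have hM0 : 0 ≤ A * M y := (abs_nonneg _).trans (hM1 y hy hz 0)
    have hM0' : 0 ≤ B * M y := (abs_nonneg _).trans (hM2 y hy hz)
    rw [← ENNReal.ofReal_mul (by positivity), ← ENNReal.ofReal_mul (by have := Kct_one; positivity)]
    apply ENNReal.ofReal_le_ofReal
    have hj : ∀ j, ‖v y j * ((φ y - a) * (cu x0 1 y * pd j K y + pd j (cu x0 1) y * K y))‖ ≤ ‖v y‖ * (‖φ y - a‖ * (1 * (A * M y) + 2 * Kct * (B * M y))) := by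
      intro j
      rw [norm_mul, norm_mul]
      have k1 := PiLp.norm_apply_le (v y) j
      have k2 := cu1_pd_le j hy
      have k3 := cu_abs (c := x0) (R := 1) y
      have k4 := hM1 y hy hz j
      have k5 := hM2 y hy hz
      gcongr
      refine (abs_add_le _ _).trans ?_
      rw [abs_mul, abs_mul]
      have := Kct_one
      gcongr
    refine (norm_sum_le _ _).trans ((Finset.sum_le_sum (fun j _ => hj j)).trans ?_)
    simp only [Finset.sum_const, Finset.card_univ, Fintype.card_fin, nsmul_eq_mul]
    apply le_of_eq; push_cast; ring
  · rw [indicator_of_notMem hy]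
    simp [cu1_zero' hy, cu1_pdz _ hy]

/-- the potential bound quantity -/
def ZZ (v : E3 → E3) (φ : E3 → ℝ) (x0 x : E3) : ℝ≥0∞ := ∫⁻ y in closedBall x0 1, ‖v y‖ₑ * ‖φ y - φ x‖ₑ * kk 3 (y - x)
/-- total mass -/
def JJ (v : E3 → E3) (φ : E3 → ℝ) (x0 : E3) : ℝ≥0∞ := ∫⁻ y in closedBall x0 1, ‖v y‖ₑ * ‖φ y‖ₑ

lemma psi_grad_le (h : Slice v g p) (hφ : Ph0 x0 φ) (hx0 : ‖x0‖ ≤ 8) (hδ : 0 < δ) (i : Fin 3) {x : E3} (hx : x ∈ closedBall x0 1) :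
    ‖pd i (psi δ v φ) x‖ₑ ≤ ENNReal.ofReal (24 * Kct) * ZZ v φ x0 x := by
  rw [psi_pd h hφ hδ i hx]
  have hδ2 : 0 < δ ^ 2 := by positivity
  have hK : ContDiff ℝ (⊤ : ℕ∞) (fun y => - pd i (hp x (δ ^ 2) (-1)) y) := (pd_contDiff (hp_contDiff hδ2 _) i).neg
  have hne : ∀ y, φ y - φ x ≠ 0 → y ≠ x := by
    rintro y hy rfl; simp at hy
  refine (divtest_le h hφ hx0 hK (φ x) (M := fun y => ‖y - x‖ ^ (-3:ℝ)) (A := 4) (B := 2) (by norm_num) (by norm_num) ?_ ?_).trans ?_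
  · intro y hy hz j
    have : pd j (fun y => - pd i (hp x (δ ^ 2) (-1)) y) y = - pd j (pd i (hp x (δ ^ 2) (-1))) y := by
      unfold pd; rw [fderiv_fun_neg]; rfl
    rw [this, abs_neg]
    exact hp_pd2_le hδ2 i j (hne y hz)
  · intro y hy hz
    rw [abs_neg]
    refine (hp_pd_le hδ2 i (hne y hz)).trans ?_
    have h0 : 0 < ‖y - x‖ := by rw [norm_pos_iff]; exact sub_ne_zero.2 (hne y hz)
    rw [show ‖y - x‖ ^ (-2:ℝ) = ‖y - x‖ * ‖y - x‖ ^ (-3:ℝ) by rw [← Real.rpow_one_add' h0.le (by norm_num)]; norm_num]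
    have := nearby hy hx
    gcongr
  · unfold ZZ kk
    refine mul_le_mul' (ENNReal.ofReal_le_ofReal ?_) le_rfl
    nlinarith [Kct_one]

lemma far_x {x y : E3} (hx : x ∉ ball x0 (1/4)) (hy : y ∈ closedBall x0 (1/8)) : 1/8 ≤ ‖y - x‖ := by
  rw [mem_ball, not_lt] at hx
  rw [mem_closedBall] at hy
  rw [← dist_eq_norm]
  have := dist_triangle x y x0
  rw [dist_comm x y] at this
  linarith

lemma ZZ_far (hφ : Ph0 x0 φ) {x : E3} (hx : x ∉ ball x0 (1/4)) :
    ZZ v φ x0 x ≤ 512 * JJ v φ x0 := by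
  have hfx : φ x = 0 := hφ.su x (fun h => hx (lt_of_le_of_lt (b := (1/8:ℝ)) h (by norm_num)))
  unfold ZZ JJ
  rw [← lintegral_const_mul' _ _ (by norm_num)]
  refine lintegral_mono fun y => ?_
  beta_reduce
  rw [hfx, sub_zero]
  by_cases hy : y ∈ closedBall x0 (1/8)
  · have h1 := far_x hx hy
    have : kk 3 (y - x) ≤ 512 := by
      unfold kk
      have : ‖y - x‖ ^ (-3:ℝ) ≤ (1/8) ^ (-3:ℝ) := Real.rpow_le_rpow_of_nonpos (by norm_num) h1 (by norm_num)
      refine (ENNReal.ofReal_le_ofReal this).trans ?_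
      rw [show ((1/8:ℝ)) ^ (-3:ℝ) = 512 by rw [Real.rpow_neg (by norm_num)]; norm_num]
      simp
    rw [mul_comm (512:ℝ≥0∞)]
    exact mul_le_mul' le_rfl this
  · rw [hφ.su y hy]; simp

lemma psi_far_le (h : Slice v g p) (hφ : Ph0 x0 φ) (hx0 : ‖x0‖ ≤ 8) (hδ : 0 < δ) {x : E3} (hx : x ∈ closedBall x0 1) (hx' : x ∉ ball x0 (1/4)) :
    ‖psi δ v φ x‖ₑ ≤ ENNReal.ofReal (240 * Kct) * JJ v φ x0 := by
  rw [psi_val hφ hx]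
  have hδ2 : 0 < δ ^ 2 := by positivity
  have hK : ContDiff ℝ (⊤ : ℕ∞) (hp x (δ ^ 2) (-1)) := hp_contDiff hδ2 _
  have hb : ∀ y, φ y - 0 ≠ 0 → 1/8 ≤ ‖y - x‖ := by
    intro y hy
    refine far_x hx' ?_
    by_contra hc; rw [hφ.su y hc] at hy; simp at hy
  have hne : ∀ y, 1/8 ≤ ‖y - x‖ → y ≠ x := by
    rintro y hy rfl; norm_num at hy
  refine (divtest_le h hφ hx0 hK 0 (M := fun y => 1) (A := 64) (B := 8) (by norm_num) (by norm_num) ?_ ?_).trans ?_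
  · intro y hy hz j
    refine (hp_pd_le hδ2 j (hne y (hb y hz))).trans ((Real.rpow_le_rpow_of_nonpos (by norm_num) (hb y hz) (by norm_num)).trans ?_)
    rw [Real.rpow_neg (by norm_num)]; norm_num
  · intro y hy hz
    rw [abs_of_pos (hp_pos hδ2 _ _)]
    refine (hp_le_kk hδ2 one_pos (hne y (hb y hz))).trans ((Real.rpow_le_rpow_of_nonpos (by norm_num) (hb y hz) (by norm_num)).trans ?_)
    rw [Real.rpow_neg (by norm_num)]; norm_num
  · unfold JJ
    simp only [sub_zero, ENNReal.ofReal_one, mul_one]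
    refine mul_le_mul' (ENNReal.ofReal_le_ofReal ?_) le_rfl
    nlinarith [Kct_one]
end

/-! ### testing the pressure equation -/
/-- norm of gradient -/
def G1 (g : E3 → Fin 3 → Fin 3 → ℝ) (x : E3) : ℝ≥0∞ := (G2 g x) ^ (1/2 : ℝ)
lemma G1_sq (g : E3 → Fin 3 → Fin 3 → ℝ) (x : E3) : G1 g x ^ 2 = G2 g x := by
  unfold G1; rw [← ENNReal.rpow_natCast, ← ENNReal.rpow_mul]; norm_num
lemma le_G1 (g : E3 → Fin 3 → Fin 3 → ℝ) (x : E3) (i j : Fin 3) : ‖g x i j‖ₑ ≤ G1 g x := by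
  have h1 : ‖g x i j‖ₑ ^ 2 ≤ G2 g x := by
    unfold G2
    exact (Finset.single_le_sum (f := fun j => ‖g x i j‖ₑ ^ 2) (fun _ _ => zero_le) (Finset.mem_univ j)).trans
      (Finset.single_le_sum (f := fun i => ∑ j, ‖g x i j‖ₑ ^ 2) (fun _ _ => zero_le) (Finset.mem_univ i))
  rw [← G1_sq] at h1
  exact le_of_not_gt fun h => absurd h1 (not_le.2 (ENNReal.pow_lt_pow_left two_ne_zero h))

lemma lap_mul {f k : E3 → ℝ} (hf : ContDiff ℝ (⊤ : ℕ∞) f) (hk : ContDiff ℝ (⊤ : ℕ∞) k) (x : E3) :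
    lap (fun y => f y * k y) x = f x * lap k x + ((∑ i, 2 * (pd i f x * pd i k x)) + lap f x * k x) := by
  have df := fun x => hf.differentiable (by simp) x
  have dk := fun x => hk.differentiable (by simp) x
  unfold lap
  have e : ∀ i, pd i (fun y => pd i (fun y => f y * k y) y) x =
      f x * pd i (fun y => pd i k y) x + (2 * (pd i f x * pd i k x) + pd i (fun y => pd i f y) x * k x) := by
    intro i
    have : (fun y => pd i (fun y => f y * k y) y) = fun y => pd i f y * k y + f y * pd i k y := by
      ext y; rw [pd_mul (df y) (dk y)]; ring
    have d1 := (pd_contDiff hf i).differentiable (by simp) x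
    have d2 := (pd_contDiff hk i).differentiable (by simp) x
    rw [this, pd_add (f := fun y => pd i f y * k y) (g := fun y => f y * pd i k y) (d1.mul (dk x)) ((df x).mul d2), pd_mul d1 (dk x), pd_mul (df x) d2]
    ring
  simp only [e, Finset.sum_add_distrib, Finset.mul_sum, Finset.sum_mul]

section
variable {v : E3 → E3} {g : E3 → Fin 3 → Fin 3 → ℝ} {p : E3 → ℝ} {x0 : E3} {φ : E3 → ℝ} {δ : ℝ}

lemma Slice.pL (h : Slice v g p) : MemLp p (ENNReal.ofReal (3/2)) volume := by
  refine ⟨h.mp.aestronglyMeasurable, ?_⟩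
  rw [eLpNorm_lt_top_iff_lintegral_rpow_enorm_lt_top (by simp) (by simp), ENNReal.toReal_ofReal (by norm_num)]
  exact h.p32

lemma one_le_32 : (1:ℝ≥0∞) ≤ ENNReal.ofReal (3/2) := by
  rw [ENNReal.one_le_ofReal]; norm_num

lemma cu4_pd_le (i : Fin 3) {y : E3} (hy : y ∈ closedBall x0 (1/2)) : |pd i (cu x0 4) y| ≤ 4 * Kct := by
  rw [cu_pd, abs_mul, abs_mul, abs_mul 4, abs_two, show |(4:ℝ)| = 4 by norm_num]
  have h1 := ct_deriv_le (4 * ‖y - x0‖ ^ 2)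
  have h2 := coord_le (y - x0) i
  rw [mem_closedBall, dist_eq_norm] at hy
  have : |(y - x0) i| ≤ 1/2 := h2.trans hy
  calc _ ≤ 2 * (1/2) * (4 * Kct) := by gcongr
    _ = _ := by ring
lemma cu4_lap_le {y : E3} (hy : y ∈ closedBall x0 (1/2)) : |lap (cu x0 4) y| ≤ 40 * Kct := by
  rw [cu_lap]
  have h1 := ct_deriv_le (4 * ‖y - x0‖ ^ 2)
  have h2 := ct_deriv2_le (4 * ‖y - x0‖ ^ 2)
  rw [mem_closedBall, dist_eq_norm] at hy
  refine (abs_add_le _ _).trans ?_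
  rw [abs_mul, abs_mul, abs_mul, abs_mul (4 ^ 2), abs_of_nonneg (show 0 ≤ 4 * ‖y - x0‖ ^ 2 by positivity),
    show |(6:ℝ)| = 6 by norm_num, show |(4:ℝ)| = 4 by norm_num, show |(4 ^ 2:ℝ)| = 16 by norm_num]
  calc _ ≤ 6 * (4 * Kct) + 4 * (1/2) ^ 2 * (16 * Kct) := by gcongr
    _ = _ := by ring
lemma cu4_dz {y : E3} (hy : y ∉ closedBall x0 (1/2)) : cu x0 4 y = 0 ∧ (∀ i, pd i (cu x0 4) y = 0) ∧ lap (cu x0 4) y = 0 := by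
  rw [mem_closedBall, not_le, dist_eq_norm] at hy
  have : 1 < 4 * ‖y - x0‖ ^ 2 := by nlinarith
  refine ⟨cu_zero this.le, fun i => ?_, ?_⟩
  · rw [cu_pd, ct_deriv_zero (Or.inr this)]; ring
  · rw [cu_lap, ct_deriv_zero (Or.inr this), ct_deriv2_zero (Or.inr this)]; ring
lemma cu4_dz' {y : E3} (hy : y ∈ ball x0 (1/4)) : (∀ i, pd i (cu x0 4) y = 0) ∧ lap (cu x0 4) y = 0 := by
  rw [mem_ball, dist_eq_norm] at hy
  have : 4 * ‖y - x0‖ ^ 2 < 1/4 := by nlinarith [norm_nonneg (y - x0)]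
  refine ⟨fun i => ?_, ?_⟩
  · rw [cu_pd, ct_deriv_zero (Or.inl this)]; ring
  · rw [cu_lap, ct_deriv_zero (Or.inl this), ct_deriv2_zero (Or.inl this)]; ring

lemma half_one {x : E3} (hx : x ∈ closedBall x0 (1/2)) : x ∈ closedBall x0 1 := closedBall_subset_closedBall (by norm_num) hx

lemma enorm_le_ofReal {a b : ℝ} (h : |a| ≤ b) : ‖a‖ₑ ≤ ENNReal.ofReal b := by
  rw [← ofReal_norm]; exact ENNReal.ofReal_le_ofReal h

lemma xi_pd_le (h : Slice v g p) (hφ : Ph0 x0 φ) (hx0 : ‖x0‖ ≤ 8) (hδ : 0 < δ) (j : Fin 3) {x : E3} (hx : x ∈ closedBall x0 (1/2)) :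
    ‖pd j (fun y => cu x0 4 y * psi δ v φ y) x‖ₑ ≤ ENNReal.ofReal (1000 * Kct ^ 2) * (ZZ v φ x0 x + JJ v φ x0) := by
  have K1 := Kct_one
  have d1 := (cu_contDiff (c := x0) (R := 4) (n := 1)).differentiable (by simp) x
  have d2 := (psi_contDiff h hφ hδ).differentiable (by simp) x
  have hg := psi_grad_le h hφ hx0 hδ j (half_one hx)
  have hcu : ‖cu x0 4 x‖ₑ ≤ 1 := by simpa using enorm_le_ofReal (cu_abs (c := x0) (R := 4) x)
  have a1 : ‖pd j (cu x0 4) x * psi δ v φ x‖ₑ ≤ ENNReal.ofReal (1000 * Kct ^ 2) * JJ v φ x0 := by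
    by_cases hb : x ∈ ball x0 (1/4)
    · rw [(cu4_dz' hb).1 j]; simp
    · rw [enorm_mul]
      refine (mul_le_mul' (enorm_le_ofReal (cu4_pd_le j hx)) (psi_far_le h hφ hx0 hδ (half_one hx) hb)).trans ?_
      rw [← mul_assoc, ← ENNReal.ofReal_mul (by positivity)]
      refine mul_le_mul' (ENNReal.ofReal_le_ofReal ?_) le_rfl
      nlinarith
  have a2 : ‖cu x0 4 x * pd j (psi δ v φ) x‖ₑ ≤ ENNReal.ofReal (1000 * Kct ^ 2) * ZZ v φ x0 x := by
    rw [enorm_mul]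
    refine (mul_le_mul' hcu hg).trans ?_
    rw [one_mul]
    refine mul_le_mul' (ENNReal.ofReal_le_ofReal ?_) le_rfl
    nlinarith
  rw [pd_mul d1 d2, mul_add, add_comm (ENNReal.ofReal _ * ZZ v φ x0 x)]
  refine (enorm_add_le _ _).trans ?_
  first
  | exact add_le_add a1 a2
  | (rw [add_comm]; refine add_le_add ?_ ?_
     · simpa [mul_comm] using a1
     · simpa [mul_comm] using a2)

lemma rem_le (h : Slice v g p) (hφ : Ph0 x0 φ) (hx0 : ‖x0‖ ≤ 8) (hδ : 0 < δ) {x : E3} (hx : x ∈ closedBall x0 (1/2)) :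
    ‖(∑ i, 2 * (pd i (cu x0 4) x * pd i (psi δ v φ) x)) + lap (cu x0 4) x * psi δ v φ x‖ₑ ≤ ENNReal.ofReal (400000 * Kct ^ 2) * JJ v φ x0 := by
  have K1 := Kct_one
  by_cases hb : x ∈ ball x0 (1/4)
  · rw [(cu4_dz' hb).2]; simp [(cu4_dz' hb).1]
  have a1 : ∀ i, ‖2 * (pd i (cu x0 4) x * pd i (psi δ v φ) x)‖ₑ ≤ ENNReal.ofReal (100000 * Kct ^ 2) * JJ v φ x0 := by
    intro i
    rw [enorm_mul, enorm_mul]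
    have := (psi_grad_le h hφ hx0 hδ i (half_one hx)).trans (mul_le_mul' le_rfl (ZZ_far hφ hb))
    refine (mul_le_mul' (enorm_le_ofReal (b := 2) (by norm_num)) (mul_le_mul' (enorm_le_ofReal (cu4_pd_le i hx)) this)).trans ?_
    rw [show (512:ℝ≥0∞) = ENNReal.ofReal 512 by simp]
    simp only [← mul_assoc]
    rw [← ENNReal.ofReal_mul (by positivity), ← ENNReal.ofReal_mul (by positivity), ← ENNReal.ofReal_mul (by positivity)]
    refine mul_le_mul' (ENNReal.ofReal_le_ofReal ?_) le_rfl
    nlinarith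
  have a2 : ‖lap (cu x0 4) x * psi δ v φ x‖ₑ ≤ ENNReal.ofReal (100000 * Kct ^ 2) * JJ v φ x0 := by
    rw [enorm_mul]
    refine (mul_le_mul' (enorm_le_ofReal (cu4_lap_le hx)) (psi_far_le h hφ hx0 hδ (half_one hx) hb)).trans ?_
    rw [← mul_assoc, ← ENNReal.ofReal_mul (by positivity)]
    refine mul_le_mul' (ENNReal.ofReal_le_ofReal ?_) le_rfl
    nlinarith
  refine (enorm_add_le _ _).trans ((add_le_add ((enorm_sum_le _ _).trans (Finset.sum_le_sum fun i _ => a1 i)) a2).trans ?_)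
  simp only [Finset.sum_const, Finset.card_univ, Fintype.card_fin, nsmul_eq_mul]
  rw [show (400000 * Kct ^ 2) = 4 * (100000 * Kct ^ 2) by ring, ENNReal.ofReal_mul (p := 4) (by norm_num)]
  apply le_of_eq
  rw [show ENNReal.ofReal 4 = 4 by simp]; push_cast; ring

lemma press_delta (h : Slice v g p) (hφ : Ph0 x0 φ) (hx0 : ‖x0‖ ≤ 8) (hδ : 0 < δ) :
    ‖∫ x, p x * (cu x0 4 x * lap (psi δ v φ) x)‖ₑ ≤ ENNReal.ofReal (400000 * Kct ^ 2) *
      ((∫⁻ x in closedBall x0 (1/2), ‖v x‖ₑ * G1 g x * (ZZ v φ x0 x + JJ v φ x0)) + JJ v φ x0 * ∫⁻ x in closedBall x0 (1/2), ‖p x‖ₑ) := by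
  have hcs : HasCompactSupport (cu x0 4) := cu_cs (by norm_num) (r := 1/2) (by norm_num) (by norm_num)
  have hsu : tsupport (cu x0 4) ⊆ closedBall x0 (1/2) := cu_supp (by norm_num) (by norm_num) (by norm_num)
  have hps := psi_contDiff h hφ hδ
  have hcu : ContDiff ℝ (⊤ : ℕ∞) (cu x0 4) := cu_contDiff
  have hxs : ContDiff ℝ (⊤ : ℕ∞) (fun y => cu x0 4 y * psi δ v φ y) := hcu.mul hps
  have hxc : HasCompactSupport (fun y => cu x0 4 y * psi δ v φ y) := hcs.mul_right
  have hxt0 : tsupport (fun y => cu x0 4 y * psi δ v φ y) ⊆ closedBall x0 (1/2) := tsupport_mul_subset_left.trans hsu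
  have hxt : tsupport (fun y => cu x0 4 y * psi δ v φ y) ⊆ ball 0 16 := hxt0.trans (cB_sub hx0 (by norm_num))
  have h0 := h.press _ hxs hxc hxt
  set ξ : E3 → ℝ := fun y => cu x0 4 y * psi δ v φ y with hξ
  set Rm : E3 → ℝ := fun x => (∑ i, 2 * (pd i (cu x0 4) x * pd i (psi δ v φ) x)) + lap (cu x0 4) x * psi δ v φ x with hRm
  have hlapc : ∀ f : E3 → ℝ, ContDiff ℝ (⊤ : ℕ∞) f → Continuous (lap f) := fun f hf => by
    unfold lap
    exact continuous_finsetSum _ (fun i _ => (pd_contDiff (pd_contDiff hf i) i).continuous)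
  have hRz : ∀ x ∉ closedBall x0 (1/2), Rm x = 0 := by
    intro x hx
    simp only [hRm, (cu4_dz hx).2.1, (cu4_dz hx).2.2]; simp
  have hRc : Continuous Rm := by
    refine Continuous.add (continuous_finsetSum _ fun i _ => continuous_const.mul ((pd_contDiff hcu i).continuous.mul (pd_contDiff hps i).continuous)) ((hlapc _ hcu).mul hps.continuous)
  have hpdz : ∀ j, ∀ x ∉ closedBall x0 (1/2), pd j ξ x = 0 := by
    intro j x hx
    unfold pd
    rw [image_eq_zero_of_notMem_tsupport (f := fderiv ℝ ξ) (fun h => hx (hxt0 (tsupport_fderiv_subset ℝ h)))]; rfl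
  have I1 : Integrable (fun x => p x * (cu x0 4 x * lap (psi δ v φ) x)) :=
    memLp_int_cc one_le_32 h.pL (hcu.continuous.mul (hlapc _ hps)) hcs.mul_right
  have I2 : Integrable (fun x => p x * Rm x) :=
    memLp_int_cc one_le_32 h.pL hRc (HasCompactSupport.intro (isCompact_closedBall x0 (1/2)) hRz)
  have Ij : ∀ j, Integrable (fun x => ∑ i, v x i * v x j * pd i (pd j ξ) x) := fun j =>
    integrable_finsetSum _ (fun i _ => by
      have hm : MemLp (fun x => v x j * pd i (pd j ξ) x) 2 volume := memLp_mul_cc (h.vi2 j)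
        (pd_contDiff (pd_contDiff hxs j) i).continuous (pd_supp (pd_supp hxc j) i)
      have : Integrable (fun x => v x i * (v x j * pd i (pd j ξ) x)) := (h.vi2 i).integrable_mul hm
      simpa only [mul_assoc] using this)
  have e1 : ∀ x, ((∑ i, ∑ j, v x i * v x j * pd i (pd j ξ) x) + p x * lap ξ x) =
      (∑ j, ∑ i, v x i * v x j * pd i (pd j ξ) x) + (p x * (cu x0 4 x * lap (psi δ v φ) x) + p x * Rm x) := by
    intro x
    rw [Finset.sum_comm, hξ, lap_mul hcu hps, mul_add]
  simp only [e1] at h0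
  have I3 : Integrable (fun x => ∑ j, ∑ i, v x i * v x j * pd i (pd j ξ) x) := integrable_finsetSum _ (fun j _ => Ij j)
  have I4 : Integrable (fun x => p x * (cu x0 4 x * lap (psi δ v φ) x) + p x * Rm x) := I1.add I2
  rw [integral_add I3 I4, integral_add I1 I2, integral_finsetSum _ (fun j _ => Ij j)] at h0
  have hib : ∀ j, ∫ x, ∑ i, v x i * v x j * pd i (pd j ξ) x = - ∫ x, ∑ i, v x i * g x j i * pd j ξ x := fun j =>
    ibp h (pd_contDiff hxs j) (pd_supp hxc j) ((closure_minimal (fun x hx => by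
      by_contra hn; exact hx (hpdz j x hn)) isClosed_closedBall).trans (cB_sub hx0 (r := 1/2) (by norm_num))) j
  simp only [hib] at h0
  have e2 : ∫ x, p x * (cu x0 4 x * lap (psi δ v φ) x) = (∑ j, ∫ x, ∑ i, v x i * g x j i * pd j ξ x) - ∫ x, p x * Rm x := by
    rw [Finset.sum_neg_distrib] at h0; linarith
  have b2 : ‖∫ x, p x * Rm x‖ₑ ≤ ENNReal.ofReal (400000 * Kct ^ 2) * (JJ v φ x0 * ∫⁻ x in closedBall x0 (1/2), ‖p x‖ₑ) := by
    refine (enorm_integral_le_lintegral_enorm _).trans ?_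
    rw [← mul_assoc, ← lintegral_const_mul _ (h.mp.enorm), ← lintegral_indicator measurableSet_closedBall]
    refine lintegral_mono fun x => ?_
    beta_reduce
    by_cases hx : x ∈ closedBall x0 (1/2)
    · rw [indicator_of_mem hx, enorm_mul, mul_comm]
      exact mul_le_mul' (rem_le h hφ hx0 hδ hx) le_rfl
    · rw [hRz x hx]; simp
  have b1 : ∀ j, ‖∫ x, ∑ i, v x i * g x j i * pd j ξ x‖ₑ ≤ ENNReal.ofReal (3000 * Kct ^ 2) * ∫⁻ x in closedBall x0 (1/2), ‖v x‖ₑ * G1 g x * (ZZ v φ x0 x + JJ v φ x0) := by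
    intro j
    refine (enorm_integral_le_lintegral_enorm _).trans ?_
    rw [← lintegral_const_mul' _ _ ENNReal.ofReal_ne_top, ← lintegral_indicator measurableSet_closedBall]
    refine lintegral_mono fun x => ?_
    beta_reduce
    by_cases hx : x ∈ closedBall x0 (1/2)
    · rw [indicator_of_mem hx]
      have hi : ∀ i, ‖v x i * g x j i * pd j ξ x‖ₑ ≤ ‖v x‖ₑ * G1 g x * (ENNReal.ofReal (1000 * Kct ^ 2) * (ZZ v φ x0 x + JJ v φ x0)) := by
        intro i
        rw [enorm_mul, enorm_mul]
        exact mul_le_mul' (mul_le_mul' (enorm_coord_le _ _) (le_G1 g x j i)) (xi_pd_le h hφ hx0 hδ j hx)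
      refine (enorm_sum_le _ _).trans ((Finset.sum_le_sum fun i _ => hi i).trans ?_)
      simp only [Finset.sum_const, Finset.card_univ, Fintype.card_fin, nsmul_eq_mul]
      rw [show (3000 * Kct ^ 2) = 3 * (1000 * Kct ^ 2) by ring, ENNReal.ofReal_mul (p := 3) (by norm_num), show ENNReal.ofReal 3 = 3 by simp]
      apply le_of_eq; push_cast; ring
    · simp [hpdz j x hx]
  rw [e2]
  refine (enorm_sub_le).trans ?_
  rw [mul_add]
  refine add_le_add ((enorm_sum_le _ _).trans ((Finset.sum_le_sum fun j _ => b1 j).trans ?_)) b2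
  simp only [Finset.sum_const, Finset.card_univ, Fintype.card_fin, nsmul_eq_mul]
  rw [← mul_assoc]
  refine mul_le_mul' ?_ le_rfl
  rw [show ((3:ℕ):ℝ≥0∞) = ENNReal.ofReal 3 by simp, ← ENNReal.ofReal_mul (by norm_num)]
  refine ENNReal.ofReal_le_ofReal ?_
  nlinarith [sq_nonneg Kct]
end

/-! ### the approximate identity pairing -/
/-- kernel -/
def rk (z : E3) : ℝ := hp 0 1 (-5) z
lemma rk_pos (z : E3) : 0 < rk z := hp_pos one_pos _ _
lemma rk_cont : Continuous rk := hp_cont one_pos _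
lemma rk_int : Integrable rk := by
  have := integrable_rpow_neg_one_add_norm_sq (E := E3) (μ := volume) (r := 5) (by simp; norm_num)
  refine this.congr (Eventually.of_forall fun z => ?_)
  simp [rk, hp, add_comm]
lemma rk_le (z : E3) : rk z ≤ 1 := by
  unfold rk hp
  apply Real.rpow_le_one_of_one_le_of_nonpos _ (by norm_num)
  have := sq_nonneg ‖z - 0‖; linarith
def c0 : ℝ := ∫ z, rk z
lemma c0_pos : 0 < c0 := by
  unfold c0
  rw [integral_pos_iff_support_of_nonneg (fun z => (rk_pos z).le) rk_int]
  have : Function.support rk = univ := by ext z; simp [(rk_pos z).ne']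
  rw [this]; simp

lemma rk_scale {δ : ℝ} (hδ : 0 < δ) (z : E3) : δ ^ 2 * hp 0 (δ ^ 2) (-5) (δ • z) = (δ ^ 3)⁻¹ * rk z := by
  unfold rk hp
  rw [sub_zero, sub_zero, norm_smul, Real.norm_of_nonneg hδ.le,
    show (δ * ‖z‖) ^ 2 + δ ^ 2 = δ ^ 2 * (‖z‖ ^ 2 + 1) by ring, Real.mul_rpow (by positivity) (by positivity),
    ← Real.rpow_natCast δ 2, ← Real.rpow_mul hδ.le, ← mul_assoc, ← Real.rpow_add hδ, ← Real.rpow_natCast δ 3, ← Real.rpow_neg hδ.le]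
  norm_num

lemma rk_conv {w : E3 → ℝ} {δ : ℝ} (hδ : 0 < δ) (x : E3) :
    ∫ y, w y * (δ ^ 2 * hp x (δ ^ 2) (-5) y) = ∫ z, w (x - δ • z) * rk z := by
  rw [← integral_sub_left_eq_self (fun y => w y * (δ ^ 2 * hp x (δ ^ 2) (-5) y)) volume x]
  have e : ∀ u, hp x (δ ^ 2) (-5) (x - u) = hp 0 (δ ^ 2) (-5) u := fun u => by rw [← hp_refl, _root_.sub_sub_cancel]
  simp only [e]
  have := Measure.integral_comp_smul (volume : Measure E3) (fun u => w (x - u) * (δ ^ 2 * hp 0 (δ ^ 2) (-5) u)) δ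
  simp only [rk_scale hδ] at this
  have h3 : Module.finrank ℝ E3 = 3 := by simp
  rw [h3, abs_of_pos (by positivity), smul_eq_mul] at this
  have h4 : ∫ z, w (x - δ • z) * ((δ ^ 3)⁻¹ * rk z) = (δ ^ 3)⁻¹ * ∫ z, w (x - δ • z) * rk z := by
    rw [← integral_const_mul]; congr 1; ext z; ring
  rw [h4] at this
  exact (mul_left_cancel₀ (by positivity) this).symm

section
variable {q w : E3 → ℝ}
/-- translation functional -/
def TT (q w : E3 → ℝ) (z : E3) : ℝ≥0∞ := ∫⁻ x, ‖q x‖ₑ * ‖w (x - z) - w x‖ₑ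

lemma TT_meas (hq : Measurable q) (hw : Measurable w) : Measurable (TT q w) := by
  unfold TT
  have m1 : Measurable (fun a : E3 × E3 => w (a.2 - a.1)) := hw.comp (measurable_snd.sub measurable_fst)
  have m2 : Measurable (fun a : E3 × E3 => w a.2) := hw.comp measurable_snd
  have m3 : Measurable (fun a : E3 × E3 => q a.2) := hq.comp measurable_snd
  have m : Measurable (fun a : E3 × E3 => ‖q a.2‖ₑ * ‖w (a.2 - a.1) - w a.2‖ₑ) := m3.enorm.mul (m1.sub m2).enorm
  exact m.lintegral_prod_right'

lemma TT_le (hq : Measurable q) (hw : Measurable w) (z : E3) :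
    TT q w z ≤ (∫⁻ x, ‖q x‖ₑ ^ (3/2:ℝ)) ^ (2/3:ℝ) * eLpNorm (fun x => w (x - z) - w x) 3 volume := by
  have hc : Real.HolderConjugate (3/2) 3 := by rw [Real.holderConjugate_iff]; norm_num
  have m1 : Measurable (fun a : E3 => w (a - z)) := hw.comp (measurable_id.sub_const z)
  have := ENNReal.lintegral_mul_le_Lp_mul_Lq volume hc (f := fun x => ‖q x‖ₑ) (g := fun x => ‖w (x - z) - w x‖ₑ)
    hq.enorm.aemeasurable (m1.sub hw).enorm.aemeasurable
  rw [eLpNorm_eq_lintegral_rpow_enorm_toReal (by norm_num) (by norm_num)]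
  simp only [Pi.mul_apply] at this
  norm_num at this ⊢
  exact this

lemma TT_tendsto (hq : Measurable q) (hw : Measurable w) (hq2 : ∫⁻ x, ‖q x‖ₑ ^ (3/2:ℝ) < ∞) (hw3 : MemLp w 3 volume) :
    Tendsto (TT q w) (nhds 0) (nhds 0) := by
  have h1 := trans_cont (p := 3) (by norm_num) (by norm_num) hw3
  have h2 := ENNReal.Tendsto.const_mul (a := (∫⁻ x, ‖q x‖ₑ ^ (3/2:ℝ)) ^ (2/3:ℝ)) h1 (Or.inr (ENNReal.rpow_ne_top_of_nonneg (by norm_num) hq2.ne))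
  rw [mul_zero] at h2
  exact tendsto_of_tendsto_of_tendsto_of_le_of_le tendsto_const_nhds h2 (fun _ => zero_le) (fun z => TT_le hq hw z)

lemma TT_bdd (hq : Measurable q) (hw : Measurable w) (hw3 : MemLp w 3 volume) (z : E3) :
    TT q w z ≤ (∫⁻ x, ‖q x‖ₑ ^ (3/2:ℝ)) ^ (2/3:ℝ) * (2 * eLpNorm w 3 volume) := by
  refine (TT_le hq hw z).trans (mul_le_mul' le_rfl ?_)
  have m1 : Measurable (fun a : E3 => w (a - z)) := hw.comp (measurable_id.sub_const z)
  refine (eLpNorm_sub_le (f := fun x => w (x - z)) m1.aestronglyMeasurable hw3.1 (by norm_num)).trans ?_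
  have := eLpNorm_comp_measurePreserving (p := 3) hw3.1 (measurePreserving_sub_right volume z)
  rw [two_mul]
  exact add_le_add this.le le_rfl

lemma TT_lim (hq : Measurable q) (hw : Measurable w) (hq2 : ∫⁻ x, ‖q x‖ₑ ^ (3/2:ℝ) < ∞) (hw3 : MemLp w 3 volume)
    {d : ℕ → ℝ} (hd : Tendsto d atTop (nhds 0)) :
    Tendsto (fun n => ∫⁻ z, TT q w (d n • z) * ENNReal.ofReal (rk z)) atTop (nhds 0) := by
  have hr : ∫⁻ z, ENNReal.ofReal (rk z) ≠ ∞ := (rk_int.lintegral_lt_top).ne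
  have mr : Measurable (fun z => ENNReal.ofReal (rk z)) := rk_cont.measurable.ennreal_ofReal
  have := tendsto_lintegral_of_dominated_convergence (μ := (volume : Measure E3)) (F := fun n z => TT q w (d n • z) * ENNReal.ofReal (rk z)) (f := fun _ => 0)
    (fun z => (∫⁻ x, ‖q x‖ₑ ^ (3/2:ℝ)) ^ (2/3:ℝ) * (2 * eLpNorm w 3 volume) * ENNReal.ofReal (rk z)) ?_ ?_ ?_ ?_
  · simpa using this
  · intro n
    exact ((TT_meas hq hw).comp (measurable_const_smul (d n))).mul mr
  · intro n
    exact Eventually.of_forall fun z => mul_le_mul' (TT_bdd hq hw hw3 _) le_rfl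
  · rw [lintegral_const_mul _ mr]
    exact ENNReal.mul_ne_top (ENNReal.mul_ne_top (ENNReal.rpow_ne_top_of_nonneg (by norm_num) hq2.ne) (ENNReal.mul_ne_top (by norm_num) hw3.2.ne)) hr
  · refine Eventually.of_forall fun z => ?_
    have h1 : Tendsto (fun n => d n • z) atTop (nhds 0) := by simpa using hd.smul_const z
    have h2 := ENNReal.Tendsto.mul_const (b := ENNReal.ofReal (rk z)) ((TT_tendsto hq hw hq2 hw3).comp h1) (Or.inr ENNReal.ofReal_ne_top)
    simpa using h2

lemma rk_comp_int (hw1 : Integrable w) {δ : ℝ} (hδ : 0 < δ) (x : E3) : Integrable (fun z => w (x - δ • z) * rk z) := by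
  have h1 : Integrable (fun z => w (x - δ • z)) := (hw1.comp_sub_left x).comp_smul hδ.ne'
  have := h1.bdd_mul (f := rk) (c := 1) rk_cont.aestronglyMeasurable (Eventually.of_forall fun z => by
    rw [Real.norm_of_nonneg (rk_pos z).le]; exact rk_le z)
  simpa [mul_comm] using this

lemma pair_diff (hq : Measurable q) (hw : Measurable w) (hw1 : Integrable w) {δ : ℝ} (hδ : 0 < δ) :
    ∫⁻ x, ‖q x * (∫ z, w (x - δ • z) * rk z) - q x * (c0 * w x)‖ₑ ≤ ∫⁻ z, TT q w (δ • z) * ENNReal.ofReal (rk z) := by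
  have m1 : Measurable (fun a : E3 × E3 => w (a.1 - δ • a.2)) := hw.comp (measurable_fst.sub (measurable_snd.const_smul δ))
  have m2 : Measurable (fun a : E3 × E3 => w a.1) := hw.comp measurable_fst
  have m3 : Measurable (fun a : E3 × E3 => q a.1) := hq.comp measurable_fst
  have m4 : Measurable (fun a : E3 × E3 => ENNReal.ofReal (rk a.2)) := (rk_cont.measurable.comp measurable_snd).ennreal_ofReal
  have m : Measurable (fun a : E3 × E3 => ‖q a.1‖ₑ * ‖w (a.1 - δ • a.2) - w a.1‖ₑ * ENNReal.ofReal (rk a.2)) := (m3.enorm.mul (m1.sub m2).enorm).mul m4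
  have hr : ∀ z, ‖rk z‖ₑ = ENNReal.ofReal (rk z) := fun z => by rw [← ofReal_norm, Real.norm_of_nonneg (rk_pos z).le]
  calc _ ≤ ∫⁻ x, ∫⁻ z, ‖q x‖ₑ * ‖w (x - δ • z) - w x‖ₑ * ENNReal.ofReal (rk z) := by
        refine lintegral_mono fun x => ?_
        beta_reduce
        have e : (∫ z, w (x - δ • z) * rk z) - c0 * w x = ∫ z, (w (x - δ • z) - w x) * rk z := by
          unfold c0
          rw [mul_comm, ← integral_const_mul, ← integral_sub (rk_comp_int hw1 hδ x) (rk_int.const_mul _)]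
          congr 1; ext z; ring
        rw [← mul_sub, e, enorm_mul]
        have hm : Measurable (fun z => ‖w (x - δ • z) - w x‖ₑ * ENNReal.ofReal (rk z)) :=
          ((m1.comp (measurable_const.prodMk measurable_id)).sub_const _).enorm.mul (rk_cont.measurable.ennreal_ofReal)
        simp only [mul_assoc]
        rw [lintegral_const_mul _ hm]
        refine mul_le_mul' le_rfl ((enorm_integral_le_lintegral_enorm _).trans (le_of_eq ?_))
        simp only [enorm_mul, hr]
    _ = ∫⁻ z, ∫⁻ x, ‖q x‖ₑ * ‖w (x - δ • z) - w x‖ₑ * ENNReal.ofReal (rk z) := lintegral_lintegral_swap m.aemeasurable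
    _ = _ := by
        refine lintegral_congr fun z => ?_
        unfold TT
        rw [lintegral_mul_const']
        exact ENNReal.ofReal_ne_top

lemma pairing (hq : Measurable q) (hw : Measurable w) (hq2 : ∫⁻ x, ‖q x‖ₑ ^ (3/2:ℝ) < ∞) (hw3 : MemLp w 3 volume) (hw1 : Integrable w)
    {B : ℝ≥0∞} (hB : ∀ δ : ℝ, 0 < δ → ‖∫ x, q x * ∫ y, w y * (δ ^ 2 * hp x (δ ^ 2) (-5) y)‖ₑ ≤ B) :
    ENNReal.ofReal c0 * ‖∫ x, q x * w x‖ₑ ≤ B := by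
  set d : ℕ → ℝ := fun n => 1 / ((n:ℝ) + 1) with hd
  have hdp : ∀ n, 0 < d n := fun n => by simp only [hd]; positivity
  have hl := TT_lim hq hw hq2 hw3 (d := d) tendsto_one_div_add_atTop_nhds_zero_nat
  have hdiff : Tendsto (fun n => ∫⁻ x, ‖q x * (∫ z, w (x - d n • z) * rk z) - q x * (c0 * w x)‖ₑ) atTop (nhds 0) :=
    tendsto_of_tendsto_of_tendsto_of_le_of_le tendsto_const_nhds hl (fun _ => zero_le) (fun n => pair_diff hq hw hw1 (hdp n))
  have mqw : Measurable (fun x => q x * (c0 * w x)) := hq.mul (hw.const_mul c0)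
  have hqw : Integrable (fun x => q x * (c0 * w x)) := by
    refine ⟨mqw.aestronglyMeasurable, ?_⟩
    have hc : Real.HolderConjugate (3/2) 3 := by rw [Real.holderConjugate_iff]; norm_num
    have := ENNReal.lintegral_mul_le_Lp_mul_Lq volume hc (f := fun x => ‖q x‖ₑ) (g := fun x => ‖c0 * w x‖ₑ)
      hq.enorm.aemeasurable (hw.const_mul c0).enorm.aemeasurable
    unfold HasFiniteIntegral
    simp only [enorm_mul]
    simp only [Pi.mul_apply, enorm_mul] at this
    refine lt_of_le_of_lt this (ENNReal.mul_lt_top (ENNReal.rpow_lt_top_of_nonneg (by norm_num) hq2.ne) (ENNReal.rpow_lt_top_of_nonneg (by norm_num) ?_))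
    have h3 := (hw3.const_mul c0).2
    rw [eLpNorm_lt_top_iff_lintegral_rpow_enorm_lt_top (by norm_num) (by norm_num)] at h3
    simp only [enorm_mul] at h3
    norm_num at h3 ⊢
    exact h3.ne
  have mF : ∀ n, StronglyMeasurable (fun x => q x * (∫ z, w (x - d n • z) * rk z)) := fun n => by
    have m1 : Measurable (fun a : E3 × E3 => w (a.1 - d n • a.2)) := hw.comp (measurable_fst.sub (measurable_snd.const_smul (d n)))
    have m2 : Measurable (fun a : E3 × E3 => w (a.1 - d n • a.2) * rk a.2) := m1.mul (rk_cont.measurable.comp measurable_snd)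
    exact hq.stronglyMeasurable.mul (StronglyMeasurable.integral_prod_right (f := fun x z => w (x - d n • z) * rk z) m2.stronglyMeasurable)
  have hev : ∀ᶠ n in atTop, Integrable (fun x => q x * (∫ z, w (x - d n • z) * rk z)) := by
    filter_upwards [hdiff.eventually (Iio_mem_nhds (show (0:ℝ≥0∞) < ∞ by simp))] with n hn
    have hI : Integrable (fun x => q x * (∫ z, w (x - d n • z) * rk z) - q x * (c0 * w x)) :=
      ⟨(mF n).aestronglyMeasurable.sub mqw.aestronglyMeasurable, hn⟩
    refine (hI.add hqw).congr (Eventually.of_forall fun x => ?_)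
    simp
  have hlim := tendsto_integral_of_L1 _ mqw.aestronglyMeasurable hev hdiff
  have hle : ∀ n, ‖∫ x, q x * (∫ z, w (x - d n • z) * rk z)‖ₑ ≤ B := fun n => by
    have := hB (d n) (hdp n)
    simpa only [rk_conv (hdp n)] using this
  have := le_of_tendsto' ((continuous_enorm.tendsto _).comp hlim) hle
  have e : ∫ x, q x * (c0 * w x) = c0 * ∫ x, q x * w x := by
    rw [← integral_const_mul]; congr 1; ext x; ring
  rw [e, enorm_mul, ← ofReal_norm, Real.norm_of_nonneg c0_pos.le] at this
  exact this
end

/-! ### slice estimate for the pressure term -/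
/-- Morrey condition -/
def Mo (κ : ℝ≥0∞) (α : ℝ) (V : E3 → ℝ≥0∞) : Prop :=
  ∀ x s, 0 < s → ∫⁻ y in closedBall x s, V y ≤ κ * ENNReal.ofReal (s ^ (2 + α))

/-- admissible weights -/
structure PhA (x0 : E3) (σ A : ℝ) (φ : E3 → ℝ) : Prop extends Ph0 x0 φ where
  A0 : 0 ≤ A
  b0 : ∀ x, |φ x| ≤ A * hp x0 σ (-3) x
  b1 : ∀ x, ‖fderiv ℝ φ x‖ ≤ A * hp x0 σ (-4) x

def SS (σ α : ℝ) : ℝ≥0∞ := ENNReal.ofReal (σ ^ ((α - 1) / 2))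
def WW (V : E3 → ℝ≥0∞) (β : ℝ) (x0 : E3) (σ : ℝ) (x : E3) : ℝ≥0∞ := ∫⁻ y in closedBall x (hp x0 σ 1 x / 4), V y * kk β (y - x)

lemma rpow_conv {a b α : ℝ} (ha : 0 < a) (h : a ^ (1/2 : ℝ) ≤ b) (hα : α ≤ 1) : b ^ (α - 1) ≤ a ^ ((α - 1) / 2) := by
  have : a ^ ((α - 1) / 2) = (a ^ (1/2 : ℝ)) ^ (α - 1) := by rw [← Real.rpow_mul ha.le]; congr 1; ring
  rw [this]
  exact Real.rpow_le_rpow_of_nonpos (by positivity) h (by linarith)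

section
variable {v : E3 → E3} {g : E3 → Fin 3 → Fin 3 → ℝ} {p : E3 → ℝ} {x0 : E3} {φ : E3 → ℝ} {σ A α : ℝ} {κ : ℝ≥0∞} {V : E3 → ℝ≥0∞}

lemma hp_le_sig (hσ : 0 < σ) {β : ℝ} (hβ : β ≤ 0) (x : E3) : hp x0 σ β x ≤ σ ^ (β / 2) := by
  unfold hp
  exact Real.rpow_le_rpow_of_nonpos hσ (by have := sq_nonneg ‖x - x0‖; linarith) (by linarith)

def CJ (α : ℝ) : ℝ := 1 + Cdy (2 + α) (1 - α)

lemma CJ_pos (hα1 : α < 1) : 0 < CJ α := by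
  have := Cdy_pos (c := 2 + α) (d := 1 - α) (by linarith); unfold CJ; linarith

lemma Jpot (hσ : 0 < σ) (hα : 0 ≤ α) (hα1 : α < 1) (hV : Measurable V) (hM : Mo κ α V) :
    ∫⁻ y, V y * hw x0 σ (-3) y ≤ κ * ENNReal.ofReal (CJ α) * SS σ α := by
  have hs : 0 < σ ^ (1/2:ℝ) := by positivity
  have hcd := Cdy_pos (c := 2 + α) (d := 1 - α) (by linarith)
  rw [← lintegral_add_compl _ (measurableSet_ball (x := x0) (ε := σ ^ (1/2:ℝ)))]
  have a1 : ∫⁻ y in ball x0 (σ ^ (1/2:ℝ)), V y * hw x0 σ (-3) y ≤ κ * SS σ α := by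
    calc _ ≤ ∫⁻ y in closedBall x0 (σ ^ (1/2:ℝ)), V y * ENNReal.ofReal (σ ^ ((-3:ℝ)/2)) := by
          refine (lintegral_mono_set ball_subset_closedBall).trans (lintegral_mono fun y => ?_)
          exact mul_le_mul' le_rfl (ENNReal.ofReal_le_ofReal (hp_le_sig hσ (by norm_num) y))
      _ ≤ κ * ENNReal.ofReal ((σ ^ (1/2:ℝ)) ^ (2 + α)) * ENNReal.ofReal (σ ^ ((-3:ℝ)/2)) := by
          rw [lintegral_mul_const _ hV]; exact mul_le_mul' (hM x0 _ hs) le_rfl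
      _ = _ := by
          rw [mul_assoc, ← ENNReal.ofReal_mul (by positivity), ← Real.rpow_mul hσ.le, ← Real.rpow_add hσ]
          unfold SS; congr 3; ring
  have a2 : ∫⁻ y in (ball x0 (σ ^ (1/2:ℝ)))ᶜ, V y * hw x0 σ (-3) y ≤ κ * ENNReal.ofReal (Cdy (2 + α) (1 - α)) * SS σ α := by
    refine le_trans ?_ ((far_pot hV (κ := κ) (γ := 2 + α) (β := 3) (by norm_num) (by linarith) (x := x0) (hM x0) hs).trans (le_of_eq ?_))
    · refine setLIntegral_mono' measurableSet_ball.compl fun y hy => ?_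
      refine mul_le_mul' le_rfl (ENNReal.ofReal_le_ofReal (hp_le_kk hσ (by norm_num) ?_))
      rintro rfl
      exact hy (mem_ball_self hs)
    · rw [show 3 - (2 + α) = 1 - α by ring, show 2 + α - 3 = α - 1 by ring, ENNReal.ofReal_mul hcd.le, ← Real.rpow_mul hσ.le, ← mul_assoc]
      unfold SS; congr 3; ring
  refine (add_le_add a1 a2).trans (le_of_eq ?_)
  unfold CJ
  rw [ENNReal.ofReal_add zero_le_one hcd.le, ENNReal.ofReal_one]; ring

lemma JJ_le (hσ : 0 < σ) (hα : 0 ≤ α) (hα1 : α < 1) (hφ : PhA x0 σ A φ) (hV : Measurable V) (hVv : ∀ y ∈ closedBall x0 1, ‖v y‖ₑ ≤ V y)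
    (hM : Mo κ α V) : JJ v φ x0 ≤ ENNReal.ofReal A * (κ * ENNReal.ofReal (CJ α) * SS σ α) := by
  refine le_trans ?_ (mul_le_mul' le_rfl (Jpot (x0 := x0) hσ hα hα1 hV hM))
  rw [← lintegral_const_mul' _ _ ENNReal.ofReal_ne_top]
  unfold JJ
  refine (setLIntegral_mono' measurableSet_closedBall fun y hy => ?_).trans (setLIntegral_le_lintegral _ _)
  calc _ ≤ V y * ENNReal.ofReal (A * hp x0 σ (-3) y) := mul_le_mul' (hVv y hy) (enorm_le_ofReal (hφ.b0 y))
    _ = _ := by rw [ENNReal.ofReal_mul hφ.A0]; unfold hw; ring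

lemma phi_lip (hσ : 0 < σ) (hφ : PhA x0 σ A φ) {x y : E3} (hy : ‖y - x‖ ≤ hp x0 σ 1 x / 2) : |φ y - φ x| ≤ 16 * A * hp x0 σ (-4) x * ‖y - x‖ := by
  have hA := hφ.A0
  have := (convex_closedBall x (hp x0 σ 1 x / 2)).norm_image_sub_le_of_norm_fderiv_le (𝕜 := ℝ) (f := φ) (C := 16 * A * hp x0 σ (-4) x)
    (fun z _ => hφ.sm.differentiable (by simp) z) (fun z hz => ?_) (x := x) (y := y) (mem_closedBall_self (by have := hp_pos (x0 := x0) hσ 1 x; positivity))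
    (by rwa [mem_closedBall, dist_eq_norm])
  · exact this
  · rw [mem_closedBall, dist_eq_norm] at hz
    refine (hφ.b1 z).trans ?_
    have := hp_comp hσ hz (-4)
    rw [show |(-4:ℝ)| = 4 by norm_num, show (2:ℝ) ^ (4:ℝ) = 16 by norm_num] at this
    calc _ ≤ A * (16 * hp x0 σ (-4) x) := by gcongr
      _ = _ := by ring

lemma ZZ_near (hσ : 0 < σ) (hφ : PhA x0 σ A φ) (hV : Measurable V) (hVv : ∀ y ∈ closedBall x0 1, ‖v y‖ₑ ≤ V y) (x : E3) :
    ∫⁻ y in closedBall x0 1 ∩ closedBall x (hp x0 σ 1 x / 4), ‖v y‖ₑ * ‖φ y - φ x‖ₑ * kk 3 (y - x) ≤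
      ENNReal.ofReal (16 * A) * hw x0 σ (-4) x * WW V 2 x0 σ x := by
  have h1 := hp_pos (x0 := x0) hσ 1 x
  have h4 := hp_pos (x0 := x0) hσ (-4) x
  have hA := hφ.A0
  unfold WW hw
  rw [← ENNReal.ofReal_mul (by positivity), ← lintegral_const_mul' _ _ ENNReal.ofReal_ne_top]
  refine (setLIntegral_mono' (measurableSet_closedBall.inter measurableSet_closedBall) fun y hy => ?_).trans (lintegral_mono_set inter_subset_right)
  have hyx : ‖y - x‖ ≤ hp x0 σ 1 x / 2 := by
    have := hy.2; rw [mem_closedBall, dist_eq_norm] at this; linarith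
  rcases eq_or_ne y x with rfl | hne
  · simp
  have h0 : 0 < ‖y - x‖ := by rw [norm_pos_iff]; exact sub_ne_zero.2 hne
  calc _ ≤ V y * ENNReal.ofReal (16 * A * hp x0 σ (-4) x * ‖y - x‖) * kk 3 (y - x) :=
        mul_le_mul' (mul_le_mul' (hVv y hy.1) (enorm_le_ofReal (phi_lip hσ hφ hyx))) le_rfl
    _ = _ := by
        unfold kk
        rw [mul_assoc, ← ENNReal.ofReal_mul (by positivity), mul_assoc (16 * A * hp x0 σ (-4) x), ← Real.rpow_one_add' h0.le (by norm_num),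
          ENNReal.ofReal_mul (by positivity), show (1:ℝ) + -3 = -2 by norm_num]
        ring

lemma ZZ_farA (hσ : 0 < σ) (hα : 0 ≤ α) (hα1 : α < 1) (hφ : PhA x0 σ A φ) (hV : Measurable V) (hVv : ∀ y ∈ closedBall x0 1, ‖v y‖ₑ ≤ V y)
    (hM : Mo κ α V) (x : E3) :
    ∫⁻ y in closedBall x0 1 ∩ (closedBall x (hp x0 σ 1 x / 4))ᶜ, ‖v y‖ₑ * ‖φ y - φ x‖ₑ * kk 3 (y - x) ≤
      ENNReal.ofReal (4 * A) * hw x0 σ (-3) x * (κ * ENNReal.ofReal (CJ α) * SS σ α) + 64 * hw x0 σ (-3) x * JJ v φ x0 := by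
  have h1 := hp_pos (x0 := x0) hσ 1 x
  have h3 := hp_pos (x0 := x0) hσ (-3) x
  have hA := hφ.A0
  have hcd := Cdy_pos (c := 2 + α) (d := 1 - α) (by linarith)
  have mk3 : Measurable (fun y => kk 3 (y - x)) := (kk_meas 3).comp (measurable_id.sub_const x)
  have b1 : ∫⁻ y in (ball x (hp x0 σ 1 x / 4))ᶜ, V y * kk 3 (y - x) ≤ 4 * (κ * ENNReal.ofReal (CJ α) * SS σ α) := by
    refine (far_pot hV (κ := κ) (γ := 2 + α) (β := 3) (by norm_num) (by linarith) (x := x) (hM x) (ρ := hp x0 σ 1 x / 4) (by positivity)).trans ?_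
    rw [show 3 - (2 + α) = 1 - α by ring, show 2 + α - 3 = α - 1 by ring]
    have e : (hp x0 σ 1 x / 4) ^ (α - 1) ≤ 4 * σ ^ ((α - 1) / 2) := by
      rw [Real.div_rpow h1.le (by norm_num), div_eq_mul_inv, mul_comm, ← Real.rpow_neg (by norm_num)]
      have k1 : (4:ℝ) ^ (-(α - 1)) ≤ 4 ^ (1:ℝ) := Real.rpow_le_rpow_of_exponent_le (by norm_num) (by linarith)
      rw [Real.rpow_one] at k1
      have k2 : hp x0 σ 1 x ^ (α - 1) ≤ σ ^ ((α - 1) / 2) := rpow_conv hσ (by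
        unfold hp
        exact Real.rpow_le_rpow hσ.le (by have := sq_nonneg ‖x - x0‖; linarith) (by norm_num)) hα1.le
      gcongr
    calc _ ≤ κ * ENNReal.ofReal (CJ α * (4 * σ ^ ((α - 1) / 2))) := by
          refine mul_le_mul' le_rfl (ENNReal.ofReal_le_ofReal ?_)
          have : Cdy (2 + α) (1 - α) ≤ CJ α := by unfold CJ; linarith
          gcongr
          unfold CJ; positivity
      _ = _ := by
          rw [ENNReal.ofReal_mul (CJ_pos hα1).le, ENNReal.ofReal_mul (by norm_num)]
          unfold SS
          rw [show ENNReal.ofReal 4 = 4 by simp]; ring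
  have b2 : ∀ y ∈ closedBall x0 1 ∩ (closedBall x (hp x0 σ 1 x / 4))ᶜ, ‖v y‖ₑ * ‖φ y - φ x‖ₑ * kk 3 (y - x) ≤
      ENNReal.ofReal A * hw x0 σ (-3) x * (V y * kk 3 (y - x)) + 64 * hw x0 σ (-3) x * (‖v y‖ₑ * ‖φ y‖ₑ) := by
    intro y hy
    have hk : kk 3 (y - x) ≤ 64 * hw x0 σ (-3) x := by
      have hy2 := hy.2
      rw [mem_compl_iff, mem_closedBall, not_le, dist_eq_norm] at hy2
      unfold kk hw
      rw [show (64:ℝ≥0∞) = ENNReal.ofReal 64 by simp, ← ENNReal.ofReal_mul (by norm_num)]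
      apply ENNReal.ofReal_le_ofReal
      refine (Real.rpow_le_rpow_of_nonpos (by positivity) hy2.le (by norm_num)).trans (le_of_eq ?_)
      rw [Real.div_rpow h1.le (by norm_num), hp_eq_rpow hσ (-3), Real.rpow_neg (by norm_num : (0:ℝ) ≤ 4)]
      norm_num; ring
    have hs : ‖φ y - φ x‖ₑ ≤ ‖φ y‖ₑ + ENNReal.ofReal A * hw x0 σ (-3) x := by
      refine enorm_sub_le.trans (add_le_add le_rfl ?_)
      unfold hw; rw [← ENNReal.ofReal_mul hA]
      exact enorm_le_ofReal (hφ.b0 x)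
    calc _ ≤ ‖v y‖ₑ * (‖φ y‖ₑ + ENNReal.ofReal A * hw x0 σ (-3) x) * kk 3 (y - x) := by gcongr
      _ = ENNReal.ofReal A * hw x0 σ (-3) x * (‖v y‖ₑ * kk 3 (y - x)) + kk 3 (y - x) * (‖v y‖ₑ * ‖φ y‖ₑ) := by ring
      _ ≤ _ := by
        have := hVv y hy.1
        gcongr
  refine (setLIntegral_mono' (measurableSet_closedBall.inter measurableSet_closedBall.compl) b2).trans ?_
  have m1 : Measurable (fun y => ENNReal.ofReal A * hw x0 σ (-3) x * (V y * kk 3 (y - x))) := (hV.mul mk3).const_mul _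
  rw [lintegral_add_left m1]
  have hne : ENNReal.ofReal A * hw x0 σ (-3) x ≠ ∞ := ENNReal.mul_ne_top ENNReal.ofReal_ne_top ENNReal.ofReal_ne_top
  have hne2 : 64 * hw x0 σ (-3) x ≠ ∞ := ENNReal.mul_ne_top (by norm_num) ENNReal.ofReal_ne_top
  rw [lintegral_const_mul' _ _ hne, lintegral_const_mul' _ _ hne2]
  refine add_le_add ?_ (mul_le_mul' le_rfl (lintegral_mono_set inter_subset_left))
  refine (mul_le_mul' le_rfl ((lintegral_mono_set ?_).trans b1)).trans (le_of_eq ?_)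
  · exact inter_subset_right.trans (compl_subset_compl.2 ball_subset_closedBall)
  · rw [ENNReal.ofReal_mul (by norm_num), show ENNReal.ofReal 4 = 4 by simp]; ring

lemma one_le_hw3 (hσ : 0 < σ) (hσ2 : σ ≤ 2) {x : E3} (hx : x ∈ closedBall x0 (1/2)) : 1 ≤ 8 * hw x0 σ (-3) x := by
  rw [mem_closedBall, dist_eq_norm] at hx
  have h0 := norm_nonneg (x - x0)
  have h1 := hp_one_sq (x0 := x0) hσ x
  have h2 := hp_pos (x0 := x0) hσ 1 x
  have h3 : hp x0 σ 1 x ≤ 2 := by nlinarith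
  unfold hw
  rw [show (8:ℝ≥0∞) = ENNReal.ofReal 8 by simp, ← ENNReal.ofReal_mul (by norm_num), ENNReal.one_le_ofReal, hp_eq_rpow hσ]
  have := Real.rpow_le_rpow_of_nonpos h2 h3 (show (-3:ℝ) ≤ 0 by norm_num)
  rw [show (2:ℝ) ^ (-3:ℝ) = 1/8 by rw [Real.rpow_neg (by norm_num)]; norm_num] at this
  linarith

lemma ZZJ_le (hσ : 0 < σ) (hσ2 : σ ≤ 2) (hα : 0 ≤ α) (hα1 : α < 1) (hφ : PhA x0 σ A φ) (hV : Measurable V) (hVv : ∀ y ∈ closedBall x0 1, ‖v y‖ₑ ≤ V y)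
    (hM : Mo κ α V) {x : E3} (hx : x ∈ closedBall x0 (1/2)) :
    ZZ v φ x0 x + JJ v φ x0 ≤ ENNReal.ofReal (16 * A) * (hw x0 σ (-4) x * WW V 2 x0 σ x) +
      ENNReal.ofReal (76 * A * CJ α) * (κ * SS σ α * hw x0 σ (-3) x) := by
  have hA := hφ.A0
  have hJ := JJ_le hσ hα hα1 hφ hV hVv hM
  have hZ : ZZ v φ x0 x ≤ ENNReal.ofReal (16 * A) * hw x0 σ (-4) x * WW V 2 x0 σ x + (ENNReal.ofReal (4 * A) * hw x0 σ (-3) x * (κ * ENNReal.ofReal (CJ α) * SS σ α) + 64 * hw x0 σ (-3) x * JJ v φ x0) := by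
    unfold ZZ
    rw [← lintegral_inter_add_diff _ (closedBall x0 1) (measurableSet_closedBall (x := x) (ε := hp x0 σ 1 x / 4)), diff_eq]
    exact add_le_add (ZZ_near hσ hφ hV hVv x) (ZZ_farA hσ hα hα1 hφ hV hVv hM x)
  have h8 : JJ v φ x0 ≤ 8 * hw x0 σ (-3) x * JJ v φ x0 := by
    calc _ = 1 * JJ v φ x0 := (one_mul _).symm
      _ ≤ _ := mul_le_mul' (one_le_hw3 hσ hσ2 hx) le_rfl
  have hC := CJ_pos hα1
  calc _ ≤ _ := add_le_add hZ h8
    _ = ENNReal.ofReal (16 * A) * (hw x0 σ (-4) x * WW V 2 x0 σ x) + (ENNReal.ofReal (4 * A) * hw x0 σ (-3) x * (κ * ENNReal.ofReal (CJ α) * SS σ α) + 72 * hw x0 σ (-3) x * JJ v φ x0) := by ring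
    _ ≤ ENNReal.ofReal (16 * A) * (hw x0 σ (-4) x * WW V 2 x0 σ x) + (ENNReal.ofReal (4 * A) * hw x0 σ (-3) x * (κ * ENNReal.ofReal (CJ α) * SS σ α) + 72 * hw x0 σ (-3) x * (ENNReal.ofReal A * (κ * ENNReal.ofReal (CJ α) * SS σ α))) := by gcongr
    _ = _ := by
      rw [show 76 * A * CJ α = 4 * A * CJ α + 72 * A * CJ α by ring, ENNReal.ofReal_add (by positivity) (by positivity), ENNReal.ofReal_mul (p := 4 * A) (by positivity),
        ENNReal.ofReal_mul (p := 72 * A) (by positivity), ENNReal.ofReal_mul (p := 72) (by positivity), show ENNReal.ofReal 72 = 72 by simp]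
      ring
end

/-! ### the slice bound -/
/-- all hypotheses on a time slice -/
structure SH (v : E3 → E3) (g : E3 → Fin 3 → Fin 3 → ℝ) (p : E3 → ℝ) (x0 : E3) (σ α : ℝ) (κ : ℝ≥0∞) (V : E3 → ℝ≥0∞) : Prop where
  h : Slice v g p
  hx0 : x0 ∈ ball (0 : E3) 8
  hσ : 0 < σ
  hσ2 : σ ≤ 2
  κ0 : κ ≠ 0
  κt : κ ≠ ∞
  hα : 0 ≤ α
  hα1 : α < 1
  hV : Measurable V
  hVv : ∀ y ∈ closedBall x0 1, ‖v y‖ₑ ≤ V y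
  hT : Tr x0 σ κ α V
  hM : Mo κ α V

def DD (v : E3 → E3) (g : E3 → Fin 3 → Fin 3 → ℝ) (x0 : E3) (σ α : ℝ) (x : E3) : ℝ≥0∞ :=
  G2 g x * hw x0 σ (-3 + α) x + ‖v x‖ₑ ^ 2 * hw x0 σ (-3 - α) x * SS σ α ^ 2

lemma young_c (a b c : ℝ≥0∞) (c0 : c ≠ 0) (ct : c ≠ ∞) : a * b ≤ c * a ^ 2 + c⁻¹ * b ^ 2 := by
  rcases le_total b (c * a) with hb | hb
  · refine le_trans ?_ le_self_add
    calc a * b ≤ a * (c * a) := by gcongr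
      _ = _ := by ring
  · refine le_trans ?_ le_add_self
    have : a ≤ c⁻¹ * b := by
      calc a = c⁻¹ * (c * a) := by rw [← mul_assoc, ENNReal.inv_mul_cancel c0 ct, one_mul]
        _ ≤ _ := by gcongr
    calc a * b ≤ (c⁻¹ * b) * b := by gcongr
      _ = _ := by ring

section
variable {v : E3 → E3} {g : E3 → Fin 3 → Fin 3 → ℝ} {p : E3 → ℝ} {x0 : E3} {φ : E3 → ℝ} {σ A α : ℝ} {κ : ℝ≥0∞} {V : E3 → ℝ≥0∞}

lemma En_le_DD (hσ : 0 < σ) (hα1 : α ≤ 1) (x : E3) : En v g x0 σ α 4 x ≤ DD v g x0 σ α x := by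
  unfold En DD
  rw [show (1:ℝ) - 4 + α = -3 + α by ring, mul_assoc (‖v x‖ₑ ^ 2)]
  refine add_le_add le_rfl (mul_le_mul' le_rfl ?_)
  rw [show -1 - 4 + α = (-3 - α) + (α - 1) + (α - 1) by ring, ← hw_mul hσ, ← hw_mul hσ, mul_assoc, sq]
  have : hw x0 σ (α - 1) x ≤ SS σ α := ENNReal.ofReal_le_ofReal (hp_le_sig hσ (by linarith) x)
  gcongr

lemma DD_meas (h : Slice v g p) (hσ : 0 < σ) : Measurable (DD v g x0 σ α) := by
  unfold DD
  have := h.mG2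
  have := h.mv
  have := hw_meas (x0 := x0) hσ
  fun_prop

lemma WW_sq (hσ : 0 < σ) (hα : 0 ≤ α) (hV : Measurable V) (hM : Mo κ α V) (x : E3) :
    WW V 2 x0 σ x ^ 2 ≤ κ * ENNReal.ofReal (Cdy (3/2) (1/2 + α)) * hw x0 σ (1/2 + α) x * WW V (5/2) x0 σ x := by
  have h1 := hp_pos (x0 := x0) hσ 1 x
  have hcd := Cdy_pos (c := 3/2) (d := 1/2 + α) (by linarith)
  have mk : ∀ β, Measurable (fun y => V y * kk β (y - x)) := fun β => hV.mul ((kk_meas β).comp (measurable_id.sub_const x))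
  have cs : WW V 2 x0 σ x ^ 2 ≤ WW V (3/2) x0 σ x * WW V (5/2) x0 σ x := by
    unfold WW
    have e : ∀ y, V y * kk 2 (y - x) = (V y * kk (3/2) (y - x)) ^ (1/2:ℝ) * (V y * kk (5/2) (y - x)) ^ (1/2:ℝ) := by
      intro y
      rw [← ENNReal.mul_rpow_of_nonneg _ _ (by norm_num)]
      have : V y * kk (3/2) (y - x) * (V y * kk (5/2) (y - x)) = (V y * kk 2 (y - x)) ^ (2:ℝ) := by
        rw [show (2:ℝ) = ((2:ℕ):ℝ) by norm_num, ENNReal.rpow_natCast]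
        have : kk (3/2) (y - x) * kk (5/2) (y - x) = kk 2 (y - x) ^ 2 := by
          unfold kk
          rcases eq_or_ne (y - x) 0 with h0 | h0
          · rw [h0, norm_zero, Real.zero_rpow (by norm_num), Real.zero_rpow (by norm_num)]; simp
          have := norm_pos_iff.2 h0
          rw [← ENNReal.ofReal_mul (by positivity), ← Real.rpow_add this, ← ENNReal.ofReal_pow (by positivity), ← Real.rpow_natCast, ← Real.rpow_mul this.le]
          norm_num
        push_cast
        calc _ = V y ^ 2 * (kk (3/2) (y - x) * kk (5/2) (y - x)) := by ring
          _ = _ := by rw [this]; ring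
      rw [this, ← ENNReal.rpow_mul]; norm_num
    simp_rw [e]
    have := ENNReal.lintegral_mul_le_Lp_mul_Lq (volume.restrict (closedBall x (hp x0 σ 1 x / 4))) (p := 2) (q := 2) ⟨by norm_num, by norm_num, by norm_num⟩
      ((mk (3/2)).pow_const (1/2:ℝ)).aemeasurable ((mk (5/2)).pow_const (1/2:ℝ)).aemeasurable
    simp only [Pi.mul_apply, ← ENNReal.rpow_mul] at this
    norm_num at this
    calc _ ≤ _ := pow_le_pow_left' this 2
      _ = _ := by
        rw [mul_pow, ← ENNReal.rpow_natCast, ← ENNReal.rpow_natCast, ← ENNReal.rpow_mul, ← ENNReal.rpow_mul]; norm_num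
  refine cs.trans (mul_le_mul' ?_ le_rfl)
  refine (near_pot hV (κ := κ) (γ := 2 + α) (β := 3/2) (by norm_num) (by linarith) (x := x) (hM x) (ρ := hp x0 σ 1 x / 4) (by positivity)).trans ?_
  rw [show 2 + α - 3/2 = 1/2 + α by ring, ENNReal.ofReal_mul hcd.le, ← mul_assoc]
  refine mul_le_mul' le_rfl (ENNReal.ofReal_le_ofReal ?_)
  rw [hp_eq_rpow hσ (1/2 + α)]
  exact Real.rpow_le_rpow (by positivity) (by linarith) (by linarith)

lemma pt1 (H : SH v g p x0 σ α κ V) (x : E3) : ‖v x‖ₑ * G1 g x * (hw x0 σ (-4) x * WW V 2 x0 σ x) ≤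
    κ * DD v g x0 σ α x + ENNReal.ofReal (Cdy (3/2) (1/2 + α)) * (‖v x‖ₑ ^ 2 * hw x0 σ (-(9/2)) x * WW V (5/2) x0 σ x) := by
  have hσ := H.hσ
  have e := young_c (G1 g x * hw x0 σ ((-3 + α) / 2) x) (‖v x‖ₑ * hw x0 σ ((-5 - α) / 2) x * WW V 2 x0 σ x) κ H.κ0 H.κt
  calc _ = (G1 g x * hw x0 σ ((-3 + α) / 2) x) * (‖v x‖ₑ * hw x0 σ ((-5 - α) / 2) x * WW V 2 x0 σ x) := by
        rw [show (-4:ℝ) = (-3 + α) / 2 + (-5 - α) / 2 by ring, ← hw_mul hσ]; ring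
    _ ≤ _ := e
    _ ≤ _ := by
      refine add_le_add (mul_le_mul' le_rfl ?_) ?_
      · rw [mul_pow, G1_sq, sq (hw _ _ _ _), hw_mul hσ, show (-3 + α) / 2 + (-3 + α) / 2 = -3 + α by ring]
        exact le_self_add
      · rw [mul_pow, mul_pow, sq (hw _ _ _ _), hw_mul hσ, show (-5 - α) / 2 + (-5 - α) / 2 = -5 - α by ring]
        calc _ ≤ κ⁻¹ * (‖v x‖ₑ ^ 2 * hw x0 σ (-5 - α) x * (κ * ENNReal.ofReal (Cdy (3/2) (1/2 + α)) * hw x0 σ (1/2 + α) x * WW V (5/2) x0 σ x)) := by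
              gcongr; exact WW_sq hσ H.hα H.hV H.hM x
          _ = (κ⁻¹ * κ) * (ENNReal.ofReal (Cdy (3/2) (1/2 + α)) * (‖v x‖ₑ ^ 2 * (hw x0 σ (-5 - α) x * hw x0 σ (1/2 + α) x) * WW V (5/2) x0 σ x)) := by ring
          _ ≤ _ := by
            rw [ENNReal.inv_mul_cancel H.κ0 H.κt, one_mul, hw_mul hσ, show -5 - α + (1/2 + α) = -(9/2) by ring]

lemma pt2 (H : SH v g p x0 σ α κ V) (x : E3) : ‖v x‖ₑ * G1 g x * (SS σ α * hw x0 σ (-3) x) ≤ DD v g x0 σ α x := by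
  have hσ := H.hσ
  have e := young_c (G1 g x * hw x0 σ ((-3 + α) / 2) x) (‖v x‖ₑ * hw x0 σ ((-3 - α) / 2) x * SS σ α) 1 one_ne_zero one_ne_top
  calc _ = (G1 g x * hw x0 σ ((-3 + α) / 2) x) * (‖v x‖ₑ * hw x0 σ ((-3 - α) / 2) x * SS σ α) := by
        rw [show (-3:ℝ) = (-3 + α) / 2 + (-3 - α) / 2 by ring, ← hw_mul hσ]; ring_nf
    _ ≤ _ := e
    _ = _ := by
      rw [mul_pow, G1_sq, sq (hw _ _ _ _), hw_mul hσ, show (-3 + α) / 2 + (-3 + α) / 2 = -3 + α by ring]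
      rw [mul_pow, mul_pow, sq (hw _ _ _ _), hw_mul hσ, show (-3 - α) / 2 + (-3 - α) / 2 = -3 - α by ring]
      unfold DD; simp

def C4 (α : ℝ) : ℝ≥0∞ := 16 * (1 + ENNReal.ofReal (Cdy (3/2) (1/2 + α)) * (ENNReal.ofReal (CQ (9/2)) * vB * ENNReal.ofReal (Cdy (5/2) (1/2)))) + 76 * ENNReal.ofReal (CJ α)

lemma pt3_int (H : SH v g p x0 σ α κ V) (hφ : PhA x0 σ A φ) :
    ∫⁻ x in closedBall x0 (1/2), ‖v x‖ₑ * G1 g x * (ZZ v φ x0 x + JJ v φ x0) ≤ ENNReal.ofReal A * C4 α * κ * ∫⁻ x in closedBall x0 1, DD v g x0 σ α x := by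
  have hσ := H.hσ
  have hA := hφ.A0
  have mD := DD_meas (x0 := x0) (α := α) H.h hσ
  have hh : closedBall x0 (1/2) ⊆ closedBall x0 1 := closedBall_subset_closedBall (by norm_num)
  set D := ∫⁻ x in closedBall x0 1, DD v g x0 σ α x with hD
  have w2 := W2est H.h H.hx0 hσ H.hσ2 H.κt H.hα H.hα1.le H.hV H.hT
  have w3 := w2.trans (mul_le_mul' le_rfl (lintegral_mono (En_le_DD hσ H.hα1.le)))
  have hC := CJ_pos H.hα1
  set c1 := ENNReal.ofReal (16 * A) * κ + ENNReal.ofReal (76 * A * CJ α) * κ with hc1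
  set c2 := ENNReal.ofReal (16 * A) * ENNReal.ofReal (Cdy (3/2) (1/2 + α)) with hc2
  have pt : ∀ x ∈ closedBall x0 (1/2), ‖v x‖ₑ * G1 g x * (ZZ v φ x0 x + JJ v φ x0) ≤ c1 * DD v g x0 σ α x + c2 * (‖v x‖ₑ ^ 2 * hw x0 σ (-(9/2)) x * WW V (5/2) x0 σ x) := by
    intro x hx
    calc _ ≤ ‖v x‖ₑ * G1 g x * (ENNReal.ofReal (16 * A) * (hw x0 σ (-4) x * WW V 2 x0 σ x) +
        ENNReal.ofReal (76 * A * CJ α) * (κ * SS σ α * hw x0 σ (-3) x)) := by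
          exact mul_le_mul' le_rfl (ZZJ_le hσ H.hσ2 H.hα H.hα1 hφ H.hV H.hVv H.hM hx)
      _ = ENNReal.ofReal (16 * A) * (‖v x‖ₑ * G1 g x * (hw x0 σ (-4) x * WW V 2 x0 σ x)) +
          ENNReal.ofReal (76 * A * CJ α) * κ * (‖v x‖ₑ * G1 g x * (SS σ α * hw x0 σ (-3) x)) := by ring
      _ ≤ _ := add_le_add (mul_le_mul' le_rfl (pt1 H x)) (mul_le_mul' le_rfl (pt2 H x))
      _ = _ := by rw [hc1, hc2]; ring
  refine (setLIntegral_mono' measurableSet_closedBall pt).trans ?_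
  rw [lintegral_add_left (mD.const_mul _), lintegral_const_mul _ mD, lintegral_const_mul' _ _ (by rw [hc2]; finiteness)]
  calc _ ≤ c1 * D + c2 * (κ * (ENNReal.ofReal (CQ (9/2)) * vB * ENNReal.ofReal (Cdy (5/2) (1/2))) * D) :=
        add_le_add (mul_le_mul' le_rfl (lintegral_mono_set hh)) (mul_le_mul' le_rfl w3)
    _ = _ := by
      rw [hc1, hc2, ENNReal.ofReal_mul (p := 16) (by norm_num), ENNReal.ofReal_mul (p := 76 * A) (by positivity), ENNReal.ofReal_mul (p := 76) (by norm_num),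
        show ENNReal.ofReal 16 = 16 by simp, show ENNReal.ofReal 76 = 76 by simp]
      unfold C4; ring

lemma cubic' (H : SH v g p x0 σ α κ V) :
    ∫⁻ x in closedBall x0 (1/2), ‖v x‖ₑ ^ 3 * hw x0 σ (-4) x ≤ κ * ENNReal.ofReal (CQ 4) * ∫⁻ x in closedBall x0 1, DD v g x0 σ α x := by
  refine le_trans (setLIntegral_mono' measurableSet_closedBall fun x hx => ?_)
    ((cubic H.h H.hx0 H.hσ H.hσ2 H.κt H.hα H.hα1.le H.hV H.hT).trans (mul_le_mul' le_rfl (lintegral_mono (En_le_DD H.hσ H.hα1.le))))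
  refine mul_le_mul' ?_ le_rfl
  have := H.hVv x (half_one hx)
  calc _ = ‖v x‖ₑ * ‖v x‖ₑ ^ 2 := by ring
    _ ≤ _ := by gcongr

lemma hw_bdd (hσ : 0 < σ) (β R : ℝ) : ∃ M : ℝ≥0∞, M ≠ ∞ ∧ ∀ x ∈ closedBall x0 R, hw x0 σ β x ≤ M := by
  obtain ⟨M, hM⟩ := hp_bdd (x0 := x0) hσ β R
  exact ⟨ENNReal.ofReal M, ENNReal.ofReal_ne_top, fun x hx => ENNReal.ofReal_le_ofReal (hM x hx)⟩

lemma DD_fin (h : Slice v g p) (hσ : 0 < σ) : ∫⁻ x in closedBall x0 1, DD v g x0 σ α x < ∞ := by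
  obtain ⟨M, hM, hM'⟩ := hw_bdd (x0 := x0) hσ (-3 + α) 1
  obtain ⟨N, hN, hN'⟩ := hw_bdd (x0 := x0) hσ (-3 - α) 1
  have hS : SS σ α ≠ ∞ := ENNReal.ofReal_ne_top
  calc _ ≤ ∫⁻ x in closedBall x0 1, M * G2 g x + N * SS σ α ^ 2 * ‖v x‖ₑ ^ 2 := by
        refine setLIntegral_mono' measurableSet_closedBall fun x hx => ?_
        unfold DD
        calc _ ≤ G2 g x * M + ‖v x‖ₑ ^ 2 * N * SS σ α ^ 2 := by gcongr; exacts [hM' x hx, hN' x hx]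
          _ = _ := by ring
    _ ≤ ∫⁻ x, M * G2 g x + N * SS σ α ^ 2 * ‖v x‖ₑ ^ 2 := setLIntegral_le_lintegral _ _
    _ < ∞ := by
      rw [lintegral_add_left (h.mG2.const_mul _), lintegral_const_mul' _ _ hM, lintegral_const_mul' _ _ (by finiteness)]
      exact ENNReal.add_lt_top.2 ⟨ENNReal.mul_lt_top hM.lt_top h.g2, ENNReal.mul_lt_top (by finiteness) h.v2⟩

lemma vphi_le (hφ : PhA x0 σ A φ) (x : E3) : ‖vphi v φ x‖ₑ ≤ ENNReal.ofReal (3 * A) * (‖v x‖ₑ * hw x0 σ (-4) x) := by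
  have hA := hφ.A0
  unfold vphi
  have e : ∀ j, ‖v x j * pd j φ x‖ₑ ≤ ENNReal.ofReal A * (‖v x‖ₑ * hw x0 σ (-4) x) := by
    intro j
    rw [enorm_mul]
    have : ‖pd j φ x‖ₑ ≤ ENNReal.ofReal A * hw x0 σ (-4) x := by
      unfold hw; rw [← ENNReal.ofReal_mul hA]
      refine enorm_le_ofReal (le_trans ?_ (hφ.b1 x))
      unfold pd
      refine (ContinuousLinearMap.le_opNorm (fderiv ℝ φ x) _).trans ?_
      simp
    calc _ ≤ ‖v x‖ₑ * (ENNReal.ofReal A * hw x0 σ (-4) x) := mul_le_mul' (enorm_coord_le _ _) this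
      _ = _ := by ring
  refine (enorm_sum_le _ _).trans ((Finset.sum_le_sum fun j _ => e j).trans (le_of_eq ?_))
  rw [Finset.sum_const, ENNReal.ofReal_mul (by norm_num)]; simp; ring

lemma vphi_meas (h : Slice v g p) (hφ : Ph0 x0 φ) : Measurable (vphi v φ) := by
  unfold vphi
  refine Finset.measurable_fun_sum _ fun j _ => (h.mvi j).mul ((pd_contDiff hφ.sm j).continuous.measurable)

lemma v3_fin (H : SH v g p x0 σ α κ V) : ∫⁻ x in closedBall x0 (1/2), ‖v x‖ₑ ^ 3 < ∞ := by
  obtain ⟨M, hM, hM'⟩ := hw_bdd (x0 := x0) H.hσ 4 (1/2)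
  calc _ ≤ ∫⁻ x in closedBall x0 (1/2), M * (‖v x‖ₑ ^ 3 * hw x0 σ (-4) x) := by
        refine setLIntegral_mono' measurableSet_closedBall fun x hx => ?_
        calc ‖v x‖ₑ ^ 3 = ‖v x‖ₑ ^ 3 * (hw x0 σ 4 x * hw x0 σ (-4) x) := by rw [hw_mul H.hσ]; norm_num [hw_zero]
          _ ≤ ‖v x‖ₑ ^ 3 * (M * hw x0 σ (-4) x) := by gcongr; exact hM' x hx
          _ = _ := by ring
    _ < ∞ := by
      rw [lintegral_const_mul' _ _ hM]
      refine ENNReal.mul_lt_top hM.lt_top ((cubic' H).trans_lt ?_)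
      exact ENNReal.mul_lt_top (by have := H.κt; finiteness) (DD_fin H.h H.hσ)

lemma eig_half {y : E3} (hy : y ∈ closedBall x0 (1/8)) : y ∈ closedBall x0 (1/2) := closedBall_subset_closedBall (by norm_num) hy

lemma vphi_L3 (H : SH v g p x0 σ α κ V) (hφ : PhA x0 σ A φ) : ∫⁻ x, ‖vphi v φ x‖ₑ ^ 3 < ∞ := by
  obtain ⟨M, hM, hM'⟩ := hw_bdd (x0 := x0) H.hσ (-4) (1/2)
  calc _ ≤ ∫⁻ x, (closedBall x0 (1/2)).indicator (fun x => (ENNReal.ofReal (3 * A) * M) ^ 3 * ‖v x‖ₑ ^ 3) x := by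
        refine lintegral_mono fun x => ?_
        by_cases hx : x ∈ closedBall x0 (1/2)
        · rw [indicator_of_mem hx, ← mul_pow]
          refine pow_le_pow_left' ((vphi_le hφ x).trans ?_) 3
          calc _ ≤ ENNReal.ofReal (3 * A) * (‖v x‖ₑ * M) := by gcongr; exact hM' x hx
            _ = _ := by ring
        · rw [vphi_zero hφ.toPh0 (fun h => hx (eig_half h))]; simp
    _ < ∞ := by
      rw [lintegral_indicator measurableSet_closedBall, lintegral_const_mul' _ _ (by finiteness)]
      exact ENNReal.mul_lt_top (by finiteness) (v3_fin H)

lemma vphi_mem3 (H : SH v g p x0 σ α κ V) (hφ : PhA x0 σ A φ) : MemLp (vphi v φ) 3 volume := by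
  refine ⟨(vphi_meas H.h hφ.toPh0).aestronglyMeasurable, ?_⟩
  rw [eLpNorm_lt_top_iff_lintegral_rpow_enorm_lt_top (by simp) (by simp)]
  have := vphi_L3 H hφ
  simpa using this

lemma vphi_int (h : Slice v g p) (hφ : Ph0 x0 φ) : Integrable (vphi v φ) := by
  unfold vphi
  exact integrable_finsetSum _ fun j _ => memLp_int_cc (by norm_num) (h.vi2 j) (pd_contDiff hφ.sm j).continuous (pd_supp hφ.cs j)

lemma pv_int (H : SH v g p x0 σ α κ V) (hφ : PhA x0 σ A φ) : Integrable (fun x => p x * vphi v φ x) := by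
  have : ENNReal.HolderTriple (ENNReal.ofReal (3/2)) 3 1 := ⟨by
    rw [← ENNReal.ofReal_inv_of_pos (by norm_num), show (3:ℝ≥0∞) = ENNReal.ofReal 3 by simp, ← ENNReal.ofReal_inv_of_pos (by norm_num), ← ENNReal.ofReal_add (by norm_num) (by norm_num)]
    norm_num⟩
  have := (vphi_mem3 H hφ).mul (p := ENNReal.ofReal (3/2)) (r := 1) H.h.pL
  exact memLp_one_iff_integrable.1 this

def C5 (α : ℝ) : ℝ≥0∞ := ENNReal.ofReal (3 * c0)⁻¹ * ENNReal.ofReal (400000 * Kct ^ 2) * (C4 α + ENNReal.ofReal (CJ α))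

lemma press_bound (H : SH v g p x0 σ α κ V) (hφ : PhA x0 σ A φ) :
    ‖∫ x, p x * vphi v φ x‖ₑ ≤ ENNReal.ofReal A * C5 α * κ * ((∫⁻ x in closedBall x0 1, DD v g x0 σ α x) + SS σ α * ∫⁻ x in closedBall x0 1, ‖p x‖ₑ) := by
  have hA := hφ.A0
  have hx0 : ‖x0‖ ≤ 8 := by have := H.hx0; rw [mem_ball, dist_zero_right] at this; exact this.le
  set R := (∫⁻ x in closedBall x0 1, DD v g x0 σ α x) + SS σ α * ∫⁻ x in closedBall x0 1, ‖p x‖ₑ with hR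
  set B := ENNReal.ofReal (400000 * Kct ^ 2) * (ENNReal.ofReal A * (C4 α + ENNReal.ofReal (CJ α)) * κ * R) with hB
  have hmeas : Measurable (fun x => p x * cu x0 4 x) := H.h.mp.mul (cu_contDiff (n := 0)).continuous.measurable
  have e1 : ∀ δ : ℝ, 0 < δ → ‖∫ x, p x * (cu x0 4 x * lap (psi δ v φ) x)‖ₑ ≤ B := by
    intro δ hδ
    refine (press_delta H.h hφ.toPh0 hx0 hδ).trans (mul_le_mul' le_rfl ?_)
    have j := JJ_le H.hσ H.hα H.hα1 hφ H.hV H.hVv H.hM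
    calc _ ≤ ENNReal.ofReal A * C4 α * κ * (∫⁻ x in closedBall x0 1, DD v g x0 σ α x) + ENNReal.ofReal A * (κ * ENNReal.ofReal (CJ α) * SS σ α) * ∫⁻ x in closedBall x0 1, ‖p x‖ₑ :=
          add_le_add (pt3_int H hφ) (mul_le_mul' j (lintegral_mono_set (closedBall_subset_closedBall (by norm_num))))
      _ = ENNReal.ofReal A * C4 α * κ * (∫⁻ x in closedBall x0 1, DD v g x0 σ α x) + ENNReal.ofReal A * ENNReal.ofReal (CJ α) * κ * (SS σ α * ∫⁻ x in closedBall x0 1, ‖p x‖ₑ) := by ring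
      _ ≤ ENNReal.ofReal A * C4 α * κ * R + ENNReal.ofReal A * ENNReal.ofReal (CJ α) * κ * R :=
          add_le_add (mul_le_mul' le_rfl le_self_add) (mul_le_mul' le_rfl le_add_self)
      _ = _ := by ring
  have e2 := pairing (q := fun x => p x * cu x0 4 x) (w := vphi v φ) hmeas (vphi_meas H.h hφ.toPh0) ?_ (vphi_mem3 H hφ) (vphi_int H.h hφ.toPh0) (B := ENNReal.ofReal (3⁻¹) * B) ?_
  · have e3 : (fun x => p x * cu x0 4 x * vphi v φ x) = fun x => p x * vphi v φ x := by
      funext x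
      by_cases hx : x ∈ closedBall x0 (1/8)
      · rw [cu_one, mul_one]
        rw [mem_closedBall, dist_eq_norm] at hx
        have := norm_nonneg (x - x0); nlinarith
      · rw [vphi_zero hφ.toPh0 hx]; simp
    rw [e3] at e2
    have hc : 0 < c0 := c0_pos
    calc _ = ENNReal.ofReal c0⁻¹ * (ENNReal.ofReal c0 * ‖∫ x, p x * vphi v φ x‖ₑ) := by
          rw [← mul_assoc, ← ENNReal.ofReal_mul (by positivity), inv_mul_cancel₀ hc.ne']; simp
      _ ≤ ENNReal.ofReal c0⁻¹ * (ENNReal.ofReal (3⁻¹) * B) := by gcongr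
      _ = _ := by
        rw [hB, ← mul_assoc, ← ENNReal.ofReal_mul (by positivity)]
        unfold C5; rw [mul_inv, mul_comm (3⁻¹:ℝ)]; ring
  · refine lt_of_le_of_lt (lintegral_mono fun x => ?_) H.h.p32
    refine ENNReal.rpow_le_rpow ?_ (by norm_num)
    rw [enorm_mul]
    calc _ ≤ ‖p x‖ₑ * 1 := by
          gcongr
          have := enorm_le_ofReal (cu_abs (c := x0) (R := 4) x); simpa using this
      _ = _ := mul_one _
  · intro δ hδ
    have e4 : (fun x => p x * cu x0 4 x * ∫ y, vphi v φ y * (δ ^ 2 * hp x (δ ^ 2) (-5) y)) = fun x => (-3)⁻¹ * (p x * (cu x0 4 x * lap (psi δ v φ) x)) := by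
      funext x
      by_cases hx : x ∈ closedBall x0 1
      · rw [psi_lap H.h hφ.toPh0 hδ hx]; ring
      · rw [(cu4_dz (fun h => hx (half_one h))).1]; simp
    rw [e4, integral_const_mul, enorm_mul]
    refine mul_le_mul' (le_of_eq ?_) (e1 δ hδ)
    rw [← ofReal_norm]; norm_num

def C6 (α : ℝ) : ℝ≥0∞ := 3 * ENNReal.ofReal (CQ 4) + 2 * C5 α

lemma v2v_le (H : SH v g p x0 σ α κ V) (hφ : PhA x0 σ A φ) : ∫⁻ x, ‖‖v x‖ ^ 2 * vphi v φ x‖ₑ ≤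
    ENNReal.ofReal A * (3 * ENNReal.ofReal (CQ 4)) * κ * ∫⁻ x in closedBall x0 1, DD v g x0 σ α x := by
  have hA := hφ.A0
  calc _ ≤ ∫⁻ x, (closedBall x0 (1/2)).indicator (fun x => ENNReal.ofReal (3 * A) * (‖v x‖ₑ ^ 3 * hw x0 σ (-4) x)) x := by
        refine lintegral_mono fun x => ?_
        by_cases hx : x ∈ closedBall x0 (1/2)
        · rw [indicator_of_mem hx, enorm_mul, enorm_pow, enorm_norm]
          calc _ ≤ ‖v x‖ₑ ^ 2 * (ENNReal.ofReal (3 * A) * (‖v x‖ₑ * hw x0 σ (-4) x)) := by gcongr; exact vphi_le hφ x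
            _ = _ := by ring
        · rw [vphi_zero hφ.toPh0 (fun h => hx (eig_half h))]; simp
    _ ≤ ENNReal.ofReal (3 * A) * (κ * ENNReal.ofReal (CQ 4) * ∫⁻ x in closedBall x0 1, DD v g x0 σ α x) := by
      rw [lintegral_indicator measurableSet_closedBall, lintegral_const_mul' _ _ (by finiteness)]
      exact mul_le_mul' le_rfl (cubic' H)
    _ = _ := by rw [ENNReal.ofReal_mul (by norm_num)]; simp; ring

lemma v2v_int (H : SH v g p x0 σ α κ V) (hφ : PhA x0 σ A φ) : Integrable (fun x => ‖v x‖ ^ 2 * vphi v φ x) := by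
  refine ⟨((H.h.mv.norm.pow_const 2).mul (vphi_meas H.h hφ.toPh0)).aestronglyMeasurable, (v2v_le H hφ).trans_lt ?_⟩
  exact ENNReal.mul_lt_top (by have := H.κt; finiteness) (DD_fin H.h H.hσ)

/-- **Slice bound** -/
lemma slice_bound (H : SH v g p x0 σ α κ V) (hφ : PhA x0 σ A φ) :
    ‖∫ x, (‖v x‖ ^ 2 + 2 * p x) * vphi v φ x‖ₑ ≤
      ENNReal.ofReal A * C6 α * κ * ((∫⁻ x in closedBall x0 1, DD v g x0 σ α x) + SS σ α * ∫⁻ x in closedBall x0 1, ‖p x‖ₑ) := by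
  have e : (fun x => (‖v x‖ ^ 2 + 2 * p x) * vphi v φ x) = fun x => ‖v x‖ ^ 2 * vphi v φ x + 2 * (p x * vphi v φ x) := by funext x; ring
  rw [e, integral_add (v2v_int H hφ) ((pv_int H hφ).const_mul 2), integral_const_mul]
  refine (enorm_add_le _ _).trans ?_
  rw [enorm_mul, show ‖(2:ℝ)‖ₑ = 2 by rw [← ofReal_norm]; norm_num]
  calc _ ≤ ENNReal.ofReal A * (3 * ENNReal.ofReal (CQ 4)) * κ * ((∫⁻ x in closedBall x0 1, DD v g x0 σ α x) + SS σ α * ∫⁻ x in closedBall x0 1, ‖p x‖ₑ) + 2 * (ENNReal.ofReal A * C5 α * κ * ((∫⁻ x in closedBall x0 1, DD v g x0 σ α x) + SS σ α * ∫⁻ x in closedBall x0 1, ‖p x‖ₑ)) :=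
        add_le_add ((enorm_integral_le_lintegral_enorm _).trans ((v2v_le H hφ).trans (mul_le_mul' le_rfl le_self_add))) (mul_le_mul' le_rfl (press_bound H hφ))
    _ = _ := by unfold C6; ring
end

/-! ### parabolic rescaling -/
section
open scoped Pointwise
variable {L R : ℝ}

lemma sc_ball (hL : 0 < L) : L • ball (0 : E3) R = ball (0 : E3) (L * R) := by
  rw [_root_.smul_ball hL.ne', smul_zero, Real.norm_of_nonneg hL.le]

lemma sc_int (hL : 0 < L) (F : E3 → ℝ) : ∫ x in ball (0 : E3) R, F (L • x) = (L ^ 3)⁻¹ * ∫ x in ball (0 : E3) (L * R), F x := by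
  rw [Measure.setIntegral_comp_smul_of_pos _ _ _ hL, sc_ball hL]; simp

lemma sc_intt (hL : 0 < L) (F : ℝ → ℝ) (a b : ℝ) : ∫ t in Ioo a b, F (L ^ 2 * t) = (L ^ 2)⁻¹ * ∫ t in Ioo (L ^ 2 * a) (L ^ 2 * b), F t := by
  have h2 : 0 < L ^ 2 := by positivity
  have := Measure.setIntegral_comp_smul_of_pos volume F (Ioo a b) h2
  rw [LinearOrderedField.smul_Ioo h2] at this
  simpa using this

lemma cvB (hL : 0 < L) {G F : E3 → ℝ → ℝ} {c : ℝ} (h : ∀ x t, G x t = c * F (L • x) (L ^ 2 * t)) (a b : ℝ) :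
    ∫ t in Ioo a b, ∫ x in ball (0 : E3) R, G x t = c * (L ^ 5)⁻¹ * ∫ t in Ioo (L ^ 2 * a) (L ^ 2 * b), ∫ x in ball (0 : E3) (L * R), F x t := by
  simp_rw [h, integral_const_mul]
  have : ∀ t, ∫ x in ball (0 : E3) R, F (L • x) (L ^ 2 * t) = (L ^ 3)⁻¹ * ∫ x in ball (0 : E3) (L * R), F x (L ^ 2 * t) := fun t => sc_int hL (fun x => F x (L ^ 2 * t))
  simp_rw [this, integral_const_mul]
  rw [sc_intt hL (fun t => ∫ x in ball (0 : E3) (L * R), F x t)]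
  rw [mul_assoc c, ← mul_assoc (L ^ 3)⁻¹, ← mul_inv]; congr 3; ring

lemma sc_lint {E : Type*} [NormedAddCommGroup E] [NormedSpace ℝ E] [MeasurableSpace E] [BorelSpace E] [FiniteDimensional ℝ E] (μ : Measure E) [μ.IsAddHaarMeasure]
    (hL : 0 < L) (F : E → ℝ≥0∞) (s : Set E) :
    ∫⁻ x in (fun x => L • x) ⁻¹' s, F (L • x) ∂μ = ENNReal.ofReal ((L ^ Module.finrank ℝ E)⁻¹) * ∫⁻ x in s, F x ∂μ := by
  let e : E ≃ᵐ E := (Homeomorph.smulOfNeZero L hL.ne').toMeasurableEquiv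
  have h2 : Measure.map e μ = ENNReal.ofReal ((L ^ Module.finrank ℝ E)⁻¹) • μ := by
    have := Measure.map_addHaar_smul μ hL.ne'
    rw [abs_of_pos (by positivity)] at this
    exact this
  rw [← smul_eq_mul, ← lintegral_smul_measure, ← Measure.restrict_smul, ← h2, e.restrict_map, lintegral_map_equiv]
  rfl

lemma sc_lintx (hL : 0 < L) (F : E3 → ℝ≥0∞) : ∫⁻ x in ball (0 : E3) R, F (L • x) = ENNReal.ofReal ((L ^ 3)⁻¹) * ∫⁻ x in ball (0 : E3) (L * R), F x := by
  have := sc_lint volume hL F (ball (0 : E3) (L * R))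
  rw [show Module.finrank ℝ E3 = 3 by simp] at this
  rw [← this]; congr 2
  ext x; simp only [mem_preimage, mem_ball_zero_iff, norm_smul, Real.norm_of_nonneg hL.le]
  exact (mul_lt_mul_iff_right₀ hL).symm

lemma sc_lintx' (hL : 0 < L) (F : E3 → ℝ≥0∞) : ∫⁻ x, F (L • x) = ENNReal.ofReal ((L ^ 3)⁻¹) * ∫⁻ x, F x := by
  have := sc_lint volume hL F univ
  rw [show Module.finrank ℝ E3 = 3 by simp] at this
  simpa using this

lemma cvL (hL : 0 < L) {G F : E3 → ℝ → ℝ≥0∞} {c : ℝ≥0∞} (hc : c ≠ ∞) (h : ∀ x t, G x t = c * F (L • x) (L ^ 2 * t)) :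
    ∫⁻ t in Ioo (-(R ^ 2)) 0, ∫⁻ x in ball (0 : E3) R, G x t = c * (ENNReal.ofReal ((L ^ 3)⁻¹) * (ENNReal.ofReal ((L ^ 2)⁻¹) *
      ∫⁻ t in Ioo (-((L * R) ^ 2)) 0, ∫⁻ x in ball (0 : E3) (L * R), F x t)) := by
  have h2 : 0 < L ^ 2 := by positivity
  simp_rw [h, lintegral_const_mul' _ _ hc]
  have : ∀ t, ∫⁻ x in ball (0 : E3) R, F (L • x) (L ^ 2 * t) = ENNReal.ofReal ((L ^ 3)⁻¹) * ∫⁻ x in ball (0 : E3) (L * R), F x (L ^ 2 * t) := fun t => sc_lintx hL (fun x => F x (L ^ 2 * t))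
  simp_rw [this]
  rw [lintegral_const_mul' _ _ ENNReal.ofReal_ne_top]
  congr 2
  have := sc_lint (volume : Measure ℝ) h2 (fun t => ∫⁻ x in ball (0 : E3) (L * R), F x t) (Ioo (-((L * R) ^ 2)) 0)
  simp only [smul_eq_mul, Module.finrank_self, pow_one] at this
  rw [← this]; congr 2
  ext t
  simp only [mem_preimage, mem_Ioo]
  constructor
  · rintro ⟨k1, k2⟩
    exact ⟨by nlinarith, by nlinarith⟩
  · rintro ⟨k1, k2⟩
    refine ⟨lt_of_mul_lt_mul_left (by nlinarith : L ^ 2 * -(R ^ 2) < L ^ 2 * t) h2.le, lt_of_mul_lt_mul_left (by nlinarith : L ^ 2 * t < L ^ 2 * 0) h2.le⟩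

lemma ae_sc (hL : 0 < L) {Q : ℝ → Prop} {a b : ℝ} (h : ∀ᵐ t ∂(volume.restrict (Ioo (L ^ 2 * a) (L ^ 2 * b))), Q t) :
    ∀ᵐ t ∂(volume.restrict (Ioo a b)), Q (L ^ 2 * t) := by
  have h2 : 0 < L ^ 2 := by positivity
  rw [ae_restrict_iff' measurableSet_Ioo] at h ⊢
  have h3 : ∀ᵐ t ∂(Measure.map (fun t : ℝ => L ^ 2 • t) volume), t ∈ Ioo (L ^ 2 * a) (L ^ 2 * b) → Q t := by
    rw [Measure.map_addHaar_smul _ h2.ne']; exact Measure.ae_smul_measure h _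
  filter_upwards [ae_of_ae_map (by fun_prop) h3] with t ht hab
  simp only [smul_eq_mul] at ht
  exact ht ⟨by have := hab.1; gcongr, by have := hab.2; gcongr⟩

lemma Ioo_sc : Ioo (L ^ 2 * -(R ^ 2)) (L ^ 2 * 0) = Ioo (-((L * R) ^ 2)) 0 := by
  congr 1 <;> ring

lemma pd_sc (f : E3 → ℝ) (i : Fin 3) (x : E3) : pd i (fun y => f (L • y)) x = L * pd i f (L • x) := by
  unfold pd
  rw [fderiv_comp_smul]; simp

lemma lap_sc (f : E3 → ℝ) (x : E3) : lap (fun y => f (L • y)) x = L ^ 2 * lap f (L • x) := by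
  unfold lap
  simp_rw [pd_sc, Finset.mul_sum]
  refine Finset.sum_congr rfl fun i _ => ?_
  rw [pd_sc (fun z => L * pd i f z)]
  unfold pd
  have h2 : fderiv ℝ (fun z => L * fderiv ℝ f z (EuclideanSpace.single i 1)) (L • x) = L • fderiv ℝ (fun z => fderiv ℝ f z (EuclideanSpace.single i 1)) (L • x) := by
    have := fderiv_const_smul_field (𝕜 := ℝ) L (f := fun z => fderiv ℝ f z (EuclideanSpace.single i 1))
    exact congrFun this _
  rw [h2]; simp; ring

lemma test_sc {F : Type*} [NormedAddCommGroup F] [NormedSpace ℝ F] (hL : 0 < L) {φ : E3 → ℝ → F} (h1 : ContDiff ℝ (⊤ : ℕ∞) (fun z : E3 × ℝ => φ z.1 z.2))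
    (h2 : HasCompactSupport (fun z : E3 × ℝ => φ z.1 z.2))
    (h3 : tsupport (fun z : E3 × ℝ => φ z.1 z.2) ⊆ (ball (0 : E3) R) ×ˢ (Ioo (-(R^2)) 0)) :
    ∃ ψ : E3 → ℝ → F, (ContDiff ℝ (⊤ : ℕ∞) (fun z : E3 × ℝ => ψ z.1 z.2) ∧ HasCompactSupport (fun z : E3 × ℝ => ψ z.1 z.2) ∧
      tsupport (fun z : E3 × ℝ => ψ z.1 z.2) ⊆ (ball (0 : E3) (L * R)) ×ˢ (Ioo (-((L * R)^2)) 0)) ∧ φ = fun x t => ψ (L • x) (L ^ 2 * t) := by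
  have h20 : L ^ 2 ≠ 0 := by positivity
  let e : (E3 × ℝ) ≃ₜ (E3 × ℝ) := (Homeomorph.smulOfNeZero L⁻¹ (inv_ne_zero hL.ne')).prodCongr (Homeomorph.smulOfNeZero (L ^ 2)⁻¹ (inv_ne_zero h20))
  have he : ∀ z, e z = (L⁻¹ • z.1, (L ^ 2)⁻¹ * z.2) := fun _ => rfl
  have hts : tsupport (fun z : E3 × ℝ => φ (L⁻¹ • z.1) ((L ^ 2)⁻¹ * z.2)) = e ⁻¹' tsupport (fun z : E3 × ℝ => φ z.1 z.2) :=
    tsupport_comp_eq_preimage (fun z : E3 × ℝ => φ z.1 z.2) e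
  refine ⟨fun x t => φ (L⁻¹ • x) ((L ^ 2)⁻¹ * t), ⟨?_, ?_, ?_⟩, ?_⟩
  · exact h1.comp (f := fun z : E3 × ℝ => (L⁻¹ • z.1, (L ^ 2)⁻¹ * z.2)) (by fun_prop)
  · exact h2.comp_homeomorph e
  · rw [hts]
    intro z hz
    have := h3 hz
    rw [he, mem_prod, mem_ball_zero_iff, norm_smul, norm_inv, Real.norm_of_nonneg hL.le, mem_Ioo] at this
    obtain ⟨k1, k2, k3⟩ := this
    simp only at k1 k2 k3
    rw [mem_prod, mem_ball_zero_iff, mem_Ioo]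
    refine ⟨?_, ?_, ?_⟩
    · rwa [inv_mul_lt_iff₀ hL] at k1
    · rw [lt_inv_mul_iff₀ (by positivity)] at k2; linarith [mul_pow L R 2]
    · rw [inv_mul_lt_iff₀ (by positivity)] at k3; linarith
  · funext x t
    simp only [smul_smul]
    rw [inv_mul_cancel₀ hL.ne', one_smul, ← mul_assoc, inv_mul_cancel₀ h20, one_mul]

/-- the rescaled solution -/
def SuitableWeakSolution.rescale {u : E3 → ℝ → E3} {P : E3 → ℝ → ℝ} (hL : 0 < L) (h : SuitableWeakSolution (L * R) u P) :
    SuitableWeakSolution R (fun x t => L • u (L • x) (L ^ 2 * t)) (fun x t => L ^ 2 * P (L • x) (L ^ 2 * t)) where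
  gu := fun x t i j => L ^ 2 * h.gu (L • x) (L ^ 2 * t) i j
  meas_u := (h.meas_u.comp (by fun_prop : Measurable (fun z : E3 × ℝ => (L • z.1, L ^ 2 * z.2)))).const_smul L
  meas_gu := by
    have m := h.meas_gu.comp (by fun_prop : Measurable (fun z : E3 × ℝ => (L • z.1, L ^ 2 * z.2)))
    refine measurable_pi_lambda _ fun i => measurable_pi_lambda _ fun j => ?_
    exact (((measurable_pi_apply j).comp ((measurable_pi_apply i).comp m))).const_mul (L ^ 2)
  meas_press := (h.meas_press.comp (by fun_prop : Measurable (fun z : E3 × ℝ => (L • z.1, L ^ 2 * z.2)))).const_mul (L ^ 2)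
  bdd_L2 := by
    have h0 := h.bdd_L2
    have h1 := _root_.ae_le_essSup (f := fun t => ∫⁻ x in ball (0 : E3) (L * R), ((‖u x t‖₊ : ℝ≥0∞)) ^ 2) (μ := volume.restrict (Ioo (-((L * R)^2)) 0))
    rw [← Ioo_sc] at h1
    have h2 := ae_sc hL h1
    rw [Ioo_sc] at h2
    refine lt_of_le_of_lt (essSup_le_of_ae_le (ENNReal.ofReal (L ^ 2) * (ENNReal.ofReal ((L ^ 3)⁻¹) * essSup (fun t => ∫⁻ x in ball (0 : E3) (L * R), ((‖u x t‖₊ : ℝ≥0∞)) ^ 2)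
      (volume.restrict (Ioo (-((L * R)^2)) 0)))) ?_) (ENNReal.mul_lt_top (by finiteness) (ENNReal.mul_lt_top (by finiteness) h0))
    filter_upwards [h2] with t ht
    refine le_trans (le_of_eq ?_) (mul_le_mul' le_rfl (mul_le_mul' le_rfl ht))
    rw [← sc_lintx hL (fun x => ((‖u x (L ^ 2 * t)‖₊ : ℝ≥0∞)) ^ 2), ← lintegral_const_mul' _ _ ENNReal.ofReal_ne_top]
    refine lintegral_congr fun x => ?_
    rw [nnnorm_smul, ENNReal.coe_mul, mul_pow]; congr 1
    rw [← enorm_eq_nnnorm, ← ofReal_norm, Real.norm_of_nonneg hL.le, ENNReal.ofReal_pow hL.le]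
  grad_L2 := by
    rw [cvL hL (c := ENNReal.ofReal (L ^ 4)) (F := fun x t => ENNReal.ofReal (∑ i : Fin 3, ∑ j : Fin 3, (h.gu x t i j) ^ 2)) ENNReal.ofReal_ne_top]
    · have := h.grad_L2
      finiteness
    · intro x t
      rw [← ENNReal.ofReal_mul (by positivity), Finset.mul_sum]
      congr 1; refine Finset.sum_congr rfl fun i _ => ?_
      rw [Finset.mul_sum]; refine Finset.sum_congr rfl fun j _ => ?_
      ring
  press_L32 := by
    rw [cvL hL (c := ENNReal.ofReal (L ^ 2) ^ (3/2:ℝ)) (F := fun x t => (ENNReal.ofReal |P x t|) ^ (3/2 : ℝ)) (by finiteness)]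
    · have := h.press_L32
      finiteness
    · intro x t
      rw [← ENNReal.mul_rpow_of_nonneg _ _ (by norm_num), ← ENNReal.ofReal_mul (by positivity), abs_mul, abs_of_pos (by positivity : 0 < L ^ 2)]
  is_grad := by
    intro φ hφ i j
    obtain ⟨ψ, hψ, rfl⟩ := test_sc hL hφ.1 hφ.2.1 hφ.2.2
    have := h.is_grad ψ hψ i j
    have a1 := cvB (R := R) hL (G := fun x t => (L • u (L • x) (L ^ 2 * t)) i * pd j (fun y => ψ (L • y) (L ^ 2 * t)) x) (c := L ^ 2) (F := fun x t => u x t i * pd j (fun y => ψ y t) x) (fun x t => by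
      rw [pd_sc (fun y => ψ y (L ^ 2 * t))]
      simp only [PiLp.smul_apply, smul_eq_mul]; ring) (-(R ^ 2)) 0
    have a2 := cvB (R := R) hL (G := fun x t => (L ^ 2 * h.gu (L • x) (L ^ 2 * t) i j) * ψ (L • x) (L ^ 2 * t)) (c := L ^ 2) (F := fun x t => h.gu x t i j * ψ x t) (fun x t => by ring) (-(R ^ 2)) 0
    rw [Ioo_sc] at a1 a2
    rw [this] at a1
    refine a1.trans ?_
    rw [mul_neg, ← a2]
  weak_NS := by
    intro w hw
    obtain ⟨ψ, hψ, rfl⟩ := test_sc hL hw.1 hw.2.1 hw.2.2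
    have := h.weak_NS ψ hψ
    rw [cvB hL (c := L ^ 3) (F := fun x t => (-(∑ i : Fin 3, u x t i * deriv (fun s => ψ x s i) t)
          - (∑ i : Fin 3, u x t i * lap (fun y => ψ y t i) x)
          - (∑ i : Fin 3, ∑ j : Fin 3, u x t i * u x t j * pd i (fun y => ψ y t j) x)
          - P x t * (∑ j : Fin 3, pd j (fun y => ψ y t j) x))), Ioo_sc, this]
    · ring
    · intro x t
      have e1 : ∀ i, deriv (fun s => ψ (L • x) (L ^ 2 * s) i) t = L ^ 2 * deriv (fun s => ψ (L • x) s i) (L ^ 2 * t) := fun i => by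
        have := deriv_comp_mul_left (L ^ 2) (fun s => ψ (L • x) s i) t
        simpa using this
      have e2 : ∀ i, lap (fun y => ψ (L • y) (L ^ 2 * t) i) x = L ^ 2 * lap (fun y => ψ y (L ^ 2 * t) i) (L • x) := fun i => lap_sc (fun y => ψ y (L ^ 2 * t) i) x
      have e3 : ∀ i j, pd i (fun y => ψ (L • y) (L ^ 2 * t) j) x = L * pd i (fun y => ψ y (L ^ 2 * t) j) (L • x) := fun i j => pd_sc (fun y => ψ y (L ^ 2 * t) j) i x
      simp only [e1, e2, e3, PiLp.smul_apply, smul_eq_mul, Fin.sum_univ_three]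
      ring
  weak_div := by
    intro φ hφ
    obtain ⟨ψ, hψ, rfl⟩ := test_sc hL hφ.1 hφ.2.1 hφ.2.2
    have := h.weak_div ψ hψ
    rw [cvB hL (c := L ^ 2) (F := fun x t => ∑ i : Fin 3, u x t i * pd i (fun y => ψ y t) x), Ioo_sc, this]
    · ring
    · intro x t
      have e3 : ∀ i, pd i (fun y => ψ (L • y) (L ^ 2 * t)) x = L * pd i (fun y => ψ y (L ^ 2 * t)) (L • x) := fun i => pd_sc (fun y => ψ y (L ^ 2 * t)) i x
      simp only [e3, PiLp.smul_apply, smul_eq_mul, Fin.sum_univ_three]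
      ring
  local_energy := by
    intro φ hφ hpos
    obtain ⟨ψ, hψ, rfl⟩ := test_sc hL hφ.1 hφ.2.1 hφ.2.2
    have h20 : L ^ 2 ≠ 0 := by positivity
    have h1 := h.local_energy ψ hψ (fun x t => by
      have h5 := hpos (L⁻¹ • x) ((L ^ 2)⁻¹ * t)
      beta_reduce at h5
      rwa [smul_smul, mul_inv_cancel₀ hL.ne', one_smul, ← mul_assoc, mul_inv_cancel₀ h20, one_mul] at h5)
    rw [← Ioo_sc] at h1
    filter_upwards [ae_sc hL h1] with t ht
    beta_reduce
    have i0 : ∫ x in ball (0 : E3) R, ‖L • u (L • x) (L ^ 2 * t)‖ ^ 2 * ψ (L • x) (L ^ 2 * t) = L⁻¹ * ∫ x in ball (0 : E3) (L * R), ‖u x (L ^ 2 * t)‖ ^ 2 * ψ x (L ^ 2 * t) := by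
      have : ∀ x, ‖L • u (L • x) (L ^ 2 * t)‖ ^ 2 * ψ (L • x) (L ^ 2 * t) = L ^ 2 * ((fun x => ‖u x (L ^ 2 * t)‖ ^ 2 * ψ x (L ^ 2 * t)) (L • x)) := fun x => by
        rw [norm_smul, Real.norm_of_nonneg hL.le]; ring
      simp_rw [this, integral_const_mul]
      rw [sc_int hL (fun x => ‖u x (L ^ 2 * t)‖ ^ 2 * ψ x (L ^ 2 * t)), ← mul_assoc]; congr 1; field_simp
    have a1 := cvB (R := R) hL (G := fun x s => (∑ i : Fin 3, ∑ j : Fin 3, (L ^ 2 * h.gu (L • x) (L ^ 2 * s) i j) ^ 2) * ψ (L • x) (L ^ 2 * s)) (c := L ^ 4) (F := fun x s => (∑ i : Fin 3, ∑ j : Fin 3, (h.gu x s i j) ^ 2) * ψ x s) (fun x s => by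
      simp only [Fin.sum_univ_three]; ring) (-(R ^ 2)) t
    have a2 := cvB (R := R) hL (G := fun x s => ‖L • u (L • x) (L ^ 2 * s)‖ ^ 2 * (deriv (fun τ => ψ (L • x) (L ^ 2 * τ)) s + lap (fun y => ψ (L • y) (L ^ 2 * s)) x)) (c := L ^ 4) (F := fun x s => ‖u x s‖ ^ 2 * (deriv (fun τ => ψ x τ) s + lap (fun y => ψ y s) x)) (fun x s => by
      have e1 : deriv (fun s => ψ (L • x) (L ^ 2 * s)) s = L ^ 2 * deriv (fun s => ψ (L • x) s) (L ^ 2 * s) := by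
        have := deriv_comp_mul_left (L ^ 2) (fun s => ψ (L • x) s) s
        simpa using this
      have e2 : lap (fun y => ψ (L • y) (L ^ 2 * s)) x = L ^ 2 * lap (fun y => ψ y (L ^ 2 * s)) (L • x) := lap_sc (fun y => ψ y (L ^ 2 * s)) x
      rw [e1, e2, norm_smul, Real.norm_of_nonneg hL.le]; ring) (-(R ^ 2)) t
    have a3 := cvB (R := R) hL (G := fun x s => (∑ i : Fin 3, (L • u (L • x) (L ^ 2 * s)) i * pd i (fun y => ψ (L • y) (L ^ 2 * s)) x) * (‖L • u (L • x) (L ^ 2 * s)‖ ^ 2 + 2 * (L ^ 2 * P (L • x) (L ^ 2 * s)))) (c := L ^ 4) (F := fun x s => (∑ i : Fin 3, u x s i * pd i (fun y => ψ y s) x) * (‖u x s‖ ^ 2 + 2 * P x s)) (fun x s => by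
      have e3 : ∀ i, pd i (fun y => ψ (L • y) (L ^ 2 * s)) x = L * pd i (fun y => ψ y (L ^ 2 * s)) (L • x) := fun i => pd_sc (fun y => ψ y (L ^ 2 * s)) i x
      simp only [e3, PiLp.smul_apply, smul_eq_mul, Fin.sum_univ_three, norm_smul, Real.norm_of_nonneg hL.le]
      ring) (-(R ^ 2)) t
    have e : L ^ 4 * (L ^ 5)⁻¹ = L⁻¹ := by field_simp
    have e5 : L ^ 2 * -(R ^ 2) = -((L * R) ^ 2) := by ring
    rw [e, e5] at a1 a2 a3
    have h9 := mul_le_mul_of_nonneg_left ht (inv_pos.2 hL).le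
    rw [mul_add, mul_add, ← a2, ← a3, mul_left_comm, ← a1, ← i0] at h9
    exact h9
end

/-! ### time slices -/
def TF (ζ : E3 → ℝ) : Prop := ContDiff ℝ (⊤ : ℕ∞) ζ ∧ HasCompactSupport ζ ∧ tsupport ζ ⊆ ball 0 16
def TI (θ : ℝ → ℝ) : Prop := ContDiff ℝ (⊤ : ℕ∞) θ ∧ HasCompactSupport θ ∧ tsupport θ ⊆ Ioo (-(16 ^ 2)) 0

section
variable {ι : Type*} [Fintype ι] {a : ι → E3 → ℝ → ℝ} {M : E3 → ℝ → ℝ≥0∞} {D : ι → (E3 → ℝ) → E3 → ℝ}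

lemma sl_meas (ha : ∀ k, Measurable (Function.uncurry (a k))) {F : ι → E3 → ℝ} (hF : ∀ k, Continuous (F k)) :
    Measurable (fun t => ∫ x, ∑ k, a k x t * F k x) := by
  have : Measurable (fun z : ℝ × E3 => ∑ k, a k z.2 z.1 * F k z.2) :=
    Finset.measurable_sum _ fun k _ => ((ha k).comp measurable_swap).mul ((hF k).measurable.comp measurable_snd)
  exact (this.stronglyMeasurable.integral_prod_right').measurable

lemma sl_bound {c : ℝ} {F : ι → E3 → ℝ} (haM : ∀ k x t, ‖a k x t‖ₑ ≤ M x t) (hB : ∀ k x t, x ∉ ball (0 : E3) 16 → a k x t = 0)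
    (hF : ∀ k, ∀ x ∈ closedBall (0 : E3) 16, |F k x| ≤ c) (t : ℝ) :
    ∫⁻ x, ‖∑ k, a k x t * F k x‖ₑ ≤ Fintype.card ι * ENNReal.ofReal c * ∫⁻ x, M x t := by
  rw [← lintegral_const_mul' _ _ (by finiteness)]
  refine lintegral_mono fun x => ?_
  refine (enorm_sum_le _ _).trans ?_
  refine (Finset.sum_le_card_nsmul _ _ (ENNReal.ofReal c * M x t) fun k _ => ?_).trans (by simp [mul_assoc])
  by_cases hx : x ∈ ball (0 : E3) 16
  · rw [enorm_mul, mul_comm]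
    refine mul_le_mul' ?_ (haM k x t)
    rw [← ofReal_norm]; exact ENNReal.ofReal_le_ofReal (hF k x (ball_subset_closedBall hx))
  · rw [hB k x t hx]; simp

lemma cont_bd {F : ι → E3 → ℝ} (hF : ∀ k, Continuous (F k)) : ∃ c, ∀ k, ∀ x ∈ closedBall (0 : E3) 16, |F k x| ≤ c := by
  have : ∀ k, ∃ c, ∀ x ∈ closedBall (0 : E3) 16, |F k x| ≤ c := fun k => by
    obtain ⟨c, hc⟩ := (isCompact_closedBall (0:E3) 16).exists_bound_of_continuousOn (hF k).continuousOn
    exact ⟨c, hc⟩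
  choose c hc using this
  refine ⟨∑ k, |c k|, fun k x hx => (hc k x hx).trans ((le_abs_self _).trans (Finset.single_le_sum (f := fun k => |c k|) (fun i _ => abs_nonneg _) (Finset.mem_univ k)))⟩

lemma ae_slice1 (ha : ∀ k, Measurable (Function.uncurry (a k))) (hMf : ∫⁻ t, ∫⁻ x, M x t ≠ ∞)
    (haM : ∀ k x t, ‖a k x t‖ₑ ≤ M x t) (hB : ∀ k x t, x ∉ ball (0 : E3) 16 → a k x t = 0) (hI : ∀ k x t, t ∉ Ioo (-(16 ^ 2) : ℝ) 0 → a k x t = 0)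
    {F : ι → E3 → ℝ} (hF : ∀ k, Continuous (F k)) (H : ∀ θ, TI θ → ∫ t, θ t * ∫ x, ∑ k, a k x t * F k x = 0) :
    ∀ᵐ t, ∫ x, ∑ k, a k x t * F k x = 0 := by
  obtain ⟨c, hc⟩ := cont_bd hF
  have hinb : Integrable (fun t => ∫ x, ∑ k, a k x t * F k x) := by
    refine ⟨(sl_meas ha hF).aestronglyMeasurable, ?_⟩
    refine lt_of_le_of_lt (lintegral_mono fun t => (enorm_integral_le_lintegral_enorm _).trans (sl_bound haM hB hc t)) ?_
    rw [lintegral_const_mul' _ _ (by finiteness)]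
    finiteness
  have := isOpen_Ioo.ae_eq_zero_of_integral_contDiff_smul_eq_zero (U := Ioo (-(16^2) : ℝ) 0) (hinb.locallyIntegrable.locallyIntegrableOn _) (fun θ h1 h2 h3 => H θ ⟨h1, h2, h3⟩)
  filter_upwards [this] with t ht
  by_cases h : t ∈ Ioo (-(16 ^ 2) : ℝ) 0
  · exact ht h
  · simp [hI _ _ t h]

lemma ae_slice (ha : ∀ k, Measurable (Function.uncurry (a k))) (hM : Measurable (Function.uncurry M)) (hMf : ∫⁻ t, ∫⁻ x, M x t ≠ ∞)
    (haM : ∀ k x t, ‖a k x t‖ₑ ≤ M x t) (hB : ∀ k x t, x ∉ ball (0 : E3) 16 → a k x t = 0) (hI : ∀ k x t, t ∉ Ioo (-(16 ^ 2) : ℝ) 0 → a k x t = 0)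
    (hD : ∀ ζ, TF ζ → ∀ k, Continuous (D k ζ)) (H : ∀ ζ, TF ζ → ∀ θ, TI θ → ∫ t, θ t * ∫ x, ∑ k, a k x t * D k ζ x = 0) :
    ∀ᵐ t, ∀ ζ, TF ζ → ∫ x, ∑ k, a k x t * D k ζ x = 0 := by
  let K := closedBall (0 : E3) 16
  have : CompactSpace K := isCompact_iff_compactSpace.1 (isCompact_closedBall _ _)
  let T : Set C(K, ι → ℝ) := {F | ∃ ζ, TF ζ ∧ ∀ k (x : K), F x k = D k ζ x}
  obtain ⟨s, hs, hd⟩ := TopologicalSpace.exists_countable_dense T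
  have hmf : ∀ᵐ t, ∫⁻ x, M x t < ∞ := ae_lt_top (hM.lintegral_prod_left') hMf
  choose Z hZ hZ2 using fun F : T => F.2
  have h1 : ∀ᵐ t, ∀ F ∈ s, ∫ x, ∑ k, a k x t * D k (Z F) x = 0 :=
    (ae_ball_iff hs).2 fun F _ => ae_slice1 ha hMf haM hB hI (hD _ (hZ F)) (H _ (hZ F))
  filter_upwards [hmf, h1] with t ht h1 ζ hζ
  have hinb : ∀ ζ, TF ζ → Integrable (fun x => ∑ k, a k x t * D k ζ x) := fun ζ hζ => by
    obtain ⟨c, hc⟩ := cont_bd (hD ζ hζ)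
    refine ⟨(Finset.measurable_sum _ fun k _ => ((ha k).comp measurable_prodMk_right).mul (hD ζ hζ k).measurable).aestronglyMeasurable, ?_⟩
    refine lt_of_le_of_lt (sl_bound haM hB hc t) ?_
    finiteness
  let F0 : T := ⟨⟨fun x k => D k ζ x, continuous_pi fun k => (hD ζ hζ k).comp continuous_subtype_val⟩, ζ, hζ, fun _ _ => rfl⟩
  have key : ∀ ε : ℝ, 0 < ε → ‖∫ x, ∑ k, a k x t * D k ζ x‖ₑ ≤ Fintype.card ι * ENNReal.ofReal ε * ∫⁻ x, M x t := by
    intro ε hε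
    obtain ⟨F, hFs, hF⟩ := hd.exists_dist_lt F0 hε
    have e : ∫ x, ∑ k, a k x t * D k ζ x = ∫ x, ∑ k, a k x t * (D k ζ x - D k (Z F) x) := by
      rw [← sub_zero (∫ x, ∑ k, a k x t * D k ζ x), ← h1 F hFs, ← integral_sub (hinb _ hζ) (hinb _ (hZ F))]
      refine integral_congr_ae (Eventually.of_forall fun x => ?_)
      simp only [mul_sub, Finset.sum_sub_distrib]
    rw [e]
    refine (enorm_integral_le_lintegral_enorm _).trans (sl_bound haM hB (fun k x hx => ?_) t)
    have h2 : dist (F0.1 ⟨x, hx⟩ k) (F.1 ⟨x, hx⟩ k) ≤ dist F0.1 F.1 := (dist_le_pi_dist _ _ k).trans (ContinuousMap.dist_apply_le_dist _)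
    rw [hZ2 F, Real.dist_eq] at h2
    exact h2.trans hF.le
  have h3 : Tendsto (fun n : ℕ => (Fintype.card ι : ℝ≥0∞) * ENNReal.ofReal (1 / ((n : ℝ) + 1)) * ∫⁻ x, M x t) atTop (nhds (Fintype.card ι * ENNReal.ofReal 0 * ∫⁻ x, M x t)) := by
    refine ENNReal.Tendsto.mul_const (ENNReal.Tendsto.const_mul (ENNReal.tendsto_ofReal tendsto_one_div_add_atTop_nhds_zero_nat) (Or.inr (by finiteness))) (Or.inr ht.ne)
  have h4 := ge_of_tendsto' h3 (fun n => key (1 / ((n : ℝ) + 1)) (by positivity))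
  simpa using h4
end

/-! ### zero extension and the working notion of solution -/
def QQ : Set (E3 × ℝ) := ball (0 : E3) 16 ×ˢ Ioo (-(16 ^ 2) : ℝ) 0
lemma QQ_meas : MeasurableSet QQ := measurableSet_ball.prod measurableSet_Ioo
def ex {F : Type*} [Zero F] (f : E3 → ℝ → F) (x : E3) (t : ℝ) : F := QQ.indicator (Function.uncurry f) (x, t)

section
variable {F : Type*} [Zero F] {f : E3 → ℝ → F}
lemma ex_in {x : E3} {t : ℝ} (hx : x ∈ ball (0 : E3) 16) (ht : t ∈ Ioo (-(16 ^ 2) : ℝ) 0) : ex f x t = f x t :=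
  indicator_of_mem (show (x, t) ∈ QQ from ⟨hx, ht⟩) _
lemma ex_out {x : E3} {t : ℝ} (h : ¬ (x ∈ ball (0 : E3) 16 ∧ t ∈ Ioo (-(16 ^ 2) : ℝ) 0)) : ex f x t = 0 :=
  indicator_of_notMem (show (x, t) ∉ QQ from fun hh => h hh) _
lemma ex_x {x : E3} {t : ℝ} (h : x ∉ ball (0 : E3) 16) : ex f x t = 0 := ex_out fun hh => h hh.1
lemma ex_t {x : E3} {t : ℝ} (h : t ∉ Ioo (-(16 ^ 2) : ℝ) 0) : ex f x t = 0 := ex_out fun hh => h hh.2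
lemma ex_meas [MeasurableSpace F] (hf : Measurable (Function.uncurry f)) : Measurable (Function.uncurry (ex f)) :=
  hf.indicator QQ_meas
end

lemma ex_intx {G G' : E3 → ℝ} (h1 : ∀ x ∈ ball (0 : E3) 16, G' x = G x) (h2 : ∀ x ∉ ball (0 : E3) 16, G' x = 0) :
    ∫ x in ball (0 : E3) 16, G x = ∫ x, G' x := by
  rw [← integral_indicator measurableSet_ball]
  congr 1; ext x
  by_cases hx : x ∈ ball (0 : E3) 16
  · rw [indicator_of_mem hx, h1 x hx]
  · rw [indicator_of_notMem hx, h2 x hx]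

lemma ex_int {G G' : E3 → ℝ → ℝ} (h1 : ∀ x ∈ ball (0 : E3) 16, ∀ t ∈ Ioo (-(16 ^ 2) : ℝ) 0, G' x t = G x t)
    (h2 : ∀ x t, x ∉ ball (0 : E3) 16 → G' x t = 0) (h3 : ∀ x t, t ∉ Ioo (-(16 ^ 2) : ℝ) 0 → G' x t = 0) :
    ∫ t in Ioo (-(16 ^ 2) : ℝ) 0, ∫ x in ball (0 : E3) 16, G x t = ∫ t, ∫ x, G' x t := by
  rw [← integral_indicator measurableSet_Ioo]
  congr 1; ext t
  by_cases ht : t ∈ Ioo (-(16 ^ 2) : ℝ) 0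
  · rw [indicator_of_mem ht]; exact ex_intx (fun x hx => h1 x hx t ht) (fun x hx => h2 x t hx)
  · rw [indicator_of_notMem ht]; simp [h3 _ t ht]

lemma ex_lintx {G G' : E3 → ℝ≥0∞} (h1 : ∀ x ∈ ball (0 : E3) 16, G' x = G x) (h2 : ∀ x ∉ ball (0 : E3) 16, G' x = 0) :
    ∫⁻ x in ball (0 : E3) 16, G x = ∫⁻ x, G' x := by
  rw [← lintegral_indicator measurableSet_ball]
  congr 1; ext x
  by_cases hx : x ∈ ball (0 : E3) 16
  · rw [indicator_of_mem hx, h1 x hx]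
  · rw [indicator_of_notMem hx, h2 x hx]

lemma ex_lint {G G' : E3 → ℝ → ℝ≥0∞} (h1 : ∀ x ∈ ball (0 : E3) 16, ∀ t ∈ Ioo (-(16 ^ 2) : ℝ) 0, G' x t = G x t)
    (h2 : ∀ x t, x ∉ ball (0 : E3) 16 → G' x t = 0) (h3 : ∀ x t, t ∉ Ioo (-(16 ^ 2) : ℝ) 0 → G' x t = 0) :
    ∫⁻ t in Ioo (-(16 ^ 2) : ℝ) 0, ∫⁻ x in ball (0 : E3) 16, G x t = ∫⁻ t, ∫⁻ x, G' x t := by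
  rw [← lintegral_indicator measurableSet_Ioo]
  congr 1; ext t
  by_cases ht : t ∈ Ioo (-(16 ^ 2) : ℝ) 0
  · rw [indicator_of_mem ht]; exact ex_lintx (fun x hx => h1 x hx t ht) (fun x hx => h2 x t hx)
  · rw [indicator_of_notMem ht]; simp [h3 _ t ht]

lemma tf_test {ζ : E3 → ℝ} {θ : ℝ → ℝ} (hζ : TF ζ) (hθ : TI θ) : IsTest 16 (fun x t => θ t * ζ x) := by
  have hsub : tsupport (fun z : E3 × ℝ => θ z.2 * ζ z.1) ⊆ tsupport ζ ×ˢ tsupport θ := by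
    refine closure_minimal (fun z hz => ?_) ((isClosed_tsupport _).prod (isClosed_tsupport _))
    rw [Function.mem_support] at hz
    exact ⟨subset_tsupport _ (right_ne_zero_of_mul hz), subset_tsupport _ (left_ne_zero_of_mul hz)⟩
  refine ⟨?_, ?_, ?_⟩
  · exact (hθ.1.comp contDiff_snd).mul (hζ.1.comp contDiff_fst)
  · exact (hζ.2.1.isCompact.prod hθ.2.1.isCompact).of_isClosed_subset (isClosed_tsupport _) hsub
  · exact hsub.trans (prod_mono hζ.2.2 hθ.2.2)

lemma tf_testV {ζ : Fin 3 → E3 → ℝ} {θ : ℝ → ℝ} (hζ : ∀ i, TF (ζ i)) (hθ : TI θ) : IsTestV 16 (fun x t => WithLp.toLp 2 (fun i => θ t * ζ i x)) := by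
  have hsub : tsupport (fun z : E3 × ℝ => (WithLp.toLp 2 (fun i => θ z.2 * ζ i z.1) : E3)) ⊆ (⋃ i, tsupport (ζ i)) ×ˢ tsupport θ := by
    refine closure_minimal (fun z hz => ?_) ((isClosed_iUnion_of_finite fun i => isClosed_tsupport _).prod (isClosed_tsupport _))
    rw [Function.mem_support] at hz
    by_contra hc
    apply hz
    ext i
    simp only [PiLp.zero_apply]
    by_contra h0
    exact hc ⟨mem_iUnion.2 ⟨i, subset_tsupport _ (right_ne_zero_of_mul h0)⟩, subset_tsupport _ (left_ne_zero_of_mul h0)⟩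
  refine ⟨?_, ?_, ?_⟩
  · rw [contDiff_euclidean]
    intro i
    exact (hθ.1.comp contDiff_snd).mul ((hζ i).1.comp contDiff_fst)
  · exact ((isCompact_iUnion fun i => (hζ i).2.1.isCompact).prod hθ.2.1.isCompact).of_isClosed_subset (isClosed_tsupport _) hsub
  · exact hsub.trans (prod_mono (iUnion_subset fun i => (hζ i).2.2) hθ.2.2)

lemma TF.pd {ζ : E3 → ℝ} (h : TF ζ) (i : Fin 3) : TF (pd i ζ) :=
  ⟨pd_contDiff h.1 i, pd_supp h.2.1 i, (tsupport_fderiv_apply_subset ℝ _).trans h.2.2⟩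

lemma lap_TF {ζ : E3 → ℝ} (h : TF ζ) : TF (lap ζ) := by
  have e : lap ζ = _root_.pd 0 (_root_.pd 0 ζ) + _root_.pd 1 (_root_.pd 1 ζ) + _root_.pd 2 (_root_.pd 2 ζ) := by
    ext x; simp only [lap, Fin.sum_univ_three, Pi.add_apply]
  have h0 := (h.pd 0).pd 0
  have h1 := (h.pd 1).pd 1
  have h2 := (h.pd 2).pd 2
  rw [e]
  refine ⟨(h0.1.add h1.1).add h2.1, (h0.2.1.add h1.2.1).add h2.2.1, ?_⟩
  exact (tsupport_add _ _).trans (union_subset ((tsupport_add _ _).trans (union_subset h0.2.2 h1.2.2)) h2.2.2)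

lemma pd_comm {ζ : E3 → ℝ} (h : ContDiff ℝ (⊤ : ℕ∞) ζ) (i j : Fin 3) : pd i (pd j ζ) = pd j (pd i ζ) := by
  ext x
  have hs : IsSymmSndFDerivAt ℝ ζ x := h.contDiffAt.isSymmSndFDerivAt (by rw [minSmoothness_of_isRCLikeNormedField]; exact WithTop.coe_le_coe.2 (le_top : (2:ℕ∞) ≤ ⊤))
  have hd : Differentiable ℝ (fderiv ℝ ζ) := (h.fderiv_right (m := (⊤:ℕ∞)) (by simp)).differentiable (by simp)
  have e : ∀ i j, pd i (pd j ζ) x = fderiv ℝ (fderiv ℝ ζ) x (EuclideanSpace.single i 1) (EuclideanSpace.single j 1) := fun i j => by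
    unfold pd
    rw [fderiv_clm_apply (hd x) (differentiableAt_const _)]
    simp
  rw [e, e]; exact hs _ _

lemma lap_pd {ζ : E3 → ℝ} (h : ContDiff ℝ (⊤ : ℕ∞) ζ) (i : Fin 3) : lap (pd i ζ) = pd i (lap ζ) := by
  ext x
  have e : lap ζ = (fun y => pd 0 (pd 0 ζ) y + pd 1 (pd 1 ζ) y + pd 2 (pd 2 ζ) y) := by
    ext x; simp only [lap, Fin.sum_univ_three]
  have hd : ∀ j, DifferentiableAt ℝ (pd j (pd j ζ)) x := fun j => (pd_contDiff (pd_contDiff h j) j).differentiable (by simp) x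
  have e2 : pd i (lap ζ) x = pd i (pd 0 (pd 0 ζ)) x + pd i (pd 1 (pd 1 ζ)) x + pd i (pd 2 (pd 2 ζ)) x := by
    rw [e]
    conv_lhs => unfold pd
    have a := fderiv_fun_add ((hd 0).fun_add (hd 1)) (hd 2)
    have b := fderiv_fun_add (hd 0) (hd 1)
    change fderiv ℝ (fun y => pd 0 (pd 0 ζ) y + pd 1 (pd 1 ζ) y + pd 2 (pd 2 ζ) y) x _ = _
    rw [a, b]; rfl
  rw [e2]
  unfold lap
  simp only [Fin.sum_univ_three]
  have e3 : ∀ j, pd j (fun y => pd j (pd i ζ) y) x = pd i (pd j (pd j ζ)) x := fun j => by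
    change pd j (pd j (pd i ζ)) x = _
    rw [pd_comm h j i, pd_comm (pd_contDiff h j) j i]
  rw [e3, e3, e3]

lemma lint2_add {f g : E3 → ℝ → ℝ≥0∞} (hf : Measurable (Function.uncurry f)) :
    ∫⁻ t, ∫⁻ x, (f x t + g x t) = (∫⁻ t, ∫⁻ x, f x t) + ∫⁻ t, ∫⁻ x, g x t := by
  have h1 : Measurable (fun t => ∫⁻ x, f x t) := hf.lintegral_prod_left'
  rw [← lintegral_add_left h1]
  refine lintegral_congr fun t => lintegral_add_left (hf.comp measurable_prodMk_right) _

section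
variable {a : E3 → ℝ → ℝ} {M : E3 → ℝ → ℝ≥0∞} {F : E3 → ℝ}

lemma sl_ix (ha : Measurable (Function.uncurry a)) (haM : ∀ x t, ‖a x t‖ₑ ≤ M x t) (hB : ∀ x t, x ∉ ball (0 : E3) 16 → a x t = 0)
    (hF : Continuous F) {t : ℝ} (ht : ∫⁻ x, M x t < ∞) : Integrable (fun x => a x t * F x) := by
  obtain ⟨c, hc⟩ := cont_bd (ι := Unit) (F := fun _ => F) (fun _ => hF)
  have := sl_bound (ι := Unit) (a := fun _ => a) (fun _ => haM) (fun _ => hB) hc t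
  simp only [Finset.univ_unique, Finset.sum_const, Finset.card_singleton, one_smul] at this
  refine ⟨((ha.comp measurable_prodMk_right).mul hF.measurable).aestronglyMeasurable, this.trans_lt ?_⟩
  finiteness

lemma sl_it (ha : Measurable (Function.uncurry a)) (hMf : ∫⁻ t, ∫⁻ x, M x t ≠ ∞) (haM : ∀ x t, ‖a x t‖ₑ ≤ M x t) (hB : ∀ x t, x ∉ ball (0 : E3) 16 → a x t = 0)
    (hF : Continuous F) {θ : ℝ → ℝ} (hθ : TI θ) : Integrable (fun t => θ t * ∫ x, a x t * F x) := by
  obtain ⟨c, hc⟩ := cont_bd (ι := Unit) (F := fun _ => F) (fun _ => hF)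
  have hb := fun t => sl_bound (ι := Unit) (a := fun _ => a) (fun _ => haM) (fun _ => hB) hc t
  have hm := sl_meas (ι := Unit) (a := fun _ => a) (fun _ => ha) (fun _ => hF)
  simp only [Finset.univ_unique, Finset.sum_const, Finset.card_singleton, one_smul] at hb hm
  have hi : Integrable (fun t => ∫ x, a x t * F x) := by
    refine ⟨hm.aestronglyMeasurable, ?_⟩
    refine lt_of_le_of_lt (lintegral_mono fun t => (enorm_integral_le_lintegral_enorm _).trans (hb t)) ?_
    rw [lintegral_const_mul' _ _ (by finiteness)]
    finiteness
  obtain ⟨C, hC⟩ := hθ.1.continuous.bounded_above_of_compact_support hθ.2.1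
  exact hi.bdd_mul hθ.1.continuous.aestronglyMeasurable (Eventually.of_forall hC)
end

section
variable {u : E3 → ℝ → E3} {P : E3 → ℝ → ℝ}

def MM (u : E3 → ℝ → E3) (g : E3 → ℝ → Fin 3 → Fin 3 → ℝ) (P : E3 → ℝ → ℝ) (x : E3) (t : ℝ) : ℝ≥0∞ :=
  QQ.indicator 1 (x, t) + (‖u x t‖ₑ ^ 2 + (G2 (fun y => g y t) x + ‖P x t‖ₑ ^ (3/2 : ℝ)))


lemma ex_mui (h : SuitableWeakSolution 16 u P) (i : Fin 3) : Measurable (Function.uncurry (fun x t => ex u x t i)) := by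
  have := ex_meas h.meas_u
  exact (by fun_prop : Measurable (fun z : E3 => z i)).comp this
lemma ex_mg (h : SuitableWeakSolution 16 u P) (i j : Fin 3) : Measurable (Function.uncurry (fun x t => ex h.gu x t i j)) :=
  (measurable_pi_apply j).comp ((measurable_pi_apply i).comp (ex_meas h.meas_gu))
lemma ex_mG2 (h : SuitableWeakSolution 16 u P) : Measurable (Function.uncurry (fun x t => G2 (fun y => ex h.gu y t) x)) := by
  have := ex_mg h
  unfold G2
  exact Finset.measurable_sum _ fun i _ => Finset.measurable_sum _ fun j _ => (this i j).enorm.pow_const 2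

lemma ex_uK (h : SuitableWeakSolution 16 u P) : ∀ᵐ t, ∫⁻ x, ‖ex u x t‖ₑ ^ 2 ≤ essSup (fun t => ∫⁻ x in ball (0 : E3) 16, ((‖u x t‖₊ : ℝ≥0∞)) ^ 2) (volume.restrict (Ioo (-(16^2)) 0)) := by
  have h1 := _root_.ae_le_essSup (f := fun t => ∫⁻ x in ball (0 : E3) 16, ((‖u x t‖₊ : ℝ≥0∞)) ^ 2) (μ := volume.restrict (Ioo (-(16^2)) 0))
  rw [ae_restrict_iff' measurableSet_Ioo] at h1
  filter_upwards [h1] with t ht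
  by_cases hI : t ∈ Ioo (-(16^2) : ℝ) 0
  · refine le_trans (le_of_eq ?_) (ht hI)
    exact (ex_lintx (fun x hx => by rw [ex_in hx hI]; rfl) (fun x hx => by rw [ex_x hx]; simp)).symm
  · simp [ex_t hI]

lemma ex_gK (h : SuitableWeakSolution 16 u P) : ∫⁻ t, ∫⁻ x, G2 (fun y => ex h.gu y t) x < ∞ := by
  refine lt_of_le_of_lt (le_of_eq ?_) h.grad_L2
  symm
  refine ex_lint (fun x hx t ht => ?_) (fun x t hx => ?_) (fun x t hx => ?_)
  · rw [ENNReal.ofReal_sum_of_nonneg (fun _ _ => by positivity)]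
    refine Finset.sum_congr rfl fun i _ => ?_
    rw [ENNReal.ofReal_sum_of_nonneg (fun _ _ => by positivity)]
    refine Finset.sum_congr rfl fun j _ => ?_
    beta_reduce
    rw [ex_in hx ht, ← ofReal_norm, ← ENNReal.ofReal_pow (norm_nonneg _), Real.norm_eq_abs, sq_abs]
  · unfold G2; simp [ex_x hx]
  · unfold G2; simp [ex_t hx]

lemma ex_pK (h : SuitableWeakSolution 16 u P) : ∫⁻ t, ∫⁻ x, ‖ex P x t‖ₑ ^ (3/2 : ℝ) < ∞ := by
  refine lt_of_le_of_lt (le_of_eq ?_) h.press_L32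
  symm
  refine ex_lint (fun x hx t ht => ?_) (fun x t hx => ?_) (fun x t hx => ?_)
  · rw [ex_in hx ht, ← ofReal_norm]; rfl
  · simp [ex_x hx]
  · simp [ex_t hx]

lemma MM_meas (h : SuitableWeakSolution 16 u P) : Measurable (Function.uncurry (MM (ex u) (ex h.gu) (ex P))) := by
  have h1 := ex_meas h.meas_u
  have h2 := ex_mG2 h
  have h3 := ex_meas h.meas_press
  exact (measurable_one.indicator QQ_meas).add ((h1.enorm.pow_const 2).add (h2.add (h3.enorm.pow_const _)))

lemma MM_fin (h : SuitableWeakSolution 16 u P) : ∫⁻ t, ∫⁻ x, MM (ex u) (ex h.gu) (ex P) x t ≠ ∞ := by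
  have h1 := ex_meas h.meas_u
  have h2 := ex_mG2 h
  have h3 := ex_meas h.meas_press
  unfold MM
  rw [lint2_add (f := fun x t => QQ.indicator 1 (x, t)) (measurable_one.indicator QQ_meas), lint2_add (f := fun x t => ‖ex u x t‖ₑ ^ 2) (h1.enorm.pow_const 2), lint2_add (f := fun x t => G2 (fun y => ex h.gu y t) x) h2]
  have k1 : ∫⁻ t, ∫⁻ x, QQ.indicator 1 (x, t) ≠ ∞ := by
    have : ∫⁻ t, ∫⁻ x, QQ.indicator (1 : E3 × ℝ → ℝ≥0∞) (x, t) = ∫⁻ t in Ioo (-(16 ^ 2) : ℝ) 0, ∫⁻ x in ball (0 : E3) 16, 1 := by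
      symm
      refine ex_lint (fun x hx t ht => ?_) (fun x t hx => ?_) (fun x t hx => ?_)
      · exact indicator_of_mem (show (x, t) ∈ QQ from ⟨hx, ht⟩) _
      · exact indicator_of_notMem (show (x, t) ∉ QQ from fun hh => hx hh.1) _
      · exact indicator_of_notMem (show (x, t) ∉ QQ from fun hh => hx hh.2) _
    rw [this]
    simp only [lintegral_const, one_mul, Measure.restrict_apply_univ]
    exact ENNReal.mul_ne_top measure_ball_lt_top.ne (by simp)
  have k2 : ∫⁻ t, ∫⁻ x, ‖ex u x t‖ₑ ^ 2 ≠ ∞ := by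
    have hK := h.bdd_L2
    set K := essSup (fun t => ∫⁻ x in ball (0 : E3) 16, ((‖u x t‖₊ : ℝ≥0∞)) ^ 2) (volume.restrict (Ioo (-(16^2)) 0))
    have : ∫⁻ t, ∫⁻ x, ‖ex u x t‖ₑ ^ 2 ≤ ∫⁻ t, (Ioo (-(16 ^ 2) : ℝ) 0).indicator (fun _ => K) t := by
      refine lintegral_mono_ae ?_
      filter_upwards [ex_uK h] with t ht
      by_cases hI : t ∈ Ioo (-(16^2) : ℝ) 0
      · rw [indicator_of_mem hI]; exact ht
      · simp [ex_t hI]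
    rw [lintegral_indicator measurableSet_Ioo, lintegral_const] at this
    exact (this.trans_lt (ENNReal.mul_lt_top hK (by simp))).ne
  exact ENNReal.add_ne_top.2 ⟨k1, ENNReal.add_ne_top.2 ⟨k2, ENNReal.add_ne_top.2 ⟨(ex_gK h).ne, (ex_pK h).ne⟩⟩⟩

lemma le_one_sq (x : ℝ≥0∞) : x ≤ 1 + x ^ 2 := by
  rcases le_total x 1 with hx | hx
  · exact hx.trans le_self_add
  · calc x = x ^ 1 := (pow_one x).symm
      _ ≤ x ^ 2 := pow_le_pow_right₀ hx (by norm_num)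
      _ ≤ _ := le_add_self
lemma le_one_32 (x : ℝ≥0∞) : x ≤ 1 + x ^ (3/2:ℝ) := by
  rcases le_total x 1 with hx | hx
  · exact hx.trans le_self_add
  · calc x = x ^ (1:ℝ) := (ENNReal.rpow_one x).symm
      _ ≤ x ^ (3/2:ℝ) := ENNReal.rpow_le_rpow_of_exponent_le hx (by norm_num)
      _ ≤ _ := le_add_self

lemma M_ui (h : SuitableWeakSolution 16 u P) (i : Fin 3) (x : E3) (t : ℝ) : ‖ex u x t i‖ₑ ≤ MM (ex u) (ex h.gu) (ex P) x t := by
  by_cases hh : (x, t) ∈ QQ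
  · refine (enorm_coord_le _ i).trans ((le_one_sq _).trans ?_)
    unfold MM; rw [indicator_of_mem hh]
    exact add_le_add le_rfl le_self_add
  · rw [ex_out (fun k => hh k)]; simp
lemma M_uij (h : SuitableWeakSolution 16 u P) (i j : Fin 3) (x : E3) (t : ℝ) : ‖ex u x t i * ex u x t j‖ₑ ≤ MM (ex u) (ex h.gu) (ex P) x t := by
  rw [enorm_mul]
  refine (mul_le_mul' (enorm_coord_le _ i) (enorm_coord_le _ j)).trans ?_
  rw [← sq]; unfold MM
  exact le_self_add.trans le_add_self
lemma M_g (h : SuitableWeakSolution 16 u P) (i j : Fin 3) (x : E3) (t : ℝ) : ‖ex h.gu x t i j‖ₑ ≤ MM (ex u) (ex h.gu) (ex P) x t := by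
  by_cases hh : (x, t) ∈ QQ
  · refine (le_one_sq _).trans ?_
    unfold MM; rw [indicator_of_mem hh]
    refine add_le_add le_rfl (le_trans (le_trans ?_ le_self_add) le_add_self)
    rw [← G1_sq]
    exact pow_le_pow_left' (le_G1 (fun y => ex h.gu y t) x i j) 2
  · rw [ex_out (fun k => hh k)]; simp
lemma M_p (h : SuitableWeakSolution 16 u P) (x : E3) (t : ℝ) : ‖ex P x t‖ₑ ≤ MM (ex u) (ex h.gu) (ex P) x t := by
  by_cases hh : (x, t) ∈ QQ
  · refine (le_one_32 _).trans ?_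
    unfold MM; rw [indicator_of_mem hh]
    exact add_le_add le_rfl (le_add_self.trans le_add_self)
  · rw [ex_out (fun k => hh k)]; simp
end

lemma TF.c {ζ : E3 → ℝ} (h : TF ζ) : Continuous ζ := h.1.continuous
lemma pd_cmul (c : ℝ) (f : E3 → ℝ) (i : Fin 3) (x : E3) : pd i (fun y => c * f y) x = c * pd i f x := by
  unfold pd
  have := congrFun (fderiv_const_smul_field (𝕜 := ℝ) c (f := f)) x
  change fderiv ℝ (c • f) x _ = _
  rw [this]; simp
lemma lap_cmul (c : ℝ) (f : E3 → ℝ) (x : E3) : lap (fun y => c * f y) x = c * lap f x := by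
  unfold lap
  rw [Finset.mul_sum]
  refine Finset.sum_congr rfl fun i _ => ?_
  rw [← pd_cmul]; congr 1; ext y; rw [pd_cmul]

section
variable {u : E3 → ℝ → E3} {P : E3 → ℝ → ℝ}

lemma sl_grad (h : SuitableWeakSolution 16 u P) (i j : Fin 3) :
    ∀ᵐ t, ∀ ζ, TF ζ → ∫ x, ex u x t i * pd j ζ x = - ∫ x, ex h.gu x t i j * ζ x := by
  have hmf : ∀ᵐ t, ∫⁻ x, MM (ex u) (ex h.gu) (ex P) x t < ∞ := ae_lt_top ((MM_meas h).lintegral_prod_left') (MM_fin h)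
  have b1 : ∀ x t, x ∉ ball (0 : E3) 16 → ex u x t i = 0 := fun x t hx => by rw [ex_x hx]; rfl
  have b2 : ∀ x t, x ∉ ball (0 : E3) 16 → ex h.gu x t i j = 0 := fun x t hx => by rw [ex_x hx]; rfl
  have c1 : ∀ x t, t ∉ Ioo (-(16 ^ 2) : ℝ) 0 → ex u x t i = 0 := fun x t hx => by rw [ex_t hx]; rfl
  have c2 : ∀ x t, t ∉ Ioo (-(16 ^ 2) : ℝ) 0 → ex h.gu x t i j = 0 := fun x t hx => by rw [ex_t hx]; rfl
  have key := ae_slice (ι := Fin 2) (a := ![fun x t => ex u x t i, fun x t => ex h.gu x t i j]) (D := ![fun ζ => pd j ζ, fun ζ => ζ]) (M := MM (ex u) (ex h.gu) (ex P))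
    (by rw [Fin.forall_fin_two]; exact ⟨ex_mui h i, ex_mg h i j⟩) (MM_meas h) (MM_fin h)
    (by rw [Fin.forall_fin_two]; exact ⟨M_ui h i, M_g h i j⟩)
    (by rw [Fin.forall_fin_two]; exact ⟨b1, b2⟩) (by rw [Fin.forall_fin_two]; exact ⟨c1, c2⟩)
    (fun ζ hζ => by rw [Fin.forall_fin_two]; exact ⟨(hζ.pd j).c, hζ.c⟩) (fun ζ hζ θ hθ => by
      simp only [Fin.sum_univ_two, Matrix.cons_val_zero, Matrix.cons_val_one]
      have i1 := sl_it (ex_mui h i) (MM_fin h) (M_ui h i) b1 (hζ.pd j).c hθ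
      have i2 := sl_it (ex_mg h i j) (MM_fin h) (M_g h i j) b2 hζ.c hθ
      have e : (fun t => θ t * ∫ x, (ex u x t i * pd j ζ x + ex h.gu x t i j * ζ x)) =ᵐ[volume] fun t => θ t * (∫ x, ex u x t i * pd j ζ x) + θ t * ∫ x, ex h.gu x t i j * ζ x := by
        filter_upwards [hmf] with t ht
        rw [integral_add (sl_ix (ex_mui h i) (M_ui h i) b1 (hζ.pd j).c ht) (sl_ix (ex_mg h i j) (M_g h i j) b2 hζ.c ht), mul_add]
      rw [integral_congr_ae e, integral_add i1 i2]
      have hg := h.is_grad _ (tf_test hζ hθ) i j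
      rw [ex_int (G' := fun x t => θ t * (ex u x t i * pd j ζ x)) (fun x hx t ht => by rw [ex_in hx ht]; rw [pd_cmul]; ring) (fun x t hx => by rw [b1 x t hx]; ring) (fun x t hx => by rw [c1 x t hx]; ring),
        ex_int (G := fun x t => h.gu x t i j * (θ t * ζ x)) (G' := fun x t => θ t * (ex h.gu x t i j * ζ x)) (fun x hx t ht => by rw [ex_in hx ht]; ring) (fun x t hx => by rw [b2 x t hx]; ring) (fun x t hx => by rw [c2 x t hx]; ring)] at hg
      simp only [integral_const_mul] at hg
      rw [hg]; ring)
  filter_upwards [key, hmf] with t ht hm ζ hζ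
  have := ht ζ hζ
  simp only [Fin.sum_univ_two, Matrix.cons_val_zero, Matrix.cons_val_one] at this
  rw [integral_add (sl_ix (ex_mui h i) (M_ui h i) b1 (hζ.pd j).c hm) (sl_ix (ex_mg h i j) (M_g h i j) b2 hζ.c hm)] at this
  linarith

lemma sl_div (h : SuitableWeakSolution 16 u P) :
    ∀ᵐ t, ∀ ζ, TF ζ → ∫ x, ∑ i, ex u x t i * pd i ζ x = 0 := by
  have b1 : ∀ i x t, x ∉ ball (0 : E3) 16 → ex u x t i = 0 := fun i x t hx => by rw [ex_x hx]; rfl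
  have c1 : ∀ i x t, t ∉ Ioo (-(16 ^ 2) : ℝ) 0 → ex u x t i = 0 := fun i x t hx => by rw [ex_t hx]; rfl
  refine ae_slice (a := fun i x t => ex u x t i) (D := fun i ζ => pd i ζ) (M := MM (ex u) (ex h.gu) (ex P)) (ex_mui h) (MM_meas h) (MM_fin h) (M_ui h) b1 c1
    (fun ζ hζ i => (hζ.pd i).c) (fun ζ hζ θ hθ => ?_)
  have hg := h.weak_div _ (tf_test hζ hθ)
  rw [ex_int (G' := fun x t => θ t * (∑ i, ex u x t i * pd i ζ x)) (fun x hx t ht => by simp only [ex_in hx ht, pd_cmul, Fin.sum_univ_three]; ring)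
    (fun x t hx => by simp [b1 _ x t hx]) (fun x t hx => by simp [c1 _ x t hx])] at hg
  simpa only [integral_const_mul] using hg

lemma sl_press (h : SuitableWeakSolution 16 u P) :
    ∀ᵐ t, ∀ ζ, TF ζ → ∫ x, ((∑ i, ∑ j, ex u x t i * ex u x t j * pd i (pd j ζ) x) + ex P x t * lap ζ x) = 0 := by
  have hmf : ∀ᵐ t, ∫⁻ x, MM (ex u) (ex h.gu) (ex P) x t < ∞ := ae_lt_top ((MM_meas h).lintegral_prod_left') (MM_fin h)
  have b1 : ∀ i x t, x ∉ ball (0 : E3) 16 → ex u x t i = 0 := fun i x t hx => by rw [ex_x hx]; rfl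
  have c1 : ∀ i x t, t ∉ Ioo (-(16 ^ 2) : ℝ) 0 → ex u x t i = 0 := fun i x t hx => by rw [ex_t hx]; rfl
  have bp : ∀ x t, x ∉ ball (0 : E3) 16 → ex P x t = 0 := fun x t hx => ex_x hx
  have cp : ∀ x t, t ∉ Ioo (-(16 ^ 2) : ℝ) 0 → ex P x t = 0 := fun x t hx => ex_t hx
  let a : Option (Fin 3 × Fin 3) → E3 → ℝ → ℝ := fun k => k.elim (ex P) (fun ij x t => ex u x t ij.1 * ex u x t ij.2)
  let D : Option (Fin 3 × Fin 3) → (E3 → ℝ) → E3 → ℝ := fun k => k.elim lap (fun ij ζ => pd ij.1 (pd ij.2 ζ))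
  have ha : ∀ k, Measurable (Function.uncurry (a k)) := by
    rintro (_ | ⟨i, j⟩)
    · exact ex_meas h.meas_press
    · exact (ex_mui h i).mul (ex_mui h j)
  have haM : ∀ k x t, ‖a k x t‖ₑ ≤ MM (ex u) (ex h.gu) (ex P) x t := by
    rintro (_ | ⟨i, j⟩)
    · exact M_p h
    · exact M_uij h i j
  have hB : ∀ k x t, x ∉ ball (0 : E3) 16 → a k x t = 0 := by
    rintro (_ | ⟨i, j⟩) x t hx
    · exact bp x t hx
    · show ex u x t i * ex u x t j = 0
      rw [b1 i x t hx, zero_mul]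
  have hI : ∀ k x t, t ∉ Ioo (-(16 ^ 2) : ℝ) 0 → a k x t = 0 := by
    rintro (_ | ⟨i, j⟩) x t hx
    · exact cp x t hx
    · show ex u x t i * ex u x t j = 0
      rw [c1 i x t hx, zero_mul]
  have hD : ∀ ζ, TF ζ → ∀ k, Continuous (D k ζ) := by
    rintro ζ hζ (_ | ⟨i, j⟩)
    · exact (lap_TF hζ).c
    · exact ((hζ.pd j).pd i).c
  have hsum : ∀ ζ x t, ∑ k, a k x t * D k ζ x = (∑ i, ∑ j, ex u x t i * ex u x t j * pd i (pd j ζ) x) + ex P x t * lap ζ x := fun ζ x t => by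
    rw [Fintype.sum_option, Fintype.sum_prod_type, add_comm]
    rfl
  have key := ae_slice (a := a) (D := D) (M := MM (ex u) (ex h.gu) (ex P)) ha (MM_meas h) (MM_fin h) haM hB hI hD (fun ζ hζ θ hθ => by
    simp only [hsum]
    have hg := h.weak_NS _ (tf_testV (ζ := fun i => pd i ζ) (fun i => hζ.pd i) hθ)
    rw [ex_int (G' := fun x t => -(deriv θ t * (∑ i, ex u x t i * pd i ζ x) + θ t * (∑ i, ex u x t i * pd i (lap ζ) x) + θ t * ((∑ i, ∑ j, ex u x t i * ex u x t j * pd i (pd j ζ) x) + ex P x t * lap ζ x)))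
      (fun x hx t ht => by
        have e1 : ∀ i, deriv (fun s => θ s * pd i ζ x) t = deriv θ t * pd i ζ x := fun i => deriv_mul_const ((hθ.1.differentiable (by simp)) t) _
        have e2 : ∀ i, lap (fun y => θ t * pd i ζ y) x = θ t * pd i (lap ζ) x := fun i => by rw [lap_cmul, lap_pd hζ.1]
        have e4 : lap ζ x = ∑ j, pd j (pd j ζ) x := rfl
        simp only [e1, e2, e4, pd_cmul, ex_in hx ht, Fin.sum_univ_three]
        ring)
      (fun x t hx => by simp [b1 _ x t hx, bp x t hx]) (fun x t hx => by simp [c1 _ x t hx, cp x t hx])] at hg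
    rw [← neg_eq_zero, ← hg, ← integral_neg]
    refine integral_congr_ae ?_
    filter_upwards [hmf, sl_div h] with t ht hdiv
    have i1 : ∀ η, TF η → Integrable (fun x => ∑ i, ex u x t i * pd i η x) := fun η hη => integrable_finsetSum _ fun i _ => sl_ix (ex_mui h i) (M_ui h i) (b1 i) (hη.pd i).c ht
    have i3 : Integrable (fun x => (∑ i, ∑ j, ex u x t i * ex u x t j * pd i (pd j ζ) x) + ex P x t * lap ζ x) := by
      simp only [← hsum]
      exact integrable_finsetSum _ fun k _ => sl_ix (ha k) (haM k) (hB k) (hD ζ hζ k) ht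
    rw [integral_neg, integral_add (((i1 ζ hζ).const_mul _).fun_add ((i1 _ (lap_TF hζ)).const_mul _)) (i3.const_mul _),
      integral_add ((i1 ζ hζ).const_mul _) ((i1 _ (lap_TF hζ)).const_mul _), integral_const_mul, integral_const_mul, integral_const_mul, hdiv ζ hζ, hdiv _ (lap_TF hζ)]
    ring)
  simpa only [hsum] using key
end

/-- working notion of solution on the cylinder of radius 16 -/
structure Sol (u : E3 → ℝ → E3) (g : E3 → ℝ → Fin 3 → Fin 3 → ℝ) (P : E3 → ℝ → ℝ) (K ε : ℝ≥0∞) : Prop where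
  mu : Measurable (Function.uncurry u)
  mG : Measurable (Function.uncurry (fun x t => G2 (fun y => g y t) x))
  mp : Measurable (Function.uncurry P)
  Kt : K ≠ ∞
  sl : ∀ᵐ t, Slice (fun x => u x t) (fun x => g x t) (fun x => P x t)
  uK : ∀ᵐ t, ∫⁻ x, ‖u x t‖ₑ ^ 2 ≤ K
  gK : ∫⁻ t, ∫⁻ x, G2 (fun y => g y t) x ≤ K
  pK : ∫⁻ t, ∫⁻ x, ‖P x t‖ₑ ^ (3/2 : ℝ) ≤ K
  en : ∀ φ : E3 → ℝ → ℝ, IsTest 16 φ → (∀ x t, 0 ≤ φ x t) → ∀ᵐ t, t ∈ Ioo (-(16 ^ 2) : ℝ) 0 →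
    (∫⁻ x, ‖u x t‖ₑ ^ 2 * ENNReal.ofReal (φ x t)) + 2 * ∫⁻ s in Iio t, ∫⁻ x, G2 (fun y => g y s) x * ENNReal.ofReal (φ x s) ≤
      (∫⁻ s in Iio t, ∫⁻ x, ‖u x s‖ₑ ^ 2 * ‖deriv (fun τ => φ x τ) s + lap (fun y => φ y s) x‖ₑ) +
      ∫⁻ s in Iio t, ‖∫ x, (‖u x s‖ ^ 2 + 2 * P x s) * vphi (fun y => u y s) (fun y => φ y s) x‖ₑ
  tr : ∀ᵐ t, ∀ f : E3 → ℝ, ContDiff ℝ 1 f → HasCompactSupport f → ∫⁻ x, ‖u x t‖ₑ * ‖f x‖ₑ ≤ ε * ∫⁻ x, ‖fderiv ℝ f x‖ₑ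

lemma lint_iter {f : E3 → ℝ → ℝ} (μ : Measure ℝ) [SFinite μ] (ν : Measure E3) [SFinite ν] (hf : Measurable (Function.uncurry f)) (h0 : ∀ x t, 0 ≤ f x t)
    (hfin : ∫⁻ t, ∫⁻ x, ENNReal.ofReal (f x t) ∂ν ∂μ ≠ ∞) :
    ENNReal.ofReal (∫ t, ∫ x, f x t ∂ν ∂μ) = ∫⁻ t, ∫⁻ x, ENNReal.ofReal (f x t) ∂ν ∂μ := by
  have hm : Measurable (fun t => ∫⁻ x, ENNReal.ofReal (f x t) ∂ν) := (hf.ennreal_ofReal).lintegral_prod_left'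
  have e : ∀ t, ∫ x, f x t ∂ν = (∫⁻ x, ENNReal.ofReal (f x t) ∂ν).toReal := fun t =>
    integral_eq_lintegral_of_nonneg_ae (Eventually.of_forall fun x => h0 x t) (hf.comp measurable_prodMk_right).aestronglyMeasurable
  simp only [e]
  rw [integral_toReal hm.aemeasurable (ae_lt_top hm hfin), ENNReal.ofReal_toReal hfin]

section
variable {u : E3 → ℝ → E3} {P : E3 → ℝ → ℝ}

lemma G2_ofReal (g : E3 → Fin 3 → Fin 3 → ℝ) (x : E3) : ENNReal.ofReal (∑ i, ∑ j, (g x i j) ^ 2) = G2 g x := by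
  unfold G2
  rw [ENNReal.ofReal_sum_of_nonneg (fun _ _ => by positivity)]
  refine Finset.sum_congr rfl fun i _ => ?_
  rw [ENNReal.ofReal_sum_of_nonneg (fun _ _ => by positivity)]
  refine Finset.sum_congr rfl fun j _ => ?_
  rw [← ofReal_norm, ← ENNReal.ofReal_pow (norm_nonneg _), Real.norm_eq_abs, sq_abs]

lemma sol_en (h : SuitableWeakSolution 16 u P) (φ : E3 → ℝ → ℝ) (hφ : IsTest 16 φ) (hp : ∀ x t, 0 ≤ φ x t) : ∀ᵐ t, t ∈ Ioo (-(16 ^ 2) : ℝ) 0 →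
    (∫⁻ x, ‖ex u x t‖ₑ ^ 2 * ENNReal.ofReal (φ x t)) + 2 * ∫⁻ s in Iio t, ∫⁻ x, G2 (fun y => ex h.gu y s) x * ENNReal.ofReal (φ x s) ≤
      (∫⁻ s in Iio t, ∫⁻ x, ‖ex u x s‖ₑ ^ 2 * ‖deriv (fun τ => φ x τ) s + lap (fun y => φ y s) x‖ₑ) +
      ∫⁻ s in Iio t, ‖∫ x, (‖ex u x s‖ ^ 2 + 2 * ex P x s) * vphi (fun y => ex u y s) (fun y => φ y s) x‖ₑ := by
  obtain ⟨Cφ, hC⟩ := hφ.1.continuous.bounded_above_of_compact_support hφ.2.1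
  have hC' : ∀ x t, φ x t ≤ Cφ := fun x t => (le_abs_self _).trans (hC (x, t))
  have mφ : Measurable (Function.uncurry φ) := hφ.1.continuous.measurable
  have h1 := h.local_energy φ hφ hp
  rw [ae_restrict_iff' measurableSet_Ioo] at h1
  filter_upwards [h1, ex_uK h] with t h1 hu hI
  have hsub : ∀ s ∈ Ioo (-(16^2) : ℝ) t, s ∈ Ioo (-(16^2) : ℝ) 0 := fun s hs => ⟨hs.1, hs.2.trans hI.2⟩
  have hIsub : Ioo (-(16^2) : ℝ) t ⊆ Iio t := fun s hs => hs.2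
  have h2 := ENNReal.ofReal_le_ofReal (h1 hI)
  -- left-hand side
  have eA : ∫⁻ x, ‖ex u x t‖ₑ ^ 2 * ENNReal.ofReal (φ x t) = ENNReal.ofReal (∫ x in ball (0 : E3) 16, ‖u x t‖ ^ 2 * φ x t) := by
    have e0 : ∀ x, ‖ex u x t‖ₑ ^ 2 * ENNReal.ofReal (φ x t) = ENNReal.ofReal (‖ex u x t‖ ^ 2 * φ x t) := fun x => by
      rw [ENNReal.ofReal_mul (by positivity), ENNReal.ofReal_pow (norm_nonneg _), ofReal_norm]
    rw [ex_intx (G' := fun x => ‖ex u x t‖ ^ 2 * φ x t) (fun x hx => by rw [ex_in hx hI]) (fun x hx => by rw [ex_x hx]; simp)]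
    rw [integral_eq_lintegral_of_nonneg_ae (Eventually.of_forall fun x => mul_nonneg (by positivity) (hp x t)), ENNReal.ofReal_toReal]
    · exact lintegral_congr e0
    · have hlt := ENNReal.mul_lt_top (ENNReal.ofReal_lt_top (r := Cφ)) (hu.trans_lt h.bdd_L2)
      rw [← lintegral_const_mul' _ _ ENNReal.ofReal_ne_top] at hlt
      refine ne_of_lt (lt_of_le_of_lt (lintegral_mono fun x => ?_) hlt)
      beta_reduce
      rw [← e0, mul_comm]
      exact mul_le_mul' (ENNReal.ofReal_le_ofReal (hC' x t)) le_rfl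
    · have m1 := (ex_meas h.meas_u).comp (measurable_prodMk_right (y := t))
      exact ((m1.norm.pow_const 2).mul (mφ.comp (measurable_prodMk_right (y := t)))).aestronglyMeasurable
  have eB : ∫⁻ s in Iio t, ∫⁻ x, G2 (fun y => ex h.gu y s) x * ENNReal.ofReal (φ x s) = ENNReal.ofReal (∫ s in Ioo (-(16^2) : ℝ) t, ∫ x in ball (0 : E3) 16, (∑ i : Fin 3, ∑ j : Fin 3, (h.gu x s i j) ^ 2) * φ x s) := by
    have e0 : ∫⁻ s in Iio t, ∫⁻ x, G2 (fun y => ex h.gu y s) x * ENNReal.ofReal (φ x s) = ∫⁻ s in Ioo (-(16^2) : ℝ) t, ∫⁻ x in ball (0 : E3) 16, ENNReal.ofReal ((∑ i : Fin 3, ∑ j : Fin 3, (h.gu x s i j) ^ 2) * φ x s) := by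
      rw [← lintegral_indicator measurableSet_Ioo, ← lintegral_indicator measurableSet_Iio]
      congr 1; ext s
      by_cases hs : s ∈ Ioo (-(16^2) : ℝ) t
      · rw [indicator_of_mem hs, indicator_of_mem (hIsub hs)]
        symm
        refine ex_lintx (fun x hx => ?_) (fun x hx => ?_)
        · rw [ENNReal.ofReal_mul (Finset.sum_nonneg fun i _ => Finset.sum_nonneg fun j _ => sq_nonneg _), G2_ofReal (fun y => h.gu y s)]
          unfold G2; beta_reduce; rw [ex_in hx (hsub s hs)]
        · unfold G2; simp [ex_x hx]
      · rw [indicator_of_notMem hs]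
        by_cases hs2 : s ∈ Iio t
        · rw [indicator_of_mem hs2]
          have : s ∉ Ioo (-(16^2) : ℝ) 0 := fun hh => hs ⟨hh.1, hs2⟩
          unfold G2; simp [ex_t this]
        · rw [indicator_of_notMem hs2]
    rw [e0, ← lint_iter]
    · have hg : ∀ i j, Measurable (fun z : E3 × ℝ => h.gu z.1 z.2 i j) := fun i j => (measurable_pi_apply j).comp ((measurable_pi_apply i).comp h.meas_gu)
      exact (Finset.measurable_sum _ fun i _ => Finset.measurable_sum _ fun j _ => (hg i j).pow_const 2).mul mφ
    · exact fun x s => mul_nonneg (Finset.sum_nonneg fun i _ => Finset.sum_nonneg fun j _ => sq_nonneg _) (hp x s)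
    · rw [← e0]
      refine ne_of_lt (lt_of_le_of_lt (setLIntegral_le_lintegral _ _) (lt_of_le_of_lt (lintegral_mono fun s => lintegral_mono fun x => mul_le_mul' le_rfl (ENNReal.ofReal_le_ofReal (hC' x s))) ?_))
      simp_rw [lintegral_mul_const' _ _ (ENNReal.ofReal_ne_top (r := Cφ))]
      exact ENNReal.mul_lt_top (ex_gK h) ENNReal.ofReal_lt_top
  rw [ENNReal.ofReal_add, ENNReal.ofReal_mul (p := 2) (by norm_num), ← eA, ← eB, ENNReal.ofReal_ofNat] at h2
  rotate_left
  · exact setIntegral_nonneg measurableSet_ball fun x _ => mul_nonneg (by positivity) (hp x t)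
  · refine mul_nonneg (by norm_num) (setIntegral_nonneg measurableSet_Ioo fun s _ => setIntegral_nonneg measurableSet_ball fun x _ => mul_nonneg (Finset.sum_nonneg fun i _ => Finset.sum_nonneg fun j _ => sq_nonneg _) (hp x s))
  refine h2.trans (ENNReal.ofReal_add_le.trans (add_le_add ?_ ?_))
  · refine (Real.ofReal_le_enorm _).trans ((enorm_integral_le_lintegral_enorm _).trans (le_trans ?_ (lintegral_mono_set hIsub)))
    refine setLIntegral_mono' measurableSet_Ioo fun s hs => (enorm_integral_le_lintegral_enorm _).trans ?_
    refine le_of_eq (ex_lintx (fun x hx => ?_) (fun x hx => by rw [ex_x hx]; simp))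
    rw [ex_in hx (hsub s hs), enorm_mul, enorm_pow, enorm_norm]
  · refine (Real.ofReal_le_enorm _).trans ((enorm_integral_le_lintegral_enorm _).trans (le_trans ?_ (lintegral_mono_set hIsub)))
    refine setLIntegral_mono' measurableSet_Ioo fun s hs => le_of_eq ?_
    congr 1
    refine ex_intx (fun x hx => ?_) (fun x hx => ?_)
    · unfold vphi; beta_reduce; simp only [ex_in hx (hsub s hs)]; ring
    · unfold vphi; simp [ex_x hx]

lemma sec_meas {β : Type*} [MeasurableSpace β] {f : E3 → ℝ → β} (hf : Measurable (Function.uncurry f)) (t : ℝ) : Measurable (fun x => f x t) := by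
  have mm : Measurable (fun x : E3 => (x, t)) := measurable_prodMk_right
  exact hf.comp mm

lemma sol_s1 (h : SuitableWeakSolution 16 u P) : ∀ᵐ t, ∀ i j, ∀ ζ, TF ζ → ∫ x, ex u x t i * pd j ζ x = - ∫ x, ex h.gu x t i j * ζ x := by
      rw [ae_all_iff]; intro i; rw [ae_all_iff]; intro j; exact sl_grad h i j
lemma sol_s2 (h : SuitableWeakSolution 16 u P) : ∀ᵐ t, ∫⁻ x, G2 (fun y => ex h.gu y t) x < ∞ := ae_lt_top (ex_mG2 h).lintegral_prod_left' (ex_gK h).ne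
lemma sol_s3 (h : SuitableWeakSolution 16 u P) : ∀ᵐ t, ∫⁻ x, ‖ex P x t‖ₑ ^ (3/2 : ℝ) < ∞ := by
  have m : Measurable (fun z : E3 × ℝ => ‖ex P z.1 z.2‖ₑ ^ (3/2 : ℝ)) := (ex_meas h.meas_press).enorm.pow_const _
  exact ae_lt_top m.lintegral_prod_left' (ex_pK h).ne

lemma sol_sl (h : SuitableWeakSolution 16 u P) : ∀ᵐ t, Slice (fun x => ex u x t) (fun x => ex h.gu x t) (fun x => ex P x t) := by
  filter_upwards [sol_s1 h, sl_div h, sl_press h, ex_uK h, sol_s2 h, sol_s3 h] with t k1 k2 k3 k4 k5 k6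
  have a1 : Measurable (fun x => ex u x t) := sec_meas (ex_meas h.meas_u) t
  have a2 : Measurable (fun x => ex h.gu x t) := sec_meas (ex_meas h.meas_gu) t
  have a3 : Measurable (fun x => ex P x t) := sec_meas (ex_meas h.meas_press) t
  have k4' := k4.trans_lt h.bdd_L2
  exact ⟨a1, a2, a3, fun x hx => ex_x hx, fun x hx => ex_x hx, fun x hx => ex_x hx, k4', k5, k6, fun i ζ a b c j => k1 i j ζ ⟨a, b, c⟩, fun ζ a b c => k2 ζ ⟨a, b, c⟩, fun ζ a b c => k3 ζ ⟨a, b, c⟩⟩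

lemma sol_of (h : SuitableWeakSolution 16 u P) {ε : ℝ≥0∞} (tr : ∀ᵐ t, ∀ f : E3 → ℝ, ContDiff ℝ 1 f → HasCompactSupport f → ∫⁻ x, ‖ex u x t‖ₑ * ‖f x‖ₑ ≤ ε * ∫⁻ x, ‖fderiv ℝ f x‖ₑ) :
    ∃ K, Sol (ex u) (ex h.gu) (ex P) K ε := by
  refine ⟨essSup (fun t => ∫⁻ x in ball (0 : E3) 16, ((‖u x t‖₊ : ℝ≥0∞)) ^ 2) (volume.restrict (Ioo (-(16^2)) 0)) + (∫⁻ t, ∫⁻ x, G2 (fun y => ex h.gu y t) x) + ∫⁻ t, ∫⁻ x, ‖ex P x t‖ₑ ^ (3/2 : ℝ),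
    ex_meas h.meas_u, ex_mG2 h, ex_meas h.meas_press, ?_, ?_, ?_, ?_, ?_, sol_en h, tr⟩
  · exact ENNReal.add_ne_top.2 ⟨ENNReal.add_ne_top.2 ⟨h.bdd_L2.ne, (ex_gK h).ne⟩, (ex_pK h).ne⟩
  · exact sol_sl h
  · filter_upwards [ex_uK h] with t ht
    exact ht.trans (by rw [add_assoc]; exact le_self_add)
  · exact le_add_self.trans le_self_add
  · exact le_add_self
end

/-! ### the backward heat kernel test function -/

lemma ee_gen {σ τ β : ℝ} (hσ : 0 < σ) (hτ : 0 ≤ τ) (hβ : β ≤ 3) :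
    σ ^ (-β) * Real.exp (-τ / (4 * σ)) ≤ 1728 * (τ + σ) ^ (-β) := by
  have hz : 0 ≤ τ / σ := by positivity
  set z := τ / σ with hzd
  have e1 : τ + σ = σ * (1 + z) := by rw [hzd]; field_simp; ring
  have e2 : -τ / (4 * σ) = -(z / 4) := by rw [hzd]; field_simp
  rw [e1, e2, Real.mul_rpow hσ.le (by positivity), mul_left_comm]
  refine mul_le_mul_of_nonneg_left ?_ (by positivity)
  have h1 : (1 + z) ^ (-3 : ℝ) ≤ (1 + z) ^ (-β) := Real.rpow_le_rpow_of_exponent_le (by linarith) (by linarith)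
  have h2 : (1 + z) ^ (-3 : ℝ) = ((1 + z) ^ 3)⁻¹ := by
    rw [Real.rpow_neg (by positivity)]; norm_cast
  have h3 : ((1 + z) / 12) ^ 3 ≤ Real.exp (z / 4) := by
    have : Real.exp (z / 4) = Real.exp (z / 12) ^ 3 := by rw [← Real.exp_nat_mul]; congr 1; push_cast; ring
    rw [this]
    exact pow_le_pow_left₀ (by positivity) (by have := Real.add_one_le_exp (z / 12); linarith) 3
  rw [Real.exp_neg]
  calc (Real.exp (z / 4))⁻¹ ≤ (((1 + z) / 12) ^ 3)⁻¹ := inv_anti₀ (by positivity) h3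
    _ = 1728 * (1 + z) ^ (-3 : ℝ) := by rw [h2]; field_simp; norm_num
    _ ≤ _ := by linarith

def EE (σ τ : ℝ) : ℝ := σ ^ (-(3/2) : ℝ) * Real.exp (-τ / (4 * σ))

lemma EE_nonneg {σ τ : ℝ} (hσ : 0 < σ) : 0 ≤ EE σ τ := by unfold EE; positivity
lemma EE_le {σ τ : ℝ} (hσ : 0 < σ) (hτ : 0 ≤ τ) : EE σ τ ≤ 1728 * (τ + σ) ^ (-(3/2) : ℝ) := ee_gen hσ hτ (by norm_num)
lemma EE_le' {σ τ : ℝ} (hσ : 0 < σ) (hτ : 0 ≤ τ) : EE σ τ / (4 * σ) ≤ 1728 * (τ + σ) ^ (-(5/2) : ℝ) := by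
  have h := ee_gen (β := 5/2) hσ hτ (by norm_num)
  have e : EE σ τ / (4 * σ) = σ ^ (-(5/2) : ℝ) * Real.exp (-τ / (4 * σ)) / 4 := by
    unfold EE
    have : σ ^ (-(5/2) : ℝ) = σ ^ (-(3/2) : ℝ) / σ := by
      rw [← Real.rpow_sub_one hσ.ne']; norm_num
    rw [this]; field_simp
  have : 0 ≤ σ ^ (-(5/2) : ℝ) * Real.exp (-τ / (4 * σ)) := by positivity
  rw [e]; linarith

lemma EE_dτ (σ τ : ℝ) : HasDerivAt (fun τ => EE σ τ) (-(EE σ τ / (4 * σ))) τ := by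
  unfold EE
  have h1 : HasDerivAt (fun τ : ℝ => -τ / (4 * σ)) (-1 / (4 * σ)) τ := ((hasDerivAt_id τ).neg).div_const _
  have h2 := (h1.exp).const_mul (σ ^ (-(3/2) : ℝ))
  refine h2.congr_deriv ?_
  ring

lemma EE_dσ {σ : ℝ} (τ : ℝ) (hσ : 0 < σ) : HasDerivAt (fun σ => EE σ τ) ((-(3 / (2 * σ)) + τ / (4 * σ ^ 2)) * EE σ τ) σ := by
  unfold EE
  have h1 : HasDerivAt (fun σ : ℝ => -τ / (4 * σ)) (τ / (4 * σ ^ 2)) σ := by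
    have := ((hasDerivAt_id σ).const_mul 4).inv (by simpa using hσ.ne') |>.const_mul (-τ)
    simp only [id, mul_one] at this
    refine (this.congr_deriv ?_).congr_of_eventuallyEq (Eventually.of_forall fun s => by simp [div_eq_mul_inv])
    field_simp
  have h2 : HasDerivAt (fun σ : ℝ => σ ^ (-(3/2) : ℝ)) (-(3/2) * σ ^ (-(3/2) - 1 : ℝ)) σ := Real.hasDerivAt_rpow_const (Or.inl hσ.ne')
  refine (h2.mul h1.exp).congr_deriv ?_
  rw [Real.rpow_sub_one hσ.ne']
  field_simp

/-- radial profile and its derivatives -/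
def FF (σ τ : ℝ) : ℝ := ct (64 * τ) * EE σ τ
def FF1 (σ τ : ℝ) : ℝ := 64 * deriv ct (64 * τ) * EE σ τ - ct (64 * τ) * (EE σ τ / (4 * σ))
def FF2 (σ τ : ℝ) : ℝ := 64 ^ 2 * deriv (deriv ct) (64 * τ) * EE σ τ - 2 * (64 * deriv ct (64 * τ) * (EE σ τ / (4 * σ))) + ct (64 * τ) * (EE σ τ / (4 * σ) / (4 * σ))

lemma ct64 (τ : ℝ) : HasDerivAt (fun τ => ct (64 * τ)) (64 * deriv ct (64 * τ)) τ := by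
  have := (ct_hasDeriv (64 * τ)).comp τ ((hasDerivAt_id τ).const_mul 64)
  refine this.congr_deriv ?_
  simp [mul_comm]
lemma ct64' (τ : ℝ) : HasDerivAt (fun τ => deriv ct (64 * τ)) (64 * deriv (deriv ct) (64 * τ)) τ := by
  have := (ct_hasDeriv2 (64 * τ)).comp τ ((hasDerivAt_id τ).const_mul 64)
  refine this.congr_deriv ?_
  simp [mul_comm]

lemma FF_d (σ τ : ℝ) : HasDerivAt (FF σ) (FF1 σ τ) τ := by
  refine ((ct64 τ).mul (EE_dτ σ τ)).congr_deriv ?_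
  unfold FF1; ring
lemma FF1_d (σ τ : ℝ) : HasDerivAt (FF1 σ) (FF2 σ τ) τ := by
  have h1 := ((ct64' τ).const_mul 64).mul (EE_dτ σ τ)
  have h2 := (ct64 τ).mul ((EE_dτ σ τ).div_const (4 * σ))
  refine (h1.sub h2).congr_deriv ?_
  unfold FF2; ring

def Tim (t0 τ0 s : ℝ) : ℝ := ct (64 * (t0 - s)) * ct ((s - t0) / τ0)
def PH (x0 : E3) (t0 ρ τ0 : ℝ) (x : E3) (s : ℝ) : ℝ := Tim t0 τ0 s * FF (t0 - s + ρ ^ 2) (‖x - x0‖ ^ 2)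

lemma Tim_nonneg (t0 τ0 s : ℝ) : 0 ≤ Tim t0 τ0 s := mul_nonneg (ct_nonneg _) (ct_nonneg _)
lemma Tim_le (t0 τ0 s : ℝ) : Tim t0 τ0 s ≤ 1 := mul_le_one₀ (ct_le_one _) (ct_nonneg _) (ct_le_one _)

section
variable {x0 : E3} {t0 ρ τ0 : ℝ}

lemma Tim_zero (h0 : 0 < τ0) {s : ℝ} (hs : t0 + τ0 ≤ s) : Tim t0 τ0 s = 0 := by
  unfold Tim
  rw [ct_zero (τ := (s - t0) / τ0), mul_zero]
  rw [le_div_iff₀ h0]; linarith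
lemma Tim_zero' {s : ℝ} (hs : s ≤ t0 - 1/64) : Tim t0 τ0 s = 0 := by
  unfold Tim
  rw [ct_zero (τ := 64 * (t0 - s)) (by linarith), zero_mul]

lemma PH_nonneg (h0 : 0 < τ0) (hτ : τ0 < ρ ^ 2) (x : E3) (s : ℝ) : 0 ≤ PH x0 t0 ρ τ0 x s := by
  unfold PH
  by_cases hs : t0 + τ0 ≤ s
  · rw [Tim_zero h0 hs, zero_mul]
  · exact mul_nonneg (Tim_nonneg _ _ _) (mul_nonneg (ct_nonneg _) (EE_nonneg (by linarith)))

lemma PH_smooth (h0 : 0 < τ0) (hτ : τ0 < ρ ^ 2) : ContDiff ℝ (⊤ : ℕ∞) (fun z : E3 × ℝ => PH x0 t0 ρ τ0 z.1 z.2) := by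
  rw [contDiff_iff_contDiffAt]
  rintro ⟨x, s⟩
  by_cases hs : s < t0 + ρ ^ 2
  · unfold PH Tim FF EE
    have c1 : ContDiff ℝ (⊤ : ℕ∞) ct := ct_contDiff
    have hn : ContDiff ℝ (⊤ : ℕ∞) (fun z : E3 × ℝ => ‖z.1 - x0‖ ^ 2) := (contDiff_fst.sub contDiff_const).norm_sq ℝ
    have hσ : ContDiff ℝ (⊤ : ℕ∞) (fun z : E3 × ℝ => t0 - z.2 + ρ ^ 2) := by fun_prop
    have hpos : t0 - s + ρ ^ 2 ≠ 0 := by linarith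
    have a1 : ContDiffAt ℝ (⊤ : ℕ∞) (fun z : E3 × ℝ => ct (64 * (t0 - z.2))) (x, s) := (c1.comp (by fun_prop)).contDiffAt
    have a2 : ContDiffAt ℝ (⊤ : ℕ∞) (fun z : E3 × ℝ => ct ((z.2 - t0) / τ0)) (x, s) := (c1.comp (by fun_prop)).contDiffAt
    have a3 : ContDiffAt ℝ (⊤ : ℕ∞) (fun z : E3 × ℝ => ct (64 * ‖z.1 - x0‖ ^ 2)) (x, s) := (c1.comp (contDiff_const.mul hn)).contDiffAt
    have a4 : ContDiffAt ℝ (⊤ : ℕ∞) (fun z : E3 × ℝ => (t0 - z.2 + ρ ^ 2) ^ (-(3/2) : ℝ)) (x, s) := hσ.contDiffAt.rpow_const_of_ne hpos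
    have a5 : ContDiffAt ℝ (⊤ : ℕ∞) (fun z : E3 × ℝ => Real.exp (-‖z.1 - x0‖ ^ 2 / (4 * (t0 - z.2 + ρ ^ 2)))) (x, s) := by
      refine ContDiffAt.exp (ContDiffAt.div hn.contDiffAt.neg (contDiffAt_const.mul hσ.contDiffAt) ?_)
      simpa using hpos
    exact (a1.mul a2).mul (a3.mul (a4.mul a5))
  · have : (fun z : E3 × ℝ => PH x0 t0 ρ τ0 z.1 z.2) =ᶠ[nhds (x, s)] fun _ => 0 := by
      have : {z : E3 × ℝ | t0 + τ0 < z.2} ∈ nhds (x, s) := (isOpen_lt continuous_const continuous_snd).mem_nhds (by change t0 + τ0 < s; linarith)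
      filter_upwards [this] with z hz
      unfold PH
      rw [Tim_zero h0 (le_of_lt hz), zero_mul]
    exact contDiffAt_const.congr_of_eventuallyEq this

lemma PH_zero {x : E3} (hx : x ∉ closedBall x0 (1/8)) (s : ℝ) : PH x0 t0 ρ τ0 x s = 0 := by
  unfold PH FF
  rw [mem_closedBall, dist_eq_norm, not_le] at hx
  rw [ct_zero (by nlinarith), zero_mul, mul_zero]

lemma PH_test (h0 : 0 < τ0) (hτ : τ0 < ρ ^ 2) (hx0 : x0 ∈ ball (0 : E3) 8) (ht : -4 < t0) (ht2 : t0 + τ0 < 0) : IsTest 16 (PH x0 t0 ρ τ0) := by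
  have hsupp : Function.support (fun z : E3 × ℝ => PH x0 t0 ρ τ0 z.1 z.2) ⊆ closedBall x0 (1/8) ×ˢ Icc (t0 - 1/64) (t0 + τ0) := by
    rintro ⟨x, s⟩ hz
    by_contra hc
    apply hz
    rw [mem_prod, not_and_or] at hc
    rcases hc with hc | hc
    · exact PH_zero hc s
    · simp only [mem_Icc, not_and_or, not_le] at hc
      beta_reduce
      unfold PH
      rcases hc with hc | hc
      · rw [Tim_zero' hc.le, zero_mul]
      · rw [Tim_zero h0 hc.le, zero_mul]
  have hK : IsCompact (closedBall x0 (1/8) ×ˢ Icc (t0 - 1/64) (t0 + τ0)) := (isCompact_closedBall _ _).prod isCompact_Icc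
  refine ⟨PH_smooth h0 hτ, HasCompactSupport.of_support_subset_isCompact hK hsupp, (closure_minimal hsupp hK.isClosed).trans (prod_mono ?_ ?_)⟩
  · refine (closedBall_subset_ball' ?_)
    rw [mem_ball] at hx0; linarith
  · intro s hs
    constructor
    · have := hs.1; norm_num; linarith
    · have := hs.2; linarith

def APH : ℝ := 2 * (1728 * (192 * Kct + 1))

lemma sec_cd {f : E3 → ℝ → ℝ} (h1 : ContDiff ℝ (⊤ : ℕ∞) (fun z : E3 × ℝ => f z.1 z.2)) (s : ℝ) : ContDiff ℝ (⊤ : ℕ∞) (fun x => f x s) := by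
  have h2 : ContDiff ℝ (⊤ : ℕ∞) (fun x : E3 => (x, s)) := contDiff_prodMk_left s
  exact h1.comp h2
lemma PH_sm (h0 : 0 < τ0) (hτ : τ0 < ρ ^ 2) (s : ℝ) : ContDiff ℝ (⊤ : ℕ∞) (fun x => PH x0 t0 ρ τ0 x s) :=
  sec_cd (PH_smooth h0 hτ) s

lemma PH_PhA (h0 : 0 < τ0) (hτ : τ0 < ρ ^ 2) (hρ : ρ ^ 2 ≤ 1) {s : ℝ} (hs : s < t0) (hs1 : t0 - 1 < s) : PhA x0 (t0 - s + ρ ^ 2) APH (fun x => PH x0 t0 ρ τ0 x s) := by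
  have hσ : 0 < t0 - s + ρ ^ 2 := by linarith
  have hK := Kct_one
  refine ⟨⟨PH_sm h0 hτ s, fun x hx => PH_zero hx s⟩, by unfold APH; positivity, fun x => ?_, fun x => ?_⟩
  · have hN : 0 ≤ ‖x - x0‖ ^ 2 := by positivity
    have h1 := EE_le hσ hN
    have h2 := EE_nonneg (τ := ‖x - x0‖ ^ 2) hσ
    rw [abs_of_nonneg (PH_nonneg h0 hτ x s)]
    have e : hp x0 (t0 - s + ρ ^ 2) (-3) x = (‖x - x0‖ ^ 2 + (t0 - s + ρ ^ 2)) ^ (-(3/2) : ℝ) := by unfold hp; norm_num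
    have hpp := hp_pos (x0 := x0) hσ (-3) x
    rw [← e] at h1
    calc PH x0 t0 ρ τ0 x s ≤ 1 * (1 * EE (t0 - s + ρ ^ 2) (‖x - x0‖ ^ 2)) :=
          mul_le_mul (Tim_le _ _ _) (mul_le_mul_of_nonneg_right (ct_le_one _) h2) (mul_nonneg (ct_nonneg _) h2) zero_le_one
      _ ≤ 1728 * hp x0 (t0 - s + ρ ^ 2) (-3) x := by linarith
      _ ≤ _ := mul_le_mul_of_nonneg_right (by unfold APH; linarith) hpp.le
  · set σ := t0 - s + ρ ^ 2 with hσd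
    set τ := ‖x - x0‖ ^ 2 with hτd
    have hN : 0 ≤ τ := by positivity
    have h1 := EE_le hσ hN
    have h1' := EE_le' hσ hN
    have h2 := EE_nonneg (τ := τ) hσ
    have hd : HasDerivAt (fun y => Tim t0 τ0 s * FF σ y) (Tim t0 τ0 s * FF1 σ τ) τ := (FF_d σ τ).const_mul _
    have hr := rad_fderiv_norm (x0 := x0) (x := x) hd
    have hw0 : 0 < τ + σ := by linarith
    have e5 : hp x0 σ (-5) x = (τ + σ) ^ (-(5/2) : ℝ) := by unfold hp; norm_num; rfl
    have key : |FF1 σ τ| ≤ 1728 * (192 * Kct + 1) * (τ + σ) ^ (-(5/2) : ℝ) := by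
      have p1 : |64 * deriv ct (64 * τ) * EE σ τ| ≤ 64 * Kct * (1728 * (3 * (τ + σ) ^ (-(5/2) : ℝ))) := by
        by_cases hc : 1 < 64 * τ
        · rw [ct_deriv_zero (Or.inr hc)]; simp; positivity
        · have e3 : (τ + σ) ^ (-(3/2) : ℝ) = (τ + σ) * (τ + σ) ^ (-(5/2) : ℝ) := by
            rw [← Real.rpow_one_add' hw0.le (by norm_num)]; norm_num
          have : (τ + σ) ^ (-(3/2) : ℝ) ≤ 3 * (τ + σ) ^ (-(5/2) : ℝ) := by
            rw [e3]; exact mul_le_mul_of_nonneg_right (by linarith) (by positivity)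
          rw [abs_mul, abs_mul, abs_of_nonneg h2, abs_of_pos (by norm_num : (0:ℝ) < 64)]
          exact mul_le_mul (mul_le_mul_of_nonneg_left (ct_deriv_le _) (by norm_num)) (by linarith) h2 (by positivity)
      have p2 : |ct (64 * τ) * (EE σ τ / (4 * σ))| ≤ 1728 * (τ + σ) ^ (-(5/2) : ℝ) := by
        rw [abs_of_nonneg (mul_nonneg (ct_nonneg _) (by positivity))]
        exact (mul_le_of_le_one_left (by positivity) (ct_le_one _)).trans h1'
      calc |FF1 σ τ| ≤ _ := abs_sub _ _
        _ ≤ _ := add_le_add p1 p2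
        _ = _ := by ring
    have hr' : ‖fderiv ℝ (fun y => PH x0 t0 ρ τ0 y s) x‖ = 2 * |Tim t0 τ0 s * FF1 σ τ| * ‖x - x0‖ := hr
    rw [hr', abs_mul, abs_of_nonneg (Tim_nonneg _ _ _)]
    have e4 : hp x0 σ (-4) x = hp x0 σ (-5) x * hp x0 σ 1 x := by rw [hp_mul hσ]; norm_num
    rw [e4, e5]
    have h3 := norm_le_hp (x0 := x0) hσ x
    have h4 : Tim t0 τ0 s * |FF1 σ τ| ≤ 1728 * (192 * Kct + 1) * (τ + σ) ^ (-(5/2) : ℝ) := (mul_le_of_le_one_left (abs_nonneg _) (Tim_le _ _ _)).trans key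
    calc 2 * (Tim t0 τ0 s * |FF1 σ τ|) * ‖x - x0‖ ≤ 2 * (1728 * (192 * Kct + 1) * (τ + σ) ^ (-(5/2) : ℝ)) * hp x0 σ 1 x :=
          mul_le_mul (by linarith) h3 (norm_nonneg _) (by positivity)
      _ = _ := by unfold APH; ring

def CPH : ℝ := 64 * Kct * (1728 * 4096) + (4 / 64 * (64 ^ 2 * Kct * (1728 * 4096) + 2 * (64 * Kct * (1728 * 2 ^ 20))) + 6 * (64 * Kct * (1728 * 4096)))

lemma w32 {w : ℝ} (hw : 1/256 ≤ w) : w ^ (-(3/2) : ℝ) ≤ 4096 := by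
  have : ((1:ℝ)/256) ^ (-(3/2) : ℝ) = 4096 := by
    rw [show (1:ℝ)/256 = 16 ^ (-2 : ℝ) by rw [Real.rpow_neg (by norm_num)]; norm_num, ← Real.rpow_mul (by norm_num)]; norm_num
  rw [← this]
  exact Real.rpow_le_rpow_of_nonpos (by norm_num) hw (by norm_num)
lemma w52 {w : ℝ} (hw : 1/256 ≤ w) : w ^ (-(5/2) : ℝ) ≤ 2 ^ 20 := by
  have : ((1:ℝ)/256) ^ (-(5/2) : ℝ) = 2 ^ 20 := by
    rw [show (1:ℝ)/256 = 16 ^ (-2 : ℝ) by rw [Real.rpow_neg (by norm_num)]; norm_num, ← Real.rpow_mul (by norm_num)]; norm_num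
  rw [← this]
  exact Real.rpow_le_rpow_of_nonpos (by norm_num) hw (by norm_num)

lemma PH_heat (h0 : 0 < τ0) {s : ℝ} (hs : s < t0) (hρ : 0 < ρ) (x : E3) :
    |deriv (fun τ => PH x0 t0 ρ τ0 x τ) s + lap (fun y => PH x0 t0 ρ τ0 y s) x| ≤ CPH := by
  set σ := t0 - s + ρ ^ 2 with hσd
  set τ := ‖x - x0‖ ^ 2 with hτd
  have hσ : 0 < σ := by have := pow_pos hρ 2; linarith
  have hN : 0 ≤ τ := by positivity
  have hK := Kct_one
  have h1 := EE_le hσ hN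
  have h1' := EE_le' hσ hN
  have h2 := EE_nonneg (τ := τ) hσ
  have hT : ∀ r < t0, Tim t0 τ0 r = ct (64 * (t0 - r)) := fun r hr => by
    unfold Tim
    rw [ct_one (τ := (r - t0) / τ0), mul_one]
    rw [div_le_iff₀ h0]; linarith
  have d1 : HasDerivAt (fun r : ℝ => ct (64 * (t0 - r))) (-(64 * deriv ct (64 * (t0 - s)))) s := by
    have := (ct64 (t0 - s)).comp s ((hasDerivAt_id s).const_sub t0)
    exact this.congr_deriv (by simp)
  have d2 : HasDerivAt (fun r : ℝ => EE (t0 - r + ρ ^ 2) τ) (-((-(3 / (2 * σ)) + τ / (4 * σ ^ 2)) * EE σ τ)) s := by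
    have := (EE_dσ τ hσ).comp s (((hasDerivAt_id s).const_sub t0).add_const (ρ ^ 2))
    exact this.congr_deriv (by simp)
  have dt : deriv (fun r => PH x0 t0 ρ τ0 x r) s = -(64 * deriv ct (64 * (t0 - s))) * (ct (64 * τ) * EE σ τ) + ct (64 * (t0 - s)) * (ct (64 * τ) * (-((-(3 / (2 * σ)) + τ / (4 * σ ^ 2)) * EE σ τ))) := by
    refine HasDerivAt.deriv ((d1.mul (d2.const_mul (ct (64 * τ)))).congr_of_eventuallyEq ?_)
    filter_upwards [Iio_mem_nhds hs] with r hr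
    unfold PH
    rw [hT r hr]; rfl
  have dl : lap (fun y => PH x0 t0 ρ τ0 y s) x = ct (64 * (t0 - s)) * (6 * FF1 σ τ + 4 * τ * FF2 σ τ) := by
    have := rad_lap (x0 := x0) (x := x) (F := fun y => ct (64 * (t0 - s)) * FF σ y) (F1 := fun y => ct (64 * (t0 - s)) * FF1 σ y)
      (Eventually.of_forall fun y => (FF_d σ y).const_mul _) ((FF1_d σ τ).const_mul _)
    have e : (fun y => PH x0 t0 ρ τ0 y s) = fun y => ct (64 * (t0 - s)) * FF σ (‖y - x0‖ ^ 2) := by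
      funext y; unfold PH; rw [hT s hs]
    rw [e, this]; ring
  have tot : deriv (fun τ => PH x0 t0 ρ τ0 x τ) s + lap (fun y => PH x0 t0 ρ τ0 y s) x =
      -(64 * deriv ct (64 * (t0 - s)) * EE σ τ) * ct (64 * τ) + ct (64 * (t0 - s)) *
        (4 * τ * (64 ^ 2 * deriv (deriv ct) (64 * τ) * EE σ τ - 2 * (64 * deriv ct (64 * τ) * (EE σ τ / (4 * σ)))) + 6 * (64 * deriv ct (64 * τ) * EE σ τ)) := by
    rw [dt, dl]; unfold FF1 FF2; field_simp; ring
  have q1 : |64 * deriv ct (64 * (t0 - s)) * EE σ τ| ≤ 64 * Kct * (1728 * 4096) := by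
    by_cases hc : 64 * (t0 - s) < 1/4
    · rw [ct_deriv_zero (Or.inl hc)]; simp; positivity
    · have := w32 (w := τ + σ) (by have := pow_pos hρ 2; linarith)
      rw [abs_mul, abs_mul, abs_of_nonneg h2, abs_of_pos (by norm_num : (0:ℝ) < 64)]
      exact mul_le_mul (mul_le_mul_of_nonneg_left (ct_deriv_le _) (by norm_num)) (by linarith) h2 (by positivity)
  have q2 : |4 * τ * (64 ^ 2 * deriv (deriv ct) (64 * τ) * EE σ τ - 2 * (64 * deriv ct (64 * τ) * (EE σ τ / (4 * σ)))) + 6 * (64 * deriv ct (64 * τ) * EE σ τ)| ≤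
      4 / 64 * (64 ^ 2 * Kct * (1728 * 4096) + 2 * (64 * Kct * (1728 * 2 ^ 20))) + 6 * (64 * Kct * (1728 * 4096)) := by
    by_cases hc : 64 * τ < 1/4 ∨ 1 < 64 * τ
    · rw [ct_deriv_zero hc, ct_deriv2_zero hc]; simp; positivity
    · push Not at hc
      have a1 := w32 (w := τ + σ) (by linarith)
      have a2 := w52 (w := τ + σ) (by linarith)
      have b1 : |64 * deriv ct (64 * τ) * EE σ τ| ≤ 64 * Kct * (1728 * 4096) := by
        rw [abs_mul, abs_mul, abs_of_nonneg h2, abs_of_pos (by norm_num : (0:ℝ) < 64)]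
        exact mul_le_mul (mul_le_mul_of_nonneg_left (ct_deriv_le _) (by norm_num)) (by linarith) h2 (by positivity)
      have b2 : |64 ^ 2 * deriv (deriv ct) (64 * τ) * EE σ τ| ≤ 64 ^ 2 * Kct * (1728 * 4096) := by
        rw [abs_mul, abs_mul, abs_of_nonneg h2, abs_of_pos (by norm_num : (0:ℝ) < 64 ^ 2)]
        exact mul_le_mul (mul_le_mul_of_nonneg_left (ct_deriv2_le _) (by norm_num)) (by linarith) h2 (by positivity)
      have b3 : |64 * deriv ct (64 * τ) * (EE σ τ / (4 * σ))| ≤ 64 * Kct * (1728 * 2 ^ 20) := by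
        rw [abs_mul, abs_mul, abs_of_nonneg (a := EE σ τ / (4 * σ)) (by positivity), abs_of_pos (by norm_num : (0:ℝ) < 64)]
        exact mul_le_mul (mul_le_mul_of_nonneg_left (ct_deriv_le _) (by norm_num)) (by linarith) (by positivity) (by positivity)
      refine (abs_add_le _ _).trans (add_le_add ?_ ?_)
      · rw [abs_mul, abs_of_nonneg (by positivity)]
        refine mul_le_mul (by linarith) ?_ (abs_nonneg _) (by norm_num)
        refine (abs_sub _ _).trans (add_le_add b2 ?_)
        rw [abs_mul, abs_of_pos (by norm_num : (0:ℝ) < 2)]; linarith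
      · rw [abs_mul, abs_of_pos (by norm_num : (0:ℝ) < 6)]; linarith
  rw [tot]
  refine (abs_add_le _ _).trans (add_le_add ?_ ?_)
  · rw [abs_mul, abs_neg, abs_of_nonneg (ct_nonneg _)]
    exact (mul_le_of_le_one_right (abs_nonneg _) (ct_le_one _)).trans q1
  · rw [abs_mul, abs_of_nonneg (ct_nonneg _)]
    exact (mul_le_of_le_one_left (abs_nonneg _) (ct_le_one _)).trans q2

lemma PH_heat0 {s : ℝ} (hs : s < t0 - 1/64) (x : E3) :
    deriv (fun τ => PH x0 t0 ρ τ0 x τ) s + lap (fun y => PH x0 t0 ρ τ0 y s) x = 0 := by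
  have e1 : (fun τ => PH x0 t0 ρ τ0 x τ) =ᶠ[nhds s] fun _ => 0 := by
    filter_upwards [Iio_mem_nhds hs] with r hr
    unfold PH; rw [Tim_zero' (le_of_lt hr), zero_mul]
  have e2 : (fun y => PH x0 t0 ρ τ0 y s) = fun _ => 0 := by
    funext y; unfold PH; rw [Tim_zero' hs.le, zero_mul]
  rw [e1.deriv_eq, e2]
  simp [lap, pd]

lemma PH_heat1 {s : ℝ} (hs : s ≤ t0 - 1/64) (x : E3) : PH x0 t0 ρ τ0 x s = 0 := by
  unfold PH; rw [Tim_zero' hs, zero_mul]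

lemma PH_lower (h0 : 0 < τ0) (hρ : 0 < ρ) (hρ2 : ρ ≤ 1/16) {s : ℝ} (hs : s < t0) (hs1 : t0 - ρ ^ 2 < s) {x : E3} (hx : x ∈ closedBall x0 ρ) :
    1 ≤ 16 * ρ ^ 3 * PH x0 t0 ρ τ0 x s := by
  rw [mem_closedBall, dist_eq_norm] at hx
  have hr2 : ρ ^ 2 ≤ 1/256 := by nlinarith
  have hN : ‖x - x0‖ ^ 2 ≤ ρ ^ 2 := pow_le_pow_left₀ (norm_nonneg _) hx 2
  have hσ : 0 < t0 - s + ρ ^ 2 := by have := pow_pos hρ 2; linarith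
  unfold PH Tim FF EE
  rw [ct_one (τ := (s - t0) / τ0) (by rw [div_le_iff₀ h0]; linarith), ct_one (by linarith), ct_one (by linarith)]
  have a1 : (2 * ρ ^ 2) ^ (-(3/2) : ℝ) ≤ (t0 - s + ρ ^ 2) ^ (-(3/2) : ℝ) := Real.rpow_le_rpow_of_nonpos hσ (by linarith) (by norm_num)
  have a2 : (4 * ρ ^ 2) ^ (-(3/2) : ℝ) ≤ (2 * ρ ^ 2) ^ (-(3/2) : ℝ) := Real.rpow_le_rpow_of_nonpos (by positivity) (by nlinarith) (by norm_num)
  have a3 : (4 * ρ ^ 2) ^ (-(3/2) : ℝ) = (8 * ρ ^ 3)⁻¹ := by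
    rw [show 4 * ρ ^ 2 = (2 * ρ) ^ (2 : ℝ) by norm_cast; ring, ← Real.rpow_mul (by positivity), show (2 : ℝ) * -(3/2) = -3 by norm_num,
      Real.rpow_neg (by positivity)]
    congr 1; norm_cast; ring
  have a4 : 1/2 ≤ Real.exp (-‖x - x0‖ ^ 2 / (4 * (t0 - s + ρ ^ 2))) := by
    have h1 := Real.add_one_le_exp (-‖x - x0‖ ^ 2 / (4 * (t0 - s + ρ ^ 2)))
    have h2 : -(1/2) ≤ -‖x - x0‖ ^ 2 / (4 * (t0 - s + ρ ^ 2)) := by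
      rw [le_div_iff₀ (by positivity)]; nlinarith
    linarith
  rw [a3] at a2
  have a5 : (8 * ρ ^ 3)⁻¹ * (1/2) ≤ (t0 - s + ρ ^ 2) ^ (-(3/2) : ℝ) * Real.exp (-‖x - x0‖ ^ 2 / (4 * (t0 - s + ρ ^ 2))) :=
    mul_le_mul (a2.trans a1) a4 (by norm_num) (by positivity)
  calc (1:ℝ) = 16 * ρ ^ 3 * ((8 * ρ ^ 3)⁻¹ * (1/2)) := by field_simp; norm_num
    _ ≤ 16 * ρ ^ 3 * ((t0 - s + ρ ^ 2) ^ (-(3/2) : ℝ) * Real.exp (-‖x - x0‖ ^ 2 / (4 * (t0 - s + ρ ^ 2)))) := mul_le_mul_of_nonneg_left a5 (by positivity)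
    _ = _ := by ring

end

/-! ### consequence of the energy inequality -/

lemma lint_Iio {F : ℝ → ℝ≥0∞} {a t t0 : ℝ} (h0 : ∀ s ≤ a, F s = 0) (ht : t ≤ t0) : ∫⁻ s in Iio t, F s ≤ ∫⁻ s in Ioo a t0, F s := by
  have hs : Iio t ⊆ Iic a ∪ Ioo a t0 := fun s hs => by
    rcases le_or_gt s a with h | h
    · exact Or.inl h
    · exact Or.inr ⟨h, lt_of_lt_of_le hs ht⟩
  refine (lintegral_mono_set hs).trans ((lintegral_union_le _ _ _).trans ?_)
  rw [setLIntegral_congr_fun measurableSet_Iic (g := fun _ => 0) (fun s hs => h0 s hs)]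
  simp

lemma lint_Iio_le {F : ℝ → ℝ≥0∞} {t0 δ : ℝ} {X : ℝ≥0∞} (hδ : 0 < δ) (h : ∀ᵐ t, t ∈ Ioo (t0 - δ) t0 → ∫⁻ s in Iio t, F s ≤ X) :
    ∫⁻ s in Iio t0, F s ≤ X := by
  have hU : Iio t0 = ⋃ n : ℕ, Iio (t0 - δ / (n + 1)) := by
    ext s
    simp only [mem_Iio, mem_iUnion]
    constructor
    · intro hs
      obtain ⟨n, hn⟩ := exists_nat_gt (δ / (t0 - s))
      refine ⟨n, ?_⟩
      have h1 : 0 < t0 - s := by linarith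
      rw [div_lt_iff₀ h1] at hn
      have h2 : δ / (n + 1) < t0 - s := by rw [div_lt_iff₀ (by positivity)]; nlinarith
      linarith
    · rintro ⟨n, hn⟩
      have : 0 < δ / (n + 1) := by positivity
      linarith
  rw [hU, setLIntegral_iUnion_of_directed]
  · refine iSup_le fun n => ?_
    have hp : 0 < δ / (n + 1) := by positivity
    have hpos : volume (Ioo (t0 - δ / (n + 1)) t0) ≠ 0 := by
      rw [Real.volume_Ioo]; simpa using hp
    obtain ⟨t, ht1, ht2⟩ : ∃ t ∈ Ioo (t0 - δ / (n + 1)) t0, (t ∈ Ioo (t0 - δ) t0 → ∫⁻ s in Iio t, F s ≤ X) := by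
      by_contra hc
      push Not at hc
      apply hpos
      refine measure_mono_null (fun t ht => ?_) h
      simp only [mem_compl_iff, mem_ofPred_eq, Classical.not_imp, not_le]
      exact hc t ht
    have hle : δ / (n + 1) ≤ δ := div_le_self hδ.le (by linarith [n.cast_nonneg (α := ℝ)])
    exact (lintegral_mono_set (Iio_subset_Iio ht1.1.le)).trans (ht2 ⟨by linarith [ht1.1], ht1.2⟩)
  · refine (monotone_nat_of_le_succ fun n => ?_).directed_le
    refine Iio_subset_Iio ?_
    have : δ / ((n + 1 : ℕ) + 1) ≤ δ / (n + 1) := div_le_div_of_nonneg_left hδ.le (by positivity) (by push_cast; linarith)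
    linarith

section
variable {u : E3 → ℝ → E3} {g : E3 → ℝ → Fin 3 → Fin 3 → ℝ} {P : E3 → ℝ → ℝ} {K ε : ℝ≥0∞}

def EX (u : E3 → ℝ → E3) (P : E3 → ℝ → ℝ) (K : ℝ≥0∞) (x0 : E3) (t0 ρ τ0 : ℝ) : ℝ≥0∞ := ENNReal.ofReal CPH * K +
  ∫⁻ s in Ioo (t0 - 1) t0, ‖∫ x, (‖u x s‖ ^ 2 + 2 * P x s) * vphi (fun y => u y s) (fun y => PH x0 t0 ρ τ0 y s) x‖ₑ

lemma energy_rhs (S : Sol u g P K ε) {x0 : E3} {t0 ρ τ0 t : ℝ} (h0 : 0 < τ0) (hρ : 0 < ρ) (ht : t ≤ t0) :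
    (∫⁻ s in Iio t, ∫⁻ x, ‖u x s‖ₑ ^ 2 * ‖deriv (fun τ => PH x0 t0 ρ τ0 x τ) s + lap (fun y => PH x0 t0 ρ τ0 y s) x‖ₑ) +
      ∫⁻ s in Iio t, ‖∫ x, (‖u x s‖ ^ 2 + 2 * P x s) * vphi (fun y => u y s) (fun y => PH x0 t0 ρ τ0 y s) x‖ₑ ≤ EX u P K x0 t0 ρ τ0 := by
  refine add_le_add ?_ ?_
  · refine (lint_Iio (a := t0 - 1) (t0 := t0) (fun s hs => ?_) ht).trans ?_
    · simp [PH_heat0 (x0 := x0) (t0 := t0) (ρ := ρ) (τ0 := τ0) (show s < t0 - 1/64 by linarith)]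
    · calc _ ≤ ∫⁻ s in Ioo (t0 - 1) t0, K * ENNReal.ofReal CPH := by
            refine setLIntegral_mono_ae' measurableSet_Ioo ?_
            filter_upwards [S.uK] with s hK hs
            refine le_trans (lintegral_mono fun x => mul_le_mul' le_rfl (?_ : _ ≤ ENNReal.ofReal CPH)) ?_
            · rw [← ofReal_norm, Real.norm_eq_abs]
              exact ENNReal.ofReal_le_ofReal (PH_heat h0 hs.2 hρ x)
            · rw [lintegral_mul_const' _ _ ENNReal.ofReal_ne_top]
              exact mul_le_mul' hK le_rfl
        _ = _ := by rw [setLIntegral_const, Real.volume_Ioo]; simp [mul_comm]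
  · refine lint_Iio (fun s hs => ?_) ht
    have e : (fun y => PH x0 t0 ρ τ0 y s) = fun _ => 0 := funext fun y => PH_heat1 (by linarith) y
    rw [e]
    simp [vphi, pd]

lemma energy_core (S : Sol u g P K ε) {x0 : E3} {t0 ρ : ℝ} (hx0 : x0 ∈ ball (0 : E3) 8) (ht : -4 < t0) (ht0 : t0 < 0) (hρ : 0 < ρ) (hρ2 : ρ ≤ 1/16) :
    ∃ τ0, 0 < τ0 ∧ τ0 < ρ ^ 2 ∧
      (∀ᵐ t, t ∈ Ioo (t0 - ρ ^ 2) t0 → ∫⁻ x in closedBall x0 ρ, ‖u x t‖ₑ ^ 2 ≤ ENNReal.ofReal (16 * ρ ^ 3) * EX u P K x0 t0 ρ τ0) ∧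
      ∫⁻ t in Ioo (t0 - ρ ^ 2) t0, ∫⁻ x in closedBall x0 ρ, G2 (fun y => g y t) x ≤ ENNReal.ofReal (16 * ρ ^ 3) * EX u P K x0 t0 ρ τ0 := by
  have hr : 0 < ρ ^ 2 := by positivity
  have hr1 : ρ ^ 2 ≤ 1 := by nlinarith
  refine ⟨min (ρ ^ 2 / 2) (-t0 / 2), lt_min (by linarith) (by linarith), (min_le_left _ _).trans_lt (by linarith), ?_⟩
  have h0 : 0 < min (ρ ^ 2 / 2) (-t0 / 2) := lt_min (by linarith) (by linarith)
  have hτ : min (ρ ^ 2 / 2) (-t0 / 2) < ρ ^ 2 := (min_le_left _ _).trans_lt (by linarith)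
  have hτ2 : t0 + min (ρ ^ 2 / 2) (-t0 / 2) < 0 := by have := min_le_right (ρ ^ 2 / 2) (-t0 / 2); linarith
  set τ0 := min (ρ ^ 2 / 2) (-t0 / 2)
  have hen := S.en _ (PH_test (ρ := ρ) h0 hτ hx0 ht hτ2) (PH_nonneg h0 hτ)
  have hlow : ∀ x ∈ closedBall x0 ρ, ∀ s ∈ Ioo (t0 - ρ ^ 2) t0, ∀ a : ℝ≥0∞, a ≤ ENNReal.ofReal (16 * ρ ^ 3) * (a * ENNReal.ofReal (PH x0 t0 ρ τ0 x s)) := fun x hx s hs a => by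
    have := ENNReal.ofReal_le_ofReal (PH_lower h0 hρ hρ2 hs.2 hs.1 hx)
    rw [ENNReal.ofReal_one, ENNReal.ofReal_mul (p := 16 * ρ ^ 3) (by positivity)] at this
    calc a = a * 1 := (mul_one a).symm
      _ ≤ a * _ := mul_le_mul' le_rfl this
      _ = _ := by ring
  have hen2 : ∀ᵐ t, t ∈ Ioo (t0 - ρ ^ 2) t0 → (∫⁻ x, ‖u x t‖ₑ ^ 2 * ENNReal.ofReal (PH x0 t0 ρ τ0 x t)) + 2 * ∫⁻ s in Iio t, ∫⁻ x, G2 (fun y => g y s) x * ENNReal.ofReal (PH x0 t0 ρ τ0 x s) ≤ EX u P K x0 t0 ρ τ0 := by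
    filter_upwards [hen] with t hen ht2
    exact (hen ⟨by norm_num; linarith [ht2.1], by linarith [ht2.2]⟩).trans (energy_rhs S h0 hρ ht2.2.le)
  constructor
  · filter_upwards [hen2] with t hen ht2
    refine le_trans ?_ (mul_le_mul' le_rfl (le_self_add.trans (hen ht2)))
    rw [← lintegral_const_mul' _ _ ENNReal.ofReal_ne_top]
    refine (setLIntegral_mono' measurableSet_closedBall fun x hx => hlow x hx t ht2 _).trans (setLIntegral_le_lintegral _ _)
  · have h3 : ∫⁻ s in Iio t0, ∫⁻ x, G2 (fun y => g y s) x * ENNReal.ofReal (PH x0 t0 ρ τ0 x s) ≤ EX u P K x0 t0 ρ τ0 := by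
      refine lint_Iio_le hr ?_
      filter_upwards [hen2] with t hen ht2
      refine le_trans ?_ (le_add_self.trans (hen ht2))
      rw [two_mul]; exact le_self_add
    refine le_trans ?_ (mul_le_mul' le_rfl h3)
    rw [← lintegral_const_mul' _ _ ENNReal.ofReal_ne_top]
    refine le_trans (setLIntegral_mono' measurableSet_Ioo fun s hs => ?_) (lintegral_mono_set (fun s hs => hs.2))
    rw [← lintegral_const_mul' _ _ ENNReal.ofReal_ne_top]
    exact (setLIntegral_mono' measurableSet_closedBall fun x hx => hlow x hx s hs _).trans (setLIntegral_le_lintegral _ _)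
end

/-! ### dyadic decomposition of the weighted integrals -/

def rr (k : ℕ) : ℝ := (1/2) ^ k
lemma rr_pos (k : ℕ) : 0 < rr k := by unfold rr; positivity
lemma rr_le_one (k : ℕ) : rr k ≤ 1 := pow_le_one₀ (by norm_num) (by norm_num)
lemma rr_succ (k : ℕ) : rr (k + 1) = rr k / 2 := by unfold rr; rw [pow_succ]; ring
lemma rr_anti {k n : ℕ} (h : k ≤ n) : rr n ≤ rr k := pow_le_pow_of_le_one (by norm_num) (by norm_num) h
lemma rr_zero : rr 0 = 1 := by simp [rr]

/-- parabolic intervals -/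
def Ik (t0 : ℝ) (k : ℕ) : Set ℝ := Ioo (t0 - rr k ^ 2) t0
lemma Ik_meas (t0 : ℝ) (k : ℕ) : MeasurableSet (Ik t0 k) := measurableSet_Ioo
lemma Ik_zero (t0 : ℝ) : Ik t0 0 = Ioo (t0 - 1) t0 := by simp [Ik, rr_zero]

lemma dy_find {x0 x : E3} {t0 s : ℝ} {n : ℕ} (hn : 0 < n) (hx : x ∈ closedBall x0 (rr 0)) (hs : s ∈ Ik t0 0) :
    ∃ k < n, x ∈ closedBall x0 (rr k) ∧ s ∈ Ik t0 k ∧ rr (k + 1) ≤ hp x0 (t0 - s + rr n ^ 2) 1 x := by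
  by_contra hc
  push Not at hc
  have hσ : 0 < t0 - s + rr n ^ 2 := by have := hs.2; have := pow_pos (rr_pos n) 2; linarith
  have key : ∀ k ≤ n, x ∈ closedBall x0 (rr k) ∧ s ∈ Ik t0 k := by
    intro k
    induction k with
    | zero => exact fun _ => ⟨hx, hs⟩
    | succ k ih =>
      intro hk
      obtain ⟨h1, h2⟩ := ih (by omega)
      have h3 := hc k (by omega) h1 h2
      have h4 := hp_one_sq (x0 := x0) hσ x
      have h5 := hp_pos (x0 := x0) hσ 1 x
      have h6 : hp x0 (t0 - s + rr n ^ 2) 1 x ^ 2 < rr (k + 1) ^ 2 := pow_lt_pow_left₀ h3 h5.le two_ne_zero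
      have h7 := pow_pos (rr_pos n) 2
      have h8 := sq_nonneg ‖x - x0‖
      have h9 := hs.2
      refine ⟨?_, by linarith, h9⟩
      rw [mem_closedBall, dist_eq_norm]
      exact (norm_le_hp hσ x).trans h3.le
  obtain ⟨m, rfl⟩ : ∃ m, n = m + 1 := ⟨n - 1, by omega⟩
  have h3 := hc m (by omega) (key m (by omega)).1 (key m (by omega)).2
  have h4 := hp_one_sq (x0 := x0) hσ x
  have h6 := pow_lt_pow_left₀ h3 (hp_pos (x0 := x0) hσ 1 x).le two_ne_zero
  have h8 := sq_nonneg ‖x - x0‖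
  have h9 := hs.2
  linarith

lemma sumQ {F W : E3 → ℝ → ℝ≥0∞} {x0 : E3} {t0 : ℝ} {n : ℕ} {c : ℕ → ℝ≥0∞} (hF : Measurable (Function.uncurry F)) (hc : ∀ k, c k ≠ ∞)
    (h : ∀ x ∈ closedBall x0 (rr 0), ∀ s ∈ Ik t0 0, ∃ k < n, x ∈ closedBall x0 (rr k) ∧ s ∈ Ik t0 k ∧ W x s ≤ c k) :
    ∫⁻ s in Ik t0 0, ∫⁻ x in closedBall x0 (rr 0), F x s * W x s ≤ ∑ k ∈ Finset.range n, c k * ∫⁻ s in Ik t0 k, ∫⁻ x in closedBall x0 (rr k), F x s := by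
  have m1 : ∀ k, Measurable (fun s => ∫⁻ x in closedBall x0 (rr k), F x s) := fun k => hF.lintegral_prod_left'
  have m2 : ∀ k s, Measurable (fun x => c k * (closedBall x0 (rr k)).indicator (fun x => F x s) x) := fun k s =>
    ((sec_meas hF s).indicator measurableSet_closedBall).const_mul _
  calc _ ≤ ∫⁻ s, ∑ k ∈ Finset.range n, c k * (Ik t0 k).indicator (fun s => ∫⁻ x in closedBall x0 (rr k), F x s) s := by
        rw [← lintegral_indicator (Ik_meas _ _)]
        refine lintegral_mono fun s => ?_
        by_cases hs : s ∈ Ik t0 0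
        · rw [indicator_of_mem hs]
          calc _ ≤ ∫⁻ x, ∑ k ∈ Finset.range n, (Ik t0 k).indicator (fun _ => c k * (closedBall x0 (rr k)).indicator (fun x => F x s) x) s := by
                rw [← lintegral_indicator measurableSet_closedBall]
                refine lintegral_mono fun x => ?_
                by_cases hx : x ∈ closedBall x0 (rr 0)
                · rw [indicator_of_mem hx]
                  obtain ⟨k, hk, hxk, hsk, hW⟩ := h x hx s hs
                  refine le_trans ?_ (Finset.single_le_sum (fun _ _ => zero_le) (Finset.mem_range.2 hk))
                  rw [indicator_of_mem hsk, indicator_of_mem hxk, mul_comm]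
                  exact mul_le_mul' hW le_rfl
                · rw [indicator_of_notMem hx]; exact zero_le
            _ = _ := by
                rw [lintegral_finsetSum]
                · refine Finset.sum_congr rfl fun k _ => ?_
                  by_cases hsk : s ∈ Ik t0 k
                  · simp only [indicator_of_mem hsk]
                    rw [lintegral_const_mul' _ _ (hc k), lintegral_indicator measurableSet_closedBall]
                  · simp only [indicator_of_notMem hsk]; simp
                · intro k _
                  by_cases hsk : s ∈ Ik t0 k
                  · simp only [indicator_of_mem hsk]; exact m2 k s
                  · simp only [indicator_of_notMem hsk]; exact measurable_const
        · rw [indicator_of_notMem hs]; exact zero_le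
    _ = _ := by
        rw [lintegral_finsetSum _ fun k _ => ((m1 k).indicator (Ik_meas _ _)).const_mul _]
        refine Finset.sum_congr rfl fun k _ => ?_
        rw [lintegral_const_mul' _ _ (hc k), lintegral_indicator (Ik_meas _ _)]

lemma lint_pow {t0 c γ : ℝ} (hc : 0 < c) (hγ : 0 < γ) : ∫⁻ s in Ioo (t0 - c) t0, ENNReal.ofReal ((t0 - s) ^ (γ - 1)) = ENNReal.ofReal (c ^ γ / γ) := by
  have e1 : ∫⁻ s in Ioo (t0 - c) t0, ENNReal.ofReal ((t0 - s) ^ (γ - 1)) = ∫⁻ s in Ioo 0 c, ENNReal.ofReal (s ^ (γ - 1)) := by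
    rw [← lintegral_indicator measurableSet_Ioo, ← lintegral_indicator measurableSet_Ioo]
    rw [← lintegral_sub_left_eq_self (fun s => (Ioo 0 c).indicator (fun s => ENNReal.ofReal (s ^ (γ - 1))) s) t0]
    congr 1; ext s
    by_cases hs : s ∈ Ioo (t0 - c) t0
    · have : t0 - s ∈ Ioo 0 c := ⟨by linarith [hs.2], by linarith [hs.1]⟩
      rw [indicator_of_mem hs, indicator_of_mem this]
    · have : t0 - s ∉ Ioo 0 c := fun h => hs ⟨by linarith [h.2], by linarith [h.1]⟩
      rw [indicator_of_notMem hs, indicator_of_notMem this]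
  have hi : IntervalIntegrable (fun s : ℝ => s ^ (γ - 1)) volume 0 c := intervalIntegral.intervalIntegrable_rpow' (by linarith)
  rw [e1, setLIntegral_congr Ioo_ae_eq_Ioc, ← ofReal_integral_eq_lintegral_ofReal hi.1]
  · rw [← intervalIntegral.integral_of_le hc.le, integral_rpow (Or.inl (by linarith))]
    congr 1
    rw [sub_add_cancel, Real.zero_rpow hγ.ne', sub_zero]
  · filter_upwards [ae_restrict_mem measurableSet_Ioc] with s hs
    exact Real.rpow_nonneg hs.1.le _

lemma young32 (a b : ℝ≥0∞) : a * b ≤ a ^ (3/2 : ℝ) + b ^ (3 : ℝ) := by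
  have h : (3/2 : ℝ).HolderConjugate 3 := by
    rw [Real.holderConjugate_iff]; norm_num
  refine (ENNReal.young_inequality a b h).trans (add_le_add ?_ ?_) <;>
  · refine ENNReal.div_le_of_le_mul (le_mul_of_one_le_right' ?_)
    rw [← ENNReal.ofReal_one]; exact ENNReal.ofReal_le_ofReal (by norm_num)

section
variable {u : E3 → ℝ → E3} {g : E3 → ℝ → Fin 3 → Fin 3 → ℝ} {P : E3 → ℝ → ℝ} {K ε : ℝ≥0∞}

structure Bd (u : E3 → ℝ → E3) (g : E3 → ℝ → Fin 3 → Fin 3 → ℝ) (x0 : E3) (t0 : ℝ) (k : ℕ) (a : ℝ≥0∞) : Prop where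
  b1 : ∀ᵐ t, t ∈ Ik t0 k → ∫⁻ x in closedBall x0 (rr k), ‖u x t‖ₑ ^ 2 ≤ a * ENNReal.ofReal (rr k ^ (3 : ℝ))
  b2 : ∫⁻ t in Ik t0 k, ∫⁻ x in closedBall x0 (rr k), G2 (fun y => g y t) x ≤ a * ENNReal.ofReal (rr k ^ (3 : ℝ))

lemma hw_dy {x0 x : E3} {σ β : ℝ} {k : ℕ} (hσ : 0 < σ) (h : rr (k + 1) ≤ hp x0 σ 1 x) (hβ : β ≤ 0) (hβ4 : -4 ≤ β) :
    hw x0 σ β x ≤ ENNReal.ofReal (16 * rr k ^ β) := by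
  unfold hw
  rw [hp_eq_rpow hσ]
  refine ENNReal.ofReal_le_ofReal ((Real.rpow_le_rpow_of_nonpos (rr_pos _) h hβ).trans ?_)
  rw [rr_succ, Real.div_rpow (rr_pos k).le (by norm_num), div_eq_mul_inv, ← Real.rpow_neg (by norm_num), mul_comm]
  refine mul_le_mul_of_nonneg_right ?_ (Real.rpow_nonneg (rr_pos k).le _)
  calc (2:ℝ) ^ (-β) ≤ 2 ^ (4 : ℝ) := Real.rpow_le_rpow_of_exponent_le (by norm_num) (by linarith)
    _ = 16 := by norm_num

lemma SS_le {t0 s α δ : ℝ} {n : ℕ} (hs : s < t0) (hα : 0 ≤ α) (hδ : 0 ≤ δ) (h : α + 2 * δ = 1/2) :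
    SS (t0 - s + rr n ^ 2) α ≤ ENNReal.ofReal (rr n ^ (-(2 * δ))) * ENNReal.ofReal ((t0 - s) ^ (-(1/4) : ℝ)) := by
  have hr := pow_pos (rr_pos n) 2
  have hσ : 0 < t0 - s + rr n ^ 2 := by linarith
  unfold SS
  rw [← ENNReal.ofReal_mul (Real.rpow_nonneg (rr_pos n).le _)]
  refine ENNReal.ofReal_le_ofReal ?_
  rw [show (α - 1) / 2 = -δ + -(1/4) by linarith, Real.rpow_add hσ]
  refine mul_le_mul ?_ (Real.rpow_le_rpow_of_nonpos (by linarith) (by linarith) (by norm_num)) (by positivity) (by positivity [rr_pos n])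
  rw [show -(2 * δ) = 2 * (-δ) by ring, Real.rpow_mul (rr_pos n).le]
  refine Real.rpow_le_rpow_of_nonpos (by norm_cast) (by norm_cast; linarith) (by linarith)

lemma SS2_le {t0 s α δ : ℝ} {n : ℕ} (hs : s < t0) (hα : 0 ≤ α) (hδ : 0 ≤ δ) (h : α + 2 * δ = 1/2) :
    SS (t0 - s + rr n ^ 2) α ^ 2 ≤ ENNReal.ofReal (rr n ^ (-(2 * δ))) * ENNReal.ofReal ((t0 - s) ^ (α + δ - 1)) := by
  have hr := pow_pos (rr_pos n) 2
  have hσ : 0 < t0 - s + rr n ^ 2 := by linarith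
  unfold SS
  rw [← ENNReal.ofReal_mul (Real.rpow_nonneg (rr_pos n).le _), ← ENNReal.ofReal_pow (Real.rpow_nonneg hσ.le _)]
  refine ENNReal.ofReal_le_ofReal ?_
  rw [← Real.rpow_natCast, ← Real.rpow_mul hσ.le, show (α - 1) / 2 * (2 : ℕ) = -δ + (α + δ - 1) by push_cast; ring, Real.rpow_add hσ]
  refine mul_le_mul ?_ (Real.rpow_le_rpow_of_nonpos (by linarith) (by linarith) (by linarith)) (by positivity) (by positivity [rr_pos n])
  rw [show -(2 * δ) = 2 * (-δ) by ring, Real.rpow_mul (rr_pos n).le]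
  refine Real.rpow_le_rpow_of_nonpos (by norm_cast) (by norm_cast; linarith) (by linarith)

lemma SS_meas (t0 ρ α : ℝ) : Measurable (fun s => SS (t0 - s + ρ) α) := by
  unfold SS
  exact (((measurable_const.sub measurable_id).add_const ρ).pow_const _).ennreal_ofReal

lemma xi_G (S : Sol u g P K ε) {x0 : E3} {t0 α δ : ℝ} {n : ℕ} {a : ℕ → ℝ≥0∞} (hn : 0 < n) (hα : 0 ≤ α) (hδ : 0 ≤ δ) (h : α + 2 * δ = 1/2)
    (hB : ∀ k < n, Bd u g x0 t0 k (a k)) :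
    ∫⁻ s in Ik t0 0, ∫⁻ x in closedBall x0 (rr 0), G2 (fun y => g y s) x * hw x0 (t0 - s + rr n ^ 2) (-3 + α) x ≤
      ENNReal.ofReal (rr n ^ (-(2 * δ))) * (16 * ∑ k ∈ Finset.range n, a k * ENNReal.ofReal (rr k ^ (1/2 : ℝ))) := by
  have hr := pow_pos (rr_pos n) 2
  refine (sumQ (W := fun x s => hw x0 (t0 - s + rr n ^ 2) (-3 + α) x) (c := fun k => ENNReal.ofReal (16 * rr k ^ (-3 + α))) (n := n) S.mG (fun k => ENNReal.ofReal_ne_top) (fun x hx s hs => ?_)).trans ?_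
  · obtain ⟨k, hk, hxk, hsk, hh⟩ := dy_find hn hx hs
    exact ⟨k, hk, hxk, hsk, hw_dy (by have := hs.2; linarith) hh (by linarith) (by linarith)⟩
  · rw [Finset.mul_sum, Finset.mul_sum]
    refine Finset.sum_le_sum fun k hk => (mul_le_mul' le_rfl (hB k (Finset.mem_range.1 hk)).b2).trans ?_
    have hk' := rr_pos k
    have e : (16 * rr k ^ (-3 + α)) * rr k ^ (3 : ℝ) ≤ rr n ^ (-(2 * δ)) * 16 * rr k ^ (1/2 : ℝ) := by
      rw [mul_assoc, ← Real.rpow_add hk', show -3 + α + 3 = -(2 * δ) + 1/2 by linarith, Real.rpow_add hk']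
      have : rr k ^ (-(2 * δ)) ≤ rr n ^ (-(2 * δ)) := Real.rpow_le_rpow_of_nonpos (rr_pos n) (rr_anti (Finset.mem_range.1 hk).le) (by linarith)
      have h2 : 0 ≤ rr k ^ (1/2 : ℝ) := by positivity
      nlinarith
    have e2 := ENNReal.ofReal_le_ofReal e
    rw [ENNReal.ofReal_mul (p := 16 * rr k ^ (-3 + α)) (by positivity), ENNReal.ofReal_mul (p := rr n ^ (-(2 * δ)) * 16) (by positivity [rr_pos n]), ENNReal.ofReal_mul (p := rr n ^ (-(2 * δ))) (by positivity [rr_pos n])] at e2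
    calc _ = a k * (ENNReal.ofReal (16 * rr k ^ (-3 + α)) * ENNReal.ofReal (rr k ^ (3 : ℝ))) := by ring
      _ ≤ _ := mul_le_mul' le_rfl e2
      _ = _ := by rw [ENNReal.ofReal_ofNat]; ring

lemma xi_u (S : Sol u g P K ε) {x0 : E3} {t0 α δ : ℝ} {n : ℕ} {a : ℕ → ℝ≥0∞} (hn : 0 < n) (hα : 0 ≤ α) (hδ : 0 ≤ δ) (h : α + 2 * δ = 1/2)
    (hB : ∀ k < n, Bd u g x0 t0 k (a k)) :
    ∫⁻ s in Ik t0 0, ∫⁻ x in closedBall x0 (rr 0), ‖u x s‖ₑ ^ 2 * hw x0 (t0 - s + rr n ^ 2) (-3 - α) x * SS (t0 - s + rr n ^ 2) α ^ 2 ≤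
      ENNReal.ofReal (rr n ^ (-(2 * δ))) * (64 * ∑ k ∈ Finset.range n, a k * ENNReal.ofReal (rr k ^ (1/2 : ℝ))) := by
  have hr := pow_pos (rr_pos n) 2
  have mF : Measurable (Function.uncurry (fun x s => ‖u x s‖ₑ ^ 2 * SS (t0 - s + rr n ^ 2) α ^ 2)) :=
    (S.mu.enorm.pow_const 2).mul (((SS_meas t0 (rr n ^ 2) α).comp measurable_snd).pow_const 2)
  have e0 : ∀ x s, ‖u x s‖ₑ ^ 2 * hw x0 (t0 - s + rr n ^ 2) (-3 - α) x * SS (t0 - s + rr n ^ 2) α ^ 2 = ‖u x s‖ₑ ^ 2 * SS (t0 - s + rr n ^ 2) α ^ 2 * hw x0 (t0 - s + rr n ^ 2) (-3 - α) x := fun x s => by ring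
  simp_rw [e0]
  refine (sumQ (W := fun x s => hw x0 (t0 - s + rr n ^ 2) (-3 - α) x) (c := fun k => ENNReal.ofReal (16 * rr k ^ (-3 - α))) (n := n) mF (fun k => ENNReal.ofReal_ne_top) (fun x hx s hs => ?_)).trans ?_
  · obtain ⟨k, hk, hxk, hsk, hh⟩ := dy_find hn hx hs
    exact ⟨k, hk, hxk, hsk, hw_dy (by have := hs.2; linarith) hh (by linarith) (by linarith)⟩
  · rw [Finset.mul_sum, Finset.mul_sum]
    refine Finset.sum_le_sum fun k hk => ?_
    have hk' := rr_pos k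
    have hn' := rr_pos n
    have h1 : ∫⁻ s in Ik t0 k, ∫⁻ x in closedBall x0 (rr k), ‖u x s‖ₑ ^ 2 * SS (t0 - s + rr n ^ 2) α ^ 2 ≤
        a k * ENNReal.ofReal (rr k ^ (3 : ℝ)) * ENNReal.ofReal (rr n ^ (-(2 * δ))) * ENNReal.ofReal (4 * rr k ^ (2 * (α + δ))) := by
      have step : ∫⁻ s in Ik t0 k, ∫⁻ x in closedBall x0 (rr k), ‖u x s‖ₑ ^ 2 * SS (t0 - s + rr n ^ 2) α ^ 2 ≤
          ∫⁻ s in Ik t0 k, a k * ENNReal.ofReal (rr k ^ (3 : ℝ)) * ENNReal.ofReal (rr n ^ (-(2 * δ))) * ENNReal.ofReal ((t0 - s) ^ (α + δ - 1)) := by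
        refine setLIntegral_mono_ae' (Ik_meas _ _) ?_
        filter_upwards [(hB k (Finset.mem_range.1 hk)).b1] with s hb hs
        rw [lintegral_mul_const' _ _ (by unfold SS; finiteness), mul_assoc (a k * _)]
        exact mul_le_mul' (hb hs) (SS2_le hs.2 hα hδ h)
      refine step.trans ?_
      rw [lintegral_const_mul]
      · refine mul_le_mul' le_rfl ?_
        unfold Ik
        rw [lint_pow (by positivity) (by linarith)]
        refine ENNReal.ofReal_le_ofReal ?_
        rw [Real.rpow_mul hk'.le, div_le_iff₀ (by linarith)]
        have : 0 ≤ (rr k ^ (2 : ℝ)) ^ (α + δ) := by positivity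
        norm_cast at *
        nlinarith
      · exact ((measurable_const.sub measurable_id).pow_const _).ennreal_ofReal
    refine (mul_le_mul' le_rfl h1).trans (le_of_eq ?_)
    have e : (16 * rr k ^ (-3 - α)) * rr k ^ (3 : ℝ) * (4 * rr k ^ (2 * (α + δ))) = 64 * rr k ^ (1/2 : ℝ) := by
      calc _ = 64 * (rr k ^ (-3 - α) * rr k ^ (3 : ℝ) * rr k ^ (2 * (α + δ))) := by ring
        _ = _ := by
          rw [← Real.rpow_add hk', ← Real.rpow_add hk']; congr 2; linarith
    have e2 := congrArg ENNReal.ofReal e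
    rw [ENNReal.ofReal_mul (p := 16 * rr k ^ (-3 - α) * rr k ^ (3 : ℝ)) (by positivity), ENNReal.ofReal_mul (p := 16 * rr k ^ (-3 - α)) (by positivity), ENNReal.ofReal_mul (p := 64) (by norm_num), ENNReal.ofReal_ofNat] at e2
    calc _ = a k * ENNReal.ofReal (rr n ^ (-(2 * δ))) * (ENNReal.ofReal (16 * rr k ^ (-3 - α)) * ENNReal.ofReal (rr k ^ (3 : ℝ)) * ENNReal.ofReal (4 * rr k ^ (2 * (α + δ)))) := by ring
      _ = _ := by rw [e2]; ring

lemma xi_p (S : Sol u g P K ε) {x0 : E3} {t0 α δ : ℝ} {n : ℕ} (hα : 0 ≤ α) (hδ : 0 ≤ δ) (h : α + 2 * δ = 1/2) :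
    ∫⁻ s in Ik t0 0, SS (t0 - s + rr n ^ 2) α * ∫⁻ x in closedBall x0 (rr 0), ‖P x s‖ₑ ≤ ENNReal.ofReal (rr n ^ (-(2 * δ))) * (K + 4 * vB) := by
  have mm : Measurable (fun s : ℝ => ENNReal.ofReal ((t0 - s) ^ (-(3/4) : ℝ))) := ((measurable_const.sub measurable_id).pow_const _).ennreal_ofReal
  calc _ ≤ ∫⁻ s in Ik t0 0, ENNReal.ofReal (rr n ^ (-(2 * δ))) * ((∫⁻ x, ‖P x s‖ₑ ^ (3/2 : ℝ)) + vB * ENNReal.ofReal ((t0 - s) ^ (-(3/4) : ℝ))) := by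
        refine setLIntegral_mono' (Ik_meas _ _) fun s hs => ?_
        refine (mul_le_mul' (SS_le hs.2 hα hδ h) le_rfl).trans ?_
        rw [mul_assoc]
        refine mul_le_mul' le_rfl ?_
        rw [← lintegral_const_mul' _ _ ENNReal.ofReal_ne_top]
        calc _ ≤ ∫⁻ x in closedBall x0 (rr 0), (‖P x s‖ₑ ^ (3/2 : ℝ) + ENNReal.ofReal ((t0 - s) ^ (-(1/4) : ℝ)) ^ (3 : ℝ)) :=
              lintegral_mono fun x => by
                beta_reduce
                rw [mul_comm]; exact young32 _ _
          _ ≤ _ := by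
              have hts : 0 ≤ t0 - s := by linarith [hs.2]
              rw [lintegral_add_right _ measurable_const, setLIntegral_const]
              refine add_le_add (setLIntegral_le_lintegral _ _) (le_of_eq ?_)
              rw [vol_cB _ (rr_pos 0).le, rr_zero, mul_comm, ENNReal.ofReal_rpow_of_nonneg (by positivity) (by norm_num), ← Real.rpow_mul hts]
              norm_num
    _ = ENNReal.ofReal (rr n ^ (-(2 * δ))) * ((∫⁻ s in Ik t0 0, ∫⁻ x, ‖P x s‖ₑ ^ (3/2 : ℝ)) + vB * ∫⁻ s in Ik t0 0, ENNReal.ofReal ((t0 - s) ^ (-(3/4) : ℝ))) := by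
        rw [lintegral_const_mul' _ _ ENNReal.ofReal_ne_top, lintegral_add_right _ (mm.const_mul _), lintegral_const_mul' _ _ vB_ne_top]
    _ ≤ _ := by
        refine mul_le_mul' le_rfl (add_le_add ((setLIntegral_le_lintegral _ _).trans S.pK) ?_)
        have := lint_pow (t0 := t0) (c := 1) (γ := 1/4) (by norm_num) (by norm_num)
        rw [Ik_zero, show (-(3/4) : ℝ) = 1/4 - 1 by norm_num, this, mul_comm]
        norm_num
end

/-! ### the core induction step -/
def CX (α : ℝ) : ℝ≥0∞ := ENNReal.ofReal APH * C6 α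
lemma CX_ne_top (α : ℝ) : CX α ≠ ∞ := by
  have := vB_ne_top
  unfold CX C6 C5 C4
  finiteness

section
variable {u : E3 → ℝ → E3} {g : E3 → ℝ → Fin 3 → Fin 3 → ℝ} {P : E3 → ℝ → ℝ} {K ε : ℝ≥0∞}

lemma hw_joint (x0 : E3) (t0 ρ β : ℝ) : Measurable (fun z : E3 × ℝ => hw x0 (t0 - z.2 + ρ) β z.1) := by
  unfold hw hp
  exact ((((measurable_fst.sub_const x0).norm.pow_const 2).add ((measurable_const.sub measurable_snd).add_const ρ)).pow_const (β / 2)).ennreal_ofReal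

lemma core (S : Sol u g P K ε) {x0 : E3} {t0 α δ : ℝ} {n : ℕ} {a : ℕ → ℝ≥0∞} {κ : ℝ≥0∞} (hx0 : x0 ∈ ball (0 : E3) 8) (ht : -4 < t0) (ht0 : t0 < 0)
    (hn : 4 ≤ n) (hα : 0 ≤ α) (hδ : 0 ≤ δ) (h : α + 2 * δ = 1/2) (hB : ∀ k < n, Bd u g x0 t0 k (a k))
    (hS : ∀ᵐ s, s ∈ Ik t0 0 → ∃ V, SH (fun y => u y s) (fun y => g y s) (fun y => P y s) x0 (t0 - s + rr n ^ 2) α κ V) (hκ : κ ≠ ∞) :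
    Bd u g x0 t0 n (16 * (ENNReal.ofReal CPH * K + CX α * κ * (ENNReal.ofReal (rr n ^ (-(2 * δ))) *
      (80 * (∑ k ∈ Finset.range n, a k * ENNReal.ofReal (rr k ^ (1/2 : ℝ))) + (K + 4 * vB))))) := by
  have hr := rr_pos n
  have hr16 : rr n ≤ 1/16 := (rr_anti hn).trans (by norm_num [rr])
  have hr1 : rr n ^ 2 ≤ 1 := by nlinarith
  obtain ⟨τ0, h0, hτ, H1, H2⟩ := energy_core S hx0 ht ht0 hr hr16
  have hE : EX u P K x0 t0 (rr n) τ0 ≤ ENNReal.ofReal CPH * K + CX α * κ * (ENNReal.ofReal (rr n ^ (-(2 * δ))) *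
      (80 * (∑ k ∈ Finset.range n, a k * ENNReal.ofReal (rr k ^ (1/2 : ℝ))) + (K + 4 * vB))) := by
    refine add_le_add le_rfl ?_
    have hI : Ioo (t0 - 1) t0 = Ik t0 0 := (Ik_zero t0).symm
    rw [hI]
    have mA : Measurable (fun s => ∫⁻ x in closedBall x0 (rr 0), G2 (fun y => g y s) x * hw x0 (t0 - s + rr n ^ 2) (-3 + α) x) := by
      have : Measurable (fun z : E3 × ℝ => G2 (fun y => g y z.2) z.1 * hw x0 (t0 - z.2 + rr n ^ 2) (-3 + α) z.1) := S.mG.mul (hw_joint _ _ _ _)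
      exact this.lintegral_prod_left'
    have mC : Measurable (fun s => SS (t0 - s + rr n ^ 2) α * ∫⁻ x in closedBall x0 (rr 0), ‖P x s‖ₑ) := by
      have : Measurable (fun z : E3 × ℝ => ‖P z.1 z.2‖ₑ) := S.mp.enorm
      exact (SS_meas _ _ _).mul this.lintegral_prod_left'
    calc _ ≤ ∫⁻ s in Ik t0 0, CX α * κ * ((∫⁻ x in closedBall x0 (rr 0), G2 (fun y => g y s) x * hw x0 (t0 - s + rr n ^ 2) (-3 + α) x) +
            (SS (t0 - s + rr n ^ 2) α * (∫⁻ x in closedBall x0 (rr 0), ‖P x s‖ₑ) +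
            ∫⁻ x in closedBall x0 (rr 0), ‖u x s‖ₑ ^ 2 * hw x0 (t0 - s + rr n ^ 2) (-3 - α) x * SS (t0 - s + rr n ^ 2) α ^ 2)) := by
          refine setLIntegral_mono_ae' (Ik_meas _ _) ?_
          filter_upwards [hS] with s hs hsI
          obtain ⟨V, H⟩ := hs hsI
          rw [← hI] at hsI
          refine (slice_bound H (PH_PhA h0 hτ hr1 hsI.2 hsI.1)).trans (le_of_eq ?_)
          have hG := H.h.mG2
          have hhw := hw_meas (x0 := x0) H.hσ (-3 + α)
          have hGw : Measurable (fun x => G2 (fun y => g y s) x * hw x0 (t0 - s + rr n ^ 2) (-3 + α) x) := hG.mul hhw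
          rw [rr_zero]
          unfold CX DD
          rw [lintegral_add_left hGw]
          ring
      _ = CX α * κ * ((∫⁻ s in Ik t0 0, ∫⁻ x in closedBall x0 (rr 0), G2 (fun y => g y s) x * hw x0 (t0 - s + rr n ^ 2) (-3 + α) x) +
            ((∫⁻ s in Ik t0 0, SS (t0 - s + rr n ^ 2) α * (∫⁻ x in closedBall x0 (rr 0), ‖P x s‖ₑ)) +
            ∫⁻ s in Ik t0 0, ∫⁻ x in closedBall x0 (rr 0), ‖u x s‖ₑ ^ 2 * hw x0 (t0 - s + rr n ^ 2) (-3 - α) x * SS (t0 - s + rr n ^ 2) α ^ 2)) := by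
          rw [lintegral_const_mul' _ _ (ENNReal.mul_ne_top (CX_ne_top α) hκ), lintegral_add_left mA, lintegral_add_left mC]
      _ ≤ CX α * κ * (ENNReal.ofReal (rr n ^ (-(2 * δ))) * (16 * ∑ k ∈ Finset.range n, a k * ENNReal.ofReal (rr k ^ (1/2 : ℝ))) +
            (ENNReal.ofReal (rr n ^ (-(2 * δ))) * (K + 4 * vB) +
            ENNReal.ofReal (rr n ^ (-(2 * δ))) * (64 * ∑ k ∈ Finset.range n, a k * ENNReal.ofReal (rr k ^ (1/2 : ℝ))))) :=
          mul_le_mul' le_rfl (add_le_add (xi_G S (by omega) hα hδ h hB) (add_le_add (xi_p S hα hδ h) (xi_u S (by omega) hα hδ h hB)))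
      _ = _ := by ring
  have e : ∀ X : ℝ≥0∞, ENNReal.ofReal (16 * rr n ^ 3) * X = 16 * X * ENNReal.ofReal (rr n ^ (3:ℝ)) := fun X => by
    rw [ENNReal.ofReal_mul (by norm_num), show (3:ℝ) = ((3:ℕ):ℝ) by norm_num, Real.rpow_natCast, show ENNReal.ofReal 16 = 16 by norm_num]; ring
  refine ⟨?_, ?_⟩
  · filter_upwards [H1] with t h1 hI
    refine (h1 hI).trans ?_
    rw [e]; gcongr
  · refine H2.trans ?_
    rw [e]; gcongr

lemma Bd_triv (S : Sol u g P K ε) (x0 : E3) (t0 : ℝ) {n : ℕ} (hn : n < 4) : Bd u g x0 t0 n (8 ^ 4 * K) := by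
  have hh : 1 ≤ (8 ^ 4 : ℝ≥0∞) * ENNReal.ofReal (rr n ^ (3:ℝ)) := by
    have h1 : (1/8:ℝ) ≤ rr n := by
      have := rr_anti (show n ≤ 3 by omega); norm_num [rr] at this ⊢; exact this
    have h2 : (1/8:ℝ)^3 ≤ rr n ^ (3:ℝ) := by
      rw [show (3:ℝ) = ((3:ℕ):ℝ) by norm_num, Real.rpow_natCast]; gcongr
    rw [show (8 ^ 4 : ℝ≥0∞) = ENNReal.ofReal (8 ^ 4) by norm_num, ← ENNReal.ofReal_mul (by norm_num), ← ENNReal.ofReal_one]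
    exact ENNReal.ofReal_le_ofReal (by nlinarith)
  have h3 : K ≤ 8 ^ 4 * K * ENNReal.ofReal (rr n ^ (3:ℝ)) := by
    calc K = K * 1 := (mul_one K).symm
      _ ≤ K * ((8 ^ 4 : ℝ≥0∞) * ENNReal.ofReal (rr n ^ (3:ℝ))) := mul_le_mul' le_rfl hh
      _ = _ := by ring
  refine ⟨?_, ?_⟩
  · filter_upwards [S.uK] with t h1 _
    exact (setLIntegral_le_lintegral _ _).trans (h1.trans h3)
  · exact (setLIntegral_le_lintegral _ _).trans ((lintegral_mono fun t => setLIntegral_le_lintegral _ _).trans (S.gK.trans h3))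

lemma Bd.mono {x0 : E3} {t0 : ℝ} {n : ℕ} {a b : ℝ≥0∞} (h : Bd u g x0 t0 n a) (hab : a ≤ b) : Bd u g x0 t0 n b := by
  refine ⟨?_, h.b2.trans (mul_le_mul' hab le_rfl)⟩
  filter_upwards [h.b1] with t h1 hI
  exact (h1 hI).trans (mul_le_mul' hab le_rfl)
end

/-! ### the first pass -/
section
variable {c y : E3} {L : ℝ}
lemma cuL_zero (hL : 0 < L) (h : L ≤ ‖y - c‖) : cu c (L ^ 2)⁻¹ y = 0 := by
  refine cu_zero ?_
  rw [inv_mul_eq_div, one_le_div (by positivity)]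
  gcongr
lemma cuL_one (hL : 0 < L) (h : ‖y - c‖ ≤ L / 2) : cu c (L ^ 2)⁻¹ y = 1 := by
  refine cu_one ?_
  rw [inv_mul_eq_div, div_le_iff₀ (by positivity)]
  have := norm_nonneg (y - c)
  nlinarith
lemma cuL_cs (hL : 0 < L) : HasCompactSupport (cu c (L ^ 2)⁻¹) :=
  cu_cs (by positivity) hL.le (by rw [inv_mul_cancel₀ (by positivity)])
lemma cuL_grad (hL : 0 < L) (y : E3) : ‖fderiv ℝ (cu c (L ^ 2)⁻¹) y‖ ≤ (closedBall c L).indicator (fun _ => 2 * Kct / L) y := by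
  have hK := Kct_one
  by_cases hy : y ∈ closedBall c L
  · rw [indicator_of_mem hy]
    have hd : HasDerivAt (fun τ => ct ((L ^ 2)⁻¹ * τ)) ((L ^ 2)⁻¹ * deriv ct ((L ^ 2)⁻¹ * ‖y - c‖ ^ 2)) (‖y - c‖ ^ 2) := by
      have h1 := (ct_hasDeriv ((L ^ 2)⁻¹ * ‖y - c‖ ^ 2)).comp (‖y - c‖ ^ 2) ((hasDerivAt_id (‖y - c‖ ^ 2)).const_mul ((L ^ 2)⁻¹))
      rw [mul_one, mul_comm] at h1
      exact h1
    have e := rad_fderiv_norm hd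
    have e2 : (fun z => ct ((L ^ 2)⁻¹ * ‖z - c‖ ^ 2)) = cu c (L ^ 2)⁻¹ := rfl
    rw [e2] at e
    rw [e, abs_mul, abs_of_pos (by positivity)]
    have h1 := ct_deriv_le ((L ^ 2)⁻¹ * ‖y - c‖ ^ 2)
    rw [mem_closedBall, dist_eq_norm] at hy
    calc _ ≤ 2 * ((L ^ 2)⁻¹ * Kct) * L := by gcongr
      _ = _ := by field_simp
  · rw [indicator_of_notMem hy]
    have hs : y ∉ tsupport (cu c (L ^ 2)⁻¹) := fun h => hy (cu_supp (by positivity) hL.le (by rw [inv_mul_cancel₀ (by positivity)]) h)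
    have := image_eq_zero_of_notMem_tsupport (fun h => hs (tsupport_fderiv_subset ℝ h))
    rw [this, norm_zero]
end

section
variable {u : E3 → ℝ → E3} {g : E3 → ℝ → Fin 3 → Fin 3 → ℝ} {P : E3 → ℝ → ℝ} {K ε : ℝ≥0∞}

def Cm : ℝ≥0∞ := ENNReal.ofReal (8 * Kct) * vB + 1
lemma Cm_ne_top : Cm ≠ ∞ := by
  have := vB_ne_top
  unfold Cm; finiteness
lemma Cm_one : 1 ≤ Cm := le_add_self

lemma Mo_tr {V : E3 → ℝ≥0∞} (h : ∀ f : E3 → ℝ, ContDiff ℝ 1 f → HasCompactSupport f → ∫⁻ x, V x * ‖f x‖ₑ ≤ ε * ∫⁻ x, ‖fderiv ℝ f x‖ₑ) :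
    Mo (Cm * ε) 0 V := by
  intro x s hs
  have hK := Kct_one
  have hL : 0 < 2 * s := by linarith
  have hcd : ContDiff ℝ 1 (cu x ((2 * s) ^ 2)⁻¹) := cu_contDiff (n := 1)
  have hcs : HasCompactSupport (cu x ((2 * s) ^ 2)⁻¹) := cuL_cs hL
  have hgr := cuL_grad (c := x) hL
  have hone : ∀ y ∈ closedBall x s, cu x ((2 * s) ^ 2)⁻¹ y = 1 := fun y hy => cuL_one hL (by rw [mem_closedBall, dist_eq_norm] at hy; linarith)
  generalize cu x ((2 * s) ^ 2)⁻¹ = f at *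
  calc _ ≤ ∫⁻ y, V y * ‖f y‖ₑ := by
        rw [← lintegral_indicator isClosed_closedBall.measurableSet]
        refine lintegral_mono fun y => ?_
        by_cases hy : y ∈ closedBall x s
        · rw [indicator_of_mem hy, hone y hy]; simp
        · rw [indicator_of_notMem hy]; exact zero_le
    _ ≤ ε * ∫⁻ y, ‖fderiv ℝ f y‖ₑ := h _ hcd hcs
    _ ≤ ε * ∫⁻ y, (closedBall x (2 * s)).indicator (fun _ => ENNReal.ofReal (Kct / s)) y := by
        refine mul_le_mul' le_rfl (lintegral_mono fun y => ?_)
        rw [← ofReal_norm]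
        refine (ENNReal.ofReal_le_ofReal (hgr y)).trans ?_
        by_cases hy : y ∈ closedBall x (2 * s)
        · rw [indicator_of_mem hy, indicator_of_mem hy, show 2 * Kct / (2 * s) = Kct / s by field_simp]
        · rw [indicator_of_notMem hy, indicator_of_notMem hy, ENNReal.ofReal_zero]
    _ = ε * (ENNReal.ofReal (8 * Kct) * vB * ENNReal.ofReal (s ^ (2 + 0 : ℝ))) := by
        have er : Kct / s * (2 * s) ^ (3:ℝ) = 8 * Kct * s ^ (2 + 0 : ℝ) := by
          rw [add_zero, show (3:ℝ) = ((3:ℕ):ℝ) by norm_num, show s ^ (2:ℝ) = s ^ 2 from Real.rpow_natCast s 2, Real.rpow_natCast]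
          field_simp
          ring
        rw [lintegral_indicator isClosed_closedBall.measurableSet, setLIntegral_const, vol_cB x hL.le, mul_comm vB, ← mul_assoc (ENNReal.ofReal _), ← ENNReal.ofReal_mul (by positivity),
          mul_right_comm _ vB, ← ENNReal.ofReal_mul (by positivity), er]
    _ ≤ _ := by
        have : ENNReal.ofReal (8 * Kct) * vB ≤ Cm := le_self_add
        calc _ = ENNReal.ofReal (8 * Kct) * vB * ε * ENNReal.ofReal (s ^ (2 + 0 : ℝ)) := by ring
          _ ≤ _ := by gcongr

lemma rr_half (k : ℕ) : 5/8 * rr k ^ (1/2 : ℝ) ≤ rr (k + 1) ^ (1/2 : ℝ) := by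
  rw [rr_succ, div_eq_mul_inv (rr k), Real.mul_rpow (rr_pos k).le (by norm_num), mul_comm]
  have : 5/8 ≤ (2⁻¹:ℝ) ^ (1/2 : ℝ) := by
    rw [← Real.sqrt_eq_rpow]; exact Real.le_sqrt_of_sq_le (by norm_num)
  have h2 := rr_pos k
  gcongr

lemma sum1 (n : ℕ) : ∑ k ∈ Finset.range n, ENNReal.ofReal (2 ^ k * rr k ^ (1/2 : ℝ)) ≤ ENNReal.ofReal (4 * (2 ^ n * rr n ^ (1/2 : ℝ))) := by
  induction n with
  | zero => simp
  | succ n ih =>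
    have h2 := rr_pos n
    rw [Finset.sum_range_succ]
    refine (add_le_add ih le_rfl).trans ?_
    rw [← ENNReal.ofReal_add (by positivity) (by positivity)]
    refine ENNReal.ofReal_le_ofReal ?_
    have := rr_half n
    have h3 : (0:ℝ) < 2 ^ n := by positivity
    rw [pow_succ]
    nlinarith

lemma rr_two (n : ℕ) : 2 ^ n * rr n = 1 := by unfold rr; rw [← mul_pow]; norm_num

def N1 (K : ℝ≥0∞) : ℝ≥0∞ := 2 * (16 * (ENNReal.ofReal CPH * K) + (K + 4 * vB)) + 8 ^ 4 * K
lemma N1_ne_top (hK : K ≠ ∞) : N1 K ≠ ∞ := by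
  have := vB_ne_top
  unfold N1; finiteness

lemma pass1 (S : Sol u g P K ε) (hε : ε ≠ 0) (hεt : ε ≠ ∞) (hs : 5120 * (CX 0 * (Cm * ε)) ≤ 2⁻¹) {x0 : E3} {t0 : ℝ} (hx0 : x0 ∈ ball (0 : E3) 8) (ht : -4 < t0) (ht0 : t0 < 0) (n : ℕ) :
    Bd u g x0 t0 n (N1 K * 2 ^ n) := by
  have hk0 : Cm * ε ≠ 0 := mul_ne_zero (fun h => by have := Cm_one; rw [h] at this; simp at this) hε
  have hkt : Cm * ε ≠ ∞ := ENNReal.mul_ne_top Cm_ne_top hεt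
  induction n using Nat.strong_induction_on with
  | _ n ih =>
  rcases lt_or_ge n 4 with hn | hn
  · refine (Bd_triv S x0 t0 hn).mono ?_
    calc 8 ^ 4 * K ≤ N1 K * 1 := by rw [mul_one]; exact le_add_self
      _ ≤ _ := mul_le_mul' le_rfl (one_le_pow₀ (by norm_num))
  have hr := rr_pos n
  have key := core (α := 0) (δ := 1/4) (κ := Cm * ε) (a := fun k => N1 K * 2 ^ k) S hx0 ht ht0 hn le_rfl (by norm_num) (by norm_num) ih ?_ hkt
  · refine key.mono ?_
    have e1 : ∑ k ∈ Finset.range n, N1 K * 2 ^ k * ENNReal.ofReal (rr k ^ (1/2 : ℝ)) ≤ N1 K * ENNReal.ofReal (4 * (2 ^ n * rr n ^ (1/2 : ℝ))) := by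
      refine le_trans (le_of_eq ?_) (mul_le_mul' le_rfl (sum1 n))
      rw [Finset.mul_sum]
      refine Finset.sum_congr rfl fun k _ => ?_
      rw [ENNReal.ofReal_mul (by positivity), ENNReal.ofReal_pow (by norm_num), mul_assoc]; norm_num
    have e2 : ENNReal.ofReal (rr n ^ (-(2 * (1/4)) : ℝ)) * ENNReal.ofReal (4 * (2 ^ n * rr n ^ (1/2 : ℝ))) = 4 * 2 ^ n := by
      rw [← ENNReal.ofReal_mul (by positivity), show rr n ^ (-(2 * (1/4)) : ℝ) * (4 * (2 ^ n * rr n ^ (1/2 : ℝ))) = 4 * 2 ^ n * (rr n ^ (-(2 * (1/4)) : ℝ) * rr n ^ (1/2 : ℝ)) by ring,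
        ← Real.rpow_add hr, ENNReal.ofReal_mul (by positivity), ENNReal.ofReal_mul (by norm_num), ENNReal.ofReal_pow (by norm_num)]
      norm_num
    have e3 : ENNReal.ofReal (rr n ^ (-(2 * (1/4)) : ℝ)) ≤ 2 ^ n := by
      have : rr n ^ (-(2 * (1/4)) : ℝ) ≤ 2 ^ n := by
        calc _ ≤ rr n ^ (-1 : ℝ) := Real.rpow_le_rpow_of_exponent_ge hr (rr_le_one n) (by norm_num)
          _ = 2 ^ n := by rw [Real.rpow_neg_one, ← eq_inv_of_mul_eq_one_left (rr_two n)]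
      refine (ENNReal.ofReal_le_ofReal this).trans (le_of_eq ?_)
      rw [ENNReal.ofReal_pow (by norm_num)]; norm_num
    have h2 : (2:ℝ≥0∞)⁻¹ ≤ 1 := ENNReal.inv_le_one.2 (by norm_num)
    have h3 : 16 * (CX 0 * (Cm * ε)) ≤ 1 := by
      refine le_trans ?_ (hs.trans h2)
      exact mul_le_mul' (by norm_num) le_rfl
    have h1n : (1:ℝ≥0∞) ≤ 2 ^ n := one_le_pow₀ (by norm_num)
    calc _ ≤ 16 * (ENNReal.ofReal CPH * K + CX 0 * (Cm * ε) * (ENNReal.ofReal (rr n ^ (-(2 * (1/4)) : ℝ)) *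
              (80 * (N1 K * ENNReal.ofReal (4 * (2 ^ n * rr n ^ (1/2 : ℝ)))) + (K + 4 * vB)))) := by gcongr
      _ = 16 * (ENNReal.ofReal CPH * K) * 1 + 1280 * (CX 0 * (Cm * ε)) * N1 K * (ENNReal.ofReal (rr n ^ (-(2 * (1/4)) : ℝ)) * ENNReal.ofReal (4 * (2 ^ n * rr n ^ (1/2 : ℝ)))) +
            16 * (CX 0 * (Cm * ε)) * (K + 4 * vB) * ENNReal.ofReal (rr n ^ (-(2 * (1/4)) : ℝ)) := by ring
      _ ≤ 16 * (ENNReal.ofReal CPH * K) * 2 ^ n + 1280 * (CX 0 * (Cm * ε)) * N1 K * (4 * 2 ^ n) + 1 * (K + 4 * vB) * 2 ^ n := by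
          rw [e2]; gcongr
      _ = (5120 * (CX 0 * (Cm * ε)) * N1 K + (16 * (ENNReal.ofReal CPH * K) + (K + 4 * vB))) * 2 ^ n := by ring
      _ ≤ _ := by
          gcongr
          calc _ ≤ 2⁻¹ * N1 K + 2⁻¹ * N1 K := by
                gcongr
                unfold N1
                rw [mul_add, ← mul_assoc 2⁻¹ 2, ENNReal.inv_mul_cancel (by norm_num) (by norm_num), one_mul]
                exact le_self_add
            _ = N1 K := by rw [← add_mul, ENNReal.inv_two_add_inv_two, one_mul]
  · filter_upwards [S.sl, S.tr] with s h1 h2 hsI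
    have hI := Ik_zero t0 ▸ hsI
    have hrr : rr n ^ 2 ≤ 1 := pow_le_one₀ hr.le (rr_le_one n)
    have hσ : 0 < t0 - s + rr n ^ 2 := by have := hI.2; positivity [sub_pos.2 this]
    refine ⟨fun y => ‖u y s‖ₑ, h1, hx0, hσ, by linarith [hI.1], hk0, hkt, le_rfl, one_pos, h1.mv.enorm, fun y _ => le_rfl, fun f hf hcs _ => ?_, Mo_tr h2⟩
    calc _ ≤ ε * ∫⁻ x, ‖fderiv ℝ f x‖ₑ := h2 f hf hcs
      _ ≤ _ := by
          refine mul_le_mul' ?_ (lintegral_mono fun x => ?_)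
          · calc ε = 1 * ε := (one_mul _).symm
              _ ≤ _ := mul_le_mul' Cm_one le_rfl
          · rw [hw_zero, mul_one]; exact le_self_add
end

/-! ### the trace inequality from the Morrey bound -/
def An : Set E3 := ball 0 1 \ closedBall 0 (1/2)
def vA : ℝ≥0∞ := volume An
lemma An_open : IsOpen An := isOpen_ball.sdiff isClosed_closedBall
lemma vA_ne_zero : vA ≠ 0 := by
  refine (An_open.measure_pos volume ⟨pt3 (3/4) 0 0, ?_⟩).ne'
  have : ‖pt3 (3/4) 0 0‖ = 3/4 := by
    rw [EuclideanSpace.norm_eq]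
    simp only [pt3, Fin.sum_univ_three]
    simp
    exact Real.sqrt_sq (by norm_num)
  simp only [An, mem_diff, mem_ball, mem_closedBall, dist_zero_right, this]
  norm_num
lemma vA_ne_top : vA ≠ ∞ := ((measure_mono diff_subset).trans_lt (measure_ball_lt_top (x := (0:E3)) (r := 1))).ne

lemma ray {F : E3 → ℝ} (hF : ContDiff ℝ 1 F) {y z : E3} {T : ℝ} (hT : 0 < T) (h0 : F (y + T • z) = 0) (hz : ‖z‖ ≤ 1) :
    ‖F y‖ₑ ≤ ∫⁻ s in Ioc 0 T, ‖fderiv ℝ F (y + s • z)‖ₑ := by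
  have hd : ∀ s : ℝ, HasDerivAt (fun s : ℝ => F (y + s • z)) (fderiv ℝ F (y + s • z) z) s := fun s => by
    have h1 : HasDerivAt (fun s : ℝ => y + s • z) z s := by
      simpa using ((hasDerivAt_id s).smul_const z).const_add y
    exact ((hF.differentiable one_ne_zero) (y + s • z)).hasFDerivAt.comp_hasDerivAt s h1
  have hc : Continuous (fun s : ℝ => fderiv ℝ F (y + s • z) z) := by
    have h1 := hF.continuous_fderiv one_ne_zero
    have h2 : Continuous (fun s : ℝ => y + s • z) := by fun_prop
    exact (h1.comp h2).clm_apply continuous_const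
  have h1 := intervalIntegral.integral_eq_sub_of_hasDerivAt (a := 0) (b := T) (fun s _ => hd s) (hc.intervalIntegrable _ _)
  rw [h0, zero_smul, add_zero, zero_sub, intervalIntegral.integral_of_le hT.le] at h1
  have e : ‖F y‖ₑ = ‖∫ s in Ioc 0 T, fderiv ℝ F (y + s • z) z‖ₑ := by rw [h1, enorm_neg]
  rw [e]
  refine (enorm_integral_le_lintegral_enorm _).trans (lintegral_mono fun s => ?_)
  beta_reduce
  rw [← ofReal_norm, ← ofReal_norm]
  refine ENNReal.ofReal_le_ofReal (((fderiv ℝ F (y + s • z)).le_opNorm z).trans ?_)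
  exact mul_le_of_le_one_right (norm_nonneg _) hz

lemma ker_s (w : E3) : ∫⁻ s in Ioi (0:ℝ), An.indicator (fun _ => (1:ℝ≥0∞)) (s⁻¹ • w) * ENNReal.ofReal ((s ^ 3)⁻¹) ≤ kk 2 w := by
  rcases eq_or_ne w 0 with rfl | hw
  · have : (0:E3) ∉ An := by simp [An]
    simp [indicator_of_notMem this]
  have hw' := norm_pos_iff.2 hw
  calc _ ≤ ∫⁻ s, (Icc ‖w‖ (2 * ‖w‖)).indicator (fun _ => ENNReal.ofReal ((‖w‖ ^ 3)⁻¹)) s := by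
        rw [← lintegral_indicator measurableSet_Ioi]
        refine lintegral_mono fun s => ?_
        by_cases hs : s ∈ Ioi (0:ℝ)
        swap
        · rw [indicator_of_notMem hs]; exact zero_le
        rw [indicator_of_mem hs]
        have hs' : 0 < s := hs
        by_cases hA : s⁻¹ • w ∈ An
        swap
        · rw [indicator_of_notMem hA, zero_mul]; exact zero_le
        rw [indicator_of_mem hA, one_mul]
        simp only [An, mem_diff, mem_ball, mem_closedBall, dist_zero_right, norm_smul, norm_inv, Real.norm_eq_abs, abs_of_pos hs', not_le, inv_mul_eq_div] at hA
        rw [div_lt_one hs', lt_div_iff₀ hs'] at hA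
        have hI : s ∈ Icc ‖w‖ (2 * ‖w‖) := ⟨hA.1.le, by linarith [hA.2]⟩
        rw [indicator_of_mem hI]
        refine ENNReal.ofReal_le_ofReal ?_
        have := hA.1.le
        gcongr
    _ = _ := by
        rw [lintegral_indicator measurableSet_Icc, setLIntegral_const, Real.volume_Icc, ← ENNReal.ofReal_mul (by positivity), kk]
        congr 1
        rw [Real.rpow_neg hw'.le, show (2:ℝ) = ((2:ℕ):ℝ) by norm_num, Real.rpow_natCast]
        push_cast
        field_simp
        ring

lemma pot {F : E3 → ℝ} (hF : ContDiff ℝ 1 F) {y : E3} {T : ℝ} (hT : 0 < T) (h0 : ∀ z, T / 2 ≤ ‖z - y‖ → F z = 0) :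
    vA * ‖F y‖ₑ ≤ ∫⁻ w, ‖fderiv ℝ F w‖ₑ * kk 2 (w - y) := by
  have hm : Measurable (fun w => ‖fderiv ℝ F w‖ₑ) := (hF.continuous_fderiv one_ne_zero).measurable.enorm
  have mI : Measurable (An.indicator (fun _ => (1:ℝ≥0∞))) := measurable_const.indicator An_open.measurableSet
  set G : E3 → ℝ≥0∞ := fun w => ‖fderiv ℝ F w‖ₑ with hG
  have m1 : Measurable (fun p : E3 × ℝ => G (y + p.2 • p.1)) := hm.comp (by fun_prop)
  have m2 : Measurable (fun p : ℝ × E3 => An.indicator (fun _ => (1:ℝ≥0∞)) (p.1⁻¹ • p.2) * ENNReal.ofReal ((p.1 ^ 3)⁻¹) * G (y + p.2)) :=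
    ((mI.comp (measurable_fst.inv.smul measurable_snd)).mul (measurable_fst.pow_const 3).inv.ennreal_ofReal).mul (hm.comp (measurable_snd.const_add y))
  calc vA * ‖F y‖ₑ = ∫⁻ z in An, ‖F y‖ₑ := by rw [setLIntegral_const, mul_comm]; rfl
    _ ≤ ∫⁻ z in An, ∫⁻ s in Ioc 0 T, G (y + s • z) := by
        refine setLIntegral_mono' An_open.measurableSet fun z hz => ?_
        simp only [An, mem_diff, mem_ball, mem_closedBall, dist_zero_right, not_le] at hz
        refine ray hF hT (h0 _ ?_) hz.1.le
        rw [add_sub_cancel_left, norm_smul, Real.norm_eq_abs, abs_of_pos hT]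
        nlinarith [hz.2]
    _ ≤ ∫⁻ z in An, ∫⁻ s in Ioi 0, G (y + s • z) := lintegral_mono fun z => lintegral_mono_set Ioc_subset_Ioi_self
    _ = ∫⁻ s in Ioi 0, ∫⁻ z in An, G (y + s • z) := lintegral_lintegral_swap m1.aemeasurable
    _ = ∫⁻ s in Ioi 0, ∫⁻ w, An.indicator (fun _ => (1:ℝ≥0∞)) (s⁻¹ • w) * ENNReal.ofReal ((s ^ 3)⁻¹) * G (y + w) := by
        refine setLIntegral_congr_fun measurableSet_Ioi fun s hs => ?_
        have hs' : 0 < s := hs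
        have e := sc_lintx' hs' (fun w => An.indicator (fun _ => (1:ℝ≥0∞)) (s⁻¹ • w) * G (y + w))
        simp only [inv_smul_smul₀ hs'.ne'] at e
        rw [← lintegral_const_mul' _ _ ENNReal.ofReal_ne_top] at e
        beta_reduce
        rw [← lintegral_indicator An_open.measurableSet]
        refine Eq.trans (lintegral_congr fun z => ?_) (e.trans (lintegral_congr fun z => by ring))
        by_cases hz : z ∈ An
        · rw [indicator_of_mem hz, indicator_of_mem hz, one_mul]
        · rw [indicator_of_notMem hz, indicator_of_notMem hz, zero_mul]
    _ = ∫⁻ w, ∫⁻ s in Ioi 0, An.indicator (fun _ => (1:ℝ≥0∞)) (s⁻¹ • w) * ENNReal.ofReal ((s ^ 3)⁻¹) * G (y + w) := lintegral_lintegral_swap m2.aemeasurable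
    _ ≤ ∫⁻ w, G (y + w) * kk 2 w := by
        refine lintegral_mono fun w => ?_
        beta_reduce
        rw [lintegral_mul_const' _ _ enorm_ne_top, mul_comm]
        exact mul_le_mul' le_rfl (ker_s w)
    _ = ∫⁻ w, G w * kk 2 (w - y) := by
        rw [← lintegral_add_left_eq_self (fun w => G w * kk 2 (w - y)) y]
        simp only [add_sub_cancel_left]

lemma pot_loc {f : E3 → ℝ} (hf : ContDiff ℝ 1 f) (y : E3) {L : ℝ} (hL : 0 < L) :
    vA * ‖f y‖ₑ ≤ ∫⁻ w in closedBall y L, (‖fderiv ℝ f w‖ₑ + ‖f w‖ₑ * ENNReal.ofReal (2 * Kct / L)) * kk 2 (w - y) := by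
  have hc : ContDiff ℝ 1 (cu y (L ^ 2)⁻¹) := cu_contDiff (n := 1)
  have h1 := cuL_grad (c := y) hL
  have h2 : cu y (L ^ 2)⁻¹ y = 1 := cuL_one hL (by simp; positivity)
  have h3 : ∀ z, L ≤ ‖z - y‖ → cu y (L ^ 2)⁻¹ z = 0 := fun z h => cuL_zero hL h
  have h4 := cu_abs (c := y) (R := (L ^ 2)⁻¹)
  have h5 : ∀ z, z ∉ closedBall y L → cu y (L ^ 2)⁻¹ z = 0 := fun z h => h3 z (by rw [mem_closedBall, dist_eq_norm] at h; linarith)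
  generalize cu y (L ^ 2)⁻¹ = c at *
  have := pot (F := fun w => f w * c w) (hf.mul hc) (y := y) (T := 2 * L) (by linarith) (fun z hz => by
    beta_reduce; rw [h3 z (by linarith), mul_zero])
  beta_reduce at this
  rw [h2, mul_one] at this
  refine this.trans ?_
  rw [← lintegral_indicator isClosed_closedBall.measurableSet]
  refine lintegral_mono fun w => ?_
  beta_reduce
  rw [fderiv_fun_mul ((hf.differentiable one_ne_zero) w) ((hc.differentiable one_ne_zero) w)]
  have hb := h1 w
  by_cases hw : w ∈ closedBall y L
  · rw [indicator_of_mem hw] at hb ⊢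
    refine mul_le_mul' ?_ le_rfl
    refine (enorm_add_le (f w • fderiv ℝ c w) (c w • fderiv ℝ f w)).trans ?_
    rw [add_comm, enorm_smul, enorm_smul]
    refine add_le_add ?_ (mul_le_mul' le_rfl ?_)
    · rw [← ofReal_norm (c w), Real.norm_eq_abs]
      calc _ ≤ ENNReal.ofReal 1 * ‖fderiv ℝ f w‖ₑ := mul_le_mul' (ENNReal.ofReal_le_ofReal (h4 w)) le_rfl
        _ = _ := by rw [ENNReal.ofReal_one, one_mul]
    · rw [← ofReal_norm]; exact ENNReal.ofReal_le_ofReal hb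
  · rw [indicator_of_notMem hw] at hb
    have e : fderiv ℝ c w = 0 := norm_le_zero_iff.1 hb
    rw [e, h5 w hw, smul_zero, zero_smul, add_zero, ← ofReal_norm, norm_zero, ENNReal.ofReal_zero, zero_mul]; exact zero_le

def CT (α : ℝ) : ℝ≥0∞ := vA⁻¹ * (ENNReal.ofReal (16 * Kct) * ENNReal.ofReal (Cdy 2 α))
lemma CT_ne_top (α : ℝ) : CT α ≠ ∞ :=
  ENNReal.mul_ne_top (ENNReal.inv_ne_top.2 vA_ne_zero) (ENNReal.mul_ne_top ENNReal.ofReal_ne_top ENNReal.ofReal_ne_top)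

lemma Tr_Mo {V : E3 → ℝ≥0∞} {x0 : E3} {σ α : ℝ} {κ : ℝ≥0∞} (hV : Measurable V) (hσ : 0 < σ) (hα : 0 < α) (hM : Mo κ α V) : Tr x0 σ (CT α * κ) α V := by
  intro f hf _ _
  have hK := Kct_one
  have hp1 : ∀ x, 0 < hp x0 σ 1 x := fun x => hp_pos hσ 1 x
  have mg : Measurable (fun w => ‖fderiv ℝ f w‖ₑ) := (hf.continuous_fderiv one_ne_zero).measurable.enorm
  have mf : Measurable (fun w => ‖f w‖ₑ) := hf.continuous.measurable.enorm
  have mh := hw_meas (x0 := x0) hσ (-1)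
  set H : E3 → ℝ≥0∞ := fun w => ‖fderiv ℝ f w‖ₑ + ‖f w‖ₑ * hw x0 σ (-1) w with hH
  have mH : Measurable H := mg.add (mf.mul mh)
  have mhp : Measurable (hp x0 σ 1) := (hp_cont hσ 1).measurable
  set D : Set (E3 × E3) := {p | ‖p.1 - p.2‖ ≤ hp x0 σ 1 p.2 / 3} with hD
  have mD : MeasurableSet D := measurableSet_le (measurable_fst.sub measurable_snd).norm ((mhp.comp measurable_snd).div_const 3)
  set I : E3 → E3 → ℝ≥0∞ := fun y w => D.indicator (fun _ => 1) (y, w) with hI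
  have mI : Measurable (fun p : E3 × E3 => D.indicator (fun _ => (1:ℝ≥0∞)) p) := measurable_const.indicator mD
  have mk : Measurable (fun p : E3 × E3 => V p.1 * (ENNReal.ofReal (16 * Kct) * H p.2 * (I p.1 p.2 * kk 2 (p.1 - p.2)))) :=
    (hV.comp measurable_fst).mul (((mH.comp measurable_snd).const_mul _).mul (mI.mul ((kk_meas 2).comp (measurable_fst.sub measurable_snd))))
  have p1 : ∀ y, vA * ‖f y‖ₑ ≤ ∫⁻ w, ENNReal.ofReal (16 * Kct) * H w * (I y w * kk 2 (y - w)) := fun y => by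
    refine (pot_loc hf y (L := hp x0 σ 1 y / 4) (by linarith [hp1 y])).trans ?_
    rw [← lintegral_indicator isClosed_closedBall.measurableSet]
    refine lintegral_mono fun w => ?_
    by_cases hw' : w ∈ closedBall y (hp x0 σ 1 y / 4)
    swap
    · rw [indicator_of_notMem hw']; exact zero_le
    rw [indicator_of_mem hw']
    rw [mem_closedBall, dist_eq_norm] at hw'
    have hl := hp_lip (x0 := x0) hσ w y
    rw [norm_sub_rev] at hl
    have hyw : ‖y - w‖ ≤ hp x0 σ 1 w / 3 := by rw [norm_sub_rev]; linarith
    have hin : I y w = 1 := indicator_of_mem (show (y, w) ∈ D from hyw) _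
    have hkk : kk 2 (w - y) = kk 2 (y - w) := by unfold kk; rw [norm_sub_rev]
    rw [hin, one_mul, hkk]
    refine mul_le_mul' ?_ le_rfl
    have hc := hp_comp (x0 := x0) hσ (x := w) (y := y) (by linarith [hp1 w]) (-1)
    have hinv : hp x0 σ (-1) y = (hp x0 σ 1 y)⁻¹ := by
      have := hp_mul (x0 := x0) hσ 1 (-1) y
      rw [show (1:ℝ) + -1 = 0 by norm_num, hp_zero] at this
      exact eq_inv_of_mul_eq_one_right this
    have h1 : ENNReal.ofReal (2 * Kct / (hp x0 σ 1 y / 4)) ≤ ENNReal.ofReal (16 * Kct) * hw x0 σ (-1) w := by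
      unfold hw
      rw [← ENNReal.ofReal_mul (by positivity)]
      refine ENNReal.ofReal_le_ofReal ?_
      rw [abs_neg, abs_one, Real.rpow_one, hinv] at hc
      calc _ = 8 * Kct * (hp x0 σ 1 y)⁻¹ := by have := hp1 y; field_simp; ring
        _ ≤ 8 * Kct * (2 * hp x0 σ (-1) w) := by gcongr
        _ = _ := by ring
    have h2 : (1:ℝ≥0∞) ≤ ENNReal.ofReal (16 * Kct) := by rw [← ENNReal.ofReal_one]; exact ENNReal.ofReal_le_ofReal (by linarith)
    calc _ ≤ ENNReal.ofReal (16 * Kct) * ‖fderiv ℝ f w‖ₑ + ‖f w‖ₑ * (ENNReal.ofReal (16 * Kct) * hw x0 σ (-1) w) :=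
          add_le_add (by calc _ = 1 * ‖fderiv ℝ f w‖ₑ := (one_mul _).symm
                          _ ≤ _ := mul_le_mul' h2 le_rfl) (mul_le_mul' le_rfl h1)
      _ = _ := by simp only [hH]; ring
  have p2 : ∀ w, ∫⁻ y, V y * (I y w * kk 2 (y - w)) ≤ κ * ENNReal.ofReal (Cdy 2 α) * hw x0 σ α w := fun w => by
    have hρ : 0 < hp x0 σ 1 w := hp1 w
    have := near_pot (κ := κ) (γ := 2 + α) (β := 2) hV (by norm_num) (by linarith) (x := w) (fun s hs => hM w s hs) (ρ := hp x0 σ 1 w) hρ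
    rw [show 2 + α - 2 = α by ring] at this
    have e : hw x0 σ α w = ENNReal.ofReal (hp x0 σ 1 w ^ α) := by unfold hw; rw [hp_eq_rpow hσ α w]
    rw [e, mul_assoc, ← ENNReal.ofReal_mul (Cdy_pos hα).le]
    refine le_trans ?_ this
    rw [← lintegral_indicator isClosed_closedBall.measurableSet]
    refine lintegral_mono fun y => ?_
    by_cases hy : (y, w) ∈ D
    · have hy2 : y ∈ closedBall w (hp x0 σ 1 w) := by
        rw [mem_closedBall, dist_eq_norm]
        have : ‖y - w‖ ≤ hp x0 σ 1 w / 3 := hy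
        linarith
      rw [indicator_of_mem hy2]
      simp only [hI, indicator_of_mem hy, one_mul]
      exact le_rfl
    · simp only [hI, indicator_of_notMem hy, zero_mul, mul_zero]; exact zero_le
  have hva : ∀ X : ℝ≥0∞, X = vA⁻¹ * (vA * X) := fun X => by rw [← mul_assoc, ENNReal.inv_mul_cancel vA_ne_zero vA_ne_top, one_mul]
  calc ∫⁻ x, V x * ‖f x‖ₑ = vA⁻¹ * (∫⁻ x, V x * (vA * ‖f x‖ₑ)) := by
        rw [hva (∫⁻ x, V x * ‖f x‖ₑ), ← lintegral_const_mul' _ _ vA_ne_top]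
        congr 2; ext x; ring
    _ ≤ vA⁻¹ * (∫⁻ y, V y * ∫⁻ w, ENNReal.ofReal (16 * Kct) * H w * (I y w * kk 2 (y - w))) :=
        mul_le_mul' le_rfl (lintegral_mono fun y => mul_le_mul' le_rfl (p1 y))
    _ = vA⁻¹ * (∫⁻ y, ∫⁻ w, V y * (ENNReal.ofReal (16 * Kct) * H w * (I y w * kk 2 (y - w)))) := by
        congr 2; ext y
        rw [lintegral_const_mul]
        have : Measurable (fun w => I y w) := mI.comp (measurable_const.prodMk measurable_id)
        exact (mH.const_mul _).mul (this.mul ((kk_meas 2).comp (measurable_const.sub measurable_id)))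
    _ = vA⁻¹ * (∫⁻ w, ∫⁻ y, V y * (ENNReal.ofReal (16 * Kct) * H w * (I y w * kk 2 (y - w)))) := by
        rw [lintegral_lintegral_swap mk.aemeasurable]
    _ ≤ vA⁻¹ * (∫⁻ w, (ENNReal.ofReal (16 * Kct) * (κ * ENNReal.ofReal (Cdy 2 α))) * (H w * hw x0 σ α w)) := by
        refine mul_le_mul' le_rfl (lintegral_mono fun w => ?_)
        beta_reduce
        have mw : Measurable (fun y => V y * (I y w * kk 2 (y - w))) :=
          hV.mul ((mI.comp (measurable_id.prodMk measurable_const)).mul ((kk_meas 2).comp (measurable_id.sub measurable_const)))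
        calc _ = ENNReal.ofReal (16 * Kct) * H w * ∫⁻ y, V y * (I y w * kk 2 (y - w)) := by
              rw [← lintegral_const_mul _ mw]; congr 1; ext y; ring
          _ ≤ ENNReal.ofReal (16 * Kct) * H w * (κ * ENNReal.ofReal (Cdy 2 α) * hw x0 σ α w) := mul_le_mul' le_rfl (p2 w)
          _ = _ := by ring
    _ = _ := by
        have mHw : Measurable (fun w => H w * hw x0 σ α w) := mH.mul (hw_meas hσ α)
        rw [lintegral_const_mul _ mHw]
        unfold CT; ring

/-! ### the second pass -/
section
variable {u : E3 → ℝ → E3} {g : E3 → ℝ → Fin 3 → Fin 3 → ℝ} {P : E3 → ℝ → ℝ} {K ε : ℝ≥0∞}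

lemma dense_ball {N : ℝ≥0∞} {r0 T : ℝ} {m : ℕ} (hT : T < 0)
    (hB : ∀ x0 ∈ ball (0 : E3) r0, ∀ t0 ∈ Ioo T 0, ∀ n, ∀ᵐ t, t ∈ Ik t0 n → ∫⁻ x in closedBall x0 (rr n), ‖u x t‖ₑ ^ 2 ≤ N * ENNReal.ofReal (rr n ^ m)) :
    ∀ᵐ t, t ∈ Ioo T 0 → ∀ x ∈ ball (0 : E3) (r0 - 1/2), ∀ s, 0 < s → s ≤ 1/2 → ∫⁻ y in closedBall x s, ‖u y t‖ₑ ^ 2 ≤ 4 ^ m * N * ENNReal.ofReal (s ^ m) := by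
  obtain ⟨D, hDc, hDd⟩ := TopologicalSpace.exists_countable_dense E3
  have hall : ∀ᵐ t, ∀ q ∈ D, ∀ τ : ℚ, ∀ n : ℕ, q ∈ ball (0 : E3) r0 → (τ : ℝ) ∈ Ioo T 0 → t ∈ Ik τ n →
      ∫⁻ x in closedBall q (rr n), ‖u x t‖ₑ ^ 2 ≤ N * ENNReal.ofReal (rr n ^ m) := by
    refine (ae_ball_iff hDc).2 fun q hq => ae_all_iff.2 fun τ => ae_all_iff.2 fun n => ?_
    by_cases h1 : q ∈ ball (0 : E3) r0
    · by_cases h2 : (τ : ℝ) ∈ Ioo T 0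
      · filter_upwards [hB q h1 τ h2 n] with t ht _ _ hI using ht hI
      · exact Eventually.of_forall fun t _ h => absurd h h2
    · exact Eventually.of_forall fun t h => absurd h h1
  filter_upwards [hall] with t ht htI x hx s hs hs2
  obtain ⟨n, hn1, hn2⟩ := exists_nat_pow_near_of_lt_one (x := 2 * s) (y := (1/2 : ℝ)) (by linarith) (by linarith) (by norm_num) (by norm_num)
  have e1 : rr (n + 1) < 2 * s := hn1
  have e2 : 2 * s ≤ rr n := hn2
  rw [rr_succ] at e1
  have hr := rr_pos n
  have hr1 := rr_le_one n
  obtain ⟨q, hqD, hq⟩ := hDd.exists_dist_lt x (show 0 < rr n / 2 by linarith)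
  obtain ⟨τ, hτ1, hτ2⟩ := exists_rat_btwn (show t < min 0 (t + rr n ^ 2) from lt_min htI.2 (by have := pow_pos hr 2; linarith))
  have hqb : q ∈ ball (0 : E3) r0 := by
    rw [mem_ball] at hx ⊢
    have := dist_triangle q x 0
    rw [dist_comm q x] at this
    linarith
  have h0 := lt_min_iff.1 hτ2
  refine (lintegral_mono_set (closedBall_subset_closedBall' (by linarith))).trans ((ht q hqD τ n hqb ⟨by linarith [htI.1], h0.1⟩ ⟨by linarith [h0.2], hτ1⟩).trans ?_)
  have : ENNReal.ofReal (rr n ^ m) ≤ 4 ^ m * ENNReal.ofReal (s ^ m) := by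
    rw [show (4:ℝ≥0∞) ^ m = ENNReal.ofReal (4 ^ m) by rw [ENNReal.ofReal_pow (by norm_num)]; norm_num, ← ENNReal.ofReal_mul (by positivity), ← mul_pow]
    exact ENNReal.ofReal_le_ofReal (by gcongr; linarith)
  calc _ ≤ N * (4 ^ m * ENNReal.ofReal (s ^ m)) := mul_le_mul' le_rfl this
    _ = _ := by ring

def k2 (K : ℝ≥0∞) : ℝ≥0∞ := (CT (1/2) + 1) * (4 ^ 2 * N1 K + vB + 8 * (K + vB * ENNReal.ofReal (6 ^ (3:ℝ))) + 1)

lemma Mo_2 {v : E3 → E3} {N : ℝ≥0∞} (hv : Measurable v) (hK : ∫⁻ x, ‖v x‖ₑ ^ 2 ≤ K)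
    (h : ∀ x ∈ ball (0 : E3) (8 - 1/2), ∀ s, 0 < s → s ≤ 1/2 → ∫⁻ y in closedBall x s, ‖v y‖ₑ ^ 2 ≤ N * ENNReal.ofReal (s ^ 2)) :
    Mo (N + vB + 8 * (K + vB * ENNReal.ofReal (6 ^ (3:ℝ))) + 1) (1/2) ((ball 0 6).indicator fun y => ‖v y‖ₑ) := by
  intro x s hs
  have mv : Measurable (fun y => ‖v y‖ₑ ^ 2) := hv.enorm.pow_const 2
  have mb : MeasurableSet (ball (0 : E3) 6) := measurableSet_ball
  rcases le_or_gt s (1/2) with hs2 | hs2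
  · by_cases hx : x ∈ ball (0 : E3) (8 - 1/2)
    · have hc : 0 < s ^ (1/2 : ℝ) := by positivity
      have c0 : ENNReal.ofReal (s ^ (1/2 : ℝ)) ≠ 0 := (ENNReal.ofReal_pos.2 hc).ne'
      calc _ ≤ ∫⁻ y in closedBall x s, (ENNReal.ofReal (s ^ (1/2 : ℝ)) * ‖v y‖ₑ ^ 2 + (ENNReal.ofReal (s ^ (1/2 : ℝ)))⁻¹) := by
            refine lintegral_mono fun y => (indicator_le_self' (fun _ _ => zero_le) y).trans ?_
            have := young_c ‖v y‖ₑ 1 _ c0 ENNReal.ofReal_ne_top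
            rwa [mul_one, one_pow, mul_one] at this
        _ = ENNReal.ofReal (s ^ (1/2 : ℝ)) * (∫⁻ y in closedBall x s, ‖v y‖ₑ ^ 2) + ENNReal.ofReal ((s ^ (1/2 : ℝ))⁻¹) * (vB * ENNReal.ofReal (s ^ (3:ℝ))) := by
            rw [lintegral_add_right _ measurable_const, lintegral_const_mul _ mv, setLIntegral_const, vol_cB x hs.le, ENNReal.ofReal_inv_of_pos hc]
        _ ≤ ENNReal.ofReal (s ^ (1/2 : ℝ)) * (N * ENNReal.ofReal (s ^ 2)) + ENNReal.ofReal ((s ^ (1/2 : ℝ))⁻¹) * (vB * ENNReal.ofReal (s ^ (3:ℝ))) := by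
            gcongr; exact h x hx s hs hs2
        _ = (N + vB) * ENNReal.ofReal (s ^ (2 + 1/2 : ℝ)) := by
            have e1 : ENNReal.ofReal (s ^ (1/2 : ℝ)) * ENNReal.ofReal (s ^ 2) = ENNReal.ofReal (s ^ (2 + 1/2 : ℝ)) := by
              rw [← ENNReal.ofReal_mul hc.le, ← Real.rpow_natCast, ← Real.rpow_add hs]; norm_num
            have e2 : ENNReal.ofReal ((s ^ (1/2 : ℝ))⁻¹) * ENNReal.ofReal (s ^ (3:ℝ)) = ENNReal.ofReal (s ^ (2 + 1/2 : ℝ)) := by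
              rw [← ENNReal.ofReal_mul (by positivity), ← Real.rpow_neg hs.le, ← Real.rpow_add hs]; norm_num
            calc _ = N * (ENNReal.ofReal (s ^ (1/2 : ℝ)) * ENNReal.ofReal (s ^ 2)) + vB * (ENNReal.ofReal ((s ^ (1/2 : ℝ))⁻¹) * ENNReal.ofReal (s ^ (3:ℝ))) := by ring
              _ = _ := by rw [e1, e2]; ring
        _ ≤ _ := mul_le_mul' (by rw [add_assoc (N + vB)]; exact le_self_add) le_rfl
    · refine le_trans (le_of_eq ?_) zero_le
      rw [setLIntegral_congr_fun isClosed_closedBall.measurableSet (g := fun _ => 0) fun y hy => ?_, lintegral_zero]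
      refine indicator_of_notMem (fun hb => hx ?_) _
      rw [mem_ball] at hb ⊢
      rw [mem_closedBall] at hy
      have := dist_triangle x y 0
      rw [dist_comm x y] at this
      linarith
  · calc _ ≤ ∫⁻ y in closedBall 0 6, (‖v y‖ₑ ^ 2 + 1) := by
          refine (setLIntegral_le_lintegral _ _).trans ?_
          rw [lintegral_indicator mb]
          refine (lintegral_mono_set ball_subset_closedBall).trans (lintegral_mono fun y => ?_)
          have := young_c ‖v y‖ₑ 1 1 one_ne_zero one_ne_top
          simpa using this
      _ ≤ K + vB * ENNReal.ofReal (6 ^ (3:ℝ)) := by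
          rw [lintegral_add_right _ measurable_const, setLIntegral_const, one_mul, vol_cB (0:E3) (by norm_num)]
          exact add_le_add ((setLIntegral_le_lintegral _ _).trans hK) le_rfl
      _ ≤ (8 * (K + vB * ENNReal.ofReal (6 ^ (3:ℝ)))) * ENNReal.ofReal (s ^ (2 + 1/2 : ℝ)) := by
          have h1 : (1:ℝ≥0∞) ≤ 8 * ENNReal.ofReal (s ^ (2 + 1/2 : ℝ)) := by
            rw [show (8:ℝ≥0∞) = ENNReal.ofReal 8 by norm_num, ← ENNReal.ofReal_mul (by norm_num), ← ENNReal.ofReal_one]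
            refine ENNReal.ofReal_le_ofReal ?_
            have : (1/2 : ℝ) ^ (3:ℝ) ≤ s ^ (2 + 1/2 : ℝ) :=
              (Real.rpow_le_rpow_of_exponent_ge (by norm_num) (by norm_num) (by norm_num : (2 + 1/2 : ℝ) ≤ 3)).trans (Real.rpow_le_rpow (by norm_num) hs2.le (by norm_num))
            norm_num at this ⊢
            linarith
          calc _ = (K + vB * ENNReal.ofReal (6 ^ (3:ℝ))) * 1 := (mul_one _).symm
            _ ≤ (K + vB * ENNReal.ofReal (6 ^ (3:ℝ))) * (8 * ENNReal.ofReal (s ^ (2 + 1/2 : ℝ))) := mul_le_mul' le_rfl h1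
            _ = _ := by ring
      _ ≤ _ := mul_le_mul' (le_add_self.trans le_self_add) le_rfl

def cG (K : ℝ≥0∞) : ℝ≥0∞ := 1280 * (CX (1/2) * k2 K)
def DG (K : ℝ≥0∞) : ℝ≥0∞ := 16 * (ENNReal.ofReal CPH * K) + 16 * (CX (1/2) * k2 K) * (K + 4 * vB) + 8 ^ 4 * K
def aG (K : ℝ≥0∞) (n : ℕ) : ℝ≥0∞ := DG K * ∏ k ∈ Finset.range n, (1 + cG K * ENNReal.ofReal (rr k ^ (1/2 : ℝ)))
def MG (K : ℝ≥0∞) : ℝ≥0∞ := DG K * ENNReal.ofReal (Real.exp ((cG K).toReal * 4))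

lemma k2_ne_top (hK : K ≠ ∞) : k2 K ≠ ∞ := by
  have := vB_ne_top
  have := N1_ne_top hK
  have := CT_ne_top (1/2)
  unfold k2; finiteness
lemma MG_ne_top (hK : K ≠ ∞) : MG K ≠ ∞ := by
  have := vB_ne_top
  have := k2_ne_top hK
  have := CX_ne_top (1/2)
  unfold MG DG; finiteness
lemma cG_ne_top (hK : K ≠ ∞) : cG K ≠ ∞ := by
  have := k2_ne_top hK
  have := CX_ne_top (1/2)
  unfold cG; finiteness

lemma aG_sum (n : ℕ) : aG K n = DG K + cG K * ∑ k ∈ Finset.range n, aG K k * ENNReal.ofReal (rr k ^ (1/2 : ℝ)) := by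
  induction n with
  | zero => simp [aG]
  | succ n ih =>
    rw [Finset.sum_range_succ, mul_add, ← add_assoc, ← ih]
    unfold aG
    rw [Finset.prod_range_succ]; ring

lemma sum2 (n : ℕ) : ∑ k ∈ Finset.range n, rr k ^ (1/2 : ℝ) ≤ 4 - 4 * rr n ^ (1/2 : ℝ) := by
  induction n with
  | zero => simp [rr_zero]
  | succ n ih =>
    rw [Finset.sum_range_succ, rr_succ, div_eq_mul_inv (rr n), Real.mul_rpow (rr_pos n).le (by norm_num)]
    have : (2⁻¹:ℝ) ^ (1/2 : ℝ) ≤ 3/4 := by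
      rw [← Real.sqrt_eq_rpow]; exact (Real.sqrt_le_left (by norm_num)).2 (by norm_num)
    have h2 : 0 ≤ rr n ^ (1/2 : ℝ) := Real.rpow_nonneg (rr_pos n).le _
    nlinarith

lemma aG_le (hK : K ≠ ∞) (n : ℕ) : aG K n ≤ MG K := by
  refine mul_le_mul' le_rfl ?_
  have hc : (0:ℝ) ≤ (cG K).toReal := ENNReal.toReal_nonneg
  calc _ ≤ ∏ k ∈ Finset.range n, ENNReal.ofReal (Real.exp ((cG K).toReal * rr k ^ (1/2 : ℝ))) := by
        refine Finset.prod_le_prod' fun k _ => ?_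
        have h2 : 0 ≤ rr k ^ (1/2 : ℝ) := Real.rpow_nonneg (rr_pos k).le _
        rw [← ENNReal.ofReal_toReal (cG_ne_top hK), ← ENNReal.ofReal_mul hc, ← ENNReal.ofReal_one, ← ENNReal.ofReal_add zero_le_one (by positivity), ENNReal.toReal_ofReal hc]
        refine ENNReal.ofReal_le_ofReal ?_
        have := Real.add_one_le_exp ((cG K).toReal * rr k ^ (1/2 : ℝ))
        linarith
    _ = ENNReal.ofReal (Real.exp ((cG K).toReal * ∑ k ∈ Finset.range n, rr k ^ (1/2 : ℝ))) := by
        rw [← ENNReal.ofReal_prod_of_nonneg (fun _ _ => (Real.exp_pos _).le), ← Real.exp_sum, Finset.mul_sum]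
    _ ≤ _ := by
        refine ENNReal.ofReal_le_ofReal (Real.exp_le_exp.2 (mul_le_mul_of_nonneg_left ?_ hc))
        have h2 : 0 ≤ rr n ^ (1/2 : ℝ) := Real.rpow_nonneg (rr_pos n).le _
        have := sum2 n
        linarith

lemma pass2 (S : Sol u g P K ε) (hε : ε ≠ 0) (hεt : ε ≠ ∞) (hs : 5120 * (CX 0 * (Cm * ε)) ≤ 2⁻¹) {x0 : E3} {t0 : ℝ} (hx0 : x0 ∈ ball (0 : E3) 1) (ht : t0 ∈ Ioo (-1 : ℝ) 0) (n : ℕ) :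
    Bd u g x0 t0 n (aG K n) := by
  have hx0' := mem_ball_zero_iff.1 hx0
  have hx8 : x0 ∈ ball (0 : E3) 8 := by rw [mem_ball_zero_iff]; linarith
  have hkt := k2_ne_top S.Kt
  have hp1 : ∀ᵐ t, t ∈ Ioo (-4 : ℝ) 0 → ∀ x ∈ ball (0 : E3) (8 - 1/2), ∀ s, 0 < s → s ≤ 1/2 → ∫⁻ y in closedBall x s, ‖u y t‖ₑ ^ 2 ≤ 4 ^ 2 * N1 K * ENNReal.ofReal (s ^ 2) := by
    refine dense_ball (by norm_num) fun y hy τ hτ m => ?_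
    filter_upwards [(pass1 S hε hεt hs hy hτ.1 hτ.2 m).b1] with t h1 hI
    refine (h1 hI).trans (le_of_eq ?_)
    rw [mul_assoc]
    congr 1
    rw [show (2:ℝ≥0∞) ^ m = ENNReal.ofReal (2 ^ m) by rw [ENNReal.ofReal_pow (by norm_num)]; norm_num, ← ENNReal.ofReal_mul (by positivity),
      show rr m ^ (3:ℝ) = rr m ^ 3 from Real.rpow_natCast _ 3]
    congr 1
    linear_combination rr m ^ 2 * rr_two m
  have hk0 : k2 K ≠ 0 := mul_ne_zero (by simp) (by simp)
  induction n using Nat.strong_induction_on with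
  | _ n ih =>
  have hDa : DG K ≤ aG K n := by rw [aG_sum]; exact le_self_add
  rcases lt_or_ge n 4 with hn | hn
  · exact (Bd_triv S x0 t0 hn).mono (le_trans le_add_self hDa)
  have hr := rr_pos n
  have key := core (α := 1/2) (δ := 0) (κ := k2 K) (a := aG K) S hx8 (by linarith [ht.1]) ht.2 hn (by norm_num) le_rfl (by norm_num) ih ?_ hkt
  · refine key.mono ?_
    rw [mul_zero, neg_zero, Real.rpow_zero, ENNReal.ofReal_one, one_mul, aG_sum]
    unfold DG cG
    generalize ∑ k ∈ Finset.range n, aG K k * ENNReal.ofReal (rr k ^ (1/2 : ℝ)) = Y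
    calc _ = 16 * (ENNReal.ofReal CPH * K) + 16 * (CX (1/2) * k2 K) * (K + 4 * vB) + 1280 * (CX (1/2) * k2 K) * Y := by ring
      _ ≤ _ := add_le_add le_self_add le_rfl
  · filter_upwards [S.sl, S.uK, hp1] with s h1 h2 h3 hsI
    have hI := Ik_zero t0 ▸ hsI
    have hrr : rr n ^ 2 ≤ 1 := pow_le_one₀ hr.le (rr_le_one n)
    have hσ : 0 < t0 - s + rr n ^ 2 := by have := hI.2; positivity [sub_pos.2 this]
    have hM := Mo_2 h1.mv h2 (h3 ⟨by linarith [ht.1, hI.1], by linarith [ht.2, hI.2]⟩)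
    have mV : Measurable ((ball (0:E3) 6).indicator fun y => ‖u y s‖ₑ) := h1.mv.enorm.indicator measurableSet_ball
    have hT := Tr_Mo (x0 := x0) mV hσ (by norm_num) hM
    refine ⟨_, h1, hx8, hσ, by linarith [hI.1], hk0, hkt, by norm_num, by norm_num, mV, fun y hy => ?_, fun f hf hcs hsu => ?_, fun x r hr => ?_⟩
    · rw [indicator_of_mem]
      rw [mem_closedBall] at hy
      rw [mem_ball]
      have := dist_triangle y x0 0
      rw [dist_zero_right x0] at this
      linarith
    · refine (hT f hf hcs hsu).trans (mul_le_mul' ?_ le_rfl)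
      exact mul_le_mul' le_self_add le_rfl
    · refine (hM x r hr).trans (mul_le_mul' ?_ le_rfl)
      unfold k2
      exact le_mul_of_one_le_left' le_add_self

lemma bound3 (S : Sol u g P K ε) (hε : ε ≠ 0) (hεt : ε ≠ ∞) (hs : 5120 * (CX 0 * (Cm * ε)) ≤ 2⁻¹) :
    ∀ᵐ t, t ∈ Ioo (-1 : ℝ) 0 → ∀ x ∈ ball (0 : E3) (1 - 1/2), ∀ s, 0 < s → s ≤ 1/2 → ∫⁻ y in closedBall x s, ‖u y t‖ₑ ^ 2 ≤ 4 ^ 3 * MG K * ENNReal.ofReal (s ^ 3) := by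
  refine dense_ball (by norm_num) fun y hy τ hτ m => ?_
  filter_upwards [((pass2 S hε hεt hs hy hτ m).mono (aG_le S.Kt m)).b1] with t h1 hI
  have := h1 hI
  rwa [show rr m ^ (3:ℝ) = rr m ^ 3 from Real.rpow_natCast _ 3] at this
end

lemma vB_ne_zero : vB ≠ 0 := by
  intro h
  have := vol_cB (0 : E3) (s := 1) (by norm_num)
  rw [h, zero_mul] at this
  exact (measure_closedBall_pos volume (0 : E3) one_pos).ne' this

/-- the bound obtained at Lebesgue points -/
lemma leb_bound {u : E3 → ℝ → E3} {g : E3 → ℝ → Fin 3 → Fin 3 → ℝ} {P : E3 → ℝ → ℝ} {K ε : ℝ≥0∞}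
    (S : Sol u g P K ε) (hε : ε ≠ 0) (hεt : ε ≠ ∞) (hs : 5120 * (CX 0 * (Cm * ε)) ≤ 2⁻¹) :
    ∀ᵐ t : ℝ, ∀ᵐ x : E3, t ∈ Ioo (-1 : ℝ) 0 → x ∈ ball (0 : E3) (1 / 2) → ‖u x t‖ₑ ^ 2 ≤ 4 ^ 3 * MG K / vB := by
  filter_upwards [bound3 S hε hεt hs, S.uK] with t hb hu
  have hm : Measurable (fun x => ‖u x t‖ₑ ^ 2) := (sec_meas S.mu t).enorm.pow_const 2
  have hfin : ∫⁻ x, ‖u x t‖ₑ ^ 2 ≠ ∞ := ne_top_of_le_ne_top S.Kt hu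
  filter_upwards [(Besicovitch.vitaliFamily (volume : Measure E3)).ae_tendsto_lintegral_div hm.aemeasurable hfin] with x hx ht hxb
  have h2 := hx.comp (Besicovitch.tendsto_filterAt volume x)
  refine le_of_tendsto h2 ?_
  have hev : ∀ᶠ s : ℝ in nhdsWithin 0 (Ioi 0), s ∈ Ioc (0 : ℝ) (1 / 2) := Ioc_mem_nhdsGT (by norm_num)
  filter_upwards [hev] with s hs'
  have h3 := hb ht x (by norm_num at hxb ⊢; exact hxb) s hs'.1 hs'.2
  refine ENNReal.div_le_of_le_mul ?_
  rw [vol_cB x hs'.1.le, ← mul_assoc, ENNReal.div_mul_cancel vB_ne_zero vB_ne_top]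
  have : s ^ (3 : ℝ) = s ^ 3 := by exact_mod_cast Real.rpow_natCast s 3
  rw [this]; exact h3

lemma real_bound {u : E3 → ℝ → E3} {g : E3 → ℝ → Fin 3 → Fin 3 → ℝ} {P : E3 → ℝ → ℝ} {K ε : ℝ≥0∞}
    (S : Sol u g P K ε) (hε : ε ≠ 0) (hεt : ε ≠ ∞) (hs : 5120 * (CX 0 * (Cm * ε)) ≤ 2⁻¹) :
    ∃ M : ℝ, ∀ᵐ z : E3 × ℝ, z.2 ∈ Ioo (-1 : ℝ) 0 → z.1 ∈ ball (0 : E3) (1 / 2) → ‖u z.1 z.2‖ ≤ M := by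
  set A := 4 ^ 3 * MG K / vB with hA
  have hAt : A ≠ ∞ := ENNReal.div_ne_top (ENNReal.mul_ne_top (by finiteness) (MG_ne_top S.Kt)) vB_ne_zero
  refine ⟨Real.sqrt A.toReal, ?_⟩
  have hms : MeasurableSet {z : E3 × ℝ | z.2 ∈ Ioo (-1 : ℝ) 0 → z.1 ∈ ball (0 : E3) (1 / 2) → ‖u z.1 z.2‖ ≤ Real.sqrt A.toReal} := by
    have a1 : MeasurableSet {z : E3 × ℝ | z.2 ∈ Ioo (-1 : ℝ) 0} := measurable_snd measurableSet_Ioo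
    have a2 : MeasurableSet {z : E3 × ℝ | z.1 ∈ ball (0 : E3) (1 / 2)} := measurable_fst measurableSet_ball
    have a3 : MeasurableSet {z : E3 × ℝ | ‖u z.1 z.2‖ ≤ Real.sqrt A.toReal} := measurableSet_le S.mu.norm measurable_const
    exact a1.imp (a2.imp a3)
  rw [Measure.volume_eq_prod, Measure.ae_prod_iff_ae_ae hms, Measure.ae_ae_comm (p := fun x t => t ∈ Ioo (-1 : ℝ) 0 → x ∈ ball (0 : E3) (1 / 2) → ‖u x t‖ ≤ Real.sqrt A.toReal) hms]
  filter_upwards [leb_bound S hε hεt hs] with t h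
  filter_upwards [h] with x h h1 h2
  refine Real.le_sqrt_of_sq_le ?_
  have := ENNReal.toReal_mono hAt (h h1 h2)
  rwa [ENNReal.toReal_pow, toReal_enorm] at this

/-- scaling of almost everywhere statements in space-time -/
lemma ae_unsc {L : ℝ} (hL : 0 < L) {Q : E3 × ℝ → Prop} (h : ∀ᵐ z : E3 × ℝ, Q z) :
    ∀ᵐ z : E3 × ℝ, Q (L⁻¹ • z.1, (L ^ 2)⁻¹ * z.2) := by
  have q1 : Measure.QuasiMeasurePreserving (fun x : E3 => L⁻¹ • x) volume volume := by
    refine ⟨by fun_prop, ?_⟩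
    rw [Measure.map_addHaar_smul _ (by positivity)]
    exact Measure.smul_absolutelyContinuous
  have q2 : Measure.QuasiMeasurePreserving (fun t : ℝ => (L ^ 2)⁻¹ * t) volume volume := by
    refine ⟨by fun_prop, ?_⟩
    have := Measure.map_addHaar_smul (volume : Measure ℝ) (r := (L ^ 2)⁻¹) (by positivity)
    simp only [smul_eq_mul] at this
    rw [this]
    exact Measure.smul_absolutelyContinuous
  have q3 : Measure.QuasiMeasurePreserving (Prod.map (fun x : E3 => L⁻¹ • x) (fun t : ℝ => (L ^ 2)⁻¹ * t)) volume volume := by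
    refine ⟨q1.1.prodMap q2.1, ?_⟩
    rw [Measure.volume_eq_prod, ← Measure.map_prod_map _ _ q1.1 q2.1]
    exact q1.2.prod q2.2
  exact q3.ae h

/-- scale invariance of the trace inequality -/
lemma trace_sc {q1 q2 q3 : ℝ} (h1 : 0 < q1) (h2 : 0 < q2) (h3 : 0 < q3) (hq : 1/q1 + 1/q2 + 1/q3 = 1) {L : ℝ} (hL : 0 < L)
    {w : E3 → E3} (hw : Measurable w) {f : E3 → ℝ} (hf : ContDiff ℝ 1 f) (hc : HasCompactSupport f) :
    ∫⁻ x, ‖(ball (0 : E3) 16).indicator (fun x => L • w (L • x)) x‖ₑ * ‖f x‖ₑ ≤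
      anisoNorm q1 q2 q3 (ball (0 : E3) (L * 16)) (fun x => ‖w x‖) * ∫⁻ x, ‖fderiv ℝ f x‖ₑ := by
  have hL' : L ≠ 0 := hL.ne'
  set f' : E3 → ℝ := fun y => f (L⁻¹ • y) with hf'
  have cf' : ContDiff ℝ 1 f' := hf.comp (contDiff_const_smul _)
  have hc' : HasCompactSupport f' := hc.comp_homeomorph (Homeomorph.smulOfNeZero L⁻¹ (inv_ne_zero hL'))
  have hm := trace_ineq h1 h2 h3 hq (Ω := ball (0 : E3) (L * 16)) measurableSet_ball hw.norm cf' hc'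
  have e1 : ∀ x, ‖(ball (0 : E3) 16).indicator (fun x => L • w (L • x)) x‖ₑ * ‖f x‖ₑ = ENNReal.ofReal L *
      (fun y => ‖(ball (0 : E3) (L * 16)).indicator (fun x => ‖w x‖) y‖ₑ * ‖f' y‖ₑ) (L • x) := fun x => by
    simp only [hf', smul_smul, inv_mul_cancel₀ hL', one_smul]
    rw [← mul_assoc]; congr 1
    have hmem : L • x ∈ ball (0 : E3) (L * 16) ↔ x ∈ ball (0 : E3) 16 := by
      simp only [mem_ball_zero_iff, norm_smul, Real.norm_of_nonneg hL.le]
      exact mul_lt_mul_iff_right₀ hL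
    by_cases hx : x ∈ ball (0 : E3) 16
    · rw [indicator_of_mem hx, indicator_of_mem (hmem.2 hx), enorm_smul, enorm_norm, Real.enorm_of_nonneg hL.le]
    · rw [indicator_of_notMem hx, indicator_of_notMem (fun h => hx (hmem.1 h))]; simp
  have e2 : ∀ y, ‖fderiv ℝ f' y‖ₑ = ENNReal.ofReal L⁻¹ * (fun x => ‖fderiv ℝ f x‖ₑ) (L⁻¹ • y) := fun y => by
    simp only [hf']
    rw [fderiv_comp_smul, enorm_smul, Real.enorm_of_nonneg (inv_pos.2 hL).le]
  rw [lintegral_congr e1, lintegral_const_mul' _ _ (by finiteness), sc_lintx' hL (fun y => ‖(ball (0 : E3) (L * 16)).indicator (fun x => ‖w x‖) y‖ₑ * ‖f' y‖ₑ)]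
  rw [lintegral_congr e2, lintegral_const_mul' _ _ (by finiteness), sc_lintx' (inv_pos.2 hL) (fun x => ‖fderiv ℝ f x‖ₑ)] at hm
  refine (mul_le_mul' le_rfl (mul_le_mul' le_rfl hm)).trans (le_of_eq ?_)
  have e3 : ENNReal.ofReal L * ENNReal.ofReal (L ^ 3)⁻¹ * ENNReal.ofReal L⁻¹ * ENNReal.ofReal ((L⁻¹ ^ 3)⁻¹) = 1 := by
    rw [← ENNReal.ofReal_mul (by positivity), ← ENNReal.ofReal_mul (by positivity), ← ENNReal.ofReal_mul (by positivity), ← ENNReal.ofReal_one]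
    congr 1; field_simp
  calc _ = (ENNReal.ofReal L * ENNReal.ofReal (L ^ 3)⁻¹ * ENNReal.ofReal L⁻¹ * ENNReal.ofReal ((L⁻¹ ^ 3)⁻¹)) *
        (anisoNorm q1 q2 q3 (ball (0 : E3) (L * 16)) (fun x => ‖w x‖) * ∫⁻ x, ‖fderiv ℝ f x‖ₑ) := by ring
    _ = _ := by rw [e3, one_mul]

lemma eps_exists : ∃ ε : ℝ, 0 < ε ∧ 5120 * (CX 0 * (Cm * ENNReal.ofReal ε)) ≤ 2⁻¹ := by
  have hB : CX 0 * Cm ≠ ∞ := ENNReal.mul_ne_top (CX_ne_top 0) Cm_ne_top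
  set b := (CX 0 * Cm).toReal with hb
  have hb0 : 0 ≤ b := ENNReal.toReal_nonneg
  refine ⟨1 / (10240 * (b + 1)), by positivity, ?_⟩
  rw [← mul_assoc (CX 0), ← ENNReal.ofReal_toReal hB, ← hb, ← ENNReal.ofReal_mul hb0,
    show (5120 : ℝ≥0∞) = ENNReal.ofReal 5120 by norm_num, ← ENNReal.ofReal_mul (by norm_num),
    show (2⁻¹ : ℝ≥0∞) = ENNReal.ofReal 2⁻¹ by rw [ENNReal.ofReal_inv_of_pos (by norm_num)]; norm_num]
  refine ENNReal.ofReal_le_ofReal ?_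
  rw [mul_one_div, mul_div_assoc', div_le_iff₀ (by positivity)]
  linarith

theorem regularity_aux
    (q1 q2 q3 : ℝ) (hq1 : 1 < q1) (hq2 : 1 < q2) (hq3 : 1 < q3)
    (hq : 1/q1 + 1/q2 + 1/q3 = 1) :
    ∃ ε : ℝ, 0 < ε ∧
      ∀ (ϱ : ℝ) (u : E3 → ℝ → E3) (P : E3 → ℝ → ℝ), 0 < ϱ →
        SuitableWeakSolution ϱ u P →
        essSup (fun t => anisoNorm q1 q2 q3 (ball (0 : E3) ϱ) (fun x => ‖u x t‖))
            (volume.restrict (Ioo (-(ϱ^2)) 0)) ≤ ENNReal.ofReal ε →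
        RegularPoint u := by
  obtain ⟨ε, hε, hεs⟩ := eps_exists
  refine ⟨ε, hε, fun ϱ u P hϱ h hes => ?_⟩
  obtain ⟨L, hL, rfl⟩ : ∃ L : ℝ, 0 < L ∧ ϱ = L * 16 := ⟨ϱ / 16, by positivity, by ring⟩
  have hR := h.rescale hL
  have tr : ∀ᵐ t : ℝ, ∀ f : E3 → ℝ, ContDiff ℝ 1 f → HasCompactSupport f →
      ∫⁻ x, ‖ex (fun x t => L • u (L • x) (L ^ 2 * t)) x t‖ₑ * ‖f x‖ₑ ≤ ENNReal.ofReal ε * ∫⁻ x, ‖fderiv ℝ f x‖ₑ := by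
    have hE : ∀ᵐ t ∂(volume.restrict (Ioo (-((L * 16) ^ 2)) 0)),
        anisoNorm q1 q2 q3 (ball (0 : E3) (L * 16)) (fun x => ‖u x t‖) ≤ ENNReal.ofReal ε := by
      filter_upwards [_root_.ae_le_essSup (μ := volume.restrict (Ioo (-((L * 16) ^ 2)) 0)) (f := fun t => anisoNorm q1 q2 q3 (ball (0 : E3) (L * 16)) (fun x => ‖u x t‖))] with t ht
      exact ht.trans hes
    rw [show -((L * 16) ^ 2) = L ^ 2 * (-(16 ^ 2)) by ring, show (0 : ℝ) = L ^ 2 * 0 by ring] at hE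
    have hE2 := ae_sc hL hE
    rw [ae_restrict_iff' measurableSet_Ioo] at hE2
    filter_upwards [hE2] with t ht f hf hc
    by_cases hI : t ∈ Ioo (-(16 ^ 2) : ℝ) 0
    · have h4 := trace_sc (by linarith) (by linarith) (by linarith) hq hL (sec_meas h.meas_u (L ^ 2 * t)) hf hc
      refine le_trans (le_of_eq ?_) (h4.trans (mul_le_mul' ?_ le_rfl))
      · refine lintegral_congr fun x => ?_
        by_cases hx : x ∈ ball (0 : E3) 16
        · rw [ex_in hx hI, indicator_of_mem hx]
        · rw [ex_x hx, indicator_of_notMem hx]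
      · simpa using ht hI
    · simp [ex_t hI]
  obtain ⟨K, S⟩ := sol_of hR tr
  obtain ⟨M, hM⟩ := real_bound S (by simpa using hε) ENNReal.ofReal_ne_top hεs
  refine ⟨L / 2, by positivity, L⁻¹ * M, ?_⟩
  rw [ae_restrict_iff' (measurableSet_ball.prod measurableSet_Ioo)]
  filter_upwards [ae_unsc hL hM] with z hz hzm
  obtain ⟨x, t⟩ := z
  obtain ⟨hx, ht⟩ := hzm
  simp only at hz hx ht ⊢
  have hx1 : L⁻¹ • x ∈ ball (0 : E3) (1 / 2) := by
    rw [mem_ball_zero_iff] at hx ⊢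
    rw [norm_smul, Real.norm_of_nonneg (inv_pos.2 hL).le, inv_mul_lt_iff₀ hL]; linarith
  have hL2 : 0 < L ^ 2 := by positivity
  have ht1 : (L ^ 2)⁻¹ * t ∈ Ioo (-1 : ℝ) 0 := by
    constructor
    · rw [lt_inv_mul_iff₀ hL2]; nlinarith [ht.1]
    · exact mul_neg_of_pos_of_neg (inv_pos.2 hL2) ht.2
  have h5 := hz ht1 hx1
  rw [ex_in (ball_subset_ball (by norm_num) hx1) ⟨by linarith [ht1.1], ht1.2⟩] at h5
  rw [smul_smul, mul_inv_cancel₀ hL.ne', one_smul, ← mul_assoc, mul_inv_cancel₀ hL2.ne', one_mul, norm_smul, Real.norm_of_nonneg hL.le] at h5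
  rw [← div_eq_inv_mul, le_div_iff₀ hL]; linarith

/-- Corollary 1.2 (2): there is `ε > 0` (depending only on `q⃗`, with `1/q̄ = 1`, `q_j > 1`)
such that if the essential supremum over `t ∈ (−ϱ²,0)` of `‖u(·,t)‖_{L^{q⃗}(B(ϱ))}` is at
most `ε` for a suitable weak solution on `Q(ϱ)`, then `(0,0)` is a regular point. -/
theorem regularity_aniso_linfty
    (q1 q2 q3 : ℝ) (hq1 : 1 < q1) (hq2 : 1 < q2) (hq3 : 1 < q3)
    (hq : 1/q1 + 1/q2 + 1/q3 = 1) :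
    ∃ ε : ℝ, 0 < ε ∧
      ∀ (ϱ : ℝ) (u : E3 → ℝ → E3) (P : E3 → ℝ → ℝ), 0 < ϱ →
        SuitableWeakSolution ϱ u P →
        essSup (fun t => anisoNorm q1 q2 q3 (ball (0 : E3) ϱ) (fun x => ‖u x t‖))
            (volume.restrict (Ioo (-(ϱ^2)) 0)) ≤ ENNReal.ofReal ε →
        RegularPoint u := by
  exact regularity_aux q1 q2 q3 hq1 hq2 hq3 hq
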